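/- Every finite simple graph G that admits an IC-planar straight-line drawing also admits a straight-line drawing that is simultaneously IC-planar, RAC (any two crossing edge segments are perpendicular), and a grid drawing (all vertex images at integer coordinates). In particular, every IC-planar graph is a RAC graph. -/

import Mathlib

/-- The open straight-line segment representing an edge (an unordered pair of
vertices) in a straight-line drawing `ρ`. -/
def edgeSeg {V : Type*} (ρ : V → ℝ × ℝ) : Sym2 V → Set (ℝ × ℝ) :=
  Sym2.lift ⟨fun u v => openSegment ℝ (ρ u) (ρ v),
    fun u v => openSegment_symm ℝ (ρ u) (ρ v)⟩

/-- Two edges *cross* in the drawing `ρ`: they share no endpoint and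
their open segments meet. -/
def Crosses {V : Type*} (ρ : V → ℝ × ℝ) (e f : Sym2 V) : Prop :=
  (∀ v : V, v ∈ e → v ∉ f) ∧ (edgeSeg ρ e ∩ edgeSeg ρ f).Nonempty

/-- `ρ` is a straight-line drawing of the simple graph `G`. -/
structure IsStraightLineDrawing {V : Type*} (G : SimpleGraph V) (ρ : V → ℝ × ℝ) : Prop where
  inj : Function.Injective ρ
  no_vertex_on_edge : ∀ e ∈ G.edgeSet, ∀ v : V, v ∉ e → ρ v ∉ edgeSeg ρ e
  meet_at_most_once : ∀ e ∈ G.edgeSet, ∀ f ∈ G.edgeSet, (∀ v : V, v ∈ e → v ∉ f) →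
    (edgeSeg ρ e ∩ edgeSeg ρ f).Subsingleton

/-- `ρ` is an IC-planar straight-line drawing of `G`: it is a straight-line drawing,
each edge crosses at most one other edge, and the crossed edges form a matching. -/
def IsICPlanarDrawing {V : Type*} (G : SimpleGraph V) (ρ : V → ℝ × ℝ) : Prop :=
  IsStraightLineDrawing G ρ ∧
  (∀ e ∈ G.edgeSet, ∀ f ∈ G.edgeSet, ∀ g ∈ G.edgeSet,
    Crosses ρ e f → Crosses ρ e g → f = g) ∧
  (∀ e ∈ G.edgeSet, ∀ f ∈ G.edgeSet,
    (∃ e' ∈ G.edgeSet, Crosses ρ e e') → (∃ f' ∈ G.edgeSet, Crosses ρ f f') →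
    e ≠ f → ∀ v : V, v ∈ e → v ∉ f)

/-- All vertices are placed at integer coordinates. -/
def IsGridDrawing {V : Type*} (ρ : V → ℝ × ℝ) : Prop :=
  ∀ v : V, ∃ a b : ℤ, ρ v = ((a : ℝ), (b : ℝ))

/-- `ρ` is a RAC drawing of `G`: any two crossing edges are perpendicular. -/
def IsRACDrawing {V : Type*} (G : SimpleGraph V) (ρ : V → ℝ × ℝ) : Prop :=
  ∀ e ∈ G.edgeSet, ∀ f ∈ G.edgeSet, Crosses ρ e f →
    ∀ a b c d : V, e = s(a, b) → f = s(c, d) →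
      ((ρ b).1 - (ρ a).1) * ((ρ d).1 - (ρ c).1)
        + ((ρ b).2 - (ρ a).2) * ((ρ d).2 - (ρ c).2) = 0

namespace ICR
open Classical

/-- Combinatorial sphere triangulation given by its oriented triangles. -/
structure Sphere {W : Type*} [Fintype W] (T : W → W → W → Prop) : Prop where
  rot : ∀ {u v w}, T u v w → T v w u
  ne : ∀ {u v w}, T u v w → u ≠ v
  uniq : ∀ {u v w w'}, T u v w → T u v w' → w = w'
  pair : ∀ {u v w}, T u v w → ∃ z, T v u z
  irr : ∀ (v : W) (S : Set W), (∃ u w, T v u w ∧ u ∈ S) →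
    (∀ u w, T v u w → u ∈ S → w ∈ S) → ∀ u w, T v u w → u ∈ S
  dual : ∀ A : W → W → W → Prop, (∀ u v w, A u v w → T u v w) → (∃ u v w, A u v w) →
    (∀ u v w, A u v w → A v w u) → (∀ u v w z, A u v w → T v u z → A v u z) →
    ∀ u v w, T u v w → A u v w
  vtx : ∀ v, ∃ u w, T v u w
  count : Set.ncard {t : W × W × W | T t.1 t.2.1 t.2.2} + 12 ≤ 6 * Fintype.card W

namespace Sphere
variable {W : Type*} [Fintype W] {T : W → W → W → Prop}

theorem rot2 (h : Sphere T) {u v w} (t : T u v w) : T w u v := h.rot (h.rot t)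

theorem adj_symm (h : Sphere T) {u v} (t : ∃ w, T u v w) : ∃ w, T v u w := by
  obtain ⟨w, t⟩ := t; exact h.pair t

theorem uniq' (h : Sphere T) {u v w w'} (t : T v w u) (t' : T v w' u) : w = w' :=
  h.uniq (h.rot2 t) (h.rot2 t')

/-- the next neighbour exists -/
theorem next (h : Sphere T) {v u w} (t : T v u w) : ∃ z, T v w z := h.pair (h.rot2 t)
theorem prev (h : Sphere T) {v u w} (t : T v u w) : ∃ z, T v z u := by
  obtain ⟨z, hz⟩ := h.pair t
  exact ⟨z, h.rot hz⟩

theorem link_cycle (h : Sphere T) {v u0 w0} (t : T v u0 w0) :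
    ∃ (n : ℕ) (s : ℕ → W), 0 < n ∧ s 0 = u0 ∧ s n = s 0 ∧ (∀ i, T v (s i) (s (i+1))) ∧
      (∀ i j, i < n → j < n → s i = s j → i = j) ∧ (∀ u w, T v u w → ∃ i, i < n ∧ s i = u) := by
  let N := {u : W // ∃ w, T v u w}
  choose f hf using fun (x : N) => x.2
  let nx : N → N := fun x => ⟨f x, h.next (hf x)⟩
  have hnx : ∀ x : N, T v x.1 (nx x).1 := fun x => hf x
  have inj : Function.Injective nx := by
    intro x y hxy
    have h1 := hnx x
    have h2 := hnx y
    rw [hxy] at h1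
    exact Subtype.ext (h.uniq' h1 h2)
  let x0 : N := ⟨u0, w0, t⟩
  have per : x0 ∈ Function.periodicPts nx := inj.mem_periodicPts x0
  have hpos := Function.minimalPeriod_pos_of_mem_periodicPts per
  have hit : ∀ i, (nx^[i+1] x0) = nx (nx^[i] x0) := fun i => Function.iterate_succ_apply' nx i x0
  have hper : nx^[Function.minimalPeriod nx x0] x0 = x0 := Function.iterate_minimalPeriod
  refine ⟨Function.minimalPeriod nx x0, fun i => (nx^[i] x0).1, hpos, rfl, ?_, ?_, ?_, ?_⟩
  · simp only [hper]; rfl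
  · intro i
    simp only [hit]
    exact hnx _
  · intro i j hi hj hij
    exact Function.iterate_injOn_Iio_minimalPeriod hi hj (Subtype.ext hij)
  · refine h.irr v {u | ∃ i, i < Function.minimalPeriod nx x0 ∧ (nx^[i] x0).1 = u}
      ⟨u0, w0, t, 0, hpos, rfl⟩ ?_
    rintro u w htw ⟨i, hi, rfl⟩
    have : w = (nx^[i+1] x0).1 := by
      rw [hit]; exact h.uniq htw (hnx _)
    by_cases hlt : i + 1 < Function.minimalPeriod nx x0
    · exact ⟨i+1, hlt, this.symm⟩
    · have : i + 1 = Function.minimalPeriod nx x0 := by omega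
      refine ⟨0, hpos, ?_⟩
      rw [‹w = _›, this, hper]; rfl

section sc
variable {α : Type*} [LinearOrder α]

theorem exists_up (h : Sphere T) (f : W → α) (hne : ∀ u v w, T u v w → f u ≠ f v) {v : W}
    (lo : ∃ u w, T v u w ∧ f u < f v) (hi : ∃ u w, T v u w ∧ f v < f u) :
    ∃ u w, T v u w ∧ f u < f v ∧ f v < f w := by
  by_contra hcon
  push Not at hcon
  obtain ⟨u, w, t, hu⟩ := hi
  have := h.irr v {u | f u < f v} lo (by
    intro u w t hu
    exact lt_of_le_of_ne (hcon u w t hu) (hne _ _ _ (h.rot2 t))) u w t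
  exact absurd hu (not_lt.mpr (le_of_lt this))

theorem exists_dn (h : Sphere T) (f : W → α) (hne : ∀ u v w, T u v w → f u ≠ f v) {v : W}
    (lo : ∃ u w, T v u w ∧ f u < f v) (hi : ∃ u w, T v u w ∧ f v < f u) :
    ∃ u w, T v u w ∧ f w < f v ∧ f v < f u := by
  by_contra hcon
  push Not at hcon
  obtain ⟨u, w, t, hu⟩ := lo
  have := h.irr v {u | f v < f u} hi (by
    intro u w t hu
    have h1 := hne _ _ _ (h.rot2 t)
    by_contra h2
    have h3 : f w < f v := lt_of_le_of_ne (not_lt.mp h2) h1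
    exact absurd hu (not_lt.mpr (hcon u w t h3))) u w t
  exact absurd hu (not_lt.mpr (le_of_lt this))

theorem card_ge (P : W × W × W → Prop) [DecidablePred P] (top bot : W)
    (ex : ∀ v, v ≠ top → v ≠ bot → ∃ u w, P (v, u, w)) :
    Fintype.card W ≤ (Finset.univ.filter P).card + 2 := by
  choose! c d hc using ex
  have h1 : ((Finset.univ.erase top).erase bot).card ≤ (Finset.univ.filter P).card := by
    refine Finset.card_le_card_of_injOn (fun v => (v, c v, d v)) ?_ ?_
    · intro v hv
      simp at hv
      simp [hc v hv.1 hv.2]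
    · intro a _ b _ hab
      simp at hab
      exact hab.1
  have h2 := Finset.pred_card_le_card_erase (s := Finset.univ.erase top) (a := bot)
  have h3 := Finset.pred_card_le_card_erase (s := (Finset.univ : Finset W)) (a := top)
  have := Finset.card_univ (α := W)
  omega

theorem card_gt (P : W × W × W → Prop) [DecidablePred P] (top bot : W)
    (ex : ∀ v, v ≠ top → v ≠ bot → ∃ u w, P (v, u, w)) {v u w u' w' : W} (h1 : P (v,u,w))
    (h2 : P (v,u',w')) (hne : (u,w) ≠ (u',w')) :
    Fintype.card W < (Finset.univ.filter P).card + 2 := by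
  have key : ∀ u w u' w', P (v,u',w') → (u,w) ≠ (u',w') → P (v,u,w) → 
     Fintype.card W ≤ (Finset.univ.filter (fun t => P t ∧ t ≠ (v,u,w))).card + 2 := by
    intro u w u' w' hp hn hp2
    apply card_ge (fun t => P t ∧ t ≠ (v,u,w)) top bot
    intro x hx hx'
    by_cases hxv : x = v
    · subst hxv
      refine ⟨u', w', hp, ?_⟩
      intro h; apply hn; simp at h; simp [h]
    · obtain ⟨a, b, hab⟩ := ex x hx hx'
      refine ⟨a, b, hab, ?_⟩
      intro h; simp at h; exact hxv h.1
  have k := key u w u' w' h2 hne h1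
  refine lt_of_le_of_lt k ?_
  apply Nat.add_lt_add_right
  apply Finset.card_lt_card
  rw [Finset.ssubset_iff_of_subset]
  · exact ⟨(v,u,w), by simp [h1], by simp⟩
  · intro t; simp; tauto

/-- In a sphere with an order having only two extrema, up triangles are unique at each vertex -/
theorem sc_count (h : Sphere T) (f : W → α) (hne : ∀ u v w, T u v w → f u ≠ f v) :
    3 * ((Finset.univ.filter (fun t : W × W × W => T t.1 t.2.1 t.2.2 ∧ f t.2.1 < f t.1 ∧ f t.1 < f t.2.2)).card
     + (Finset.univ.filter (fun t : W × W × W => T t.1 t.2.1 t.2.2 ∧ f t.2.2 < f t.1 ∧ f t.1 < f t.2.1)).card) + 12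
      ≤ 6 * Fintype.card W := by
  have hc := h.count
  set P : Finset (W × W × W) := (Finset.univ.filter (fun t : W × W × W => T t.1 t.2.1 t.2.2 ∧ f t.2.1 < f t.1 ∧ f t.1 < f t.2.2)) with hP
  set Q : Finset (W × W × W) := (Finset.univ.filter (fun t : W × W × W => T t.1 t.2.1 t.2.2 ∧ f t.2.2 < f t.1 ∧ f t.1 < f t.2.1)) with hQ
  have hT : Set.ncard {t : W × W × W | T t.1 t.2.1 t.2.2} = (Finset.univ.filter (fun t : W × W × W => T t.1 t.2.1 t.2.2)).card := by
    rw [← Set.ncard_coe_finset]; congr 1; ext; simp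
  have hPQ : Disjoint P Q := by
    rw [Finset.disjoint_left]
    intro t ht ht'
    simp [hP, hQ] at ht ht'
    exact absurd ht.2.1 (not_lt.mpr ht'.2.2.le)
  rw [← Finset.card_union_of_disjoint hPQ]
  have hR : ((Finset.univ : Finset (Fin 3)) ×ˢ (P ∪ Q)).card ≤ (Finset.univ.filter (fun t : W × W × W => T t.1 t.2.1 t.2.2)).card := by
    have hmem : ∀ a b c, (a,b,c) ∈ P ∪ Q ↔ T a b c ∧ (f b < f a ∧ f a < f c ∨ f c < f a ∧ f a < f b) := by
      intro a b c; simp [hP, hQ]; tauto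
    refine Finset.card_le_card_of_injOn (fun x => if x.1 = 0 then x.2 else if x.1 = 1 then (x.2.2.1, x.2.2.2, x.2.1)
      else (x.2.2.2, x.2.1, x.2.2.1)) ?_ ?_
    · rintro ⟨i, a, b, c⟩ hx
      have hx' : (a,b,c) ∈ P ∪ Q := by simpa using hx
      rw [hmem] at hx'
      clear hx
      fin_cases i <;> simp
      · exact hx'.1
      · exact h.rot hx'.1
      · exact h.rot2 hx'.1
    · rintro ⟨i, a, b, c⟩ hx ⟨j, a', b', c'⟩ hy hxy
      have hx : (a,b,c) ∈ P ∪ Q := by simpa using hx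
      have hy : (a',b',c') ∈ P ∪ Q := by simpa using hy
      rw [hmem] at hx hy
      have h1 := hx.2
      have h2 := hy.2
      fin_cases i <;> fin_cases j <;> simp at hxy ⊢ <;> obtain ⟨rfl, rfl, rfl⟩ := hxy <;>
       first | exact ⟨rfl, rfl, rfl⟩ | (exfalso; clear hx hy; grind)
  simp only [Finset.card_product, Finset.card_univ, Fintype.card_fin] at hR
  omega

theorem sc_uniq (h : Sphere T) (f : W → α) (hne : ∀ u v w, T u v w → f u ≠ f v) (top bot : W)
    (val : ∀ v, v ≠ top → v ≠ bot → (∃ u w, T v u w ∧ f u < f v) ∧ (∃ u w, T v u w ∧ f v < f u)) :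
    (∀ v u w u' w', T v u w → f u < f v → f v < f w → T v u' w' → f u' < f v → f v < f w' → u = u' ∧ w = w') ∧
    (∀ v u w u' w', T v u w → f w < f v → f v < f u → T v u' w' → f w' < f v → f v < f u' → u = u' ∧ w = w') := by
  have hc := h.sc_count f hne
  have e1 : ∀ v, v ≠ top → v ≠ bot → ∃ u w, (fun t : W × W × W => T t.1 t.2.1 t.2.2 ∧ f t.2.1 < f t.1 ∧ f t.1 < f t.2.2) (v,u,w) := by
    intro v hv hv'
    obtain ⟨a, b⟩ := val v hv hv'
    exact h.exists_up f hne a b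
  have e2 : ∀ v, v ≠ top → v ≠ bot → ∃ u w, (fun t : W × W × W => T t.1 t.2.1 t.2.2 ∧ f t.2.2 < f t.1 ∧ f t.1 < f t.2.1) (v,u,w) := by
    intro v hv hv'
    obtain ⟨a, b⟩ := val v hv hv'
    exact h.exists_dn f hne a b
  have c1 := card_ge (fun t : W × W × W => T t.1 t.2.1 t.2.2 ∧ f t.2.1 < f t.1 ∧ f t.1 < f t.2.2) top bot e1
  have c2 := card_ge (fun t : W × W × W => T t.1 t.2.1 t.2.2 ∧ f t.2.2 < f t.1 ∧ f t.1 < f t.2.1) top bot e2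
  constructor
  · intro v u w u' w' t1 a1 b1 t2 a2 b2
    by_contra hcon
    have := card_gt (fun t : W × W × W => T t.1 t.2.1 t.2.2 ∧ f t.2.1 < f t.1 ∧ f t.1 < f t.2.2) top bot e1 (v := v) (u := u) (w := w) (u' := u') (w' := w') ⟨t1, a1, b1⟩ ⟨t2, a2, b2⟩ (by simpa using hcon)
    omega
  · intro v u w u' w' t1 a1 b1 t2 a2 b2
    by_contra hcon
    have := card_gt (fun t : W × W × W => T t.1 t.2.1 t.2.2 ∧ f t.2.2 < f t.1 ∧ f t.1 < f t.2.1) top bot e2 (v := v) (u := u) (w := w) (u' := u') (w' := w') ⟨t1, a1, b1⟩ ⟨t2, a2, b2⟩ (by simpa using hcon)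
    omega
end sc

theorem three (h : Sphere T) (X : Set W) (hX : X.Nonempty) {a b c : W} (t : T a b c)
    (ha : a ∉ X) (hb : b ∉ X) (hc : c ∉ X) (β β' : W)
    (hN : ∀ x u w, x ∈ X → T x u w → u ∈ X ∨ u = β ∨ u = β') : False := by
  have hN' : ∀ x u, x ∈ X → (∃ w, T u x w) → u ∈ X ∨ u = β ∨ u = β' := by
    intro x u hx hu
    obtain ⟨w, hw⟩ := h.adj_symm hu
    exact hN x u w hx hw
  have := h.dual (fun u v w => T u v w ∧ (u ∈ X ∨ v ∈ X ∨ w ∈ X)) (fun _ _ _ hh => hh.1)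
    (by
      obtain ⟨x, hx⟩ := hX
      obtain ⟨u, w, t⟩ := h.vtx x
      exact ⟨x, u, w, t, Or.inl hx⟩)
    (fun u v w hh => ⟨h.rot hh.1, by tauto⟩)
    (by
      rintro u v w z ⟨t1, hX1⟩ t2
      refine ⟨t2, ?_⟩
      by_cases hu : u ∈ X
      · tauto
      by_cases hv : v ∈ X
      · tauto
      have hw : w ∈ X := by tauto
      right; right
      by_contra hz
      have hub := (hN' w u hw (h.adj_symm ⟨_, h.rot2 t1⟩))
      have hvb := (hN' w v hw ⟨_, h.rot t1⟩)
      have hne := h.ne t1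
      obtain ⟨z', hz'⟩ := h.next t1
      have := h.irr u X ⟨w, z', hz', hw⟩ (by
        intro x y txy hx
        have hyb := hN' x y hx (by
          obtain ⟨z, hz⟩ := h.pair (h.rot txy)
          exact ⟨z, hz⟩)
        have hyu : y ≠ u := h.ne (h.rot2 txy)
        by_contra hy
        have hyv : y = v := by
          rcases hub with hub | hub | hub <;> rcases hvb with hvb | hvb | hvb <;>
          rcases hyb with hyb | hyb | hyb <;> first | contradiction | (subst_vars; contradiction) | grind
        subst hyv
        have := h.uniq' txy (h.rot t2)
        exact hz (this ▸ hx)) v w t1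
      exact hv this) a b c t
  tauto
end Sphere
end ICR

namespace ICR
open Classical

theorem ear_path {N : Type*} (adj : N → N → Prop) (hs : ∀ u v, adj u v → adj v u)
    (O : Set N) (hO : ∃ v, v ∉ O)
    (h2 : ∀ X : Set N, X.Nonempty → (∀ x ∈ X, x ∉ O) → ∃ b b', b ≠ b' ∧ b ∉ X ∧ b' ∉ X ∧
      (∃ x ∈ X, adj x b) ∧ (∃ x ∈ X, adj x b')) :
    ∃ (o o' : N) (n : ℕ) (s : ℕ → N), o ∈ O ∧ o' ∈ O ∧ o ≠ o' ∧ adj o (s 0) ∧ adj (s n) o' ∧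
      (∀ i, i < n → adj (s i) (s (i+1))) ∧ (∀ i, i ≤ n → s i ∉ O) ∧
      (∀ i j, i ≤ n → j ≤ n → s i = s j → i = j) := by
  obtain ⟨v, hv⟩ := hO
  let G : SimpleGraph N :=
    { Adj := fun u v => u ≠ v ∧ adj u v ∧ u ∉ O ∧ v ∉ O
      symm := ⟨fun u v h => ⟨h.1.symm, hs _ _ h.2.1, h.2.2.2, h.2.2.1⟩⟩
      loopless := ⟨fun u h => h.1 rfl⟩ }
  have hout : ∀ x y, G.Reachable x y → x ∉ O → y ∉ O := by
    intro x y hxy hx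
    obtain ⟨p⟩ := hxy
    induction p with
    | nil => exact hx
    | cons hadj p ih => exact ih hadj.2.2.2
  obtain ⟨b, b', hbb, hb, hb', ⟨x, hx, hxb⟩, ⟨x', hx', hxb'⟩⟩ := h2 {x | G.Reachable v x} ⟨v, SimpleGraph.Reachable.refl v⟩
    (fun x hx => hout v x hx hv)
  have inO : ∀ x b, G.Reachable v x → adj x b → ¬ G.Reachable v b → b ∈ O := by
    intro x b hx hxb hb
    by_contra hbO
    apply hb
    refine hx.trans ?_
    by_cases e : x = b
    · subst e; exact SimpleGraph.Reachable.refl _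
    · exact SimpleGraph.Adj.reachable (show G.Adj x b from ⟨e, hxb, hout v x hx hv, hbO⟩)
  have hr : G.Reachable x x' := (SimpleGraph.Reachable.symm hx).trans hx'
  obtain ⟨p, hp⟩ := hr.exists_isPath
  refine ⟨b, b', p.length, p.getVert, inO x b hx hxb hb, inO x' b' hx' hxb' hb', hbb, ?_, ?_, ?_, ?_, ?_⟩
  · simpa using hs _ _ hxb
  · simpa using hxb'
  · intro i hi
    exact (p.adj_getVert_succ hi).2.1
  · intro i hi
    refine hout x _ ?_ (hout v x hx hv)
    exact ⟨p.take i⟩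
  · intro i j hi hj hij
    exact hp.getVert_injOn hi hj hij

theorem gap {N : Type*} [Fintype N] (O : Set N) (g : N → ℝ) (c : ℝ) :
    ∃ ε > 0, ∀ z ∈ O, c < g z → c + ε < g z := by
  have : ∀ z : N, ∃ ε > 0, ∀ ε', 0 < ε' → ε' ≤ ε → (z ∈ O → c < g z → c + ε' < g z) := by
    intro z
    by_cases h : c < g z
    · exact ⟨(g z - c)/2, by linarith, fun ε' h1 h2 _ _ => by linarith⟩
    · exact ⟨1, one_pos, fun ε' h1 h2 _ h3 => absurd h3 h⟩
  choose e he h using this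
  obtain ⟨ε, hε, hle⟩ : ∃ ε > 0, ∀ z, ε ≤ e z := by
    by_cases hN : Nonempty N
    · obtain ⟨z, hz⟩ := Finite.exists_min e
      exact ⟨e z, he z, hz⟩
    · exact ⟨1, one_pos, fun z => absurd ⟨z⟩ hN⟩
  exact ⟨ε, hε, fun z => h z ε hε (hle z)⟩

theorem ear {N : Type*} [Fintype N] (adj : N → N → Prop) (hs : ∀ u v, adj u v → adj v u) :
    ∀ (m : ℕ) (O : Set N) (g : N → ℝ), (Oᶜ).ncard ≤ m → Set.InjOn g O →
    (∀ X : Set N, X.Nonempty → (∀ x ∈ X, x ∉ O) → ∃ b b', b ≠ b' ∧ b ∉ X ∧ b' ∉ X ∧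
      (∃ x ∈ X, adj x b) ∧ (∃ x ∈ X, adj x b')) →
    ∃ g' : N → ℝ, Function.Injective g' ∧ (∀ v ∈ O, g' v = g v) ∧
      ∀ v, v ∉ O → (∃ u, adj v u ∧ g' u < g' v) ∧ (∃ u, adj v u ∧ g' v < g' u) := by
  intro m
  induction m with
  | zero =>
    intro O g hm hinj h2
    have : Oᶜ = ∅ := by
      rw [← Set.ncard_eq_zero]; omega
    have hO : ∀ v, v ∈ O := fun v => by
      by_contra hv
      have : v ∈ Oᶜ := hv
      simp_all
    exact ⟨g, fun a b hab => hinj (hO a) (hO b) hab, fun _ _ => rfl, fun v hv => absurd (hO v) hv⟩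
  | succ m ih =>
    intro O g hm hinj h2
    by_cases hO : ∃ v, v ∉ O
    swap
    · push Not at hO
      exact ⟨g, fun a b hab => hinj (hO a) (hO b) hab, fun _ _ => rfl, fun v hv => absurd (hO v) hv⟩
    obtain ⟨o, o', n, s, ho, ho', hoo, h0, hn, hadj, hsO, hsinj⟩ : ∃ (o o' : N) (n : ℕ) (s : ℕ → N), o ∈ O ∧ o' ∈ O ∧ g o < g o' ∧ adj o (s 0) ∧ adj (s n) o' ∧
      (∀ i, i < n → adj (s i) (s (i+1))) ∧ (∀ i, i ≤ n → s i ∉ O) ∧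
      (∀ i j, i ≤ n → j ≤ n → s i = s j → i = j) := by
      obtain ⟨o, o', n, s, ho, ho', hoo, h0, hn, hadj, hsO, hsinj⟩ := ear_path adj hs O hO h2
      have hgne : g o ≠ g o' := fun e => hoo (hinj ho ho' e)
      rcases lt_or_gt_of_ne hgne with hlt | hlt
      · exact ⟨o, o', n, s, ho, ho', hlt, h0, hn, hadj, hsO, hsinj⟩
      · refine ⟨o', o, n, fun i => s (n - i), ho', ho, hlt, ?_, ?_, ?_, ?_, ?_⟩
        · simpa using hs _ _ hn
        · simpa using hs _ _ h0
        · intro i hi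
          have := hadj (n - (i+1)) (by omega)
          rw [show n - (i+1) + 1 = n - i by omega] at this
          exact hs _ _ this
        · intro i hi; exact hsO _ (by omega)
        · intro i j hi hj hij
          have := hsinj _ _ (by omega) (by omega) hij
          omega
    obtain ⟨ε, hε, hgap⟩ := gap O g (g o)
    let val : ℕ → ℝ := fun i => g o + ε * ((i + 1 : ℝ) / (n + 2))
    have hval : ∀ i j : ℕ, i < j → val i < val j := by
      intro i j hij
      have : (i : ℝ) < j := by exact_mod_cast hij
      have hn2 : (0:ℝ) < n + 2 := by positivity
      simp only [val]
      gcongr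
    have hval0 : ∀ i, g o < val i := by
      intro i
      have : 0 < ε * ((i + 1 : ℝ) / (n + 2)) := by positivity
      simp only [val]; linarith
    have hval1 : ∀ i, i ≤ n → val i < g o + ε := by
      intro i hi
      have : ((i + 1 : ℝ) / (n + 2)) < 1 := by
        rw [div_lt_one (by positivity)]
        have : (i:ℝ) ≤ n := by exact_mod_cast hi
        linarith
      have : ε * ((i + 1 : ℝ) / (n + 2)) < ε * 1 := by gcongr
      simp only [val]; linarith
    let g1 : N → ℝ := fun v => if h : ∃ i, i ≤ n ∧ s i = v then val h.choose else g v
    have g1s : ∀ i, i ≤ n → g1 (s i) = val i := by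
      intro i hi
      have h : ∃ j, j ≤ n ∧ s j = s i := ⟨i, hi, rfl⟩
      simp only [g1, dif_pos h]
      rw [hsinj _ _ h.choose_spec.1 hi h.choose_spec.2]
    have g1O : ∀ v ∈ O, g1 v = g v := by
      intro v hv
      have h : ¬ ∃ j, j ≤ n ∧ s j = v := by
        rintro ⟨j, hj, rfl⟩; exact hsO j hj hv
      simp only [g1, dif_neg h]
    let O' : Set N := O ∪ {v | ∃ i, i ≤ n ∧ s i = v}
    have hsub : O ⊆ O' := Set.subset_union_left
    have key : ∀ z ∈ O, ∀ i, i ≤ n → g z ≠ val i := by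
      intro z hz i hi e
      by_cases hlt : g o < g z
      · have := hgap z hz hlt
        have := hval1 i hi
        linarith
      · have := hval0 i
        linarith
    obtain ⟨g', ginj, gO, gv⟩ := ih O' g1 (by
        have : (O'ᶜ).ncard < (Oᶜ).ncard := by
          apply Set.ncard_lt_ncard _ (Set.toFinite _)
          rw [Set.ssubset_iff_of_subset (Set.compl_subset_compl.mpr hsub)]
          exact ⟨s 0, hsO 0 (by omega), fun h => h (Or.inr ⟨0, by omega, rfl⟩)⟩
        omega) (by
        rintro a (ha | ⟨i, hi, rfl⟩) b (hb | ⟨j, hj, rfl⟩) hab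
        · rw [g1O a ha, g1O b hb] at hab; exact hinj ha hb hab
        · rw [g1O a ha, g1s j hj] at hab; exact absurd hab (key a ha j hj)
        · rw [g1O b hb, g1s i hi] at hab; exact absurd hab.symm (key b hb i hi)
        · rw [g1s i hi, g1s j hj] at hab
          rcases lt_trichotomy i j with h | h | h
          · exact absurd hab (hval _ _ h).ne
          · rw [h]
          · exact absurd hab (hval _ _ h).ne') (by
        intro X hX hXO
        exact h2 X hX (fun x hx hxO => hXO x hx (hsub hxO)))
    have hgO : ∀ v ∈ O, g' v = g v := fun v hv => by rw [gO v (hsub hv), g1O v hv]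
    have hgs : ∀ i, i ≤ n → g' (s i) = val i := fun i hi => by
      rw [gO _ (Or.inr ⟨i, hi, rfl⟩), g1s i hi]
    refine ⟨g', ginj, hgO, ?_⟩
    intro v hv
    by_cases hv' : v ∈ O'
    swap
    · exact gv v hv'
    rcases hv' with hv' | ⟨i, hi, rfl⟩
    · exact absurd hv' hv
    constructor
    · rcases Nat.eq_zero_or_pos i with h | h
      · subst h
        exact ⟨o, hs _ _ h0, by rw [hgO o ho, hgs _ hi]; exact hval0 _⟩
      · refine ⟨s (i-1), ?_, ?_⟩
        · have := hadj (i-1) (by omega)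
          rw [show i - 1 + 1 = i by omega] at this
          exact hs _ _ this
        · rw [hgs _ hi, hgs _ (by omega)]; exact hval _ _ (by omega)
    · rcases Nat.lt_or_ge i n with h | h
      · exact ⟨s (i+1), hadj i h, by rw [hgs _ hi, hgs _ (by omega)]; exact hval _ _ (by omega)⟩
      · have : i = n := by omega
        subst this
        refine ⟨o', hn, ?_⟩
        rw [hgO o' ho', hgs _ hi]
        exact (hval1 _ hi).trans (hgap _ ho' hoo)
end ICR

namespace ICR
open Classical

/-- twice the signed area of a triangle -/
def D (p q r : ℝ × ℝ) : ℝ := (q.1-p.1)*(r.2-p.2)-(q.2-p.2)*(r.1-p.1)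

theorem D_rot (p q r : ℝ × ℝ) : D q r p = D p q r := by unfold D; ring
theorem D_rot2 (p q r : ℝ × ℝ) : D r p q = D p q r := by unfold D; ring
theorem D_swap (p q r : ℝ × ℝ) : D q p r = - D p q r := by unfold D; ring
theorem D_swap' (p q r : ℝ × ℝ) : D p r q = - D p q r := by unfold D; ring

def IsOut {W : Type*} (o0 o1 o2 : W) (u v w : W) : Prop :=
  (u = o0 ∧ v = o2 ∧ w = o1) ∨ (u = o2 ∧ v = o1 ∧ w = o0) ∨ (u = o1 ∧ v = o0 ∧ w = o2)

def Outer {W : Type*} (o0 o1 o2 : W) (v : W) : Prop := v = o0 ∨ v = o1 ∨ v = o2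

def Pos {W : Type*} (T : W → W → W → Prop) (o0 o1 o2 : W) (p : W → ℝ × ℝ) : Prop :=
  0 < D (p o0) (p o1) (p o2) ∧ ∀ u v w, T u v w → IsOut o0 o1 o2 u v w ∨ 0 < D (p u) (p v) (p w)

theorem transition (P : ℕ → Prop) (a b : ℕ) (hab : a < b) (ha : P a) (hb : ¬ P b) :
    ∃ i, a ≤ i ∧ i < b ∧ P i ∧ ¬ P (i+1) := by
  induction b with
  | zero => omega
  | succ b ih =>
    by_cases h : P b
    · exact ⟨b, by omega, by omega, h, hb⟩
    · have : a ≠ b := fun e => h (e ▸ ha)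
      obtain ⟨i, h1, h2, h3⟩ := ih (by omega) h
      exact ⟨i, h1, by omega, h3⟩

theorem inj_lohi {W : Type*} [Fintype W] (x y : W) (hxy : x ≠ y) :
    ∃ g : W → ℝ, Function.Injective g ∧ ∀ z, z ≠ x → z ≠ y → g x < g z ∧ g z < g y := by
  let e : W → ℝ := fun v => ((Fintype.equivFin W v : ℕ) : ℝ)
  have he : ∀ v, e v < Fintype.card W := fun v => by
    simp only [e]; exact_mod_cast (Fintype.equivFin W v).2
  have he0 : ∀ v, 0 ≤ e v := fun v => by simp only [e]; positivity
  have einj : Function.Injective e := by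
    intro a b hab
    simp only [e] at hab
    have : (Fintype.equivFin W a : ℕ) = (Fintype.equivFin W b : ℕ) := by exact_mod_cast hab
    exact (Fintype.equivFin W).injective (Fin.ext this)
  have hc : (0:ℝ) ≤ Fintype.card W := by positivity
  refine ⟨fun v => if v = x then -1 else if v = y then Fintype.card W else e v, ?_, ?_⟩
  · intro a b hab
    have h1 := he a
    have h2 := he b
    have h3 := he0 a
    have h4 := he0 b
    by_cases hax : a = x <;> by_cases hbx : b = x <;> by_cases hay : a = y <;> by_cases hby : b = y <;>
      simp [hax, hbx, hay, hby] at hab ⊢ <;> first | (subst_vars; done) | exact einj hab | grind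
  · intro z h1 h2
    have := he z
    have := he0 z
    simp [h1, h2]
    rw [if_neg hxy.symm]
    constructor <;> linarith

theorem inj_two {W : Type*} [Fintype W] (x y : W) (hxy : x ≠ y) :
    ∃ g : W → ℝ, Function.Injective g ∧ g x < g y ∧ ∀ z, z ≠ x → z ≠ y → g y < g z := by
  let e : W → ℝ := fun v => ((Fintype.equivFin W v : ℕ) : ℝ)
  have he0 : ∀ v, 0 ≤ e v := fun v => by simp only [e]; positivity
  have einj : Function.Injective e := by
    intro a b hab
    simp only [e] at hab
    have : (Fintype.equivFin W a : ℕ) = (Fintype.equivFin W b : ℕ) := by exact_mod_cast hab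
    exact (Fintype.equivFin W).injective (Fin.ext this)
  refine ⟨fun v => if v = x then -2 else if v = y then -1 else e v, ?_, ?_, ?_⟩
  · intro a b hab
    have h3 := he0 a
    have h4 := he0 b
    by_cases hax : a = x <;> by_cases hbx : b = x <;> by_cases hay : a = y <;> by_cases hby : b = y <;>
      simp [hax, hbx, hay, hby] at hab ⊢ <;> first | (subst_vars; done) | exact einj hab | grind
  · simp [hxy.symm]
  · intro z h1 h2
    have := he0 z
    simp [h1, h2]
    rw [if_neg hxy.symm]
    linarith

section level
variable {W : Type*} [Fintype W] {T : W → W → W → Prop} (h : Sphere T) {o0 o1 o2 : W} (ho : T o0 o2 o1)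
variable (l : W → ℝ)
  (hc : ∀ v, ¬ Outer o0 o1 o2 v → (∃ u w, T v u w ∧ l u ≠ l v) →
    (∃ u w, T v u w ∧ l u < l v) ∧ (∃ u w, T v u w ∧ l v < l u))

def Stuck (T : W → W → W → Prop) (o0 o1 o2 : W) (l : W → ℝ) (v : W) : Prop :=
  ¬ Outer o0 o1 o2 v ∧ ∀ u w, T v u w → l u = l v

include h ho hc in
theorem level_ext (g0 : W → ℝ) (hg0 : Function.Injective g0) :
    ∃ g : W → ℝ, Function.Injective g ∧ (∀ v, ¬ Stuck T o0 o1 o2 l v → g v = g0 v) ∧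
    (∀ v u w u' w', T v u w → toLex (l u, g u) < toLex (l v, g v) → toLex (l v, g v) < toLex (l w, g w) → 
      T v u' w' → toLex (l u', g u') < toLex (l v, g v) → toLex (l v, g v) < toLex (l w', g w') → u = u' ∧ w = w') ∧
    (∀ v u w u' w', T v u w → toLex (l w, g w) < toLex (l v, g v) → toLex (l v, g v) < toLex (l u, g u) → 
      T v u' w' → toLex (l w', g w') < toLex (l v, g v) → toLex (l v, g v) < toLex (l u', g u') → u = u' ∧ w = w') := by
  obtain ⟨g, ginj, gO, gv⟩ := ear (fun u v => ∃ w, T u v w) (fun u v => h.adj_symm) _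
    {v | ¬ Stuck T o0 o1 o2 l v} g0 le_rfl hg0.injOn (by
      intro X hX hXO
      by_contra hcon
      push Not at hcon
      have hXO : ∀ x ∈ X, Stuck T o0 o1 o2 l x := fun x hx => by simpa using hXO x hx
      have n0 : o0 ∉ X := fun hx => (hXO _ hx).1 (Or.inl rfl)
      have n1 : o1 ∉ X := fun hx => (hXO _ hx).1 (Or.inr (Or.inl rfl))
      have n2 : o2 ∉ X := fun hx => (hXO _ hx).1 (Or.inr (Or.inr rfl))
      by_cases hb : ∃ b, b ∉ X ∧ ∃ x ∈ X, ∃ w, T x b w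
      · obtain ⟨b, hb, hxb⟩ := hb
        refine h.three X hX ho n0 n2 n1 b b ?_
        intro x u w hx t
        by_contra hh
        push Not at hh
        obtain ⟨x', hx', w', t'⟩ := hxb
        exact hcon u b hh.2.1 hh.1 hb ⟨x, hx, w, t⟩ x' hx' w' t'
      · push Not at hb
        refine h.three X hX ho n0 n2 n1 o0 o0 ?_
        intro x u w hx t
        by_contra hh
        push Not at hh
        exact hb u hh.1 x hx w t)
  have fne : ∀ u v w, T u v w → toLex (l u, g u) ≠ toLex (l v, g v) := by
    intro u v w t e
    have : (l u, g u) = (l v, g v) := toLex.injective e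
    exact h.ne t (ginj (congrArg Prod.snd this))
  have int : ∀ v, ¬ Outer o0 o1 o2 v → (∃ u w, T v u w ∧ toLex (l u, g u) < toLex (l v, g v)) ∧ 
     (∃ u w, T v u w ∧ toLex (l v, g v) < toLex (l u, g u)) := by
    intro v hv
    by_cases hs : Stuck T o0 o1 o2 l v
    · obtain ⟨⟨u, ⟨w, t⟩, hu⟩, ⟨u', ⟨w', t'⟩, hu'⟩⟩ := gv v (by simpa using hs)
      exact ⟨⟨u, w, t, Prod.Lex.toLex_lt_toLex.mpr (Or.inr ⟨hs.2 u w t, hu⟩)⟩,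
       ⟨u', w', t', Prod.Lex.toLex_lt_toLex.mpr (Or.inr ⟨(hs.2 u' w' t').symm, hu'⟩)⟩⟩
    · have : ∃ u w, T v u w ∧ l u ≠ l v := by
        by_contra hcon; push Not at hcon
        exact hs ⟨hv, hcon⟩
      obtain ⟨⟨u, w, t, hu⟩, ⟨u', w', t', hu'⟩⟩ := hc v hv this
      exact ⟨⟨u, w, t, Prod.Lex.toLex_lt_toLex.mpr (Or.inl hu)⟩,
       ⟨u', w', t', Prod.Lex.toLex_lt_toLex.mpr (Or.inl hu')⟩⟩
  have main : ∀ top bot : W, (∀ v, v ≠ top → v ≠ bot → (∃ u w, T v u w ∧ toLex (l u, g u) < toLex (l v, g v)) ∧ 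
     (∃ u w, T v u w ∧ toLex (l v, g v) < toLex (l u, g u))) → _ := 
    fun top bot hval => h.sc_uniq (fun v => toLex (l v, g v)) fne top bot hval
  refine ⟨g, ginj, fun v hv => gO v hv, ?_⟩
  have a1 := h.rot ho
  have a2 := h.rot a1
  obtain ⟨_, b0⟩ := h.pair ho
  obtain ⟨_, b1⟩ := h.pair a1
  obtain ⟨_, b2⟩ := h.pair a2
  have mk : ∀ x y z : W, (∀ v, Outer o0 o1 o2 v → v = x ∨ v = y ∨ v = z) → 
     (∃ w, T y x w) → (∃ w, T y z w) → toLex (l x, g x) < toLex (l y, g y) → toLex (l y, g y) < toLex (l z, g z) → 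
     (∀ v, v ≠ x → v ≠ z → (∃ u w, T v u w ∧ toLex (l u, g u) < toLex (l v, g v)) ∧ 
     (∃ u w, T v u w ∧ toLex (l v, g v) < toLex (l u, g u))) := by
    intro x y z hO ⟨w, h1⟩ ⟨w', h2⟩ h3 h4 v hv hv'
    by_cases hvo : Outer o0 o1 o2 v
    · have : v = y := by have := hO v hvo; tauto
      subst this
      exact ⟨⟨x, w, h1, h3⟩, ⟨z, w', h2, h4⟩⟩
    · exact int v hvo
  rcases lt_or_gt_of_ne (fne _ _ _ ho) with k0 | k0 <;> rcases lt_or_gt_of_ne (fne _ _ _ a1) with k1 | k1 <;>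
    rcases lt_or_gt_of_ne (fne _ _ _ a2) with k2 | k2
  · exact absurd (k0.trans (k1.trans k2)) (lt_irrefl _)
  · exact main o0 o1 (mk o0 o2 o1 (by unfold Outer; tauto) ⟨_, b0⟩ ⟨_, a1⟩ k0 k1)
  · exact main o1 o2 (mk o1 o0 o2 (by unfold Outer; tauto) ⟨_, b2⟩ ⟨_, ho⟩ k2 k0)
  · exact main o0 o2 (mk o0 o1 o2 (by unfold Outer; tauto) ⟨_, a2⟩ ⟨_, b1⟩ k2 k1)
  · exact main o2 o0 (mk o2 o1 o0 (by unfold Outer; tauto) ⟨_, b1⟩ ⟨_, a2⟩ k1 k2)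
  · exact main o2 o1 (mk o2 o0 o1 (by unfold Outer; tauto) ⟨_, ho⟩ ⟨_, b2⟩ k0 k2)
  · exact main o1 o0 (mk o1 o2 o0 (by unfold Outer; tauto) ⟨_, a1⟩ ⟨_, b0⟩ k1 k0)
  · exact absurd (k0.trans (k2.trans k1)) (lt_irrefl _)

include h ho hc in
theorem no_stuck (hl : ¬ (l o0 = l o1 ∧ l o0 = l o2)) (x : W) : ¬ Stuck T o0 o1 o2 l x := by
  intro hx
  set X : Set W := {v | Stuck T o0 o1 o2 l v ∧ l v = l x} with hX
  have n0 : o0 ∉ X := fun hx => hx.1.1 (Or.inl rfl)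
  have n1 : o1 ∉ X := fun hx => hx.1.1 (Or.inr (Or.inl rfl))
  have n2 : o2 ∉ X := fun hx => hx.1.1 (Or.inr (Or.inr rfl))
  have lev : ∀ y u w, y ∈ X → T y u w → l u = l x := fun y u w hy t => (hy.1.2 u w t).trans hy.2
  have hex : ∃ β x1 w, x1 ∈ X ∧ T x1 β w ∧ β ∉ X ∧ ¬ Outer o0 o1 o2 β := by
    by_contra hcon
    push Not at hcon
    have : ∃ β β', ∀ u, Outer o0 o1 o2 u → l u = l x → u = β ∨ u = β' := by
      by_cases e0 : l o0 = l x
      · by_cases e1 : l o1 = l x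
        · refine ⟨o0, o1, ?_⟩
          rintro u (rfl | rfl | rfl) hu
          · tauto
          · tauto
          · exact absurd ⟨e0.trans e1.symm, e0.trans hu.symm⟩ hl
        · refine ⟨o0, o2, ?_⟩
          rintro u (rfl | rfl | rfl) hu <;> tauto
      · refine ⟨o1, o2, ?_⟩
        rintro u (rfl | rfl | rfl) hu <;> tauto
    obtain ⟨β, β', hβ⟩ := this
    refine h.three X ⟨x, hx, rfl⟩ ho n0 n2 n1 β β' ?_
    intro y u w hy t
    by_cases hu : u ∈ X
    · exact Or.inl hu
    · exact Or.inr (hβ u (hcon u y w hy t hu) (lev y u w hy t))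
  obtain ⟨β, x1, w1, hx1, t1, hβX, hβo⟩ := hex
  have hβl : l β = l x := lev _ _ _ hx1 t1
  have hβs : ¬ Stuck T o0 o1 o2 l β := fun hs => hβX ⟨hs, hβl⟩
  have hβd : ∃ u w, T β u w ∧ l u ≠ l β := by
    by_contra hcon; push Not at hcon
    exact hβs ⟨hβo, hcon⟩
  obtain ⟨⟨d, wd, td, hd⟩, ⟨u, wu, tu, hu⟩⟩ := hc β hβo hβd
  have notX : ∀ z, l z ≠ l β → z ∉ X := fun z hz hzX => hz (hzX.2.trans hβl.symm)
  -- exit from X around β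
  obtain ⟨y, s0, ty, hy, hs0⟩ : ∃ y s0, T β y s0 ∧ y ∈ X ∧ s0 ∉ X := by
    by_contra hcon
    push Not at hcon
    obtain ⟨z, tz⟩ := h.pair t1
    have := h.irr β X ⟨x1, z, tz, hx1⟩ hcon u wu tu
    exact notX u hu.ne' this
  have levn : ∀ a b, T β a b → a ∈ X → l b = l β := by
    intro a b t ha
    exact (lev a b _ ha (h.rot t)).trans hβl.symm
  have levp : ∀ a b, T β a b → b ∈ X → l a = l β := by
    intro a b t hb
    obtain ⟨z, hz⟩ := h.pair (h.rot t)
    exact (lev b a _ hb hz).trans hβl.symm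
  obtain ⟨z0, tz0⟩ := h.next ty
  obtain ⟨n, s, hn, es0, esn, ts, sinj, sall⟩ := h.link_cycle tz0
  have hlast : s (n-1) = y := by
    have := ts (n-1)
    rw [show n - 1 + 1 = n by omega, esn, es0] at this
    exact h.uniq' this ty
  obtain ⟨iu, hiu, eiu⟩ := sall u wu tu
  obtain ⟨id, hid, eid⟩ := sall d wd td
  have hs0l : l (s 0) = l β := by rw [es0]; exact levn _ _ ty hy
  have hiu0 : iu ≠ 0 := by
    rintro rfl; rw [eiu] at hs0l; exact hu.ne' hs0l
  have hid0 : id ≠ 0 := by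
    rintro rfl; rw [eid] at hs0l; exact hd.ne hs0l
  -- last non-X index
  obtain ⟨j, hjn, hjX, hjl⟩ : ∃ j, j < n ∧ s j ∉ X ∧ ∀ i, j < i → i < n → s i ∈ X := by
    have hex : ∃ k, k < n ∧ s (n - 1 - k) ∉ X := ⟨n-1, by omega, by simpa [es0] using hs0⟩
    refine ⟨n - 1 - Nat.find hex, by omega, (Nat.find_spec hex).2, ?_⟩
    intro i h1 h2
    have hfl := (Nat.find_spec hex).1
    have := Nat.find_min hex (m := n - 1 - i) (by omega)
    by_contra hcon
    apply this
    refine ⟨by omega, ?_⟩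
    rwa [show n - 1 - (n - 1 - i) = i by omega]
  have hle : ∀ i, i < n → s i ∉ X → i ≤ j := by
    intro i hi hiX
    by_contra hcon
    exact hiX (hjl i (by omega) hi)
  have hjn1 : j ≠ n - 1 := by
    intro e; rw [e, hlast] at hjX; exact hjX hy
  have hjlev : l (s j) = l β := levp _ _ (ts j) (hjl (j+1) (by omega) (by omega))
  have hiuj : iu < j := by
    have h1 := hle iu hiu (by rw [eiu]; exact notX u hu.ne')
    have : iu ≠ j := by rintro rfl; rw [eiu] at hjlev; exact hu.ne' hjlev
    omega
  have hidj : id < j := by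
    have h1 := hle id hid (by rw [eid]; exact notX d hd.ne)
    have : id ≠ j := by rintro rfl; rw [eid] at hjlev; exact hd.ne hjlev
    omega
  have hne : s 0 ≠ s j := fun e => by
    have := sinj 0 j (by omega) (by omega) e
    omega
  have hβne : ∀ i, β ≠ s i := fun i => h.ne (ts i)
  have s0u : ¬ Stuck T o0 o1 o2 l (s 0) := fun hs => by
    apply hs0; rw [← es0]; exact ⟨hs, hs0l.trans hβl⟩
  have sju : ¬ Stuck T o0 o1 o2 l (s j) := fun hs => hjX ⟨hs, hjlev.trans hβl⟩
  have hud : iu ≠ id := by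
    rintro rfl
    have : u = d := eiu.symm.trans eid
    subst this; linarith
  rcases lt_or_gt_of_ne hud with hlt | hlt
  · obtain ⟨g0, g0inj, hg0⟩ := inj_lohi (s 0) (s j) hne
    obtain ⟨g, ginj, gO, U, _⟩ := level_ext h ho l hc g0 g0inj
    have hb := hg0 β (hβne 0) (hβne j)
    rw [← gO _ hβs, ← gO _ s0u, ← gO _ sju] at hb
    have tot : ∀ i, ¬ toLex (l (s i), g (s i)) < toLex (l β, g β) → toLex (l β, g β) < toLex (l (s i), g (s i)) := by
      intro i hi
      rcases lt_trichotomy (toLex (l (s i), g (s i))) (toLex (l β, g β)) with h1 | h1 | h1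
      · exact absurd h1 hi
      · have : (l (s i), g (s i)) = (l β, g β) := toLex.injective h1
        exact absurd (ginj (congrArg Prod.snd this)).symm (hβne i)
      · exact h1
    obtain ⟨i1, _, h12, h13, h14⟩ := transition (fun i => toLex (l (s i), g (s i)) < toLex (l β, g β)) 0 iu (by omega)
      (Prod.Lex.toLex_lt_toLex.mpr (Or.inr ⟨hs0l, hb.1⟩))
      (not_lt.mpr (le_of_lt (Prod.Lex.toLex_lt_toLex.mpr (Or.inl (by rw [eiu]; exact hu)))))
    obtain ⟨i2, h21, h22, h23, h24⟩ := transition (fun i => toLex (l (s i), g (s i)) < toLex (l β, g β)) id j (by omega)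
      (Prod.Lex.toLex_lt_toLex.mpr (Or.inl (by rw [eid]; exact hd)))
      (not_lt.mpr (le_of_lt (Prod.Lex.toLex_lt_toLex.mpr (Or.inr ⟨hjlev.symm, hb.2⟩))))
    have := (U β _ _ _ _ (ts i1) h13 (tot _ h14) (ts i2) h23 (tot _ h24)).1
    have := sinj i1 i2 (by omega) (by omega) this
    omega
  · obtain ⟨g0, g0inj, hg0⟩ := inj_lohi (s j) (s 0) hne.symm
    obtain ⟨g, ginj, gO, _, U⟩ := level_ext h ho l hc g0 g0inj
    have hb := hg0 β (hβne j) (hβne 0)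
    rw [← gO _ hβs, ← gO _ s0u, ← gO _ sju] at hb
    have tot : ∀ i, ¬ toLex (l β, g β) < toLex (l (s i), g (s i)) → toLex (l (s i), g (s i)) < toLex (l β, g β) := by
      intro i hi
      rcases lt_trichotomy (toLex (l (s i), g (s i))) (toLex (l β, g β)) with h1 | h1 | h1
      · exact h1
      · have : (l (s i), g (s i)) = (l β, g β) := toLex.injective h1
        exact absurd (ginj (congrArg Prod.snd this)).symm (hβne i)
      · exact absurd h1 hi
    obtain ⟨i1, _, h12, h13, h14⟩ := transition (fun i => toLex (l β, g β) < toLex (l (s i), g (s i))) 0 id (by omega)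
      (Prod.Lex.toLex_lt_toLex.mpr (Or.inr ⟨hs0l.symm, hb.2⟩))
      (not_lt.mpr (le_of_lt (Prod.Lex.toLex_lt_toLex.mpr (Or.inl (by rw [eid]; exact hd)))))
    obtain ⟨i2, h21, h22, h23, h24⟩ := transition (fun i => toLex (l β, g β) < toLex (l (s i), g (s i))) iu j (by omega)
      (Prod.Lex.toLex_lt_toLex.mpr (Or.inl (by rw [eiu]; exact hu)))
      (not_lt.mpr (le_of_lt (Prod.Lex.toLex_lt_toLex.mpr (Or.inr ⟨hjlev, hb.1⟩))))
    have := (U β _ _ _ _ (ts i1) (tot _ h14) h13 (ts i2) (tot _ h24) h23).1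
    have := sinj i1 i2 (by omega) (by omega) this
    omega

include h ho hc in
theorem edge_ge (hl : ¬ (l o0 = l o1 ∧ l o0 = l o2)) {u v w w' : W} (t : T u v w) (t' : T v u w')
    (hv : ¬ Outer o0 o1 o2 v) (huv : l u = l v) (hw : l v ≤ l w) (hw' : l v ≤ l w') : False := by
  have ns := no_stuck h ho l hc hl
  obtain ⟨g0, g0inj, huv0, hg0⟩ := inj_two u v (h.ne t)
  obtain ⟨g, ginj, gO, U, _⟩ := level_ext h ho l hc g0 g0inj
  have gg : g = g0 := funext fun v => gO v (ns v)
  subst gg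
  have hd : ∃ u w, T v u w ∧ l u ≠ l v := by
    by_contra hcon; push Not at hcon
    exact ns v ⟨hv, hcon⟩
  obtain ⟨⟨d, wd, td, hd⟩, _⟩ := hc v hv hd
  have big : ∀ z, z ≠ u → z ≠ v → l v ≤ l z → toLex (l v, g v) < toLex (l z, g z) := by
    intro z h1 h2 h3
    rw [Prod.Lex.toLex_lt_toLex]
    rcases lt_or_eq_of_le h3 with h4 | h4
    · exact Or.inl h4
    · exact Or.inr ⟨h4, hg0 z h1 h2⟩
  have hwb := big w (h.ne (h.rot2 t)) (h.ne (h.rot t)).symm hw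
  have hwb' := big w' (h.ne (h.rot t')).symm (h.ne (h.rot2 t')) hw'
  have hub : toLex (l u, g u) < toLex (l v, g v) := Prod.Lex.toLex_lt_toLex.mpr (Or.inr ⟨huv, huv0⟩)
  obtain ⟨z', hz'⟩ := h.next t'
  have := h.irr v {z | toLex (l z, g z) < toLex (l v, g v) ∧ z ≠ u} ⟨d, wd, td, 
    Prod.Lex.toLex_lt_toLex.mpr (Or.inl hd), by rintro rfl; linarith⟩ (by
    rintro z y tz ⟨hz, hzu⟩
    have hyu : y ≠ u := by
      rintro rfl
      have := h.uniq' tz (h.rot t)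
      subst this
      exact absurd hz (not_lt.mpr hwb.le)
    refine ⟨?_, hyu⟩
    by_contra hcon
    have hyv : y ≠ v := h.ne (h.rot2 tz)
    have : toLex (l v, g v) < toLex (l y, g y) := by
      refine lt_of_le_of_ne (not_lt.mp hcon) ?_
      intro e
      have : (l v, g v) = (l y, g y) := toLex.injective e
      exact hyv (ginj (congrArg Prod.snd this)).symm
    exact hzu (U v _ _ _ _ tz hz this t' hub hwb').1) w' z' hz'
  exact absurd this.1 (not_lt.mpr hwb'.le)

end level
end ICR

namespace ICR
open Classical

def lin (a b : ℝ) (q : ℝ × ℝ) : ℝ := a * q.1 + b * q.2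

section tutte
variable {W : Type*} [Fintype W] {T : W → W → W → Prop} 

def HC (T : W → W → W → Prop) (o0 o1 o2 : W) (p : W → ℝ × ℝ) : Prop :=
  ∀ v, ¬ Outer o0 o1 o2 v → ∀ a b : ℝ, (∃ u w, T v u w ∧ lin a b (p u) ≠ lin a b (p v)) →
    (∃ u w, T v u w ∧ lin a b (p u) < lin a b (p v)) ∧ (∃ u w, T v u w ∧ lin a b (p v) < lin a b (p u))

theorem lin_nonconst {x y z : ℝ × ℝ} (hD : 0 < D x y z) {a b : ℝ} (hab : a ≠ 0 ∨ b ≠ 0) :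
    ¬ (lin a b x = lin a b y ∧ lin a b x = lin a b z) := by
  rintro ⟨h1, h2⟩
  unfold lin at h1 h2
  unfold D at hD
  have e1 : a * (y.1 - x.1) + b * (y.2 - x.2) = 0 := by linarith
  have e2 : a * (z.1 - x.1) + b * (z.2 - x.2) = 0 := by linarith
  have k1 : a * ((y.1 - x.1) * (z.2 - x.2) - (y.2 - x.2) * (z.1 - x.1)) = 0 := by
    linear_combination (z.2 - x.2) * e1 - (y.2 - x.2) * e2
  have k2 : b * ((y.1 - x.1) * (z.2 - x.2) - (y.2 - x.2) * (z.1 - x.1)) = 0 := by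
    linear_combination -(z.1 - x.1) * e1 + (y.1 - x.1) * e2
  rcases hab with h | h
  · rcases mul_eq_zero.mp k1 with h' | h'
    · exact h h'
    · linarith
  · rcases mul_eq_zero.mp k2 with h' | h'
    · exact h h'
    · linarith

theorem lin_D (x y z : ℝ × ℝ) : lin (-(y.2 - x.2)) (y.1 - x.1) z - lin (-(y.2 - x.2)) (y.1 - x.1) x = D x y z := by
  unfold lin D; ring
theorem lin_D0 (x y : ℝ × ℝ) : lin (-(y.2 - x.2)) (y.1 - x.1) y = lin (-(y.2 - x.2)) (y.1 - x.1) x := by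
  unfold lin; ring

theorem lin_neg (a b : ℝ) (q : ℝ × ℝ) : lin (-a) (-b) q = - lin a b q := by unfold lin; ring

variable (h : Sphere T) {o0 o1 o2 : W} (ho : T o0 o2 o1) {p : W → ℝ × ℝ}
  (hD : 0 < D (p o0) (p o1) (p o2)) (hc : HC T o0 o1 o2 p)

include h ho hD hc
theorem edge_opp {u v w w' : W} (t : T u v w) (t' : T v u w') (hv : ¬ Outer o0 o1 o2 v)
    {a b : ℝ} (hab : a ≠ 0 ∨ b ≠ 0) (huv : lin a b (p u) = lin a b (p v)) :
    (lin a b (p v) < lin a b (p w) ∧ lin a b (p w') < lin a b (p v)) ∨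
    (lin a b (p v) < lin a b (p w') ∧ lin a b (p w) < lin a b (p v)) := by
  have h1 := edge_ge h ho (fun v => lin a b (p v)) (fun v hv => hc v hv a b) (lin_nonconst hD hab) t t' hv huv
  have h2 := edge_ge h ho (fun v => lin (-a) (-b) (p v)) (fun v hv => hc v hv (-a) (-b))
    (lin_nonconst hD (by simpa using hab)) t t' hv (by simp [lin_neg, huv])
  simp only [lin_neg, neg_le_neg_iff] at h2
  by_contra hcon
  push Not at hcon
  rcases lt_trichotomy (lin a b (p v)) (lin a b (p w)) with k | k | k <;>
  rcases lt_trichotomy (lin a b (p v)) (lin a b (p w')) with k' | k' | k' 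
  · exact h1 k.le k'.le
  · exact h1 k.le k'.le
  · linarith [hcon.1 k]
  · exact h1 k.le k'.le
  · exact h1 k.le k'.le
  · exact h2 k.ge k'.le
  · linarith [hcon.2 k']
  · exact h2 k.le k'.ge
  · exact h2 k.le k'.le

theorem edge_sign' {u v w w' : W} (t : T u v w) (t' : T v u w') (hv : ¬ Outer o0 o1 o2 v) :
    0 < D (p u) (p v) (p w) * D (p v) (p u) (p w') := by
  have hne : p u ≠ p v := by
    intro e
    by_cases hw : p w = p v
    · have := edge_opp h ho hD hc t t' hv (a := 1) (b := 0) (by norm_num) (by rw [e])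
      rw [hw] at this
      rcases this with k | k <;> linarith [k.1, k.2]
    · have := edge_opp h ho hD hc t t' hv (a := -((p w).2 - (p v).2)) (b := (p w).1 - (p v).1) (by
        by_contra hh
        push Not at hh
        apply hw
        ext
        · linarith [hh.2]
        · linarith [hh.1]) (by rw [e])
      rw [lin_D0] at this
      rcases this with k | k <;> linarith [k.1, k.2]
  have := edge_opp h ho hD hc t t' hv (a := -((p v).2 - (p u).2)) (b := (p v).1 - (p u).1) (by
    by_contra hh
    push Not at hh
    apply hne
    ext
    · linarith [hh.2]
    · linarith [hh.1]) (by rw [lin_D0])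
  rw [lin_D0] at this
  have e1 := lin_D (p u) (p v) (p w)
  have e2 := lin_D (p u) (p v) (p w')
  rw [D_swap (p u) (p v) (p w')]
  rcases this with k | k
  · apply mul_pos <;> linarith [k.1, k.2]
  · apply mul_pos_of_neg_of_neg <;> linarith [k.1, k.2]

theorem edge_sign {u v w w' : W} (t : T u v w) (t' : T v u w') (hv : ¬ (Outer o0 o1 o2 u ∧ Outer o0 o1 o2 v)) :
    0 < D (p u) (p v) (p w) * D (p v) (p u) (p w') := by
  by_cases hv' : Outer o0 o1 o2 v
  · have hu : ¬ Outer o0 o1 o2 u := fun hu => hv ⟨hu, hv'⟩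
    have := edge_sign' h ho hD hc t' t hu
    linarith
  · exact edge_sign' h ho hD hc t t' hv'

theorem side_pos {x y z : W} (hxy : ∀ v, Outer o0 o1 o2 v → v = x ∨ v = y ∨ v = z)
    (hxyz : 0 < D (p x) (p y) (p z)) (v : W) (hv : ¬ Outer o0 o1 o2 v) : 0 < D (p x) (p y) (p v) := by
  set a := -((p y).2 - (p x).2) with ha
  set b := (p y).1 - (p x).1 with hb
  have hab : a ≠ 0 ∨ b ≠ 0 := by
    by_contra hh
    push Not at hh
    unfold D at hxyz
    rw [← hb, hh.2] at hxyz
    have : (p y).2 - (p x).2 = 0 := by linarith [hh.1]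
    rw [this] at hxyz
    simp at hxyz
  have ns := no_stuck h ho (fun v => lin a b (p v)) (fun v hv => hc v hv a b) (lin_nonconst hD hab)
  have low : ∀ v, ¬ Outer o0 o1 o2 v → ∃ u, lin a b (p u) < lin a b (p v) := by
    intro v hv
    have : ∃ u w, T v u w ∧ lin a b (p u) ≠ lin a b (p v) := by
      by_contra hcon; push Not at hcon
      exact ns v ⟨hv, hcon⟩
    obtain ⟨⟨u, _, _, hu⟩, _⟩ := hc v hv a b this
    exact ⟨u, hu⟩
  haveI : Nonempty W := ⟨o0⟩
  obtain ⟨m, hm⟩ := Finite.exists_min (fun v => lin a b (p v))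
  have hmo : Outer o0 o1 o2 m := by
    by_contra hmo
    obtain ⟨u, hu⟩ := low m hmo
    linarith [hm u]
  have hmx : lin a b (p x) ≤ lin a b (p m) := by
    rcases hxy m hmo with rfl | rfl | rfl
    · exact le_rfl
    · exact (lin_D0 _ _).ge
    · have := lin_D (p x) (p y) (p m)
      linarith
  obtain ⟨u, hu⟩ := low v hv
  have := lin_D (p x) (p y) (p v)
  linarith [hm u]

theorem tutte : Pos T o0 o1 o2 p := by
  refine ⟨hD, ?_⟩
  by_contra hcon
  push Not at hcon
  obtain ⟨u, v, w, t, hnO, hnD⟩ := hcon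
  have a1 := h.rot ho
  have a2 := h.rot a1
  have side : ∀ x y z w, T y x z → Outer o0 o1 o2 x → Outer o0 o1 o2 y → Outer o0 o1 o2 z → 
      (∀ v, Outer o0 o1 o2 v → v = x ∨ v = y ∨ v = z) →
      0 < D (p x) (p y) (p z) → T x y w → 0 < D (p x) (p y) (p w) := by
    intro x y z w t1 _ _ _ hO hxyz t2
    by_cases hw : Outer o0 o1 o2 w
    · rcases hO w hw with rfl | rfl | rfl
      · exact absurd rfl (h.ne (h.rot2 t2))
      · exact absurd rfl (h.ne (h.rot t2))
      · exact hxyz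
    · exact side_pos h ho hD hc hO hxyz w hw
  have := h.dual (fun u v w => T u v w ∧ ¬ IsOut o0 o1 o2 u v w ∧ D (p u) (p v) (p w) ≤ 0)
    (fun _ _ _ hh => hh.1) ⟨u, v, w, t, hnO, hnD⟩ (by
      rintro u v w ⟨t, h1, h2⟩
      refine ⟨h.rot t, ?_, ?_⟩
      · intro hh; apply h1; unfold IsOut at hh ⊢; tauto
      · rwa [D_rot]) (by
      rintro u v w z ⟨t, h1, h2⟩ t'
      by_cases hb : Outer o0 o1 o2 u ∧ Outer o0 o1 o2 v
      · exfalso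
        have huv := h.ne t
        have e0 : ∀ w, T o0 o2 w → w = o1 := fun w tw => h.uniq tw ho
        have e1 : ∀ w, T o2 o1 w → w = o0 := fun w tw => h.uniq tw a1
        have e2 : ∀ w, T o1 o0 w → w = o2 := fun w tw => h.uniq tw a2
        have s0 := side o0 o1 o2 w a2 (by unfold Outer; tauto) (by unfold Outer; tauto) (by unfold Outer; tauto)
          (by unfold Outer; tauto) hD
        have s1 := side o1 o2 o0 w a1 (by unfold Outer; tauto) (by unfold Outer; tauto) (by unfold Outer; tauto)
          (by unfold Outer; tauto) (by rwa [D_rot])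
        have s2 := side o2 o0 o1 w ho (by unfold Outer; tauto) (by unfold Outer; tauto) (by unfold Outer; tauto)
          (by unfold Outer; tauto) (by rwa [D_rot2])
        obtain ⟨hu, hv⟩ := hb
        rcases hu with rfl | rfl | rfl <;> rcases hv with rfl | rfl | rfl
        · exact huv rfl
        · linarith [s0 t]
        · exact h1 (Or.inl ⟨rfl, rfl, e0 w t⟩)
        · exact h1 (Or.inr (Or.inr ⟨rfl, rfl, e2 w t⟩))
        · exact huv rfl
        · linarith [s1 t]
        · linarith [s2 t]
        · exact h1 (Or.inr (Or.inl ⟨rfl, rfl, e1 w t⟩))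
        · exact huv rfl
      · have := edge_sign h ho hD hc t t' hb
        refine ⟨t', ?_, ?_⟩
        · intro hh
          apply hb
          unfold IsOut at hh
          unfold Outer
          tauto
        · by_contra hcon
          push Not at hcon
          nlinarith) o0 o2 o1 ho
  exact this.2.1 (Or.inl ⟨rfl, rfl, rfl⟩)
end tutte
end ICR

namespace ICR
open Classical Filter Topology

theorem D_tendsto {ι : Type*} {F : Filter ι} {a b c : ι → ℝ × ℝ} {x y z : ℝ × ℝ}
    (ha : Tendsto a F (𝓝 x)) (hb : Tendsto b F (𝓝 y)) (hc : Tendsto c F (𝓝 z)) :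
    Tendsto (fun i => D (a i) (b i) (c i)) F (𝓝 (D x y z)) := by
  have a1 := (continuous_fst.tendsto x).comp ha
  have a2 := (continuous_snd.tendsto x).comp ha
  have b1 := (continuous_fst.tendsto y).comp hb
  have b2 := (continuous_snd.tendsto y).comp hb
  have c1 := (continuous_fst.tendsto z).comp hc
  have c2 := (continuous_snd.tendsto z).comp hc
  exact ((b1.sub a1).mul (c2.sub a2)).sub ((b2.sub a2).mul (c1.sub a1))

section emb
variable {W : Type*} [Fintype W] {T : W → W → W → Prop}

theorem Pos.eventually {ι : Type*} {F : Filter ι} {o0 o1 o2 : W} {p : W → ℝ × ℝ}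
    (hp : Pos T o0 o1 o2 p) (P : ι → W → ℝ × ℝ) (hP : ∀ w, Tendsto (fun i => P i w) F (𝓝 (p w))) :
    ∀ᶠ i in F, Pos T o0 o1 o2 (P i) := by
  unfold Pos
  rw [eventually_and]
  constructor
  · exact (D_tendsto (hP o0) (hP o1) (hP o2)).eventually (lt_mem_nhds hp.1)
  · rw [eventually_all]; intro u
    rw [eventually_all]; intro v
    rw [eventually_all]; intro w
    by_cases t : T u v w
    · rcases hp.2 u v w t with h1 | h1
      · exact Eventually.of_forall fun _ _ => Or.inl h1
      · filter_upwards [(D_tendsto (hP u) (hP v) (hP w)).eventually (lt_mem_nhds h1)] with i hi _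
        exact Or.inr hi
    · exact Eventually.of_forall fun _ h => absurd h t

theorem Pos.ne0 {o0 o1 o2 : W} {p : W → ℝ × ℝ}
    (hp : Pos T o0 o1 o2 p) {u v w} (t : T u v w) : D (p u) (p v) (p w) ≠ 0 := by
  rcases hp.2 u v w t with h1 | h1
  · have := hp.1
    rcases h1 with ⟨rfl, rfl, rfl⟩ | ⟨rfl, rfl, rfl⟩ | ⟨rfl, rfl, rfl⟩ <;> unfold D at * <;> intro h2 <;> linarith
  · exact h1.ne'

theorem Pos.pne {o0 o1 o2 : W} {p : W → ℝ × ℝ}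
    (hp : Pos T o0 o1 o2 p) {u v w} (t : T u v w) : p u ≠ p v := by
  intro e
  apply hp.ne0 t
  rw [e]; unfold D; ring

def sh (t : ℝ) (q : ℝ × ℝ) : ℝ × ℝ := (q.1, q.2 + t * q.1)

theorem D_sh (t : ℝ) (x y z : ℝ × ℝ) : D (sh t x) (sh t y) (sh t z) = D x y z := by
  unfold D sh; ring

/-- crossing edge at level c -/
def Cr (T : W → W → W → Prop) (p : W → ℝ × ℝ) (c : ℝ) (e : W × W) : Prop :=
  (∃ w, T e.2 e.1 w) ∧ (p e.1).2 < c ∧ c < (p e.2).2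

noncomputable def Xp (p : W → ℝ × ℝ) (c : ℝ) (e : W × W) : ℝ :=
  ((p e.1).1 * ((p e.2).2 - c) + (p e.2).1 * (c - (p e.1).2)) / ((p e.2).2 - (p e.1).2)

def Nx (T : W → W → W → Prop) (o0 o1 o2 : W) (p : W → ℝ × ℝ) (c : ℝ) (e f : W × W) : Prop :=
  Cr T p c e ∧ ∃ w, T e.2 e.1 w ∧ ¬ IsOut o0 o1 o2 e.2 e.1 w ∧
    ((c < (p w).2 ∧ f = (e.1, w)) ∨ ((p w).2 < c ∧ f = (w, e.2)))

variable (h : Sphere T) {o0 o1 o2 : W} (ho : T o0 o2 o1) {p : W → ℝ × ℝ}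
  (hp : Pos T o0 o1 o2 p) {c : ℝ} (hcv : ∀ v, (p v).2 ≠ c)

include h hp in
theorem Nx_lt {e f : W × W} (n : Nx T o0 o1 o2 p c e f) : Cr T p c f ∧ Xp p c e < Xp p c f := by
  obtain ⟨u, v⟩ := e
  obtain ⟨⟨_, hu, hv⟩, w, t, hno, hh⟩ := n
  simp only at hu hv t hno hh
  have hD : 0 < D (p v) (p u) (p w) := (hp.2 _ _ _ t).resolve_left hno
  rcases hh with ⟨hw, rfl⟩ | ⟨hw, rfl⟩
  · refine ⟨⟨h.pair (h.rot t), hu, hw⟩, ?_⟩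
    unfold Xp; simp only
    rw [div_lt_div_iff₀ (by linarith) (by linarith)]
    unfold D at hD
    have : 0 < (c - (p u).2) * (((p u).1 - (p v).1) * ((p w).2 - (p v).2) - ((p u).2 - (p v).2) * ((p w).1 - (p v).1)) :=
      mul_pos (by linarith) hD
    nlinarith [this]
  · refine ⟨⟨h.pair (h.rot2 t), hw, hv⟩, ?_⟩
    unfold Xp; simp only
    rw [div_lt_div_iff₀ (by linarith) (by linarith)]
    unfold D at hD
    have : 0 < ((p v).2 - c) * (((p u).1 - (p v).1) * ((p w).2 - (p v).2) - ((p u).2 - (p v).2) * ((p w).1 - (p v).1)) :=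
      mul_pos (by linarith) hD
    nlinarith [this]

include h in
theorem Nx_inj {e e' f : W × W} (n : Nx T o0 o1 o2 p c e f) (n' : Nx T o0 o1 o2 p c e' f) : e = e' := by
  obtain ⟨u, v⟩ := e
  obtain ⟨u', v'⟩ := e'
  obtain ⟨⟨_, hu, hv⟩, w, t, hno, hh⟩ := n
  obtain ⟨⟨_, hu', hv'⟩, w', t', hno', hh'⟩ := n'
  simp only at *
  rcases hh with ⟨hw, rfl⟩ | ⟨hw, rfl⟩ <;> rcases hh' with ⟨hw', e⟩ | ⟨hw', e⟩ <;>
    (simp only [Prod.mk.injEq] at e; obtain ⟨rfl, rfl⟩ := e)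
  · have := h.uniq (h.rot t) (h.rot t')
    rw [this]
  · have := h.uniq (h.rot t) (h.rot2 t')
    subst this; linarith
  · have := h.uniq (h.rot2 t) (h.rot t')
    subst this; linarith
  · have := h.uniq (h.rot2 t) (h.rot2 t')
    rw [this]

include h hp hcv in
theorem Cr_uniq {e f : W × W} (he : Cr T p c e) (hf : Cr T p c f) (hX : Xp p c e = Xp p c f) : e = f := by
  have term : ∀ e, Cr T p c e → ∃ e', Relation.ReflTransGen (Nx T o0 o1 o2 p c) e e' ∧ Cr T p c e' ∧
      ∃ w, IsOut o0 o1 o2 e'.2 e'.1 w := by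
    by_contra hcon
    push Not at hcon
    obtain ⟨e, he, hbad⟩ := hcon
    let B := {e : W × W // Cr T p c e ∧ ∀ e', Relation.ReflTransGen (Nx T o0 o1 o2 p c) e e' → Cr T p c e' →
      ∀ w, ¬ IsOut o0 o1 o2 e'.2 e'.1 w}
    have : Nonempty B := ⟨⟨e, he, hbad⟩⟩
    obtain ⟨⟨m, hm, hmb⟩, hmax⟩ := Finite.exists_max (fun e : B => Xp p c e.1)
    obtain ⟨⟨w, tw⟩, h1, h2⟩ := id hm
    have hno := hmb m Relation.ReflTransGen.refl hm w
    have : ∃ f, Nx T o0 o1 o2 p c m f := by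
      rcases lt_or_gt_of_ne (hcv w) with k | k
      · exact ⟨(w, m.2), hm, w, tw, hno, Or.inr ⟨k, rfl⟩⟩
      · exact ⟨(m.1, w), hm, w, tw, hno, Or.inl ⟨k, rfl⟩⟩
    obtain ⟨f, hf⟩ := this
    obtain ⟨hfc, hlt⟩ := Nx_lt h hp hf
    have := hmax ⟨f, hfc, fun e' he' => hmb e' (Relation.ReflTransGen.head hf he')⟩
    simp only at this
    linarith
  obtain ⟨e', he1, ⟨_, he2, he3⟩, w, he4⟩ := term e he
  obtain ⟨f', hf1, ⟨_, hf2, hf3⟩, w', hf4⟩ := term f hf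
  have hef : e' = f' := by
    obtain ⟨a, b⟩ := e'
    obtain ⟨a', b'⟩ := f'
    simp only at *
    unfold IsOut at he4 hf4
    rcases he4 with ⟨rfl, rfl, rfl⟩ | ⟨rfl, rfl, rfl⟩ | ⟨rfl, rfl, rfl⟩ <;>
    rcases hf4 with ⟨rfl, rfl, rfl⟩ | ⟨rfl, rfl, rfl⟩ | ⟨rfl, rfl, rfl⟩ <;> first | rfl | (exfalso; linarith)
  subst hef
  have mono : ∀ a b, Relation.ReflTransGen (Nx T o0 o1 o2 p c) a b → a = b ∨ Xp p c a < Xp p c b := by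
    intro a b hab
    induction hab with
    | refl => exact Or.inl rfl
    | tail _ h2 ih =>
      right
      have := (Nx_lt h hp h2).2
      rcases ih with rfl | ih
      · exact this
      · exact ih.trans this
  have tot := Relation.ReflTransGen.total_of_right_unique (r := Function.swap (Nx T o0 o1 o2 p c)) (by
      intro a b d hab had
      exact Nx_inj h hab had) (Relation.reflTransGen_swap.mpr he1) (Relation.reflTransGen_swap.mpr hf1)
  rcases tot with k | k
  · rcases mono _ _ (Relation.reflTransGen_swap.mp k) with k | k
    · exact k.symm
    · linarith
  · rcases mono _ _ (Relation.reflTransGen_swap.mp k) with k | k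
    · exact k
    · linarith

omit [Fintype W] in
theorem Cr_of_seg (hcv : ∀ v, (p v).2 ≠ c) {u v : W} {x : ℝ} (h1 : ∃ w, T u v w) (h2 : ∃ w, T v u w)
    (hs : (x, c) ∈ openSegment ℝ (p u) (p v)) :
    ∃ e : W × W, Cr T p c e ∧ Xp p c e = x ∧ (e = (u, v) ∨ e = (v, u)) := by
  obtain ⟨a, b, ha, hb, hab, hs⟩ := hs
  simp only [Prod.ext_iff, Prod.fst_add, Prod.snd_add, Prod.smul_fst, Prod.smul_snd, smul_eq_mul] at hs
  have hu := hcv u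
  have hv := hcv v
  have hb' : b = 1 - a := by linarith
  subst hb'
  rcases lt_or_gt_of_ne hu with k | k <;> rcases lt_or_gt_of_ne hv with k' | k'
  · exfalso; nlinarith
  · refine ⟨(u, v), ⟨h2, k, k'⟩, ?_, Or.inl rfl⟩
    unfold Xp; simp only
    rw [div_eq_iff (by linarith)]
    rw [← hs.1, ← hs.2]; ring
  · refine ⟨(v, u), ⟨h1, k', k⟩, ?_, Or.inr rfl⟩
    unfold Xp; simp only
    rw [div_eq_iff (by linarith)]
    rw [← hs.1, ← hs.2]; ring
  · exfalso; nlinarith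

theorem sh_seg (t : ℝ) {s x y : ℝ × ℝ} (hs : s ∈ openSegment ℝ x y) : sh t s ∈ openSegment ℝ (sh t x) (sh t y) := by
  obtain ⟨a, b, ha, hb, hab, rfl⟩ := hs
  refine ⟨a, b, ha, hb, hab, ?_⟩
  unfold sh
  ext <;> simp
  ring

include h hp in
theorem lemN {u v u' v' : W} {s : ℝ × ℝ} (hsv : ∀ z, p z ≠ s) (e : ∃ w, T u v w) (e' : ∃ w, T u' v' w)
    (hs : s ∈ openSegment ℝ (p u) (p v)) (hs' : s ∈ openSegment ℝ (p u') (p v')) :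
    (u = u' ∧ v = v') ∨ (u = v' ∧ v = u') := by
  obtain ⟨t, ht⟩ : ∃ t : ℝ, ∀ z, (p z).2 + t * (p z).1 ≠ s.2 + t * s.1 := by
    have hfin : (Set.range fun z => -((p z).2 - s.2) / ((p z).1 - s.1)).Finite := Set.finite_range _
    obtain ⟨t, ht⟩ := hfin.infinite_compl.nonempty
    refine ⟨t, fun z hz => ?_⟩
    by_cases h1 : (p z).1 - s.1 = 0
    · apply hsv z
      have : (p z).1 = s.1 := by linarith
      rw [this] at hz
      ext <;> linarith
    · apply ht
      refine ⟨z, ?_⟩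
      simp only
      rw [div_eq_iff h1]; linarith
  have hp' : Pos T o0 o1 o2 (fun z => sh t (p z)) := by
    refine ⟨by rw [D_sh]; exact hp.1, fun u v w tt => by rw [D_sh]; exact hp.2 u v w tt⟩
  have hcv : ∀ v, (sh t (p v)).2 ≠ (sh t s).2 := ht
  have s1 := sh_seg t hs
  have s2 := sh_seg t hs'
  obtain ⟨f, f1, f2, f3⟩ := Cr_of_seg (p := fun z => sh t (p z)) hcv e (h.adj_symm e) (x := (sh t s).1) s1
  obtain ⟨f', f1', f2', f3'⟩ := Cr_of_seg (p := fun z => sh t (p z)) hcv e' (h.adj_symm e') (x := (sh t s).1) s2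
  have := Cr_uniq h hp' hcv f1 f1' (f2.trans f2'.symm)
  subst this
  rcases f3 with rfl | rfl <;> rcases f3' with f3' | f3' <;> simp at f3' <;> tauto

theorem D_seg0 {s x y : ℝ × ℝ} (hs : s ∈ openSegment ℝ x y) : D x y s = 0 := by
  obtain ⟨a, b, ha, hb, hab, rfl⟩ := hs
  have hb' : b = 1 - a := by linarith
  subst hb'
  unfold D; simp; ring

include h hp in
theorem emb_vertex {u v z : W} (e : ∃ w, T u v w) (hu : z ≠ u) (hv : z ≠ v) :
    p z ∉ openSegment ℝ (p u) (p v) := by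
  intro hs
  obtain ⟨w0, tw0⟩ := id e
  have huv := hp.pne tw0
  have hline := D_seg0 hs
  -- a neighbour off the line
  obtain ⟨u', e', hu'⟩ : ∃ u', (∃ w, T z u' w) ∧ D (p u) (p v) (p u') ≠ 0 := by
    obtain ⟨a, b, t⟩ := h.vtx z
    by_contra hcon
    push Not at hcon
    have ha := hcon a ⟨b, t⟩
    have hb := hcon b (h.next t)
    apply hp.ne0 t
    unfold D at *
    have k1 : ((p v).1 - (p u).1) * (((p a).1 - (p z).1) * ((p b).2 - (p z).2) - ((p a).2 - (p z).2) * ((p b).1 - (p z).1)) = 0 := by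
      linear_combination ((p a).1 - (p z).1) * (hb - hline) - ((p b).1 - (p z).1) * (ha - hline)
    have k2 : ((p v).2 - (p u).2) * (((p a).1 - (p z).1) * ((p b).2 - (p z).2) - ((p a).2 - (p z).2) * ((p b).1 - (p z).1)) = 0 := by
      linear_combination ((p a).2 - (p z).2) * (hb - hline) - ((p b).2 - (p z).2) * (ha - hline)
    by_contra hne
    apply huv
    have := (mul_eq_zero.mp k1).resolve_right hne
    have := (mul_eq_zero.mp k2).resolve_right hne
    ext <;> linarith
  have hu's : p u' ≠ p z := fun e => hu' (by rw [e, hline])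
  have hus : p u ≠ p z := by
    intro e2
    rw [← e2, left_mem_openSegment_iff] at hs
    exact huv hs
  have hvs : p v ≠ p z := by
    intro e2
    rw [← e2, right_mem_openSegment_iff] at hs
    exact huv hs
  set s := p z with hsdef
  let P : ℝ → W → ℝ × ℝ := fun τ w => if p w = s then s - τ • (p u' - s) else p w
  have hP : ∀ w, Tendsto (fun τ => P τ w) (𝓝[>] 0) (𝓝 (p w)) := by
    intro w
    by_cases hw : p w = s
    · simp only [P, hw, if_true]
      have : Continuous (fun τ : ℝ => s - τ • (p u' - s)) := by fun_prop
      have := (this.tendsto 0).mono_left (nhdsWithin_le_nhds (s := Set.Ioi 0))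
      simpa using this
    · simp only [P, hw, if_false]
      exact tendsto_const_nhds
  obtain ⟨τ, hτp, hτ⟩ := ((hp.eventually P hP).and self_mem_nhdsWithin).exists
  have hτ : 0 < τ := hτ
  have Pz : P τ z = s - τ • (p u' - s) := by simp only [P]; rw [if_pos hsdef.symm]
  have Pu' : P τ u' = p u' := by simp only [P]; rw [if_neg hu's]
  have Pu : P τ u = p u := by simp only [P]; rw [if_neg hus]
  have Pv : P τ v = p v := by simp only [P]; rw [if_neg hvs]
  have := lemN h hτp (s := s) (u := u) (v := v) (u' := z) (v' := u') (by
    intro y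
    simp only [P]
    split_ifs with hy
    · intro e2
      have : τ • (p u' - s) = 0 := by simpa using e2
      rcases smul_eq_zero.mp this with k | k
      · linarith
      · exact hu's (sub_eq_zero.mp k)
    · exact hy) e e' (by rw [Pu, Pv]; exact hs) (by
      rw [Pz, Pu']
      refine ⟨1/(1+τ), τ/(1+τ), by positivity, by positivity, by field_simp, ?_⟩
      ext <;> simp <;> field_simp <;> ring)
  rcases this with ⟨k1, k2⟩ | ⟨k1, k2⟩
  · exact hu k1.symm
  · exact hv k2.symm

include h hp in
theorem emb_inj : Function.Injective p := by
  intro w v hwv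
  by_contra hne
  obtain ⟨u', b, t⟩ := h.vtx v
  have hu's := hp.pne t
  have hwu : w ≠ u' := by rintro rfl; exact hu's hwv.symm
  let P : ℝ → W → ℝ × ℝ := fun τ y => if y = w then p v + τ • (p u' - p v) else p y
  have hP : ∀ y, Tendsto (fun τ => P τ y) (𝓝[>] 0) (𝓝 (p y)) := by
    intro y
    by_cases hw : y = w
    · simp only [P, hw, if_true]
      have : Continuous (fun τ : ℝ => p v + τ • (p u' - p v)) := by fun_prop
      have := (this.tendsto 0).mono_left (nhdsWithin_le_nhds (s := Set.Ioi 0))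
      simpa [hwv] using this
    · simp only [P, hw, if_false]
      exact tendsto_const_nhds
  obtain ⟨τ, ⟨hτp, hτ⟩, hτ1⟩ := (((hp.eventually P hP).and self_mem_nhdsWithin).and 
    (show ∀ᶠ τ : ℝ in 𝓝[>] 0, τ < 1 from nhdsWithin_le_nhds (gt_mem_nhds one_pos))).exists
  have hτ : 0 < τ := hτ
  refine emb_vertex h hτp ⟨b, t⟩ hne hwu ?_
  simp only [P]
  rw [if_pos trivial, if_neg (Ne.symm hne), if_neg (Ne.symm hwu)]
  refine ⟨1-τ, τ, by linarith, hτ, by ring, ?_⟩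
  ext <;> simp <;> ring

include h hp in
theorem emb_edge {u v u' v' : W} (e : ∃ w, T u v w) (e' : ∃ w, T u' v' w) (h1 : u ≠ u') (h2 : u ≠ v')
    (h3 : v ≠ u') (h4 : v ≠ v') :
    Disjoint (openSegment ℝ (p u) (p v)) (openSegment ℝ (p u') (p v')) := by
  rw [Set.disjoint_left]
  intro s hs hs'
  by_cases hz : ∃ z, p z = s
  · obtain ⟨z, rfl⟩ := hz
    by_cases hzu : z = u
    · subst hzu; exact emb_vertex h hp e' h1 h2 hs'
    · by_cases hzv : z = v
      · subst hzv; exact emb_vertex h hp e' h3 h4 hs'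
      · exact emb_vertex h hp e hzu hzv hs
  · push Not at hz
    rcases lemN h hp hz e e' hs hs' with k | k <;> tauto
end emb
end ICR

namespace ICR
open Classical Filter Topology

theorem mem_oseg {x a y : ℝ × ℝ} : y ∈ openSegment ℝ x a ↔ ∃ t : ℝ, 0 < t ∧ t < 1 ∧ y = (1-t)•x + t•a := by
  rw [openSegment_eq_image]
  constructor
  · rintro ⟨t, ⟨h1, h2⟩, rfl⟩; exact ⟨t, h1, h2, rfl⟩
  · rintro ⟨t, h1, h2, rfl⟩; exact ⟨t, ⟨h1, h2⟩, rfl⟩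

def Aff (φ : ℝ × ℝ → ℝ) : Prop := ∀ (t : ℝ) x a, φ ((1-t)•x + t•a) = (1-t) * φ x + t * φ a

theorem D_aff (p q : ℝ × ℝ) : Aff (D p q) := by
  intro t x a; unfold D; simp; ring

theorem lin_aff (a b : ℝ) : Aff (lin a b) := by
  intro t x y; unfold lin; simp; ring

theorem oseg_trans {a b x y : ℝ × ℝ} (hx : x ∈ openSegment ℝ a b) (hy : y ∈ openSegment ℝ x a) :
    y ∈ openSegment ℝ a b := by
  rw [mem_oseg] at *
  obtain ⟨t, h1, h2, rfl⟩ := hx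
  obtain ⟨r, h3, h4, rfl⟩ := hy
  refine ⟨(1-r)*t, by nlinarith, by nlinarith, ?_⟩
  ext <;> simp <;> ring

/-- exit lemma -/
theorem exit_lem {φ ψ : ℝ × ℝ → ℝ} (hφ : Aff φ) (hψ : Aff ψ) {x a : ℝ × ℝ} (h1 : 0 < φ x) (h2 : 0 < ψ x)
    (h3 : φ a < 0 ∨ ψ a < 0) : ∃ y ∈ openSegment ℝ x a, (φ y = 0 ∧ 0 ≤ ψ y) ∨ (ψ y = 0 ∧ 0 ≤ φ y) := by
  have one : ∀ {φ ψ : ℝ × ℝ → ℝ}, Aff φ → Aff ψ → 0 < φ x → 0 < ψ x → φ a < 0 → 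
      (0 ≤ ψ a ∨ φ a * ψ x ≤ ψ a * φ x) → ∃ y ∈ openSegment ℝ x a, (φ y = 0 ∧ 0 ≤ ψ y) := by
    intro φ ψ hφ hψ h1 h2 h3 h4
    have hpos : 0 < φ x - φ a := by linarith
    refine ⟨(1 - φ x / (φ x - φ a)) • x + (φ x / (φ x - φ a)) • a, ?_, ?_, ?_⟩
    · rw [mem_oseg]
      exact ⟨_, by positivity, by rw [div_lt_one hpos]; linarith, rfl⟩
    · rw [hφ]; field_simp; ring
    · rw [hψ]
      have : (1 - φ x / (φ x - φ a)) * ψ x + φ x / (φ x - φ a) * ψ a = (- φ a * ψ x + φ x * ψ a) / (φ x - φ a) := by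
        field_simp; ring
      rw [this]
      apply div_nonneg _ hpos.le
      rcases h4 with h4 | h4
      · nlinarith [mul_pos (neg_pos.mpr h3) h2, mul_nonneg h1.le h4]
      · linarith
  rcases lt_or_ge (φ a) 0 with k | k <;> rcases lt_or_ge (ψ a) 0 with k' | k'
  · rcases le_total (φ a * ψ x) (ψ a * φ x) with m | m
    · obtain ⟨y, hy, e⟩ := one hφ hψ h1 h2 k (Or.inr m)
      exact ⟨y, hy, Or.inl e⟩
    · obtain ⟨y, hy, e⟩ := one hψ hφ h2 h1 k' (Or.inr m)
      exact ⟨y, hy, Or.inr e⟩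
  · obtain ⟨y, hy, e⟩ := one hφ hψ h1 h2 k (Or.inl k')
    exact ⟨y, hy, Or.inl e⟩
  · obtain ⟨y, hy, e⟩ := one hψ hφ h2 h1 k' (Or.inl k)
    exact ⟨y, hy, Or.inr e⟩
  · exfalso; rcases h3 with h3 | h3 <;> linarith

theorem Aff.between_ge {φ : ℝ × ℝ → ℝ} (hφ : Aff φ) {x a y : ℝ × ℝ} {m : ℝ} (hy : y ∈ openSegment ℝ x a)
    (h1 : m ≤ φ x) (h2 : m ≤ φ a) : m ≤ φ y := by
  obtain ⟨t, h3, h4, rfl⟩ := mem_oseg.mp hy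
  rw [hφ]; nlinarith

theorem Aff.between_gt {φ : ℝ × ℝ → ℝ} (hφ : Aff φ) {x a y : ℝ × ℝ} {m : ℝ} (hy : y ∈ openSegment ℝ x a)
    (h1 : m < φ x) (h2 : m ≤ φ a) : m < φ y := by
  obtain ⟨t, h3, h4, rfl⟩ := mem_oseg.mp hy
  rw [hφ]; nlinarith

/-- from an interior point, one of the ends is at least as high -/
theorem Aff.ends {φ : ℝ × ℝ → ℝ} (hφ : Aff φ) {x a b : ℝ × ℝ} (hx : x ∈ openSegment ℝ a b) :
    φ x ≤ φ a ∨ φ x ≤ φ b := by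
  obtain ⟨t, h3, h4, rfl⟩ := mem_oseg.mp hx
  by_contra hcon
  push Not at hcon
  rw [hφ] at hcon
  nlinarith

theorem seg_of_D {u v w y : ℝ × ℝ} (h0 : 0 < D u v w) (h1 : D w u y = 0) (h2 : 0 < D u v y) (h3 : 0 < D v w y) :
    y ∈ openSegment ℝ u w := by
  rw [mem_oseg]
  have hs : D v w y + D u v y = D u v w := by
    have : D w u y + D v w y + D u v y = D u v w := by unfold D; ring
    linarith
  refine ⟨D u v y / D u v w, by positivity, by rw [div_lt_one h0]; linarith, ?_⟩
  have hne := h0.ne'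
  have k1 : (D u v w) * y.1 = (D u v w - D u v y) * u.1 + D u v y * w.1 := by
    have : D u v w * y.1 - ((D u v w - D u v y) * u.1 + D u v y * w.1) = (D w u y) * (v.1 - u.1) := by unfold D; ring
    rw [h1] at this; linarith
  have k2 : (D u v w) * y.2 = (D u v w - D u v y) * u.2 + D u v y * w.2 := by
    have : D u v w * y.2 - ((D u v w - D u v y) * u.2 + D u v y * w.2) = (D w u y) * (v.2 - u.2) := by unfold D; ring
    rw [h1] at this; linarith
  ext
  · simp; field_simp; linarith
  · simp; field_simp; linarith

theorem pt_of_D {u v w y : ℝ × ℝ} (h0 : 0 < D u v w) (h1 : D w u y = 0) (h2 : D u v y = 0) : y = u := by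
  have hne := h0.ne'
  have k1 : (D u v w) * (y.1 - u.1) = 0 := by
    have : D u v w * (y.1 - u.1) = (D w u y) * (v.1 - u.1) + D u v y * (w.1 - u.1) := by unfold D; ring
    rw [this, h1, h2]; ring
  have k2 : (D u v w) * (y.2 - u.2) = 0 := by
    have : D u v w * (y.2 - u.2) = (D w u y) * (v.2 - u.2) + D u v y * (w.2 - u.2) := by unfold D; ring
    rw [this, h1, h2]; ring
  have := (mul_eq_zero.mp k1).resolve_left hne
  have := (mul_eq_zero.mp k2).resolve_left hne
  ext <;> linarith

section geo
variable {W : Type*} [Fintype W] (q : W → ℝ × ℝ)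

structure Plane (E : W → W → Prop) : Prop where
  symm : ∀ {u v}, E u v → E v u
  ne : ∀ {u v}, E u v → u ≠ v
  vert : ∀ {u v z}, E u v → z ≠ u → z ≠ v → q z ∉ openSegment ℝ (q u) (q v)
  cross : ∀ {u v u' v' s}, E u v → E u' v' → u ≠ u' → u ≠ v' → v ≠ u' → v ≠ v' →
    s ∈ openSegment ℝ (q u) (q v) → s ∉ openSegment ℝ (q u') (q v')

structure MaxPlane (E : W → W → Prop) : Prop extends Plane q E where
  max : ∀ {u v}, u ≠ v → (∀ z, z ≠ u → z ≠ v → q z ∉ openSegment ℝ (q u) (q v)) →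
    (∀ a b s, E a b → a ≠ u → a ≠ v → b ≠ u → b ≠ v → s ∈ openSegment ℝ (q a) (q b) →
      s ∉ openSegment ℝ (q u) (q v)) → E u v

variable {q}
theorem exists_maxPlane {E0 : W → W → Prop} (h0 : Plane q E0) :
    ∃ E : W → W → Prop, MaxPlane q E ∧ ∀ u v, E0 u v → E u v := by
  let S : Set (Set (W × W)) := {A | Plane q (fun u v => (u,v) ∈ A) ∧ ∀ u v, E0 u v → (u,v) ∈ A}
  have hS : S.Finite := Set.toFinite _
  have hne : S.Nonempty := ⟨{x | E0 x.1 x.2}, h0, fun u v h => h⟩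
  obtain ⟨A, hA⟩ := hS.exists_maximal hne
  have hAS := hA.prop
  refine ⟨fun u v => (u,v) ∈ A, ⟨hAS.1, ?_⟩, hAS.2⟩
  intro u v huv hv hx
  have hmem : A ∪ {(u,v),(v,u)} ∈ S := by
    have key : ∀ a b, (a,b) ∈ A ∪ {(u,v),(v,u)} → (a,b) ∈ A ∨ (a = u ∧ b = v) ∨ (a = v ∧ b = u) := by
      intro a b hab; simp at hab; tauto
    have hx' : ∀ a b s, (a,b) ∈ A → a ≠ u → a ≠ v → b ≠ u → b ≠ v → s ∈ openSegment ℝ (q u) (q v) →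
      s ∉ openSegment ℝ (q a) (q b) := fun a b s h1 h2 h3 h4 h5 h6 h7 => hx a b s h1 h2 h3 h4 h5 h7 h6
    refine ⟨⟨?_, ?_, ?_, ?_⟩, ?_⟩
    · intro a b hab
      rcases key a b hab with h | ⟨rfl, rfl⟩ | ⟨rfl, rfl⟩
      · exact Or.inl (hAS.1.symm h)
      · simp
      · simp
    · intro a b hab
      rcases key a b hab with h | ⟨rfl, rfl⟩ | ⟨rfl, rfl⟩
      · exact hAS.1.ne h
      · exact huv
      · exact huv.symm
    · intro a b z hab h1 h2
      rcases key a b hab with h | ⟨rfl, rfl⟩ | ⟨rfl, rfl⟩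
      · exact hAS.1.vert h h1 h2
      · exact hv z h1 h2
      · rw [openSegment_symm]; exact hv z h2 h1
    · intro a b a' b' s hab hab' h1 h2 h3 h4 hs
      rcases key a b hab with h | ⟨rfl, rfl⟩ | ⟨rfl, rfl⟩ <;> rcases key a' b' hab' with h' | ⟨rfl, rfl⟩ | ⟨rfl, rfl⟩
      · exact hAS.1.cross h h' h1 h2 h3 h4 hs
      · exact hx _ _ s h h1 h2 h3 h4 hs
      · rw [openSegment_symm]; exact hx _ _ s h h2 h1 h4 h3 hs
      · exact hx' _ _ s h' h1.symm h3.symm h2.symm h4.symm hs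
      · exact absurd rfl h1
      · exact absurd rfl h2
      · rw [openSegment_symm] at hs
        exact hx' _ _ s h' h3.symm h1.symm h4.symm h2.symm hs
      · exact absurd rfl h2
      · exact absurd rfl h1
    · exact fun a b hab => Or.inl (hAS.2 a b hab)
  exact hA.2 hmem Set.subset_union_left (Or.inr (by simp))

/-- two edges whose open segments meet coincide -/
theorem Plane.same {E : W → W → Prop} (h : Plane q E) (hq : Function.Injective q) {a b a' b' : W} {s : ℝ × ℝ} (e : E a b) (e' : E a' b')
    (hs : s ∈ openSegment ℝ (q a) (q b)) (hs' : s ∈ openSegment ℝ (q a') (q b')) :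
    (a = a' ∧ b = b') ∨ (a = b' ∧ b = a') := by
  have share : ∀ u v v', E u v → E u v' → s ∈ openSegment ℝ (q u) (q v) → s ∈ openSegment ℝ (q u) (q v') → v = v' := by
    intro u v v' e e' hs hs'
    by_contra hne
    obtain ⟨t, h1, h2, e1⟩ := mem_oseg.mp hs
    obtain ⟨t', h1', h2', e2⟩ := mem_oseg.mp hs'
    have ee : (1-t) • q u + t • q v = (1-t') • q u + t' • q v' := e1.symm.trans e2
    have c1 := congrArg Prod.fst ee
    have c2 := congrArg Prod.snd ee
    simp at c1 c2
    rcases lt_trichotomy t t' with k | k | k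
    · refine h.vert e (z := v') (h.ne e').symm (Ne.symm hne) ?_
      rw [mem_oseg]
      refine ⟨t/t', by positivity, by rw [div_lt_one h1']; exact k, ?_⟩
      ext
      · simp; field_simp; linarith
      · simp; field_simp; linarith
    · subst k
      have : q v = q v' := by
        ext
        · apply mul_left_cancel₀ h1.ne'; linarith
        · apply mul_left_cancel₀ h1.ne'; linarith
      exact hne (hq this)
    · refine h.vert e' (z := v) (h.ne e).symm hne ?_
      rw [mem_oseg]
      refine ⟨t'/t, by positivity, by rw [div_lt_one h1]; exact k, ?_⟩
      ext
      · simp; field_simp; linarith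
      · simp; field_simp; linarith
  by_cases h1 : a = a'
  · subst h1; left; exact ⟨rfl, share a b b' e e' hs hs'⟩
  by_cases h2 : a = b'
  · subst h2; right; refine ⟨rfl, share a b a' e (h.symm e') hs (by rwa [openSegment_symm])⟩
  by_cases h3 : b = a'
  · subst h3; right; refine ⟨share b a b' (h.symm e) e' (by rwa [openSegment_symm]) hs', rfl⟩
  by_cases h4 : b = b'
  · subst h4; left; refine ⟨share b a a' (h.symm e) (h.symm e') (by rwa [openSegment_symm]) (by rwa [openSegment_symm]), rfl⟩
  exact absurd hs' (h.cross e e' h1 h2 h3 h4 hs)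
end geo
end ICR

namespace ICR
open Classical Filter Topology

theorem coords {u c s : ℝ × ℝ} (h : D u c s ≠ 0) : ∃ α β : ℝ × ℝ → ℝ, Aff α ∧ Aff β ∧
    (∀ y, y = (1 - α y - β y) • u + α y • c + β y • s) ∧ α u = 0 ∧ β u = 0 ∧ α c = 1 ∧ β c = 0 ∧ α s = 0 ∧ β s = 1 := by
  refine ⟨fun y => D u y s / D u c s, fun y => D u c y / D u c s, ?_, ?_, ?_, ?_, ?_, ?_, ?_, ?_, ?_⟩
  · intro t x a; field_simp; unfold D; simp; ring
  · intro t x a; field_simp; unfold D; simp; ring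
  · intro y
    ext
    · simp; field_simp; unfold D; ring
    · simp; field_simp; unfold D; ring
  all_goals first | (field_simp) | skip
  all_goals (unfold D; ring)

theorem line_split {u z a b : ℝ × ℝ} {τ τ' : ℝ} (h1 : τ < 0) (h2 : 0 < τ') (ha : a = (1-τ)•u + τ•z)
    (hb : b = (1-τ')•u + τ'•z) : u ∈ openSegment ℝ a b := by
  rw [mem_oseg]
  have hd : 0 < τ' - τ := by linarith
  refine ⟨(-τ) / (τ' - τ), div_pos (by linarith) hd, by rw [div_lt_one hd]; linarith, ?_⟩
  rw [ha, hb]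
  ext
  · simp; field_simp; ring
  · simp; field_simp; ring

section geo
variable {W : Type*} [Fintype W] {q : W → ℝ × ℝ} {E : W → W → Prop}

set_option maxHeartbeats 1000000 in
theorem vis_tri (hE : MaxPlane q E) (hq : Function.Injective q) {u a0 s0 : W} {c : ℝ × ℝ}
    (e0 : E a0 s0) (hc : c ∈ openSegment ℝ (q a0) (q s0)) (hsu : s0 ≠ u)
    (hau : a0 ≠ u)
    (hfree : ∀ a b, a ≠ u → b ≠ u → (a = b ∨ E a b) → ∀ t : ℝ, 0 ≤ t → t < 1 → (1-t)•(q u) + t•c ∉ segment ℝ (q a) (q b))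
    (hD : D (q u) c (q s0) ≠ 0) (h : ℝ × ℝ → ℝ) (hh : Aff h) (hc1 : h (q u) < h c) (hc2 : h (q u) < h (q s0)) :
    ∃ z, E u z ∧ h (q u) < h (q z) := by
  obtain ⟨α, β, hα, hβ, rep, αu, βu, αc, βc, αs, βs⟩ := coords hD
  have hcv : ∀ z, q z ≠ c := by
    intro z hz
    rw [← hz] at hc
    refine hE.vert e0 (z := z) ?_ ?_ hc
    · rintro rfl
      have := congrArg α (hz); 
      obtain ⟨t, h1, h2, e⟩ := mem_oseg.mp hc
      have k1 := congrArg Prod.fst e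
      have k2 := congrArg Prod.snd e
      simp at k1 k2
      have : q z = q s0 := by
        ext
        · apply mul_left_cancel₀ h1.ne'; linarith
        · apply mul_left_cancel₀ h1.ne'; linarith
      exact hE.ne e0 (hq this)
    · rintro rfl
      rw [← hz] at αc; rw [αs] at αc; norm_num at αc
  have hfreev : ∀ z, z ≠ u → ∀ t : ℝ, 0 ≤ t → t < 1 → q z ≠ (1-t)•(q u) + t•c := by
    intro z hz t h0 h1 e
    exact hfree z z hz hz (Or.inl rfl) t h0 h1 (by rw [← e]; simp)
  -- candidates
  let S : Finset W := Finset.univ.filter (fun z => z ≠ u ∧ 0 ≤ α (q z) ∧ 0 ≤ β (q z) ∧ α (q z) + β (q z) ≤ 1)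
  have hS : s0 ∈ S := by simp [S, hsu, αs, βs]
  have hβpos : ∀ z ∈ S, 0 < β (q z) := by
    intro z hz
    simp [S] at hz
    obtain ⟨h1, h2, h3, h4⟩ := hz
    rcases h3.lt_or_eq with k | k
    · exact k
    · exfalso
      have e := rep (q z)
      rw [← k] at e
      simp at e
      rcases (show α (q z) ≤ 1 by linarith).lt_or_eq with m | m
      · exact hfreev z h1 _ h2 m e
      · rw [m] at e; simp at e; exact hcv z e
  -- choose minimal ratio β/α ~ minimal β/(α+β), then minimal α+β
  obtain ⟨z, hzS, hzmin⟩ := S.exists_min_image (fun z => toLex (β (q z) / (α (q z) + β (q z)), α (q z) + β (q z))) ⟨s0, hS⟩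
  have hzβ := hβpos z hzS
  have hzS' := hzS
  simp only [S, Finset.mem_filter, Finset.mem_univ, true_and] at hzS'
  obtain ⟨hzu, hzα, -, hzσ⟩ := hzS'
  have min1 : ∀ y ∈ S, 0 ≤ α (q z) * β (q y) - β (q z) * α (q y) := by
    intro y hy
    have h1 := hβpos y hy
    have hy' := hy
    simp only [S, Finset.mem_filter, Finset.mem_univ, true_and] at hy'
    have h2 := hzmin y hy
    rw [Prod.Lex.toLex_le_toLex] at h2
    have h3 : β (q z) / (α (q z) + β (q z)) ≤ β (q y) / (α (q y) + β (q y)) := by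
      rcases h2 with h2 | h2
      · exact h2.le
      · exact h2.1.le
    rw [div_le_div_iff₀ (by linarith) (by linarith)] at h3
    nlinarith
  have min2 : ∀ y ∈ S, α (q z) * β (q y) - β (q z) * α (q y) = 0 → α (q z) + β (q z) ≤ α (q y) + β (q y) := by
    intro y hy h0
    have h1 := hβpos y hy
    have hy' := hy
    simp only [S, Finset.mem_filter, Finset.mem_univ, true_and] at hy'
    have h2 := hzmin y hy
    rw [Prod.Lex.toLex_le_toLex] at h2
    rcases h2 with h2 | h2
    · exfalso
      rw [div_lt_div_iff₀ (by linarith) (by linarith)] at h2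
      nlinarith
    · exact h2.2
  -- points on open segment u z
  have hpt : ∀ x ∈ openSegment ℝ (q u) (q z), ∃ t : ℝ, 0 < t ∧ t < 1 ∧ α x = t * α (q z) ∧ β x = t * β (q z) := by
    intro x hx
    obtain ⟨t, h1, h2, rfl⟩ := mem_oseg.mp hx
    refine ⟨t, h1, h2, ?_, ?_⟩
    · rw [hα, αu]; ring
    · rw [hβ, βu]; ring
  have hnov : ∀ y, y ≠ u → y ≠ z → q y ∉ openSegment ℝ (q u) (q z) := by
    intro y hyu hyz hy
    obtain ⟨t, h1, h2, h3, h4⟩ := hpt _ hy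
    have hyS : y ∈ S := by
      simp only [S, Finset.mem_filter, Finset.mem_univ, true_and]
      rw [h3, h4]
      refine ⟨hyu, by positivity, by positivity, by nlinarith⟩
    have := min2 y hyS (by rw [h3, h4]; ring)
    rw [h3, h4] at this
    nlinarith
  have hEz : E u z := by
    refine hE.max (Ne.symm hzu) hnov ?_
    -- main: suppose blocker a b
    have main : ∀ a b x, E a b → a ≠ u → a ≠ z → b ≠ u → b ≠ z → x ∈ openSegment ℝ (q a) (q b) →
      x ∈ openSegment ℝ (q u) (q z) → ¬ (α (q z) * β (q a) - β (q z) * α (q a) < 0) := by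
      intro a b x hab h1 h2 h3 h4 hx hx' hneg
      obtain ⟨t, ht0, ht1, xα, xβ⟩ := hpt _ hx'
      have haS : β (q a) < 0 ∨ 1 - (α (q a) + β (q a)) < 0 := by
        by_contra hcon
        push Not at hcon
        have hab0 : 0 < α (q a) := by
          by_contra hc0
          push Not at hc0
          nlinarith [mul_nonneg hzα hcon.1, mul_nonneg hzβ.le (neg_nonneg.mpr hc0)]
        have := min1 a (by simp only [S, Finset.mem_filter, Finset.mem_univ, true_and]; exact ⟨h1, hab0.le, hcon.1, by linarith⟩)
        linarith
      obtain ⟨y, hy, hycase⟩ := exit_lem (φ := β) (ψ := fun y => 1 - (α y + β y)) hβ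
        (by intro r x a; show 1 - (α _ + β _) = _; rw [hα, hβ]; ring) (x := x) (a := q a) (by rw [xβ]; positivity)
        (by show 0 < 1 - (α x + β x); rw [xα, xβ]; nlinarith) haS
      have hyab : y ∈ openSegment ℝ (q a) (q b) := oseg_trans hx hy
      have hγ : α (q z) * β y - β (q z) * α y < 0 := by
        obtain ⟨r, r0, r1, rfl⟩ := mem_oseg.mp hy
        rw [hα, hβ, xα, xβ]
        have : α (q z) * ((1 - r) * (t * β (q z)) + r * β (q a)) - β (q z) * ((1 - r) * (t * α (q z)) + r * α (q a)) = r * (α (q z) * β (q a) - β (q z) * α (q a)) := by ring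
        rw [this]; exact mul_neg_of_pos_of_neg r0 hneg
      have hyβ : 0 ≤ β y := by rcases hycase with k | k; exacts [k.1.ge, k.2]
      have hyα : 0 < α y := by
        by_contra hc0
        push Not at hc0
        nlinarith [mul_nonneg hzα hyβ, mul_nonneg hzβ.le (neg_nonneg.mpr hc0)]
      have hysame : y ∈ openSegment ℝ (q a0) (q s0) := by
        have e := rep y
        rcases hycase with ⟨k1, k2⟩ | ⟨k1, k2⟩
        · rw [k1] at e
          simp at e
          have k2' : α y ≤ 1 := by have : 0 ≤ 1 - (α y + β y) := k2; linarith
          rcases k2'.lt_or_eq with m | m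
          · exfalso
            refine hfree a b h1 h3 (Or.inr hab) (α y) hyα.le m ?_
            rw [← e]; exact openSegment_subset_segment _ _ _ hyab
          · rw [m] at e; simp at e; rw [e]; exact hc
        · have k1' : α y = 1 - β y := by have : 1 - (α y + β y) = 0 := k1; linarith
          rcases hyβ.lt_or_eq with m | m
          · rw [openSegment_symm]
            rw [openSegment_symm] at hc
            refine oseg_trans hc ?_
            rw [mem_oseg]
            refine ⟨β y, m, by linarith, ?_⟩
            rw [k1'] at e
            simpa using e
          · rw [k1', ← m] at e; simp at e; rw [e]; exact hc
      have hxs : x ∈ openSegment ℝ (q a0) (q s0) := by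
        rcases hE.same hq hab e0 hyab hysame with ⟨rfl, rfl⟩ | ⟨rfl, rfl⟩
        · exact hx
        · rwa [openSegment_symm]
      -- σ = 1 on the line
      have hσ : α x + β x = 1 := by
        obtain ⟨t1, _, t1', e1⟩ := mem_oseg.mp hc
        obtain ⟨t2, _, _, e2⟩ := mem_oseg.mp hxs
        have s1 : α c = (1-t1) * α (q a0) + t1 * α (q s0) := by rw [e1, hα]
        have s2 : β c = (1-t1) * β (q a0) + t1 * β (q s0) := by rw [e1, hβ]
        rw [αc, αs] at s1
        rw [βc, βs] at s2
        have : α (q a0) + β (q a0) = 1 := by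
          apply mul_left_cancel₀ (sub_pos.mpr t1').ne'; linarith
        have s3 : α x = (1-t2) * α (q a0) + t2 * α (q s0) := by rw [e2, hα]
        have s4 : β x = (1-t2) * β (q a0) + t2 * β (q s0) := by rw [e2, hβ]
        rw [αs] at s3
        rw [βs] at s4
        rw [s3, s4]
        have : (1-t2) * (α (q a0) + β (q a0)) = 1 - t2 := by rw [this]; ring
        linarith
      rw [xα, xβ] at hσ
      nlinarith
    -- collinear
    intro a b x hab h1 h2 h3 h4 hx hx'
    obtain ⟨t, ht0, ht1, xα, xβ⟩ := hpt _ hx'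
    have m1 := main a b x hab h1 h2 h3 h4 hx hx'
    have m2 := main b a x (hE.symm hab) h3 h4 h1 h2 (by rwa [openSegment_symm]) hx'
    push Not at m1 m2
    obtain ⟨r, r0, r1, e⟩ := mem_oseg.mp hx
    have ea : α x = (1-r) * α (q a) + r * α (q b) := by rw [e, hα]
    have eb : β x = (1-r) * β (q a) + r * β (q b) := by rw [e, hβ]
    have z0 : (1-r) * (α (q z) * β (q a) - β (q z) * α (q a)) + r * (α (q z) * β (q b) - β (q z) * α (q b)) = 0 := by
      have : (1-r) * (α (q z) * β (q a) - β (q z) * α (q a)) + r * (α (q z) * β (q b) - β (q z) * α (q b)) = α (q z) * β x - β (q z) * α x := by rw [ea, eb]; ring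
      rw [this, xα, xβ]; ring
    have za : α (q z) * β (q a) - β (q z) * α (q a) = 0 := by
      nlinarith [mul_nonneg (sub_pos.mpr r1).le m1, mul_nonneg r0.le m2]
    have zb : α (q z) * β (q b) - β (q z) * α (q b) = 0 := by
      nlinarith [mul_nonneg (sub_pos.mpr r1).le m1, mul_nonneg r0.le m2]
    -- q w = u + τ (z - u), τ = β(w)/β(z)
    have line : ∀ w, α (q z) * β (q w) - β (q z) * α (q w) = 0 → q w = (1 - β (q w) / β (q z)) • q u + (β (q w) / β (q z)) • q z := by
      intro w hw
      have e1 := rep (q w)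
      have e2 := rep (q z)
      have hb : β (q w) = (β (q w) / β (q z)) * β (q z) := by field_simp
      have ha : α (q w) = (β (q w) / β (q z)) * α (q z) := by field_simp; linarith
      set τ := β (q w) / β (q z)
      rw [ha, hb] at e1
      have f1 := congrArg Prod.fst e1
      have f2 := congrArg Prod.snd e1
      have g1 := congrArg Prod.fst e2
      have g2 := congrArg Prod.snd e2
      simp at f1 f2 g1 g2
      ext
      · simp; rw [f1]; linear_combination (-τ) * g1
      · simp; rw [f2]; linear_combination (-τ) * g2
    have fin : ∀ a b : W, E a b → a ≠ u → a ≠ z → b ≠ u → b ≠ z → α (q z) * β (q a) - β (q z) * α (q a) = 0 →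
        α (q z) * β (q b) - β (q z) * α (q b) = 0 → β (q a) ≤ β x → β x ≤ β (q b) → False := by
      intro a b hab h1 h2 h3 h4 za zb k1 k2
      have la := line a za
      have lb := line b zb
      set τ := β (q a) / β (q z) with hτ
      set τ' := β (q b) / β (q z) with hτ'
      have hτ1 : τ < 1 := by rw [hτ, div_lt_one hzβ]; nlinarith
      have hτ'0 : 0 < τ' := by rw [hτ']; apply div_pos _ hzβ; nlinarith [mul_pos ht0 hzβ]
      rcases lt_trichotomy τ 0 with k | k | k
      · refine hE.vert hab (Ne.symm h1) (Ne.symm h3) ?_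
        exact line_split k hτ'0 la lb
      · rw [k] at la; simp at la; exact h1 (hq la)
      · exact hnov a h1 h2 (mem_oseg.mpr ⟨τ, k, hτ1, la⟩)
    rcases le_total (β (q a)) (β (q b)) with k | k
    · exact fin a b hab h1 h2 h3 h4 za zb (by rw [eb]; nlinarith) (by rw [eb]; nlinarith)
    · exact fin b a (hE.symm hab) h3 h4 h1 h2 zb za (by rw [eb]; nlinarith) (by rw [eb]; nlinarith)
  refine ⟨z, hEz, ?_⟩
  have hrep : h (q z) = (1 - α (q z) - β (q z)) * h (q u) + α (q z) * h c + β (q z) * h (q s0) := by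
    have e := rep (q z)
    have hσ : 0 < α (q z) + β (q z) := by linarith
    have e' : q z = (1 - (α (q z) + β (q z))) • q u + (α (q z) + β (q z)) • 
      ((1 - β (q z) / (α (q z) + β (q z))) • c + (β (q z) / (α (q z) + β (q z))) • (q s0)) := by
      conv_lhs => rw [e]
      ext
      · simp; field_simp; ring
      · simp; field_simp; ring
    rw [e', hh, hh, ← e']
    field_simp; ring
  rw [hrep]
  nlinarith [mul_nonneg hzα (sub_pos.mpr hc1).le, mul_pos hzβ (sub_pos.mpr hc2)]

theorem vis (hE : MaxPlane q E) (hq : Function.Injective q) (u z0 : W) (h : ℝ × ℝ → ℝ) (hh : Aff h)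
    (hz0 : h (q u) < h (q z0)) : ∃ z, E u z ∧ h (q u) < h (q z) := by
  let K : Set (ℝ × ℝ) := ⋃ (x : {x : W × W // x.1 ≠ u ∧ x.2 ≠ u ∧ (x.1 = x.2 ∨ E x.1 x.2)}), segment ℝ (q x.1.1) (q x.1.2)
  have hK : IsClosed K := isClosed_iUnion_of_finite (fun x => by
    rw [segment_eq_image_lineMap]
    exact (isCompact_Icc.image (AffineMap.lineMap_continuous)).isClosed)
  let f : ℝ → ℝ × ℝ := fun t => (1-t)•q u + t•q z0
  have hf : Continuous f := by fun_prop
  have hz0u : z0 ≠ u := by rintro rfl; exact lt_irrefl _ hz0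
  have huK : q u ∉ K := by
    intro hu
    simp only [K, Set.mem_iUnion] at hu
    obtain ⟨⟨⟨a, b⟩, h1, h2, h3⟩, hs⟩ := hu
    simp only at h1 h2 h3 hs
    rcases h3 with rfl | h3
    · simp at hs; exact h1 (hq hs.symm)
    · rw [← insert_endpoints_openSegment] at hs
      rcases hs with hs | hs | hs
      · exact h1 (hq hs.symm)
      · exact h2 (hq hs.symm)
      · exact hE.vert h3 (Ne.symm h1) (Ne.symm h2) hs
  have hcomp : IsCompact (Set.Icc (0:ℝ) 1 ∩ f ⁻¹' K) := isCompact_Icc.inter_right (hK.preimage hf)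
  obtain ⟨t, ht⟩ := hcomp.exists_isLeast ⟨1, by simp, by
    simp only [f, Set.mem_preimage, K, Set.mem_iUnion]
    refine ⟨⟨(z0, z0), hz0u, hz0u, Or.inl rfl⟩, ?_⟩; simp⟩
  obtain ⟨⟨⟨ht0, ht1⟩, htK⟩, htmin⟩ := ht
  have htpos : 0 < t := by
    rcases ht0.lt_or_eq with k | k
    · exact k
    · subst k; exact absurd (by simpa [f] using htK) huK
  set c := f t with hc
  have hcu : h (q u) < h c := by rw [hc]; show _ < h _; rw [hh]; nlinarith
  have hfree : ∀ a b, a ≠ u → b ≠ u → (a = b ∨ E a b) → ∀ r : ℝ, 0 ≤ r → r < 1 → (1-r)•(q u) + r•c ∉ segment ℝ (q a) (q b) := by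
    intro a b ha hb hab r r0 r1 hmem
    have : r * t ∈ Set.Icc (0:ℝ) 1 ∩ f ⁻¹' K := by
      refine ⟨⟨by positivity, by nlinarith⟩, ?_⟩
      simp only [Set.mem_preimage, K, Set.mem_iUnion]
      refine ⟨⟨(a, b), ha, hb, hab⟩, ?_⟩
      convert hmem using 1
      ext <;> simp [hc, f] <;> ring
    have := htmin this
    nlinarith
  have htK' : c ∈ K := htK
  clear_value c
  simp only [K, Set.mem_iUnion] at htK'
  obtain ⟨⟨⟨a, b⟩, h1, h2, h3⟩, hs⟩ := htK'
  simp only at h1 h2 h3 hs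
  -- if c is a vertex
  have hvert : ∀ z, z ≠ u → q z = c → ∃ z, E u z ∧ h (q u) < h (q z) := by
    intro z hz hzc
    refine ⟨z, hE.max (Ne.symm hz) ?_ ?_, by rw [hzc]; exact hcu⟩
    · intro y hy hyz hmem
      obtain ⟨r, r0, r1, e⟩ := mem_oseg.mp hmem
      refine hfree y y hy hy (Or.inl rfl) r r0.le r1 ?_
      rw [← hzc, ← e]; simp
    · intro a b s hab ha _ hb _ hs hs'
      obtain ⟨r, r0, r1, e⟩ := mem_oseg.mp hs'
      refine hfree a b ha hb (Or.inr hab) r r0.le r1 ?_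
      rw [← hzc, ← e]; exact openSegment_subset_segment _ _ _ hs
  rw [← insert_endpoints_openSegment] at hs
  rcases hs with hs | hs | hs
  · exact hvert a h1 hs.symm
  · exact hvert b h2 hs.symm
  rcases h3 with rfl | h3
  · simp at hs; exact hvert a h1 hs.symm
  have fin : ∀ a b, a ≠ u → b ≠ u → E a b → c ∈ openSegment ℝ (q a) (q b) → h c ≤ h (q b) → ∃ z, E u z ∧ h (q u) < h (q z) := by
    intro a b h1 h2 h3 hs hb
    by_cases hD : D (q u) c (q b) = 0
    · exfalso
      -- b on line
      obtain ⟨r, r0, r1, e⟩ := mem_oseg.mp hs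
      have hDa : D (q u) c (q a) = 0 := by
        have h4 : D (q u) c c = (1-r) * D (q u) c (q a) + r * D (q u) c (q b) := by
          conv_lhs => rw [show D (q u) c c = D (q u) c ((1-r)•q a + r•q b) by rw [← e]]
          rw [D_aff]
        have h5 : D (q u) c c = 0 := by unfold D; ring
        rw [h5, hD] at h4
        have : (1-r) * D (q u) c (q a) = 0 := by linarith
        exact (mul_eq_zero.mp this).resolve_left (by linarith)
      have hneuc : (c.1 - (q u).1)^2 + (c.2 - (q u).2)^2 ≠ 0 := by
        intro h0
        have g1 : c.1 = (q u).1 := by nlinarith [sq_nonneg (c.1 - (q u).1), sq_nonneg (c.2 - (q u).2)]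
        have g2 : c.2 = (q u).2 := by nlinarith [sq_nonneg (c.1 - (q u).1), sq_nonneg (c.2 - (q u).2)]
        have : c = q u := Prod.ext g1 g2
        rw [this] at hcu; exact lt_irrefl _ hcu
      have param : ∀ y, D (q u) c y = 0 → ∃ τ : ℝ, y = (1-τ)•q u + τ•c := by
        intro y hy
        refine ⟨((y.1 - (q u).1) * (c.1 - (q u).1) + (y.2 - (q u).2) * (c.2 - (q u).2)) / ((c.1 - (q u).1)^2 + (c.2 - (q u).2)^2), ?_⟩
        unfold D at hy
        ext
        · simp; field_simp; linear_combination (-(c.2 - (q u).2)) * hy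
        · simp; field_simp; linear_combination ((c.1 - (q u).1)) * hy
      obtain ⟨τa, ea⟩ := param _ hDa
      obtain ⟨τb, eb⟩ := param _ hD
      have hb1 : 1 ≤ τb := by
        have := hb; rw [eb, hh] at this; nlinarith
      -- c = (1-r) a + r b : 1 = (1-r) τa + r τb
      have hr : (1-r) * τa + r * τb = 1 := by
        have e1 := congrArg h e
        rw [hh, ea, eb, hh, hh] at e1
        have : (h c - h (q u)) * ((1-r) * τa + r * τb - 1) = 0 := by linarith
        have := (mul_eq_zero.mp this).resolve_left (by linarith)
        linarith
      have ha1 : τa < 1 ∨ τa = 1 := by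
        rcases lt_trichotomy τa 1 with k | k | k
        · exact Or.inl k
        · exact Or.inr k
        · exfalso; nlinarith [mul_pos (sub_pos.mpr r1) (sub_pos.mpr k), mul_nonneg r0.le (sub_nonneg.mpr hb1)]
      rcases ha1 with k | k
      · rcases lt_or_ge τa 0 with m | m
        · refine hE.vert h3 (Ne.symm h1) (Ne.symm h2) ?_
          exact line_split m (by linarith) ea eb
        · refine hfree a a h1 h1 (Or.inl rfl) τa m k ?_
          rw [← ea]; simp
      · have : τb = 1 := by subst k; nlinarith
        rw [k] at ea; rw [this] at eb
        exact hE.ne h3 (hq (ea.trans eb.symm))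
    · exact vis_tri hE hq h3 hs h2 h1 hfree hD h hh hcu (lt_of_lt_of_le hcu hb)
  rcases hh.ends hs with k | k
  · exact fin b a h2 h1 (hE.symm h3) (by rwa [openSegment_symm]) k
  · exact fin a b h1 h2 h3 hs k
end geo
end ICR

namespace ICR
open Classical Filter Topology

theorem left_not_mem {a b : ℝ × ℝ} (h : a ≠ b) : a ∉ openSegment ℝ a b := by
  intro hm
  rw [left_mem_openSegment_iff] at hm
  exact h hm

theorem D_self1 (a b : ℝ × ℝ) : D a b a = 0 := by unfold D; ring
theorem D_self2 (a b : ℝ × ℝ) : D a b b = 0 := by unfold D; ring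
theorem D_self3 (a b : ℝ × ℝ) : D a a b = 0 := by unfold D; ring
theorem D_sum (u v w y : ℝ × ℝ) : D w u y + D u v y + D v w y = D u v w := by unfold D; ring

section geo
variable {W : Type*} [Fintype W] {q : W → ℝ × ℝ} {E : W → W → Prop}

theorem wedge_empty (hE : MaxPlane q E) (hq : Function.Injective q) {u v w : W} (euv : E u v) (euw : E u w)
    (hD : 0 < D (q u) (q v) (q w))
    (hno : ∀ z, E u z → ¬ (0 < D (q u) (q v) (q z) ∧ 0 < D (q w) (q u) (q z))) :
    (∀ z, z ≠ u → z ≠ v → z ≠ w → ¬ (0 ≤ D (q u) (q v) (q z) ∧ 0 ≤ D (q v) (q w) (q z) ∧ 0 ≤ D (q w) (q u) (q z))) ∧ E v w := by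
  have hD' : 0 < D (q v) (q w) (q u) := by rw [D_rot]; exact hD
  have hD'' : 0 < D (q w) (q u) (q v) := by rw [D_rot2]; exact hD
  -- point classification on sides
  have sideB : ∀ y, D (q u) (q v) y = 0 → 0 ≤ D (q w) (q u) y → 0 ≤ D (q v) (q w) y → y = q u ∨ y = q v ∨ y ∈ openSegment ℝ (q u) (q v) := by
    intro y h1 h2 h3
    rcases h2.eq_or_lt with k | k
    · left; exact pt_of_D hD k.symm h1
    rcases h3.eq_or_lt with m | m
    · right; left; exact pt_of_D hD' h1 m.symm
    · right; right; rw [openSegment_symm]; exact seg_of_D hD' h1 m k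
  have sideA : ∀ y, D (q w) (q u) y = 0 → 0 ≤ D (q u) (q v) y → 0 ≤ D (q v) (q w) y → y = q u ∨ y = q w ∨ y ∈ openSegment ℝ (q u) (q w) := by
    intro y h1 h2 h3
    rcases h2.eq_or_lt with k | k
    · left; exact pt_of_D hD h1 k.symm
    rcases h3.eq_or_lt with m | m
    · right; left; exact pt_of_D hD'' m.symm h1
    · right; right; exact seg_of_D hD h1 k m
  have part1 : ∀ z, z ≠ u → z ≠ v → z ≠ w → ¬ (0 ≤ D (q u) (q v) (q z) ∧ 0 ≤ D (q v) (q w) (q z) ∧ 0 ≤ D (q w) (q u) (q z)) := by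
    let S : Finset W := Finset.univ.filter (fun z => z ≠ u ∧ z ≠ v ∧ z ≠ w ∧ 0 ≤ D (q u) (q v) (q z) ∧ 0 ≤ D (q v) (q w) (q z) ∧ 0 ≤ D (q w) (q u) (q z))
    by_contra hcon
    push Not at hcon
    obtain ⟨z', hz'⟩ := hcon
    have hSne : S.Nonempty := ⟨z', by simp only [S, Finset.mem_filter, Finset.mem_univ, true_and]; exact hz'⟩
    obtain ⟨z, hzS, hmax⟩ := S.exists_max_image (fun z => D (q v) (q w) (q z)) hSne
    simp only [S, Finset.mem_filter, Finset.mem_univ, true_and] at hzS hmax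
    obtain ⟨zu, zv, zw, zB, zC, zA⟩ := hzS
    have hB : 0 < D (q u) (q v) (q z) := by
      rcases zB.lt_or_eq with k | k
      · exact k
      · exfalso
        rcases sideB _ k.symm zA zC with m | m | m
        · exact zu (hq m)
        · exact zv (hq m)
        · exact hE.vert euv zu zv m
    have hA : 0 < D (q w) (q u) (q z) := by
      rcases zA.lt_or_eq with k | k
      · exact k
      · exfalso
        rcases sideA _ k.symm zB zC with m | m | m
        · exact zu (hq m)
        · exact zw (hq m)
        · exact hE.vert euw zu zw m
    have hpt : ∀ x ∈ openSegment ℝ (q u) (q z), 0 < D (q w) (q u) x ∧ 0 < D (q u) (q v) x ∧ D (q v) (q w) (q z) < D (q v) (q w) x := by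
      intro x hx
      obtain ⟨t, h1, h2, rfl⟩ := mem_oseg.mp hx
      rw [D_aff, D_aff, D_aff, D_self2, D_self1]
      have := D_sum (q u) (q v) (q w) (q z)
      have := D_rot (p := q u) (q := q v) (r := q w)
      refine ⟨by simp; positivity, by simp; positivity, ?_⟩
      nlinarith
    have hnE : ¬ E u z := fun h => hno z h ⟨hB, hA⟩
    refine hnE (hE.max (Ne.symm zu) ?_ ?_)
    · intro y yu yz hy
      obtain ⟨h1, h2, h3⟩ := hpt _ hy
      have := hmax y ⟨yu, ?_, ?_, h2.le, zC.trans h3.le, h1.le⟩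
      · linarith
      · rintro rfl; rw [D_self2] at h2; exact lt_irrefl _ h2
      · rintro rfl; rw [D_self1] at h1; exact lt_irrefl _ h1
    · have main : ∀ a b x, E a b → a ≠ u → b ≠ u → x ∈ openSegment ℝ (q a) (q b) → x ∈ openSegment ℝ (q u) (q z) →
        D (q v) (q w) x ≤ D (q v) (q w) (q a) → False := by
        intro a b x hab au bu hx hx' hC
        obtain ⟨h1, h2, h3⟩ := hpt _ hx'
        have hout : D (q w) (q u) (q a) < 0 ∨ D (q u) (q v) (q a) < 0 := by
          by_contra hcon
          push Not at hcon
          have := hmax a ⟨au, ?_, ?_, hcon.2, by linarith, hcon.1⟩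
          · linarith
          · rintro rfl; rw [D_self1] at hC; linarith
          · rintro rfl; rw [D_self2] at hC; linarith
        obtain ⟨y, hy, hcase⟩ := exit_lem (D_aff (q w) (q u)) (D_aff (q u) (q v)) h1 h2 hout
        have hyab := oseg_trans hx hy
        have hyC : D (q v) (q w) x ≤ D (q v) (q w) y := (D_aff (q v) (q w)).between_ge hy le_rfl hC
        have hyu : y ≠ q u := by
          rintro rfl; exact hE.vert hab (Ne.symm au) (Ne.symm bu) hyab
        rcases hcase with ⟨k1, k2⟩ | ⟨k1, k2⟩
        · rcases sideA y k1 k2 (by linarith) with m | m | m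
          · exact hyu m
          · rw [m, D_self2] at hyC; linarith
          · rcases hE.same hq hab euw hyab m with ⟨r, _⟩ | ⟨_, r⟩
            · exact au r
            · exact bu r
        · rcases sideB y k1 k2 (by linarith) with m | m | m
          · exact hyu m
          · rw [m, D_self1] at hyC; linarith
          · rcases hE.same hq hab euv hyab m with ⟨r, _⟩ | ⟨_, r⟩
            · exact au r
            · exact bu r
      intro a b x hab au az bu bz hx hx'
      rcases (D_aff (q v) (q w)).ends hx with k | k
      · exact main a b x hab au bu hx hx' k
      · exact main b a x (hE.symm hab) bu au (by rwa [openSegment_symm]) hx' k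
  refine ⟨part1, ?_⟩
  have hvw : v ≠ w := by rintro rfl; rw [D_self2] at hD; exact lt_irrefl _ hD
  have hpt : ∀ x ∈ openSegment ℝ (q v) (q w), 0 < D (q w) (q u) x ∧ 0 < D (q u) (q v) x ∧ D (q v) (q w) x = 0 := by
    intro x hx
    obtain ⟨t, h1, h2, rfl⟩ := mem_oseg.mp hx
    rw [D_aff, D_aff, D_aff, D_self2, D_self1, D_self1, D_self2]
    refine ⟨?_, by simp; positivity, by ring⟩
    have : 0 < 1 - t := by linarith
    simp; positivity
  refine hE.max hvw ?_ ?_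
  · intro y yv yw hy
    obtain ⟨h1, h2, h3⟩ := hpt _ hy
    refine part1 y ?_ yv yw ⟨h2.le, h3.ge, h1.le⟩
    rintro rfl; rw [D_self1] at h2; exact lt_irrefl _ h2
  · have main : ∀ a b x, E a b → a ≠ v → a ≠ w → b ≠ v → b ≠ w → x ∈ openSegment ℝ (q a) (q b) → x ∈ openSegment ℝ (q v) (q w) →
        D (q v) (q w) x ≤ D (q v) (q w) (q a) → False := by
      intro a b x hab av aw bv bw hx hx' hC
      obtain ⟨h1, h2, h3⟩ := hpt _ hx'
      rw [h3] at hC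
      by_cases hau : a = u
      · subst hau
        obtain ⟨t, t0, t1, rfl⟩ := mem_oseg.mp hx
        rw [D_aff, D_self2] at h1
        rw [D_aff, D_self1] at h2
        refine hno b hab ⟨?_, ?_⟩
        · apply pos_of_mul_pos_right _ t0.le; simpa using h2
        · apply pos_of_mul_pos_right _ t0.le; simpa using h1
      have hout : D (q w) (q u) (q a) < 0 ∨ D (q u) (q v) (q a) < 0 := by
        by_contra hcon
        push Not at hcon
        exact part1 a hau av aw ⟨hcon.2, hC, hcon.1⟩
      obtain ⟨y, hy, hcase⟩ := exit_lem (D_aff (q w) (q u)) (D_aff (q u) (q v)) h1 h2 hout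
      have hyab := oseg_trans hx hy
      have hyC : 0 ≤ D (q v) (q w) y := (D_aff (q v) (q w)).between_ge hy h3.ge hC
      have hyu : y ≠ q u := by
        rintro rfl
        by_cases hbu : b = u
        · subst hbu
          rw [openSegment_symm] at hyab
          exact left_not_mem (fun h => hau (hq h).symm) hyab
        exact hE.vert hab (Ne.symm hau) (Ne.symm hbu) hyab
      rcases hcase with ⟨k1, k2⟩ | ⟨k1, k2⟩
      · rcases sideA y k1 k2 hyC with m | m | m
        · exact hyu m
        · rw [m] at hyab; exact hE.vert hab (Ne.symm aw) (Ne.symm bw) hyab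
        · rcases hE.same hq hab euw hyab m with ⟨_, r⟩ | ⟨r, _⟩
          · exact bw r
          · exact aw r
      · rcases sideB y k1 k2 hyC with m | m | m
        · exact hyu m
        · rw [m] at hyab; exact hE.vert hab (Ne.symm av) (Ne.symm bv) hyab
        · rcases hE.same hq hab euv hyab m with ⟨_, r⟩ | ⟨r, _⟩
          · exact bv r
          · exact av r
    intro a b x hab av aw bv bw hx hx'
    rcases (D_aff (q v) (q w)).ends hx with k | k
    · exact main a b x hab av aw bv bw hx hx' k
    · exact main b a x (hE.symm hab) bv bw av aw (by rwa [openSegment_symm]) hx' k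

def Tgeo (q : W → ℝ × ℝ) (E : W → W → Prop) (u v w : W) : Prop :=
  0 < D (q u) (q v) (q w) ∧ E u v ∧ E v w ∧ E w u ∧
    ∀ z, z ≠ u → z ≠ v → z ≠ w → ¬ (0 ≤ D (q u) (q v) (q z) ∧ 0 ≤ D (q v) (q w) (q z) ∧ 0 ≤ D (q w) (q u) (q z))

theorem Tgeo.rot {u v w : W} (h : Tgeo q E u v w) : Tgeo q E v w u := by
  obtain ⟨h1, h2, h3, h4, h5⟩ := h
  refine ⟨by rw [D_rot]; exact h1, h3, h4, h2, fun z a b c ⟨d, e, f⟩ => h5 z c a b ⟨f, d, e⟩⟩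

/-- an edge with some vertex strictly on the left bounds a triangle on the left -/
theorem edge_left (hE : MaxPlane q E) (hq : Function.Injective q) {u v z0 : W} (e : E u v)
    (hz : 0 < D (q u) (q v) (q z0)) : ∃ w, Tgeo q E u v w := by
  obtain ⟨z, hz1, hz2⟩ := vis hE hq u z0 (D (q u) (q v)) (D_aff _ _) (by rw [D_self1]; exact hz)
  rw [D_self1] at hz2
  let S : Finset W := Finset.univ.filter (fun z => E u z ∧ 0 < D (q u) (q v) (q z))
  -- maximize dot/cross
  obtain ⟨w, hw, hmax⟩ := S.exists_max_image (fun z => (((q z).1 - (q u).1) * ((q v).1 - (q u).1) + ((q z).2 - (q u).2) * ((q v).2 - (q u).2)) / D (q u) (q v) (q z)) ⟨z, by simp [S, hz1, hz2]⟩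
  simp only [S, Finset.mem_filter, Finset.mem_univ, true_and] at hw hmax
  obtain ⟨hw1, hw2⟩ := hw
  have := wedge_empty hE hq e hw1 hw2 (by
    rintro z hz ⟨h1, h2⟩
    have h3 := hmax z ⟨hz, h1⟩
    rw [div_le_div_iff₀ h1 hw2] at h3
    have hpos : 0 < ((q v).1 - (q u).1)^2 + ((q v).2 - (q u).2)^2 := by
      by_contra hc
      have g1 : (q v).1 - (q u).1 = 0 := by nlinarith [sq_nonneg ((q v).1 - (q u).1), sq_nonneg ((q v).2 - (q u).2)]
      have g2 : (q v).2 - (q u).2 = 0 := by nlinarith [sq_nonneg ((q v).1 - (q u).1), sq_nonneg ((q v).2 - (q u).2)]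
      exact hE.ne e (hq (Prod.ext (by linarith) (by linarith)))
    have h4 : 0 < (((q v).1 - (q u).1)^2 + ((q v).2 - (q u).2)^2) * D (q w) (q u) (q z) := mul_pos hpos h2
    unfold D at h3 h4
    nlinarith)
  exact ⟨w, hw2, e, this.2, hE.symm hw1, this.1⟩

/-- no edge from a corner into an empty triangle -/
theorem Tgeo.nop (hE : MaxPlane q E) (hq : Function.Injective q) {u v w z : W} (h : Tgeo q E u v w) (e : E u z)
    (h1 : 0 < D (q u) (q v) (q z)) (h2 : 0 < D (q w) (q u) (q z)) : False := by
  obtain ⟨t1, t2, t3, t4, t5⟩ := h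
  have zu : z ≠ u := (hE.ne e).symm
  have zv : z ≠ v := by rintro rfl; rw [D_self2] at h1; exact lt_irrefl _ h1
  have zw : z ≠ w := by rintro rfl; rw [D_self1] at h2; exact lt_irrefl _ h2
  have h3 : D (q v) (q w) (q z) < 0 := by
    by_contra hc
    push Not at hc
    exact t5 z zu zv zw ⟨h1.le, hc, h2.le⟩
  have hs := D_sum (q u) (q v) (q w) (q z)
  -- crossing point
  set t := D (q u) (q v) (q w) / (D (q u) (q v) (q w) - D (q v) (q w) (q z)) with ht
  have hd : 0 < D (q u) (q v) (q w) - D (q v) (q w) (q z) := by linarith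
  have ht0 : 0 < t := by positivity
  have ht1 : t < 1 := by rw [ht, div_lt_one hd]; linarith
  have hy : (1-t)•q u + t•q z ∈ openSegment ℝ (q u) (q z) := mem_oseg.mpr ⟨t, ht0, ht1, rfl⟩
  have hC : D (q v) (q w) ((1-t)•q u + t•q z) = 0 := by
    rw [D_aff, D_rot, ht]; field_simp; ring
  have hy2 : (1-t)•q u + t•q z ∈ openSegment ℝ (q w) (q v) := by
    refine seg_of_D (v := q u) (by rw [D_rot2]; exact t1) hC ?_ ?_
    · rw [D_aff, D_self2]; simp; positivity
    · rw [D_aff, D_self1]; simp; positivity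
  rcases hE.same hq e t3 hy (by rwa [openSegment_symm]) with ⟨r, _⟩ | ⟨r, _⟩
  · exact hE.ne t2 r
  · exact hE.ne t4 r.symm

theorem Tgeo.uniq (hE : MaxPlane q E) (hq : Function.Injective q) {u v w w' : W} (h : Tgeo q E u v w) (h' : Tgeo q E u v w') :
    w = w' := by
  by_contra hne
  -- w' not strictly in the wedge at u, and conversely
  have a1 : ¬ (0 < D (q w) (q u) (q w')) := fun hh => h.nop hE hq (hE.symm h'.2.2.2.1) h'.1 hh
  have a2 : ¬ (0 < D (q w') (q u) (q w)) := fun hh => h'.nop hE hq (hE.symm h.2.2.2.1) h.1 hh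
  push Not at a1 a2
  have e1 : D (q w) (q u) (q w') = - D (q w') (q u) (q w) := by unfold D; ring
  have e2 : D (q w) (q u) (q w') = 0 := by linarith
  -- collinear with u: one lies on the other's edge
  have hline : ∀ w w' : W, Tgeo q E u v w → Tgeo q E u v w' → w ≠ w' → D (q w) (q u) (q w') = 0 → D (q u) (q v) (q w') ≤ D (q u) (q v) (q w) → False := by
    intro w w' h h' hne e hle
    have hwu := (hE.ne h'.2.2.2.1)
    have hwv := (hE.ne h'.2.2.1).symm
    have hC : 0 ≤ D (q v) (q w) (q w') := by have := D_sum (q u) (q v) (q w) (q w'); linarith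
    exact h.2.2.2.2 w' hwu hwv (Ne.symm hne) ⟨h'.1.le, hC, e.ge⟩
  rcases le_total (D (q u) (q v) (q w')) (D (q u) (q v) (q w)) with k | k
  · exact hline w w' h h' hne e2 k
  · exact hline w' w h' h (Ne.symm hne) (by linarith) k
end geo
end ICR

namespace ICR
open Classical Filter Topology

section geo
variable {W : Type*} [Fintype W] {q : W → ℝ × ℝ} {E : W → W → Prop} {o0 o1 o2 : W}

structure OutTri (q : W → ℝ × ℝ) (o0 o1 o2 : W) : Prop where
  pos : 0 < D (q o0) (q o1) (q o2)
  ins : ∀ z, ¬ Outer o0 o1 o2 z → 0 < D (q o0) (q o1) (q z) ∧ 0 < D (q o1) (q o2) (q z) ∧ 0 < D (q o2) (q o0) (q z)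

theorem OutTri.rot (h : OutTri q o0 o1 o2) : OutTri q o1 o2 o0 := by
  refine ⟨by rw [D_rot]; exact h.pos, fun z hz => ?_⟩
  have := h.ins z (by unfold Outer at *; tauto)
  tauto

theorem IsOut.rot {u v w : W} (h : IsOut o0 o1 o2 u v w) : IsOut o0 o1 o2 v w u := by
  unfold IsOut at *; tauto

theorem OutTri.side (h : OutTri q o0 o1 o2) {z : W} (h0 : z ≠ o0) (h1 : z ≠ o1) : 0 < D (q o0) (q o1) (q z) := by
  by_cases hz : Outer o0 o1 o2 z
  · rcases hz with k | k | k
    · exact absurd k h0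
    · exact absurd k h1
    · subst k; exact h.pos
  · exact (h.ins z hz).1

theorem OutTri.out_neg (h : OutTri q o0 o1 o2) {u v w x : W} (ho : IsOut o0 o1 o2 u v w) (h1 : x ≠ u) (h2 : x ≠ v) :
    D (q u) (q v) (q x) < 0 := by
  rw [show D (q u) (q v) (q x) = - D (q v) (q u) (q x) by unfold D; ring]
  rw [neg_lt_zero]
  rcases ho with ⟨rfl, rfl, rfl⟩ | ⟨rfl, rfl, rfl⟩ | ⟨rfl, rfl, rfl⟩
  · exact h.rot.rot.side h2 h1
  · exact h.rot.side h2 h1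
  · exact h.side h2 h1

theorem OutTri.out_le (h : OutTri q o0 o1 o2) {u v w : W} (ho : IsOut o0 o1 o2 u v w) (x : W) :
    D (q u) (q v) (q x) ≤ 0 := by
  by_cases h1 : x = u
  · subst h1; rw [D_self1]
  by_cases h2 : x = v
  · subst h2; rw [D_self2]
  exact (h.out_neg ho h1 h2).le

theorem OutTri.ne01 (h : OutTri q o0 o1 o2) : o0 ≠ o1 := by
  rintro rfl; have := h.pos; rw [D_self3] at this; exact lt_irrefl _ this

theorem OutTri.edge (h : OutTri q o0 o1 o2) (hE : MaxPlane q E) : E o0 o1 := by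
  refine hE.max h.ne01 ?_ ?_
  · intro z h0 h1 hz
    have := h.side h0 h1
    rw [D_seg0 hz] at this; exact lt_irrefl _ this
  · intro a b s _ a0 a1 b0 b1 hs hs'
    have k := (D_aff (q o0) (q o1)).between_gt hs (h.side a0 a1) (h.side b0 b1).le
    rw [D_seg0 hs'] at k; exact lt_irrefl _ k

theorem OutTri.out_edge (h : OutTri q o0 o1 o2) (hE : MaxPlane q E) {u v w : W} (ho : IsOut o0 o1 o2 u v w) : E u v := by
  rcases ho with ⟨rfl, rfl, rfl⟩ | ⟨rfl, rfl, rfl⟩ | ⟨rfl, rfl, rfl⟩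
  · exact hE.symm (h.rot.rot.edge hE)
  · exact hE.symm (h.rot.edge hE)
  · exact hE.symm (h.edge hE)

def Tg (q : W → ℝ × ℝ) (E : W → W → Prop) (o0 o1 o2 : W) (u v w : W) : Prop :=
  Tgeo q E u v w ∨ IsOut o0 o1 o2 u v w

theorem Tg.rot {u v w : W} (h : Tg q E o0 o1 o2 u v w) : Tg q E o0 o1 o2 v w u :=
  h.imp Tgeo.rot IsOut.rot

theorem Tg.edge (ho : OutTri q o0 o1 o2) (hE : MaxPlane q E) {u v w : W} (h : Tg q E o0 o1 o2 u v w) : E u v := by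
  rcases h with h | h
  · exact h.2.1
  · exact ho.out_edge hE h

theorem edge_T (ho : OutTri q o0 o1 o2) (hE : MaxPlane q E) (hq : Function.Injective q) {u v : W} (e : E u v) :
    ∃ w, Tg q E o0 o1 o2 u v w := by
  by_cases hz : ∃ z, 0 < D (q u) (q v) (q z)
  · obtain ⟨z, hz⟩ := hz
    obtain ⟨w, hw⟩ := edge_left hE hq e hz
    exact ⟨w, Or.inl hw⟩
  push Not at hz
  have key : ∀ x, D (q u) (q v) (q x) = 0 → Outer o0 o1 o2 x := by
    intro x hx
    by_contra hc
    obtain ⟨k1, k2, k3⟩ := ho.ins x hc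
    have id1 : D (q o0) (q o1) (q o2) * D (q u) (q v) (q x) = D (q o1) (q o2) (q x) * D (q u) (q v) (q o0) + D (q o2) (q o0) (q x) * D (q u) (q v) (q o1) + D (q o0) (q o1) (q x) * D (q u) (q v) (q o2) := by
      unfold D; ring
    rw [hx, mul_zero] at id1
    have m0 := hz o0
    have m1 := hz o1
    have m2 := hz o2
    have n0 : D (q u) (q v) (q o0) = 0 := by nlinarith [mul_nonneg k2.le (neg_nonneg.mpr m0), mul_nonneg k3.le (neg_nonneg.mpr m1), mul_nonneg k1.le (neg_nonneg.mpr m2)]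
    have n1 : D (q u) (q v) (q o1) = 0 := by nlinarith [mul_nonneg k2.le (neg_nonneg.mpr m0), mul_nonneg k3.le (neg_nonneg.mpr m1), mul_nonneg k1.le (neg_nonneg.mpr m2)]
    have n2 : D (q u) (q v) (q o2) = 0 := by nlinarith [mul_nonneg k2.le (neg_nonneg.mpr m0), mul_nonneg k3.le (neg_nonneg.mpr m1), mul_nonneg k1.le (neg_nonneg.mpr m2)]
    have r1 : D (q o0) (q o1) (q o2) * ((q v).1 - (q u).1) = 0 := by
      have : D (q o0) (q o1) (q o2) * ((q v).1 - (q u).1) = - (D (q u) (q v) (q o1) - D (q u) (q v) (q o0)) * ((q o2).1 - (q o0).1) + (D (q u) (q v) (q o2) - D (q u) (q v) (q o0)) * ((q o1).1 - (q o0).1) := by unfold D; ring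
      rw [this, n0, n1, n2]; ring
    have r2 : D (q o0) (q o1) (q o2) * ((q v).2 - (q u).2) = 0 := by
      have : D (q o0) (q o1) (q o2) * ((q v).2 - (q u).2) = - (D (q u) (q v) (q o1) - D (q u) (q v) (q o0)) * ((q o2).2 - (q o0).2) + (D (q u) (q v) (q o2) - D (q u) (q v) (q o0)) * ((q o1).2 - (q o0).2) := by unfold D; ring
      rw [this, n0, n1, n2]; ring
    have r1' := (mul_eq_zero.mp r1).resolve_left ho.pos.ne'
    have r2' := (mul_eq_zero.mp r2).resolve_left ho.pos.ne'
    exact hE.ne e (hq (Prod.ext (by linarith) (by linarith)))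
  have hu := key u (D_self1 _ _)
  have hv := key v (D_self2 _ _)
  have hne := hE.ne e
  have p0 := ho.pos
  have p1 := ho.rot.pos
  have p2 := ho.rot.rot.pos
  have l0 := hz o0
  have l1 := hz o1
  have l2 := hz o2
  rcases hu with rfl | rfl | rfl <;> rcases hv with rfl | rfl | rfl
  all_goals first
    | exact absurd rfl hne
    | (exfalso; linarith)
    | exact ⟨o0, Or.inr (by unfold IsOut; tauto)⟩
    | exact ⟨o1, Or.inr (by unfold IsOut; tauto)⟩
    | exact ⟨o2, Or.inr (by unfold IsOut; tauto)⟩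
    | exact ⟨u, Or.inr (by unfold IsOut; tauto)⟩

theorem Tg.uniq (ho : OutTri q o0 o1 o2) (hE : MaxPlane q E) (hq : Function.Injective q) {u v w w' : W}
    (h : Tg q E o0 o1 o2 u v w) (h' : Tg q E o0 o1 o2 u v w') : w = w' := by
  have n01 := ho.ne01
  have n12 := ho.rot.ne01
  have n20 := ho.rot.rot.ne01
  rcases h with h | h <;> rcases h' with h' | h'
  · exact h.uniq hE hq h'
  · exfalso; have := ho.out_le h' w; have := h.1; linarith
  · exfalso; have := ho.out_le h w'; have := h'.1; linarith
  · unfold IsOut at h h'; grind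

/-- two neighbours on the same ray coincide -/
theorem same_ray (hE : MaxPlane q E) (hq : Function.Injective q) {v u w : W} (e : E v u) (e' : E v w)
    (h0 : D (q v) (q u) (q w) = 0)
    (h1 : 0 < ((q u).1 - (q v).1) * ((q w).1 - (q v).1) + ((q u).2 - (q v).2) * ((q w).2 - (q v).2)) : u = w := by
  by_contra hne
  have main : ∀ u w, u ≠ w → E v u → E v w → D (q v) (q u) (q w) = 0 → 
      0 < ((q u).1 - (q v).1) * ((q w).1 - (q v).1) + ((q u).2 - (q v).2) * ((q w).2 - (q v).2) →
      ((q u).1 - (q v).1)^2 + ((q u).2 - (q v).2)^2 ≤ ((q u).1 - (q v).1) * ((q w).1 - (q v).1) + ((q u).2 - (q v).2) * ((q w).2 - (q v).2) → False := by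
    intro u w hne e e' h0 h1 h2
    have hpos : 0 < ((q u).1 - (q v).1)^2 + ((q u).2 - (q v).2)^2 := by
      by_contra hc
      have g1 : (q u).1 - (q v).1 = 0 := by nlinarith [sq_nonneg ((q u).1 - (q v).1), sq_nonneg ((q u).2 - (q v).2)]
      have g2 : (q u).2 - (q v).2 = 0 := by nlinarith [sq_nonneg ((q u).1 - (q v).1), sq_nonneg ((q u).2 - (q v).2)]
      rw [g1, g2] at h1; simp at h1
    set n := ((q u).1 - (q v).1)^2 + ((q u).2 - (q v).2)^2 with hn
    set d := ((q u).1 - (q v).1) * ((q w).1 - (q v).1) + ((q u).2 - (q v).2) * ((q w).2 - (q v).2) with hd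
    have k1 : n * ((q w).1 - (q v).1) = d * ((q u).1 - (q v).1) := by
      have : n * ((q w).1 - (q v).1) - d * ((q u).1 - (q v).1) = - D (q v) (q u) (q w) * ((q u).2 - (q v).2) := by rw [hn, hd]; unfold D; ring
      rw [h0] at this; linarith
    have k2 : n * ((q w).2 - (q v).2) = d * ((q u).2 - (q v).2) := by
      have : n * ((q w).2 - (q v).2) - d * ((q u).2 - (q v).2) = D (q v) (q u) (q w) * ((q u).1 - (q v).1) := by rw [hn, hd]; unfold D; ring
      rw [h0] at this; linarith
    rcases h2.lt_or_eq with m | m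
    · refine hE.vert e' (z := u) (hE.ne e).symm hne ?_
      rw [mem_oseg]
      refine ⟨n / d, by positivity, by rw [div_lt_one h1]; exact m, ?_⟩
      ext
      · simp; field_simp; linarith
      · simp; field_simp; linarith
    · rw [← m] at k1 k2
      have := mul_left_cancel₀ hpos.ne' k1
      have := mul_left_cancel₀ hpos.ne' k2
      exact hne (hq (Prod.ext (by linarith) (by linarith)))
  rcases le_total (((q u).1 - (q v).1)^2 + ((q u).2 - (q v).2)^2) (((q u).1 - (q v).1) * ((q w).1 - (q v).1) + ((q u).2 - (q v).2) * ((q w).2 - (q v).2)) with k | k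
  · exact main u w hne e e' h0 h1 k
  · refine main w u (Ne.symm hne) e' e (by rw [D_swap', h0]; ring) (by linarith) ?_
    -- |w|^2 ≤ u·w
    have hid : (((q u).1 - (q v).1)^2 + ((q u).2 - (q v).2)^2) * (((q w).1 - (q v).1)^2 + ((q w).2 - (q v).2)^2) = (((q u).1 - (q v).1) * ((q w).1 - (q v).1) + ((q u).2 - (q v).2) * ((q w).2 - (q v).2))^2 := by
      have : (((q u).1 - (q v).1)^2 + ((q u).2 - (q v).2)^2) * (((q w).1 - (q v).1)^2 + ((q w).2 - (q v).2)^2) = (((q u).1 - (q v).1) * ((q w).1 - (q v).1) + ((q u).2 - (q v).2) * ((q w).2 - (q v).2))^2 + (D (q v) (q u) (q w))^2 := by unfold D; ring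
      rw [this, h0]; ring
    by_contra hc
    push Not at hc
    nlinarith

theorem nsq_pos (hq : Function.Injective q) {v u : W} (h : v ≠ u) : 0 < ((q u).1 - (q v).1)^2 + ((q u).2 - (q v).2)^2 := by
  by_contra hc
  have g1 : (q u).1 - (q v).1 = 0 := by nlinarith [sq_nonneg ((q u).1 - (q v).1), sq_nonneg ((q u).2 - (q v).2)]
  have g2 : (q u).2 - (q v).2 = 0 := by nlinarith [sq_nonneg ((q u).1 - (q v).1), sq_nonneg ((q u).2 - (q v).2)]
  exact h (hq (Prod.ext (by linarith) (by linarith)))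

theorem Tg.irr (ho : OutTri q o0 o1 o2) (hE : MaxPlane q E) (hq : Function.Injective q)
    (v : W) (S : Set W) (hS : ∃ u w, Tg q E o0 o1 o2 v u w ∧ u ∈ S)
    (hcl : ∀ u w, Tg q E o0 o1 o2 v u w → u ∈ S → w ∈ S) : ∀ u w, Tg q E o0 o1 o2 v u w → u ∈ S := by
  intro u0 w0 t0
  by_contra hu0
  have e0 : E v u0 := t0.edge ho hE
  have hn := nsq_pos hq (hE.ne e0)
  let dot : W → ℝ := fun z => ((q u0).1 - (q v).1) * ((q z).1 - (q v).1) + ((q u0).2 - (q v).2) * ((q z).2 - (q v).2)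
  have hid : ∀ z w, dot z * D (q v) (q u0) (q w) - dot w * D (q v) (q u0) (q z) = (((q u0).1 - (q v).1)^2 + ((q u0).2 - (q v).2)^2) * D (q v) (q z) (q w) := by
    intro z w; simp only [dot]; unfold D; ring
  have step : ∀ z, z ∈ S → E v z → ∃ w, Tg q E o0 o1 o2 v z w ∧ w ∈ S ∧ E v w := by
    intro z hz ez
    obtain ⟨w, tw⟩ := edge_T ho hE hq ez
    exact ⟨w, tw, hcl z w tw hz, hE.symm (tw.rot.rot.edge ho hE)⟩
  have zero : ∀ w, w ∈ S → E v w → D (q v) (q u0) (q w) = 0 → dot w < 0 := by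
    intro w hw ew h0
    by_contra hc
    push Not at hc
    rcases hc.lt_or_eq with k | k
    · have := same_ray hE hq e0 ew h0 k
      exact hu0 (this ▸ hw)
    · have : (((q u0).1 - (q v).1)^2 + ((q u0).2 - (q v).2)^2) * (((q w).1 - (q v).1)^2 + ((q w).2 - (q v).2)^2) = (dot w)^2 + (D (q v) (q u0) (q w))^2 := by simp only [dot]; unfold D; ring
      rw [h0, ← k] at this
      have := mul_pos hn (nsq_pos hq (hE.ne ew))
      linarith
  -- right elements
  have hR : ∀ z, z ∈ S → E v z → 0 ≤ D (q v) (q u0) (q z) := by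
    by_contra hcon
    push Not at hcon
    obtain ⟨z', hz'⟩ := hcon
    let R : Finset W := Finset.univ.filter (fun z => z ∈ S ∧ E v z ∧ D (q v) (q u0) (q z) < 0)
    obtain ⟨z, hz, hmax⟩ := R.exists_max_image (fun z => dot z / (- D (q v) (q u0) (q z))) ⟨z', by simp only [R, Finset.mem_filter, Finset.mem_univ, true_and]; exact hz'⟩
    simp only [R, Finset.mem_filter, Finset.mem_univ, true_and] at hz hmax
    obtain ⟨hzS, hzE, hzD⟩ := hz
    have hzu : 0 < D (q v) (q z) (q u0) := by rw [D_swap']; linarith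
    obtain ⟨w, tw, wS, we⟩ := step z hzS hzE
    rcases tw with tw | tw
    · rcases lt_trichotomy (D (q v) (q u0) (q w)) 0 with k | k | k
      · have h3 := hmax w ⟨wS, we, k⟩
        rw [div_le_div_iff₀ (by linarith) (by linarith)] at h3
        have := hid z w
        have := mul_pos hn tw.1
        linarith
      · have h4 := zero w wS we k
        have := hid z w
        rw [k] at this
        have := mul_pos hn tw.1
        nlinarith
      · exact tw.nop hE hq e0 hzu (by rw [D_rot2]; exact k)
    · have := ho.out_le tw u0
      linarith
  have hL : ∀ z, z ∈ S → E v z → 0 < D (q v) (q u0) (q z) := by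
    intro z hz ez
    rcases (hR z hz ez).lt_or_eq with k | k
    · exact k
    · exfalso
      obtain ⟨w, tw, wS, we⟩ := step z hz ez
      rcases tw with tw | tw
      · have h1 := zero z hz ez k.symm
        have h2 := hR w wS we
        have h3 := hid z w
        rw [← k] at h3
        have := mul_pos hn tw.1
        nlinarith
      · have := ho.out_neg tw (x := u0) (hE.ne e0).symm (by rintro rfl; exact hu0 hz)
        rw [D_swap', ← k] at this
        simp at this
  obtain ⟨u1, w1, t1, hu1⟩ := hS
  let R : Finset W := Finset.univ.filter (fun z => z ∈ S ∧ E v z)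
  obtain ⟨z, hz, hmin⟩ := R.exists_min_image (fun z => dot z / (D (q v) (q u0) (q z))) ⟨u1, by simp only [R, Finset.mem_filter, Finset.mem_univ, true_and]; exact ⟨hu1, t1.edge ho hE⟩⟩
  simp only [R, Finset.mem_filter, Finset.mem_univ, true_and] at hz hmin
  obtain ⟨hzS, hzE⟩ := hz
  obtain ⟨w, tw, wS, we⟩ := step z hzS hzE
  rcases tw with tw | tw
  · have h3 := hmin w ⟨wS, we⟩
    rw [div_le_div_iff₀ (hL z hzS hzE) (hL w wS we)] at h3
    have := hid z w
    have := mul_pos hn tw.1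
    linarith
  · have := ho.out_le tw.rot.rot u0
    have h2 := hL w wS we
    have : D (q w) (q v) (q u0) = D (q v) (q u0) (q w) := by unfold D; ring
    linarith
end geo
end ICR

namespace ICR
open Classical Filter Topology

section geo
variable {W : Type*} [Fintype W] {q : W → ℝ × ℝ} {E : W → W → Prop} {o0 o1 o2 : W}

theorem closed_has_out (ho : OutTri q o0 o1 o2) (hE : MaxPlane q E) (hq : Function.Injective q)
    (A : W → W → W → Prop) (hA : ∀ u v w, A u v w → Tg q E o0 o1 o2 u v w) (hne : ∃ u v w, A u v w)
    (hrot : ∀ u v w, A u v w → A v w u) (hpair : ∀ u v w z, A u v w → Tg q E o0 o1 o2 v u z → A v u z) :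
    A o0 o2 o1 := by
  let s : Finset (W × W × W) := Finset.univ.filter (fun t => A t.1 t.2.1 t.2.2)
  let c : W × W × W → ℝ := fun t => (q t.1).1 * (q t.2.1).2 - (q t.1).2 * (q t.2.1).1
  have hs : ∀ t, t ∈ s ↔ A t.1 t.2.1 t.2.2 := by intro t; simp [s]
  have ex : ∀ t ∈ s, ∃ z, A t.2.1 t.1 z := by
    intro t ht
    rw [hs] at ht
    obtain ⟨z, hz⟩ := edge_T ho hE hq (hE.symm ((hA _ _ _ ht).edge ho hE))
    exact ⟨z, hpair _ _ _ _ ht hz⟩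
  choose f hf using ex
  have h0 : ∑ t ∈ s, c t = 0 := by
    refine Finset.sum_involution (fun t ht => (t.2.1, t.1, f t ht)) ?_ ?_ ?_ ?_
    · intro t ht; simp only [c]; ring
    · intro t ht _ heq
      have h1 : t.2.1 = t.1 := congrArg Prod.fst heq
      exact hE.ne ((hA _ _ _ ((hs t).mp ht)).edge ho hE) h1.symm
    · intro t ht; rw [hs]; exact hf t ht
    · intro t ht
      have h1 := hA _ _ _ (hf (t.2.1, t.1, f t ht) ((hs _).mpr (hf t ht)))
      have h2 := hA _ _ _ ((hs t).mp ht)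
      have := Tg.uniq ho hE hq h1 h2
      simp only [this]
  have hrot1 : ∑ t ∈ s, c (t.2.1, t.2.2, t.1) = ∑ t ∈ s, c t := by
    refine Finset.sum_nbij' (fun t => (t.2.1, t.2.2, t.1)) (fun t => (t.2.2, t.1, t.2.1)) ?_ ?_ ?_ ?_ ?_
    · intro t ht; rw [hs] at *; exact hrot _ _ _ ht
    · intro t ht; rw [hs] at *; exact hrot _ _ _ (hrot _ _ _ ht)
    · intro t _; rfl
    · intro t _; rfl
    · intro t _; rfl
  have hrot2 : ∑ t ∈ s, c (t.2.2, t.1, t.2.1) = ∑ t ∈ s, c t := by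
    refine Finset.sum_nbij' (fun t => (t.2.2, t.1, t.2.1)) (fun t => (t.2.1, t.2.2, t.1)) ?_ ?_ ?_ ?_ ?_
    · intro t ht; rw [hs] at *; exact hrot _ _ _ (hrot _ _ _ ht)
    · intro t ht; rw [hs] at *; exact hrot _ _ _ ht
    · intro t _; rfl
    · intro t _; rfl
    · intro t _; rfl
  have hsum : ∑ t ∈ s, D (q t.1) (q t.2.1) (q t.2.2) = 0 := by
    have : ∀ t : W × W × W, D (q t.1) (q t.2.1) (q t.2.2) = c t + c (t.2.1, t.2.2, t.1) + c (t.2.2, t.1, t.2.1) := by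
      intro t; simp only [c]; unfold D; ring
    rw [Finset.sum_congr rfl (fun t _ => this t), Finset.sum_add_distrib, Finset.sum_add_distrib, hrot1, hrot2, h0]
    ring
  by_contra hno
  have hnone : ∀ u v w, A u v w → ¬ IsOut o0 o1 o2 u v w := by
    intro u v w h hi
    rcases hi with ⟨rfl, rfl, rfl⟩ | ⟨rfl, rfl, rfl⟩ | ⟨rfl, rfl, rfl⟩
    · exact hno h
    · exact hno (hrot _ _ _ (hrot _ _ _ h))
    · exact hno (hrot _ _ _ h)
  obtain ⟨u, v, w, h⟩ := hne
  have : 0 < ∑ t ∈ s, D (q t.1) (q t.2.1) (q t.2.2) := by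
    refine Finset.sum_pos ?_ ⟨(u, v, w), (hs _).mpr h⟩
    intro t ht
    rw [hs] at ht
    exact ((hA _ _ _ ht).resolve_right (hnone _ _ _ ht)).1
  linarith

theorem generic_lin (hq : Function.Injective q) : ∃ a b : ℝ, ∀ u v, lin a b (q u) = lin a b (q v) → u = v := by
  have : (⋃ x : W × W, {s : ℝ | x.1 ≠ x.2 ∧ lin 1 s (q x.1) = lin 1 s (q x.2)}).Finite := by
    refine Set.finite_iUnion (fun x => ?_)
    apply Set.Subsingleton.finite
    rintro s ⟨hs, e⟩ t ⟨_, e'⟩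
    unfold lin at e e'
    by_contra hst
    have : (s - t) * ((q x.1).2 - (q x.2).2) = 0 := by linarith
    have h2 := (mul_eq_zero.mp this).resolve_left (sub_ne_zero.mpr hst)
    refine hs (hq (Prod.ext ?_ (by linarith)))
    have : (q x.1).2 = (q x.2).2 := by linarith
    rw [this] at e; linarith
  obtain ⟨s, hs⟩ := this.infinite_compl.nonempty
  refine ⟨1, s, fun u v h => ?_⟩
  by_contra hne
  exact hs (Set.mem_iUnion.mpr ⟨(u, v), hne, h⟩)

theorem up_uniq (ho : OutTri q o0 o1 o2) (hE : MaxPlane q E) (hq : Function.Injective q) (a b : ℝ)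
    {v u w u' w' : W} (t : Tg q E o0 o1 o2 v u w) (t' : Tg q E o0 o1 o2 v u' w')
    (h1 : lin a b (q v) < lin a b (q u)) (h2 : lin a b (q w) < lin a b (q v))
    (h1' : lin a b (q v) < lin a b (q u')) (h2' : lin a b (q w') < lin a b (q v)) : u = u' := by
  have id1 : ∀ x y z : W, (lin a b (q x) - lin a b (q v)) * D (q v) (q y) (q z) + (lin a b (q y) - lin a b (q v)) * D (q v) (q z) (q x) + (lin a b (q z) - lin a b (q v)) * D (q v) (q x) (q y) = 0 := by
    intro x y z; unfold lin D; ring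
  have main : ∀ u w u' w', Tgeo q E v u w → Tgeo q E v u' w' → lin a b (q v) < lin a b (q u) → lin a b (q w) < lin a b (q v) →
      lin a b (q v) < lin a b (q u') → ¬ (0 < D (q v) (q u) (q u')) := by
    intro u w u' w' t t' h1 h2 h1' hD
    refine t.nop hE hq t'.2.1 hD ?_
    have i := id1 u u' w
    rw [D_rot2]
    have s1 : D (q v) (q w) (q u) = - D (q v) (q u) (q w) := D_swap' ..
    have p1 := t.1
    by_contra hc
    push Not at hc
    rw [s1] at i
    nlinarith [mul_pos (sub_pos.mpr h1') p1, mul_pos (sub_pos.mpr h2) hD, mul_nonneg (sub_pos.mpr h1).le (neg_nonneg.mpr hc)]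
  have mixed : ∀ u w u' w', IsOut o0 o1 o2 v u w → Tgeo q E v u' w' → lin a b (q v) < lin a b (q u) → lin a b (q w) < lin a b (q v) →
      lin a b (q v) < lin a b (q u') → lin a b (q w') < lin a b (q v) → False := by
    intro u w u' w' t t' h1 h2 h1' h2'
    have p1 := t'.1
    have n1 := ho.out_le t u'
    have n2 := ho.out_le t w'
    have n3 := ho.out_le t.rot.rot u'
    have n4 := ho.out_le t.rot.rot w'
    rw [D_rot2] at n3 n4
    -- D v w' w ≤ 0, D v u' w ≤ 0
    have i1 := id1 u u' w'
    have i2 := id1 w u' w'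
    have s1 : D (q v) (q w') (q u) = - D (q v) (q u) (q w') := D_swap' ..
    have s2 : D (q v) (q w) (q u') = - D (q v) (q u') (q w) := D_swap' ..
    rw [s1] at i1
    nlinarith [mul_pos (sub_pos.mpr h1) p1, mul_pos (sub_pos.mpr h2) p1, mul_nonneg (sub_pos.mpr h1').le (neg_nonneg.mpr n2), mul_nonneg (sub_pos.mpr h2').le (neg_nonneg.mpr n1), mul_nonneg (sub_pos.mpr h1').le (neg_nonneg.mpr n4), mul_nonneg (sub_pos.mpr h2').le (neg_nonneg.mpr n3)]
  rcases t with t | t <;> rcases t' with t' | t'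
  · have k1 := main u w u' w' t t' h1 h2 h1'
    have k2 := main u' w' u w t' t h1' h2' h1
    have s : D (q v) (q u') (q u) = - D (q v) (q u) (q u') := D_swap' ..
    have k0 : D (q v) (q u) (q u') = 0 := by linarith
    refine same_ray hE hq t.2.1 t'.2.1 k0 ?_
    by_contra hc
    push Not at hc
    -- opposite or zero: contradiction with both up
    have hn := nsq_pos hq (hE.ne t.2.1)
    have id2 : (((q u).1 - (q v).1)^2 + ((q u).2 - (q v).2)^2) * (lin a b (q u') - lin a b (q v)) = (((q u).1 - (q v).1) * ((q u').1 - (q v).1) + ((q u).2 - (q v).2) * ((q u').2 - (q v).2)) * (lin a b (q u) - lin a b (q v)) + D (q v) (q u) (q u') * (b * ((q u).1 - (q v).1) - a * ((q u).2 - (q v).2)) := by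
      unfold lin D; ring
    rw [k0] at id2
    nlinarith [mul_pos hn (sub_pos.mpr h1'), mul_nonneg (neg_nonneg.mpr hc) (sub_pos.mpr h1).le]
  · exact (mixed u' w' u w t' t h1' h2' h1 h2).elim
  · exact (mixed u w u' w' t t' h1 h2 h1' h2').elim
  · have n01 := ho.ne01
    have n12 := ho.rot.ne01
    have n20 := ho.rot.rot.ne01
    unfold IsOut at t t'; grind

theorem Tg.count (ho : OutTri q o0 o1 o2) (hE : MaxPlane q E) (hq : Function.Injective q) :
    Set.ncard {t : W × W × W | Tg q E o0 o1 o2 t.1 t.2.1 t.2.2} + 12 ≤ 6 * Fintype.card W := by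
  obtain ⟨a, b, hab⟩ := generic_lin hq
  let f : W → ℝ := fun w => lin a b (q w)
  have hf : Function.Injective f := hab
  let M : Finset W := Finset.univ.filter (fun v => (∃ u, f u < f v) ∧ ∃ u, f v < f u)
  have hM : M.card + 2 ≤ Fintype.card W := by
    obtain ⟨x, -, hx⟩ := Finset.univ.exists_min_image f ⟨o0, Finset.mem_univ o0⟩
    obtain ⟨y, -, hy⟩ := Finset.univ.exists_max_image f ⟨o0, Finset.mem_univ o0⟩
    have hxy : x ≠ y := by
      rintro rfl
      have h0 : f o0 = f x := le_antisymm (hy o0 (Finset.mem_univ _)) (hx o0 (Finset.mem_univ _))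
      have h1 : f o1 = f x := le_antisymm (hy o1 (Finset.mem_univ _)) (hx o1 (Finset.mem_univ _))
      exact ho.ne01 (hf (h0.trans h1.symm))
    have hsub : M ⊆ Finset.univ \ {x, y} := by
      intro v hv
      simp only [M, Finset.mem_filter, Finset.mem_univ, true_and] at hv
      simp only [Finset.mem_sdiff, Finset.mem_univ, true_and, Finset.mem_insert, Finset.mem_singleton, not_or]
      obtain ⟨⟨u, hu⟩, w, hw⟩ := hv
      constructor
      · rintro rfl; have := hx u (Finset.mem_univ _); linarith
      · rintro rfl; have := hy w (Finset.mem_univ _); linarith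
    have := Finset.card_le_card hsub
    have h2 : ({x, y} : Finset W).card = 2 := Finset.card_pair hxy
    rw [Finset.card_sdiff_of_subset (Finset.subset_univ _), h2] at this
    have : 2 ≤ Fintype.card W := by
      rw [← h2]; exact Finset.card_le_univ _
    simp at *
    omega
  have up : ∀ {v u w u' w'}, Tg q E o0 o1 o2 v u w → Tg q E o0 o1 o2 v u' w' → f v < f u → f w < f v → f v < f u' → f w' < f v → u = u' ∧ w = w' := by
    intro v u w u' w' t t' h1 h2 h3 h4
    have := up_uniq ho hE hq a b t t' h1 h2 h3 h4
    subst this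
    exact ⟨rfl, Tg.uniq ho hE hq t t'⟩
  have hneg : ∀ x, lin (-a) (-b) x = - lin a b x := by intro x; unfold lin; ring
  have dn : ∀ {v u w u' w'}, Tg q E o0 o1 o2 v u w → Tg q E o0 o1 o2 v u' w' → f u < f v → f v < f w → f u' < f v → f v < f w' → u = u' ∧ w = w' := by
    intro v u w u' w' t t' h1 h2 h3 h4
    have := up_uniq ho hE hq (-a) (-b) t t' (by rw [hneg, hneg]; simpa using h1) (by rw [hneg, hneg]; simpa using h2) (by rw [hneg, hneg]; simpa using h3) (by rw [hneg, hneg]; simpa using h4)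
    subst this
    exact ⟨rfl, Tg.uniq ho hE hq t t'⟩
  have bound : ∀ (B : Set (W × W × W)) (m : W × W × W → W), (∀ t ∈ B, m t ∈ M) → Set.InjOn m B → B.ncard ≤ M.card := by
    intro B m h1 h2
    rw [← Set.ncard_coe_finset]
    exact Set.ncard_le_ncard_of_injOn m h1 h2
  let P : (W × W × W) → Prop := fun t => Tg q E o0 o1 o2 t.1 t.2.1 t.2.2
  let U : Set (W × W × W) := {t | P t ∧ f t.1 < f t.2.1 ∧ f t.2.2 < f t.1}
  let U1 : Set (W × W × W) := {t | P t ∧ f t.2.1 < f t.2.2 ∧ f t.1 < f t.2.1}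
  let U2 : Set (W × W × W) := {t | P t ∧ f t.2.2 < f t.1 ∧ f t.2.1 < f t.2.2}
  let D0 : Set (W × W × W) := {t | P t ∧ f t.2.1 < f t.1 ∧ f t.1 < f t.2.2}
  let D1 : Set (W × W × W) := {t | P t ∧ f t.2.2 < f t.2.1 ∧ f t.2.1 < f t.1}
  let D2 : Set (W × W × W) := {t | P t ∧ f t.1 < f t.2.2 ∧ f t.2.2 < f t.2.1}
  have hMm : ∀ u v w, f u < f v → f v < f w → v ∈ M := by
    intro u v w h1 h2; simp only [M, Finset.mem_filter, Finset.mem_univ, true_and]; exact ⟨⟨u, h1⟩, w, h2⟩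
  have cU : U.ncard ≤ M.card := bound U (fun t => t.1) (fun t ht => hMm _ _ _ ht.2.2 ht.2.1) (by
    rintro ⟨v, u, w⟩ ⟨h1, h2, h3⟩ ⟨v', u', w'⟩ ⟨h1', h2', h3'⟩ (rfl : v = v')
    obtain ⟨rfl, rfl⟩ := up h1 h1' h2 h3 h2' h3'; rfl)
  have cU1 : U1.ncard ≤ M.card := bound U1 (fun t => t.2.1) (fun t ht => hMm _ _ _ ht.2.2 ht.2.1) (by
    rintro ⟨w, v, u⟩ ⟨h1, h2, h3⟩ ⟨w', v', u'⟩ ⟨h1', h2', h3'⟩ (rfl : v = v')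
    obtain ⟨rfl, rfl⟩ := up h1.rot h1'.rot h2 h3 h2' h3'; rfl)
  have cU2 : U2.ncard ≤ M.card := bound U2 (fun t => t.2.2) (fun t ht => hMm _ _ _ ht.2.2 ht.2.1) (by
    rintro ⟨u, w, v⟩ ⟨h1, h2, h3⟩ ⟨u', w', v'⟩ ⟨h1', h2', h3'⟩ (rfl : v = v')
    obtain ⟨rfl, rfl⟩ := up h1.rot.rot h1'.rot.rot h2 h3 h2' h3'; rfl)
  have cD0 : D0.ncard ≤ M.card := bound D0 (fun t => t.1) (fun t ht => hMm _ _ _ ht.2.1 ht.2.2) (by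
    rintro ⟨v, u, w⟩ ⟨h1, h2, h3⟩ ⟨v', u', w'⟩ ⟨h1', h2', h3'⟩ (rfl : v = v')
    obtain ⟨rfl, rfl⟩ := dn h1 h1' h2 h3 h2' h3'; rfl)
  have cD1 : D1.ncard ≤ M.card := bound D1 (fun t => t.2.1) (fun t ht => hMm _ _ _ ht.2.1 ht.2.2) (by
    rintro ⟨w, v, u⟩ ⟨h1, h2, h3⟩ ⟨w', v', u'⟩ ⟨h1', h2', h3'⟩ (rfl : v = v')
    obtain ⟨rfl, rfl⟩ := dn h1.rot h1'.rot h2 h3 h2' h3'; rfl)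
  have cD2 : D2.ncard ≤ M.card := bound D2 (fun t => t.2.2) (fun t ht => hMm _ _ _ ht.2.1 ht.2.2) (by
    rintro ⟨u, w, v⟩ ⟨h1, h2, h3⟩ ⟨u', w', v'⟩ ⟨h1', h2', h3'⟩ (rfl : v = v')
    obtain ⟨rfl, rfl⟩ := dn h1.rot.rot h1'.rot.rot h2 h3 h2' h3'; rfl)
  have hsub : {t : W × W × W | Tg q E o0 o1 o2 t.1 t.2.1 t.2.2} ⊆ U ∪ (U1 ∪ (U2 ∪ (D0 ∪ (D1 ∪ D2)))) := by
    intro t ht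
    have e1 : f t.1 ≠ f t.2.1 := fun h => hE.ne (Tg.edge ho hE ht) (hf h)
    have e2 : f t.2.1 ≠ f t.2.2 := fun h => hE.ne (Tg.edge ho hE ht.rot) (hf h)
    have e3 : f t.2.2 ≠ f t.1 := fun h => hE.ne (Tg.edge ho hE ht.rot.rot) (hf h)
    have hP : P t := ht
    simp only [U, U1, U2, D0, D1, D2, Set.mem_union, Set.mem_setOf_eq, hP, true_and]
    rcases lt_or_gt_of_ne e1 with k1 | k1 <;> rcases lt_or_gt_of_ne e2 with k2 | k2 <;> rcases lt_or_gt_of_ne e3 with k3 | k3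
    · linarith
    all_goals first | tauto | (exfalso; linarith)
  have h := Set.ncard_le_ncard hsub (Set.toFinite _)
  have g1 := Set.ncard_union_le U (U1 ∪ (U2 ∪ (D0 ∪ (D1 ∪ D2))))
  have g2 := Set.ncard_union_le U1 (U2 ∪ (D0 ∪ (D1 ∪ D2)))
  have g3 := Set.ncard_union_le U2 (D0 ∪ (D1 ∪ D2))
  have g4 := Set.ncard_union_le D0 (D1 ∪ D2)
  have g5 := Set.ncard_union_le D1 D2
  omega

theorem sphere_geo (ho : OutTri q o0 o1 o2) (hE : MaxPlane q E) (hq : Function.Injective q) :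
    Sphere (Tg q E o0 o1 o2) where
  rot := Tg.rot
  ne := fun h => hE.ne (h.edge ho hE)
  uniq := Tg.uniq ho hE hq
  pair := fun h => edge_T ho hE hq (hE.symm (h.edge ho hE))
  irr := Tg.irr ho hE hq
  dual := by
    intro A hA hne hrot hpair u v w t
    by_contra hno
    have h1 := closed_has_out ho hE hq A hA hne hrot hpair
    have h2 := closed_has_out ho hE hq (fun u v w => Tg q E o0 o1 o2 u v w ∧ ¬ A u v w) (fun _ _ _ h => h.1) ⟨u, v, w, t, hno⟩
      (fun u v w h => ⟨h.1.rot, fun h' => h.2 (hrot _ _ _ (hrot _ _ _ h'))⟩)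
      (fun u v w z h h' => ⟨h', fun h'' => h.2 (hpair _ _ _ _ h'' h.1)⟩)
    exact h2.2 h1
  vtx := by
    intro v
    obtain ⟨z, hz⟩ : ∃ z, v ≠ z := by
      by_cases h : v = o0
      · exact ⟨o1, h ▸ ho.ne01⟩
      · exact ⟨o0, h⟩
    have hn := nsq_pos hq hz
    obtain ⟨u, hu, -⟩ := vis hE hq v z (lin ((q z).1 - (q v).1) ((q z).2 - (q v).2)) (lin_aff _ _) (by unfold lin; nlinarith)
    obtain ⟨w, hw⟩ := edge_T ho hE hq hu
    exact ⟨u, w, hw⟩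
  count := Tg.count ho hE hq
end geo
end ICR

namespace ICR
open Classical Filter Topology

def R3 {α : Type*} (x y z a b c : α) : Prop := (a = x ∧ b = y ∧ c = z) ∨ (a = y ∧ b = z ∧ c = x) ∨ (a = z ∧ b = x ∧ c = y)

theorem R3.rot {α : Type*} {x y z a b c : α} (h : R3 x y z a b c) : R3 x y z b c a := by unfold R3 at *; tauto

theorem f4a (i : Fin 4) : i + 3 + 1 = i := by revert i; decide
theorem f4b (i : Fin 4) : i + 1 + 3 = i := by revert i; decide
theorem f4c (i : Fin 4) : i + 2 + 2 = i := by revert i; decide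
theorem f4d (i : Fin 4) : i + 1 + 1 = i + 2 := by revert i; decide
theorem f4e (i : Fin 4) : i + 2 + 1 = i + 3 := by revert i; decide
theorem f4f (i : Fin 4) : i + 1 + 2 = i + 3 := by revert i; decide
theorem f4g (i : Fin 4) : i + 3 + 2 = i + 1 := by revert i; decide
theorem f4h (i : Fin 4) : i + 3 + 3 = i + 2 := by revert i; decide
theorem f4n1 (i : Fin 4) : i + 1 ≠ i := by revert i; decide
theorem f4n2 (i : Fin 4) : i + 2 ≠ i := by revert i; decide
theorem f4n3 (i : Fin 4) : i + 3 ≠ i := by revert i; decide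

section surg
variable {N K : Type*} [Fintype N] [Fintype K] {T : N ⊕ K → N ⊕ K → N ⊕ K → Prop} {sp : K → Fin 4 → N}
  {sec : K → N ⊕ K → Fin 4}

structure KD (T : N ⊕ K → N ⊕ K → N ⊕ K → Prop) (sp : K → Fin 4 → N) (sec : K → N ⊕ K → Fin 4) : Prop where
  sph : Sphere T
  adj : ∀ k i, ∃ w, T (Sum.inr k) (Sum.inl (sp k i)) w
  sec_sp : ∀ k i, sec k (Sum.inl (sp k i)) = i
  nxt : ∀ k u w, T (Sum.inr k) u w → w = Sum.inl (sp k (sec k u + 1)) ∨ (sec k w = sec k u ∧ ∀ i, w ≠ Sum.inl (sp k i))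
  non : ∀ k i l w, ¬ T (Sum.inl (sp k i)) (Sum.inl (sp k l)) w
  inj : ∀ k i k' i', sp k i = sp k' i' → k = k' ∧ i = i'

def lam (sec : K → N ⊕ K → Fin 4) : N ⊕ K → N ⊕ K → N ⊕ (K × Fin 4)
  | Sum.inl n, _ => Sum.inl n
  | Sum.inr k, v => Sum.inr (k, sec k v)

def T1 (T : N ⊕ K → N ⊕ K → N ⊕ K → Prop) (sec : K → N ⊕ K → Fin 4) (a b c : N ⊕ (K × Fin 4)) : Prop :=
  ∃ u v w, T u v w ∧ a = lam sec u v ∧ b = lam sec v w ∧ c = lam sec w u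

def T2 (sp : K → Fin 4 → N) (k : K) (i : Fin 4) (a b c : N ⊕ (K × Fin 4)) : Prop :=
  R3 (Sum.inr (k, i)) (Sum.inl (sp k (i+1))) (Sum.inl (sp k i)) a b c

def T3 (sp : K → Fin 4 → N) (k : K) (i : Fin 4) (a b c : N ⊕ (K × Fin 4)) : Prop :=
  R3 (Sum.inl (sp k i)) (Sum.inl (sp k (i+1))) (Sum.inl (sp k (i+2))) a b c

def TS (T : N ⊕ K → N ⊕ K → N ⊕ K → Prop) (sp : K → Fin 4 → N) (sec : K → N ⊕ K → Fin 4) (j : K → Fin 4)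
    (a b c : N ⊕ (K × Fin 4)) : Prop :=
  T1 T sec a b c ∨ (∃ k i, T2 sp k i a b c) ∨ ∃ k i, (i = j k ∨ i = j k + 2) ∧ T3 sp k i a b c

theorem TS.i1 {j : K → Fin 4} {u v w} (t : T u v w) : TS T sp sec j (lam sec u v) (lam sec v w) (lam sec w u) :=
  Or.inl ⟨u, v, w, t, rfl, rfl, rfl⟩
theorem TS.i2 {j : K → Fin 4} (k : K) (i : Fin 4) : TS T sp sec j (Sum.inr (k, i)) (Sum.inl (sp k (i+1))) (Sum.inl (sp k i)) :=
  Or.inr (Or.inl ⟨k, i, Or.inl ⟨rfl, rfl, rfl⟩⟩)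
theorem TS.i3 {j : K → Fin 4} (k : K) (i : Fin 4) (h : i = j k ∨ i = j k + 2) : TS T sp sec j (Sum.inl (sp k i)) (Sum.inl (sp k (i+1))) (Sum.inl (sp k (i+2))) :=
  Or.inr (Or.inr ⟨k, i, h, Or.inl ⟨rfl, rfl, rfl⟩⟩)

theorem T1.rot (h : KD T sp sec) {a b c} (t : T1 T sec a b c) : T1 T sec b c a := by
  obtain ⟨u, v, w, t, h1, h2, h3⟩ := t
  exact ⟨v, w, u, h.sph.rot t, h2, h3, h1⟩

theorem TS.rot (h : KD T sp sec) {j : K → Fin 4} {a b c} (t : TS T sp sec j a b c) : TS T sp sec j b c a := by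
  rcases t with t | ⟨k, i, t⟩ | ⟨k, i, hi, t⟩
  · exact Or.inl (t.rot h)
  · exact Or.inr (Or.inl ⟨k, i, R3.rot t⟩)
  · exact Or.inr (Or.inr ⟨k, i, hi, R3.rot t⟩)

/-- the diagonal alternatives seen at corner `i` -/
theorem diag_cases (j i : Fin 4) : (i = j ∨ i = j + 2) ∨ (i + 3 = j ∨ i + 3 = j + 2) := by
  revert i j; decide
theorem diag_not (j i : Fin 4) : (i = j ∨ i = j + 2) → ¬ (i + 3 = j ∨ i + 3 = j + 2) := by
  revert i j; decide
theorem diag_two (j i : Fin 4) : (i = j ∨ i = j + 2) → (i + 2 = j ∨ i + 2 = j + 2) := by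
  revert i j; decide

theorem KD.nxt_sp (h : KD T sp sec) {k u i} (t : T (Sum.inr k) u (Sum.inl (sp k i))) : sec k u = i + 3 := by
  rcases h.nxt k u _ t with e | ⟨_, e⟩
  · have := (h.inj _ _ _ _ (Sum.inl_injective e)).2
    rw [this, f4b]
  · exact absurd rfl (e i)

theorem KD.prev_sp (h : KD T sp sec) (k i) : ∃ u, T (Sum.inr k) u (Sum.inl (sp k i)) ∧ sec k u = i + 3 := by
  obtain ⟨w, t⟩ := h.adj k i
  obtain ⟨u, hu⟩ := h.sph.prev t
  exact ⟨u, hu, h.nxt_sp hu⟩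

theorem KD.lam_eq (h : KD T sp sec) {v w n} (t : T v w n) (hn : ∀ k i, v = Sum.inr k → n ≠ Sum.inl (sp k i)) :
    lam sec v w = lam sec v n := by
  rcases v with v | k
  · rfl
  · rcases h.nxt k w n t with e | ⟨e, _⟩
    · exact absurd e (hn k _ rfl)
    · simp only [lam, e]

theorem KD.lam_eq_inr (h : KD T sp sec) {v w k} (t : T v w (Sum.inr k)) : lam sec v w = lam sec v (Sum.inr k) :=
  h.lam_eq t (by simp)

theorem KD.lam_sp (h : KD T sp sec) (k i) : lam sec (Sum.inr k) (Sum.inl (sp k i)) = Sum.inr (k, i) := by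
  simp only [lam, h.sec_sp]

theorem lam_fst {u u' v v' : N ⊕ K} (h : lam sec u v = lam sec u' v') : u = u' := by
  rcases u with u | u <;> rcases u' with u' | u' <;> simp [lam] at h ⊢
  · exact h
  · exact h.1

theorem lam_inl {u v : N ⊕ K} {n : N} (h : lam sec u v = Sum.inl n) : u = Sum.inl n := by
  rcases u with u | u <;> simp [lam] at h ⊢
  exact h
theorem lam_inr {u v : N ⊕ K} {k : K} {i : Fin 4} (h : lam sec u v = Sum.inr (k, i)) : u = Sum.inr k ∧ sec k v = i := by
  rcases u with u | u <;> simp [lam] at h ⊢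
  obtain ⟨rfl, h⟩ := h
  exact ⟨rfl, h⟩

/-- kind-one triples determine the third vertex, and never use an edge of the other kinds -/
theorem T1.uniq (h : KD T sp sec) {a b c c'} (t : T1 T sec a b c) (t' : T1 T sec a b c') : c = c' := by
  obtain ⟨u, v, w, t, h1, h2, h3⟩ := t
  obtain ⟨u', v', w', t', h1', h2', h3'⟩ := t'
  have := lam_fst (h1.symm.trans h1')
  subst this
  have := lam_fst (h2.symm.trans h2')
  subst this
  have := h.sph.uniq t t'
  subst this
  rw [h3, h3']

theorem T1.not_ysp (h : KD T sp sec) {k i c} (t : T1 T sec (Sum.inr (k,i)) (Sum.inl (sp k (i+1))) c) : False := by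
  obtain ⟨u, v, w, t, h1, h2, h3⟩ := t
  obtain ⟨rfl, e⟩ := lam_inr h1.symm
  have := lam_inl h2.symm
  subst this
  rw [h.sec_sp] at e
  exact f4n1 _ e

theorem T1.not_spy (h : KD T sp sec) {k i c} (t : T1 T sec (Sum.inl (sp k i)) (Sum.inr (k,i)) c) : False := by
  obtain ⟨u, v, w, t, h1, h2, h3⟩ := t
  have := lam_inl h1.symm
  subst this
  obtain ⟨rfl, e⟩ := lam_inr h2.symm
  have := h.nxt_sp (h.sph.rot t)
  rw [e] at this
  exact f4n3 _ this.symm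

theorem T1.not_spsp (h : KD T sp sec) {k i l c} (t : T1 T sec (Sum.inl (sp k i)) (Sum.inl (sp k l)) c) : False := by
  obtain ⟨u, v, w, t, h1, h2, h3⟩ := t
  have := lam_inl h1.symm
  subst this
  have := lam_inl h2.symm
  subst this
  exact h.non _ _ _ _ t

theorem T1.not_T2 (h : KD T sp sec) {k i a b c c'} (t : T1 T sec a b c) (t' : T2 sp k i a b c') : False := by
  rcases t' with ⟨rfl, rfl, rfl⟩ | ⟨rfl, rfl, rfl⟩ | ⟨rfl, rfl, rfl⟩
  · exact t.not_ysp h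
  · exact t.not_spsp h
  · exact t.not_spy h

theorem T1.not_T3 (h : KD T sp sec) {k i a b c c'} (t : T1 T sec a b c) (t' : T3 sp k i a b c') : False := by
  rcases t' with ⟨rfl, rfl, rfl⟩ | ⟨rfl, rfl, rfl⟩ | ⟨rfl, rfl, rfl⟩ <;> exact t.not_spsp h

theorem f4n12 (i : Fin 4) : i + 1 ≠ i + 2 := by revert i; decide
theorem f4n13 (i : Fin 4) : i + 1 ≠ i + 3 := by revert i; decide

theorem T2.uniq (h : KD T sp sec) {k i k' i' a b c c'} (t : T2 sp k i a b c) (t' : T2 sp k' i' a b c') : c = c' := by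
  have hi := h.inj
  have h1 := f4n1
  have h2 := f4n2
  have h3 := f4d
  unfold T2 R3 at *
  grind

theorem f4k {a b : Fin 4} (h1 : b = a + 1) (h2 : a = b + 1) : False := by revert a b; decide
theorem f4k2 {a b : Fin 4} (h1 : b = a + 1) (h2 : a = b + 2) : False := by revert a b; decide

theorem T2.not_T3 (h : KD T sp sec) {k i k' i' a b c c'} (t : T2 sp k i a b c) (t' : T3 sp k' i' a b c') : False := by
  rcases t with ⟨rfl, rfl, rfl⟩ | ⟨rfl, rfl, rfl⟩ | ⟨rfl, rfl, rfl⟩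
  · rcases t' with ⟨e, _⟩ | ⟨e, _⟩ | ⟨e, _⟩ <;> cases e
  · rcases t' with ⟨e, e', rfl⟩ | ⟨e, e', rfl⟩ | ⟨e, e', rfl⟩
    all_goals
      obtain ⟨rfl, g⟩ := h.inj _ _ _ _ (Sum.inl_injective e)
      obtain ⟨-, g'⟩ := h.inj _ _ _ _ (Sum.inl_injective e')
      clear e e' 
      revert g g' i i'; decide
  · rcases t' with ⟨_, e, _⟩ | ⟨_, e, _⟩ | ⟨_, e, _⟩ <;> cases e

theorem T3.uniq (h : KD T sp sec) {j : K → Fin 4} {k i k' i' a b c c'} (t : T3 sp k i a b c) (t' : T3 sp k' i' a b c')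
    (hi : i = j k ∨ i = j k + 2) (hi' : i' = j k' ∨ i' = j k' + 2) : c = c' := by
  rcases t with ⟨rfl, rfl, rfl⟩ | ⟨rfl, rfl, rfl⟩ | ⟨rfl, rfl, rfl⟩
  all_goals
    rcases t' with ⟨e, e', rfl⟩ | ⟨e, e', rfl⟩ | ⟨e, e', rfl⟩
    all_goals
      obtain ⟨rfl, g⟩ := h.inj _ _ _ _ (Sum.inl_injective e)
      obtain ⟨-, g'⟩ := h.inj _ _ _ _ (Sum.inl_injective e')
      clear e e'
      congr 2
      generalize j k = jj at hi hi'
      revert g g' hi hi' i i' jj; decide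

theorem TS.uniq (h : KD T sp sec) {j : K → Fin 4} {a b c c'} (t : TS T sp sec j a b c) (t' : TS T sp sec j a b c') : c = c' := by
  rcases t with t | ⟨k, i, t⟩ | ⟨k, i, hi, t⟩ <;> rcases t' with t' | ⟨k', i', t'⟩ | ⟨k', i', hi', t'⟩
  · exact t.uniq h t'
  · exact (t.not_T2 h t').elim
  · exact (t.not_T3 h t').elim
  · exact (t'.not_T2 h t).elim
  · exact t.uniq h t'
  · exact (t.not_T3 h t').elim
  · exact (t'.not_T3 h t).elim
  · exact (t'.not_T3 h t).elim
  · exact t.uniq h t' hi hi'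

theorem TS.pair1 (h : KD T sp sec) {j : K → Fin 4} {u v w} (t : T u v w) : ∃ z, TS T sp sec j (lam sec v w) (lam sec u v) z := by
  obtain ⟨z, tz⟩ := h.sph.pair t
  -- T v u z
  by_cases hu : ∃ k i, u = Sum.inr k ∧ v = Sum.inl (sp k i)
  · obtain ⟨k, i, rfl, rfl⟩ := hu
    rw [h.lam_sp]
    exact ⟨_, (TS.i2 k i).rot h |>.rot h⟩
  by_cases hv : ∃ k i, v = Sum.inr k ∧ u = Sum.inl (sp k i)
  · obtain ⟨k, i, rfl, rfl⟩ := hv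
    have := h.nxt_sp (h.sph.rot t)
    have e : lam sec (Sum.inr k) w = Sum.inr (k, i+3) := by simp only [lam, this]
    rw [e]
    have := TS.i2 (T := T) (sp := sp) (sec := sec) (j := j) k (i+3)
    rw [f4a] at this
    exact ⟨_, this⟩
  refine ⟨lam sec z v, ?_⟩
  have e1 : lam sec v w = lam sec v u := h.lam_eq (h.sph.rot t) (by rintro k i rfl rfl; exact hv ⟨k, i, rfl, rfl⟩)
  have e2 : lam sec u z = lam sec u v := h.lam_eq (h.sph.rot tz) (by rintro k i rfl rfl; exact hu ⟨k, i, rfl, rfl⟩)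
  rw [e1, ← e2]
  exact TS.i1 tz

theorem TS.side (h : KD T sp sec) {j : K → Fin 4} (k i) : ∃ z, TS T sp sec j (Sum.inl (sp k i)) (Sum.inl (sp k (i+1))) z := by
  rcases diag_cases (j k) i with hi | hi
  · exact ⟨_, TS.i3 k i hi⟩
  · have := (TS.i3 (T := T) (sp := sp) (sec := sec) (j := j) k (i+3) hi).rot h
    rw [f4a, f4g] at this
    exact ⟨_, this⟩

theorem TS.pair (h : KD T sp sec) {j : K → Fin 4} {a b c} (t : TS T sp sec j a b c) : ∃ z, TS T sp sec j b a z := by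
  rcases t with ⟨u, v, w, t, rfl, rfl, rfl⟩ | ⟨k, i, t⟩ | ⟨k, i, hi, t⟩
  · exact TS.pair1 h t
  · rcases t with ⟨rfl, rfl, rfl⟩ | ⟨rfl, rfl, rfl⟩ | ⟨rfl, rfl, rfl⟩
    · obtain ⟨u, hu, e⟩ := h.prev_sp k (i+1)
      rw [f4b] at e
      have := TS.i1 (sp := sp) (sec := sec) (j := j) (h.sph.rot2 hu)
      have e2 : lam sec (Sum.inr k) u = Sum.inr (k, i) := by simp only [lam, e]
      rw [e2] at this
      exact ⟨_, this⟩
    · exact TS.side h k i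
    · obtain ⟨w, hw⟩ := h.adj k i
      have := TS.i1 (sp := sp) (sec := sec) (j := j) hw
      rw [h.lam_sp] at this
      exact ⟨_, this⟩
  · rcases t with ⟨rfl, rfl, rfl⟩ | ⟨rfl, rfl, rfl⟩ | ⟨rfl, rfl, rfl⟩
    · exact ⟨_, (TS.i2 k i).rot h⟩
    · have := (TS.i2 (T := T) (sp := sp) (sec := sec) (j := j) k (i+1)).rot h
      rw [f4d] at this
      exact ⟨_, this⟩
    · have := ((TS.i3 (T := T) (sp := sp) (sec := sec) (j := j) k (i+2) (diag_two _ _ hi)).rot h).rot h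
      rw [f4c] at this
      exact ⟨_, this⟩

theorem TS.ne (h : KD T sp sec) {j : K → Fin 4} {a b c} (t : TS T sp sec j a b c) : a ≠ b := by
  rcases t with ⟨u, v, w, t, rfl, rfl, rfl⟩ | ⟨k, i, t⟩ | ⟨k, i, hi, t⟩
  · intro e; exact h.sph.ne t (lam_fst e)
  · rcases t with ⟨rfl, rfl, rfl⟩ | ⟨rfl, rfl, rfl⟩ | ⟨rfl, rfl, rfl⟩ <;> intro e
    · cases e
    · exact f4n1 _ (h.inj _ _ _ _ (Sum.inl_injective e)).2
    · cases e
  · rcases t with ⟨rfl, rfl, rfl⟩ | ⟨rfl, rfl, rfl⟩ | ⟨rfl, rfl, rfl⟩ <;> intro e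
    · exact f4n1 _ (h.inj _ _ _ _ (Sum.inl_injective e)).2.symm
    · exact f4n12 _ (h.inj _ _ _ _ (Sum.inl_injective e)).2
    · exact f4n2 _ (h.inj _ _ _ _ (Sum.inl_injective e)).2
end surg
end ICR

namespace ICR
open Classical Filter Topology
section surg2
variable {N K : Type*} [Fintype N] [Fintype K] {T : N ⊕ K → N ⊕ K → N ⊕ K → Prop} {sp : K → Fin 4 → N}
  {sec : K → N ⊕ K → Fin 4} {j : K → Fin 4}

theorem TS.i3' (h : KD T sp sec) (k i) : (i = j k ∨ i = j k + 2) →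
    TS T sp sec j (Sum.inl (sp k i)) (Sum.inl (sp k (i+2))) (Sum.inl (sp k (i+3))) := by
  intro hi
  have := ((TS.i3 (T := T) (sp := sp) (sec := sec) (j := j) k (i+2) (diag_two _ _ hi)).rot h).rot h
  rwa [f4c, f4e] at this

theorem TS.i3'' (h : KD T sp sec) (k i) : (i + 3 = j k ∨ i + 3 = j k + 2) →
    TS T sp sec j (Sum.inl (sp k i)) (Sum.inl (sp k (i+1))) (Sum.inl (sp k (i+3))) := by
  intro hi
  have := (TS.i3 (T := T) (sp := sp) (sec := sec) (j := j) k (i+3) hi).rot h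
  rwa [f4a, f4g] at this

theorem TS.i2' (h : KD T sp sec) (k i) : TS T sp sec j (Sum.inl (sp k i)) (Sum.inl (sp k (i+3))) (Sum.inr (k, i+3)) := by
  have := (TS.i2 (T := T) (sp := sp) (sec := sec) (j := j) k (i+3)).rot h
  rwa [f4a] at this

theorem TS.i2'' (h : KD T sp sec) (k i) : TS T sp sec j (Sum.inl (sp k i)) (Sum.inr (k, i)) (Sum.inl (sp k (i+1))) :=
  ((TS.i2 (T := T) (sp := sp) (sec := sec) (j := j) k i).rot h).rot h

theorem chain1 (h : KD T sp sec) {k i} {S : Set (N ⊕ K × Fin 4)}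
    (hS : ∀ u w, TS T sp sec j (Sum.inl (sp k i)) u w → u ∈ S → w ∈ S) :
    (Sum.inr (k, i) ∈ S → Sum.inl (sp k (i+1)) ∈ S) ∧ (Sum.inl (sp k (i+1)) ∈ S → Sum.inl (sp k (i+3)) ∈ S) ∧
    ((i = j k ∨ i = j k + 2) → Sum.inl (sp k (i+1)) ∈ S → Sum.inl (sp k (i+2)) ∈ S) ∧
    ((i = j k ∨ i = j k + 2) → Sum.inl (sp k (i+2)) ∈ S → Sum.inl (sp k (i+3)) ∈ S) ∧
    (Sum.inl (sp k (i+3)) ∈ S → Sum.inr (k, i+3) ∈ S) := by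
  have h3 : (i = j k ∨ i = j k + 2) → Sum.inl (sp k (i+1)) ∈ S → Sum.inl (sp k (i+2)) ∈ S :=
    fun hi => hS _ _ (TS.i3 k i hi)
  have h4 : (i = j k ∨ i = j k + 2) → Sum.inl (sp k (i+2)) ∈ S → Sum.inl (sp k (i+3)) ∈ S :=
    fun hi => hS _ _ (TS.i3' h k i hi)
  refine ⟨hS _ _ (TS.i2'' h k i), ?_, h3, h4, hS _ _ (TS.i2' h k i)⟩
  rcases diag_cases (j k) i with hi | hi
  · exact fun m => h4 hi (h3 hi m)
  · exact hS _ _ (TS.i3'' h k i hi)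

theorem TS.at_inl {n : N} {u w} (t : TS T sp sec j (Sum.inl n) u w) :
    (∃ v' w', T (Sum.inl n) v' w' ∧ u = lam sec v' w') ∨
    ∃ k i, n = sp k i ∧ (u = Sum.inr (k,i) ∨ u = Sum.inl (sp k (i+1)) ∨ ((i = j k ∨ i = j k + 2) ∧ u = Sum.inl (sp k (i+2))) ∨ u = Sum.inl (sp k (i+3))) := by
  rcases t with ⟨u', v', w', t, e1, rfl, rfl⟩ | ⟨k, i, t⟩ | ⟨k, i, hi, t⟩
  · have := lam_inl e1.symm
    subst this
    exact Or.inl ⟨_, _, t, rfl⟩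
  · right
    rcases t with ⟨e, e', rfl⟩ | ⟨e, e', rfl⟩ | ⟨e, e', rfl⟩
    · cases e
    · refine ⟨k, i+1, Sum.inl_injective e, ?_⟩
      rw [f4b]; right; right; right; exact e'
    · exact ⟨k, i, Sum.inl_injective e, Or.inl e'⟩
  · right
    rcases t with ⟨e, e', rfl⟩ | ⟨e, e', rfl⟩ | ⟨e, e', rfl⟩
    · exact ⟨k, i, Sum.inl_injective e, Or.inr (Or.inl e')⟩
    · refine ⟨k, i+1, Sum.inl_injective e, Or.inr (Or.inl ?_)⟩
      rw [f4d]; exact e'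
    · refine ⟨k, i+2, Sum.inl_injective e, Or.inr (Or.inr (Or.inl ⟨diag_two _ _ hi, ?_⟩))⟩
      rw [f4c]; exact e'

theorem TS.at_inr {k i} {u w} (t : TS T sp sec j (Sum.inr (k, i)) u w) :
    (∃ v' w', T (Sum.inr k) v' w' ∧ sec k v' = i ∧ u = lam sec v' w' ∧ w = lam sec w' (Sum.inr k)) ∨ (u = Sum.inl (sp k (i+1)) ∧ w = Sum.inl (sp k i)) := by
  rcases t with ⟨u', v', w', t, e1, rfl, rfl⟩ | ⟨k', i', t⟩ | ⟨k', i', hi, t⟩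
  · obtain ⟨rfl, e⟩ := lam_inr e1.symm
    exact Or.inl ⟨_, _, t, e, rfl, rfl⟩
  · right
    rcases t with ⟨e, e', e''⟩ | ⟨e, e', e''⟩ | ⟨e, e', e''⟩
    · cases e; exact ⟨e', e''⟩
    · cases e
    · cases e
  · rcases t with ⟨e, e', rfl⟩ | ⟨e, e', rfl⟩ | ⟨e, e', rfl⟩ <;> cases e

theorem TS.irr_inl (h : KD T sp sec) (n : N) (S : Set (N ⊕ K × Fin 4)) (hne : ∃ u w, TS T sp sec j (Sum.inl n) u w ∧ u ∈ S)
    (hS : ∀ u w, TS T sp sec j (Sum.inl n) u w → u ∈ S → w ∈ S) : ∀ u w, TS T sp sec j (Sum.inl n) u w → u ∈ S := by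
  -- the set downstairs
  have key : ∀ v w, T (Sum.inl n) v w → ∀ k i, w = Sum.inr k → n = sp k i → lam sec w (Sum.inl n) = Sum.inr (k, i) := by
    rintro v w t k i rfl rfl; exact h.lam_sp k i
  let R : Set (N ⊕ K) := {v | (∃ k i, v = Sum.inr k ∧ n = sp k i ∧ Sum.inr (k, i+3) ∈ S) ∨
    ((¬ ∃ k i, v = Sum.inr k ∧ n = sp k i) ∧ lam sec v (Sum.inl n) ∈ S)}
  have mu : ∀ v w, T (Sum.inl n) v w → (v ∈ R ↔ lam sec v w ∈ S) := by
    intro v w t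
    by_cases hv : ∃ k i, v = Sum.inr k ∧ n = sp k i
    · obtain ⟨k, i, rfl, rfl⟩ := hv
      have e := h.nxt_sp (h.sph.rot t)
      have e' : lam sec (Sum.inr k) w = Sum.inr (k, i+3) := by simp only [lam, e]
      rw [e']
      constructor
      · rintro (⟨k', i', e1, e2, m⟩ | ⟨m, _⟩)
        · obtain ⟨rfl, rfl⟩ := h.inj _ _ _ _ e2
          exact m
        · exact absurd ⟨k, i, rfl, rfl⟩ m
      · intro m; exact Or.inl ⟨k, i, rfl, rfl, m⟩
    · have : lam sec v w = lam sec v (Sum.inl n) := h.lam_eq (h.sph.rot t) (by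
        rintro k i e e'; exact hv ⟨k, i, e, Sum.inl_injective e'⟩)
      rw [this]
      constructor
      · rintro (⟨k', i', e1, e2, m⟩ | ⟨_, m⟩)
        · exact absurd ⟨k', i', e1, e2⟩ hv
        · exact m
      · intro m; exact Or.inr ⟨hv, m⟩
  have step : ∀ v w, T (Sum.inl n) v w → v ∈ R → lam sec w (Sum.inl n) ∈ S := by
    intro v w t m
    exact hS _ _ (TS.i1 t) ((mu v w t).1 m)
  have hR : ∀ v w, T (Sum.inl n) v w → v ∈ R → w ∈ R := by
    intro v w t m
    have m' := step v w t m
    by_cases hw : ∃ k i, w = Sum.inr k ∧ n = sp k i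
    · obtain ⟨k, i, rfl, rfl⟩ := hw
      rw [h.lam_sp] at m'
      have c := chain1 h hS
      exact Or.inl ⟨k, i, rfl, rfl, c.2.2.2.2 (c.2.1 (c.1 m'))⟩
    · exact Or.inr ⟨hw, m'⟩
  have hne' : ∃ v w, T (Sum.inl n) v w ∧ v ∈ R := by
    obtain ⟨u, w, t, m⟩ := hne
    rcases t.at_inl with ⟨v', w', t', rfl⟩ | ⟨k, i, rfl, hc⟩
    · exact ⟨v', w', t', (mu _ _ t').2 m⟩
    · obtain ⟨z, hz⟩ := h.adj k i
      obtain ⟨z', hz'⟩ := h.sph.pair hz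
      refine ⟨_, _, hz', Or.inl ⟨k, i, rfl, rfl, ?_⟩⟩
      have c := chain1 h hS
      rcases hc with rfl | rfl | ⟨hi, rfl⟩ | rfl
      · exact c.2.2.2.2 (c.2.1 (c.1 m))
      · exact c.2.2.2.2 (c.2.1 m)
      · exact c.2.2.2.2 (c.2.2.2.1 hi m)
      · exact c.2.2.2.2 m
  have all := h.sph.irr _ R hne' hR
  intro u w t
  rcases t.at_inl with ⟨v', w', t', rfl⟩ | ⟨k, i, rfl, hc⟩
  · exact (mu _ _ t').1 (all _ _ t')
  · obtain ⟨z, hz⟩ := h.adj k i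
    have hz' := h.sph.rot2 hz
    obtain ⟨y, hy⟩ := h.sph.pair hz
    obtain ⟨x, hx⟩ := h.sph.prev hy
    have m := step _ _ hx (all _ _ hx)
    rw [h.lam_sp] at m
    have c := chain1 h hS
    rcases hc with rfl | rfl | ⟨hi, rfl⟩ | rfl
    · exact m
    · exact c.1 m
    · exact c.2.2.1 hi (c.1 m)
    · exact c.2.1 (c.1 m)

theorem TS.irr_inr (h : KD T sp sec) (k i) (S : Set (N ⊕ K × Fin 4)) (hne : ∃ u w, TS T sp sec j (Sum.inr (k, i)) u w ∧ u ∈ S)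
    (hS : ∀ u w, TS T sp sec j (Sum.inr (k, i)) u w → u ∈ S → w ∈ S) : ∀ u w, TS T sp sec j (Sum.inr (k, i)) u w → u ∈ S := by
  have st : ∀ v w, T (Sum.inr k) v w → sec k v = i → lam sec v (Sum.inr k) ∈ S → lam sec w (Sum.inr k) ∈ S := by
    intro v w t e m
    have := TS.i1 (sp := sp) (sec := sec) (j := j) t
    rw [h.lam_eq_inr (h.sph.rot t)] at this
    simp only [lam] at this
    rw [e] at this
    exact hS _ _ this m
  have m1 : Sum.inl (sp k (i+1)) ∈ S := by
    by_contra hc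
    have all := h.sph.irr (Sum.inr k) {v | sec k v = i ∧ lam sec v (Sum.inr k) ∈ S} ?_ ?_
    · obtain ⟨w, t⟩ := h.adj k (i+1)
      have := (all _ _ t).1
      rw [h.sec_sp] at this
      exact f4n1 _ this
    · obtain ⟨u, w, t, m⟩ := hne
      rcases t.at_inr with ⟨v', w', t', e, rfl, rfl⟩ | ⟨rfl, rfl⟩
      · refine ⟨v', w', t', e, ?_⟩
        rwa [h.lam_eq_inr (h.sph.rot t')] at m
      · exact absurd m hc
    · rintro v w t ⟨e, m⟩
      have m' := st v w t e m
      rcases h.nxt k v w t with rfl | ⟨e', _⟩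
      · rw [e] at m'
        exact absurd m' hc
      · exact ⟨e'.trans e, m'⟩
  have m2 : Sum.inl (sp k i) ∈ S := hS _ _ (TS.i2 k i) m1
  have all := h.sph.irr (Sum.inr k) {v | sec k v = i → lam sec v (Sum.inr k) ∈ S} ?_ ?_
  · intro u w t
    rcases t.at_inr with ⟨v', w', t', e, rfl, rfl⟩ | ⟨rfl, rfl⟩
    · rw [h.lam_eq_inr (h.sph.rot t')]
      exact all _ _ t' e
    · exact m1
  · obtain ⟨w, t⟩ := h.adj k (i+1)
    refine ⟨_, _, t, fun e => ?_⟩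
    rw [h.sec_sp] at e
    exact absurd e (f4n1 _)
  · intro v w t m e
    rcases h.nxt k v w t with rfl | ⟨e', _⟩
    · rw [h.sec_sp] at e
      rw [e]; exact m2
    · exact st v w t (e'.symm.trans e) (m (e'.symm.trans e))

theorem TS.dual (h : KD T sp sec) (A : (N ⊕ K × Fin 4) → (N ⊕ K × Fin 4) → (N ⊕ K × Fin 4) → Prop)
    (hA : ∀ u v w, A u v w → TS T sp sec j u v w) (hne : ∃ u v w, A u v w) (hr : ∀ u v w, A u v w → A v w u)
    (hc : ∀ u v w z, A u v w → TS T sp sec j v u z → A v u z) : ∀ u v w, TS T sp sec j u v w → A u v w := by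
  have a3 : ∀ k i, (i = j k ∨ i = j k + 2) → A (Sum.inl (sp k i)) (Sum.inl (sp k (i+1))) (Sum.inl (sp k (i+2))) →
      A (Sum.inr (k, i)) (Sum.inl (sp k (i+1))) (Sum.inl (sp k i)) ∧
      A (Sum.inr (k, i+1)) (Sum.inl (sp k (i+2))) (Sum.inl (sp k (i+1))) ∧
      A (Sum.inl (sp k (i+2))) (Sum.inl (sp k (i+3))) (Sum.inl (sp k i)) := by
    intro k i hi a
    refine ⟨?_, ?_, ?_⟩
    · exact hr _ _ _ (hr _ _ _ (hc _ _ _ _ a ((TS.i2 k i).rot h)))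
    · have := (TS.i2 (T := T) (sp := sp) (sec := sec) (j := j) k (i+1)).rot h
      rw [f4d] at this
      exact hr _ _ _ (hr _ _ _ (hc _ _ _ _ (hr _ _ _ a) this))
    · exact hr _ _ _ (hc _ _ _ _ (hr _ _ _ (hr _ _ _ a)) (TS.i3' h k i hi))
  have b3 : ∀ k i, (i = j k ∨ i = j k + 2) → A (Sum.inl (sp k i)) (Sum.inl (sp k (i+1))) (Sum.inl (sp k (i+2))) →
      (∀ l, A (Sum.inr (k, l)) (Sum.inl (sp k (l+1))) (Sum.inl (sp k l))) ∧
      ∀ l, (l = j k ∨ l = j k + 2) → A (Sum.inl (sp k l)) (Sum.inl (sp k (l+1))) (Sum.inl (sp k (l+2))) := by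
    intro k i hi a
    obtain ⟨p, q, r⟩ := a3 k i hi a
    have r' : A (Sum.inl (sp k (i+2))) (Sum.inl (sp k (i+2+1))) (Sum.inl (sp k (i+2+2))) := by
      rw [f4c, f4e]; exact r
    obtain ⟨p', q', r''⟩ := a3 k (i+2) (diag_two _ _ hi) r'
    rw [f4e] at p' q'
    rw [f4c] at q'
    constructor
    · intro l
      have : l = i ∨ l = i + 1 ∨ l = i + 2 ∨ l = i + 3 := by clear * - i l; revert l i; decide
      rcases this with rfl | rfl | rfl | rfl
      · exact p
      · rw [f4d]; exact q
      · rw [f4e]; exact p'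
      · rw [f4a]; exact q'
    · intro l hl
      have : l = i ∨ l = i + 2 := by
        generalize j k = jj at hi hl
        clear * - hi hl
        revert l i jj; decide
      rcases this with rfl | rfl
      · exact a
      · exact r'
  have a2 : ∀ k i, A (Sum.inr (k, i)) (Sum.inl (sp k (i+1))) (Sum.inl (sp k i)) →
      (∀ l, A (Sum.inr (k, l)) (Sum.inl (sp k (l+1))) (Sum.inl (sp k l))) ∧
      ∀ l, (l = j k ∨ l = j k + 2) → A (Sum.inl (sp k l)) (Sum.inl (sp k (l+1))) (Sum.inl (sp k (l+2))) := by
    intro k i a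
    rcases diag_cases (j k) i with hi | hi
    · exact b3 k i hi (hc _ _ _ _ (hr _ _ _ a) (TS.i3 k i hi))
    · refine b3 k (i+3) hi ?_
      have := hc _ _ _ _ (hr _ _ _ a) (TS.i3'' h k i hi)
      rw [f4a, f4g]
      exact hr _ _ _ (hr _ _ _ this)
  have ys : ∀ k i w, A (Sum.inr (k, i)) (Sum.inl (sp k i)) w →
      (∀ l, A (Sum.inr (k, l)) (Sum.inl (sp k (l+1))) (Sum.inl (sp k l))) ∧
      ∀ l, (l = j k ∨ l = j k + 2) → A (Sum.inl (sp k l)) (Sum.inl (sp k (l+1))) (Sum.inl (sp k (l+2))) := by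
    intro k i w a
    exact a2 k i (hr _ _ _ (hc _ _ _ _ a (TS.i2'' h k i)))
  have main := h.sph.dual (fun u v w => T u v w ∧ A (lam sec u v) (lam sec v w) (lam sec w u)) (fun _ _ _ a => a.1) ?_
    (fun _ _ _ a => ⟨h.sph.rot a.1, hr _ _ _ a.2⟩) ?_
  · have kt : ∀ k, (∀ l, A (Sum.inr (k, l)) (Sum.inl (sp k (l+1))) (Sum.inl (sp k l))) ∧
      ∀ l, (l = j k ∨ l = j k + 2) → A (Sum.inl (sp k l)) (Sum.inl (sp k (l+1))) (Sum.inl (sp k (l+2))) := by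
      intro k
      obtain ⟨w, t⟩ := h.adj k 0
      have := (main _ _ _ t).2
      rw [h.lam_sp] at this
      exact ys k 0 _ this
    rintro a b c (⟨u, v, w, t, rfl, rfl, rfl⟩ | ⟨k, i, t⟩ | ⟨k, i, hi, t⟩)
    · exact (main _ _ _ t).2
    · have := (kt k).1 i
      rcases t with ⟨rfl, rfl, rfl⟩ | ⟨rfl, rfl, rfl⟩ | ⟨rfl, rfl, rfl⟩
      · exact this
      · exact hr _ _ _ this
      · exact hr _ _ _ (hr _ _ _ this)
    · have := (kt k).2 i hi
      rcases t with ⟨rfl, rfl, rfl⟩ | ⟨rfl, rfl, rfl⟩ | ⟨rfl, rfl, rfl⟩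
      · exact this
      · exact hr _ _ _ this
      · exact hr _ _ _ (hr _ _ _ this)
  · have fin : ∀ k, (∀ l, A (Sum.inr (k, l)) (Sum.inl (sp k (l+1))) (Sum.inl (sp k l))) →
        ∃ u v w, T u v w ∧ A (lam sec u v) (lam sec v w) (lam sec w u) := by
      intro k a
      obtain ⟨w, t⟩ := h.adj k 0
      refine ⟨_, _, _, t, ?_⟩
      have t' := TS.i1 (sp := sp) (sec := sec) (j := j) t
      rw [h.lam_sp] at t' ⊢
      exact hc _ _ _ _ (hr _ _ _ (hr _ _ _ (a 0))) t'
    obtain ⟨a, b, c, m⟩ := hne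
    rcases hA _ _ _ m with ⟨u, v, w, t, rfl, rfl, rfl⟩ | ⟨k, i, t⟩ | ⟨k, i, hi, t⟩
    · exact ⟨u, v, w, t, m⟩
    · refine fin k (a2 k i ?_).1
      rcases t with ⟨rfl, rfl, rfl⟩ | ⟨rfl, rfl, rfl⟩ | ⟨rfl, rfl, rfl⟩
      · exact m
      · exact hr _ _ _ (hr _ _ _ m)
      · exact hr _ _ _ m
    · refine fin k (b3 k i hi ?_).1
      rcases t with ⟨rfl, rfl, rfl⟩ | ⟨rfl, rfl, rfl⟩ | ⟨rfl, rfl, rfl⟩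
      · exact m
      · exact hr _ _ _ (hr _ _ _ m)
      · exact hr _ _ _ m
  · rintro u v w z ⟨t, a⟩ tz
    refine ⟨tz, ?_⟩
    by_cases hu : ∃ k i, u = Sum.inr k ∧ v = Sum.inl (sp k i)
    · obtain ⟨k, i, rfl, rfl⟩ := hu
      rw [h.lam_sp] at a
      have := (ys k i _ a).1 (i+3)
      rw [f4a] at this
      have t' := TS.i1 (sp := sp) (sec := sec) (j := j) tz
      have e := h.nxt_sp (h.sph.rot tz)
      have e' : lam sec (Sum.inr k) z = Sum.inr (k, i+3) := by simp only [lam, e]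
      rw [e'] at t' ⊢
      exact hc _ _ _ _ this t'
    by_cases hv : ∃ k i, v = Sum.inr k ∧ u = Sum.inl (sp k i)
    · obtain ⟨k, i, rfl, rfl⟩ := hv
      have e := h.nxt_sp (h.sph.rot t)
      have e' : lam sec (Sum.inr k) w = Sum.inr (k, i+3) := by simp only [lam, e]
      rw [e'] at a
      have a' : A (Sum.inr (k, i+3)) (Sum.inl (sp k (i+3+1))) (Sum.inl (sp k (i+3))) := by
        have := TS.i2 (T := T) (sp := sp) (sec := sec) (j := j) k (i+3)
        rw [f4a] at this ⊢
        exact hc _ _ _ _ a this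
      have := (a2 k _ a').1 i
      have t' := TS.i1 (sp := sp) (sec := sec) (j := j) tz
      rw [h.lam_sp] at t' ⊢
      exact hc _ _ _ _ (hr _ _ _ (hr _ _ _ this)) t'
    have e1 : lam sec v w = lam sec v u := h.lam_eq (h.sph.rot t) (by rintro k i rfl rfl; exact hv ⟨k, i, rfl, rfl⟩)
    have e2 : lam sec u z = lam sec u v := h.lam_eq (h.sph.rot tz) (by rintro k i rfl rfl; exact hu ⟨k, i, rfl, rfl⟩)
    have t' := TS.i1 (sp := sp) (sec := sec) (j := j) tz
    rw [e2] at t' ⊢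
    rw [e1] at a
    exact hc _ _ _ _ a t'

theorem TS.vtx (h : KD T sp sec) (v) : ∃ u w, TS T sp sec j v u w := by
  rcases v with n | ⟨k, i⟩
  · obtain ⟨u, w, t⟩ := h.sph.vtx (Sum.inl n)
    exact ⟨_, _, TS.i1 t⟩
  · exact ⟨_, _, TS.i2 k i⟩

def rot3 {α : Type*} (m : Fin 3) (x y z : α) : α × α × α := if m = 0 then (x, y, z) else if m = 1 then (y, z, x) else (z, x, y)

theorem R3.ex {α : Type*} {x y z a b c : α} (h : R3 x y z a b c) : ∃ m, (a, b, c) = rot3 m x y z := by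
  rcases h with ⟨rfl, rfl, rfl⟩ | ⟨rfl, rfl, rfl⟩ | ⟨rfl, rfl, rfl⟩
  · exact ⟨0, rfl⟩
  · exact ⟨1, rfl⟩
  · exact ⟨2, rfl⟩

theorem TS.count (h : KD T sp sec) : Set.ncard {t : (N ⊕ K × Fin 4) × (N ⊕ K × Fin 4) × (N ⊕ K × Fin 4) | TS T sp sec j t.1 t.2.1 t.2.2} + 12 ≤
    6 * Fintype.card (N ⊕ K × Fin 4) := by
  have c := h.sph.count
  let f1 : (N ⊕ K) × (N ⊕ K) × (N ⊕ K) → (N ⊕ K × Fin 4) × (N ⊕ K × Fin 4) × (N ⊕ K × Fin 4) :=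
    fun t => (lam sec t.1 t.2.1, lam sec t.2.1 t.2.2, lam sec t.2.2 t.1)
  let f2 : K × Fin 4 × Fin 3 → (N ⊕ K × Fin 4) × (N ⊕ K × Fin 4) × (N ⊕ K × Fin 4) :=
    fun t => rot3 t.2.2 (Sum.inr (t.1, t.2.1)) (Sum.inl (sp t.1 (t.2.1+1))) (Sum.inl (sp t.1 t.2.1))
  let f3 : K × Fin 2 × Fin 3 → (N ⊕ K × Fin 4) × (N ⊕ K × Fin 4) × (N ⊕ K × Fin 4) :=
    fun t => rot3 t.2.2 (Sum.inl (sp t.1 (j t.1 + if t.2.1 = 0 then 0 else 2))) (Sum.inl (sp t.1 (j t.1 + (if t.2.1 = 0 then 0 else 2) + 1))) (Sum.inl (sp t.1 (j t.1 + (if t.2.1 = 0 then 0 else 2) + 2)))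
  have sub : {t : (N ⊕ K × Fin 4) × (N ⊕ K × Fin 4) × (N ⊕ K × Fin 4) | TS T sp sec j t.1 t.2.1 t.2.2} ⊆
      (f1 '' {t | T t.1 t.2.1 t.2.2} ∪ f2 '' Set.univ) ∪ f3 '' Set.univ := by
    rintro ⟨a, b, c⟩ (⟨u, v, w, t, e1, e2, e3⟩ | ⟨k, i, t⟩ | ⟨k, i, hi, t⟩)
    · left; left
      exact ⟨(u, v, w), t, by simp only [f1]; simp only at e1 e2 e3; rw [e1, e2, e3]⟩
    · left; right
      obtain ⟨m, hm⟩ := R3.ex t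
      exact ⟨(k, i, m), trivial, hm.symm⟩
    · right
      obtain ⟨m, hm⟩ := R3.ex t
      rcases hi with rfl | rfl
      · exact ⟨(k, 0, m), trivial, by simp only [f3, if_true, add_zero]; exact hm.symm⟩
      · exact ⟨(k, 1, m), trivial, by simp only [f3, if_neg (show ¬ ((1 : Fin 2) = 0) by decide)]; exact hm.symm⟩
  have l0 := Set.ncard_le_ncard sub (Set.toFinite _)
  have l1 := Set.ncard_union_le (f1 '' {t | T t.1 t.2.1 t.2.2} ∪ f2 '' Set.univ) (f3 '' Set.univ)
  have l2 := Set.ncard_union_le (f1 '' {t | T t.1 t.2.1 t.2.2}) (f2 '' Set.univ)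
  have l3 := Set.ncard_image_le (f := f1) (s := {t | T t.1 t.2.1 t.2.2}) (Set.toFinite _)
  have l4 := Set.ncard_image_le (f := f2) (s := Set.univ) (Set.toFinite _)
  have l5 := Set.ncard_image_le (f := f3) (s := Set.univ) (Set.toFinite _)
  rw [Set.ncard_univ, Nat.card_eq_fintype_card] at l4 l5
  simp only [Fintype.card_prod, Fintype.card_fin, Fintype.card_sum] at *
  omega

theorem KD.sphere (h : KD T sp sec) (j : K → Fin 4) : Sphere (TS T sp sec j) where
  rot t := t.rot h
  ne t := t.ne h
  uniq t t' := t.uniq h t'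
  pair t := t.pair h
  irr v S := by
    rcases v with n | ⟨k, i⟩
    · exact TS.irr_inl h n S
    · exact TS.irr_inr h k i S
  dual A := TS.dual h A
  vtx := TS.vtx h
  count := TS.count h
end surg2
end ICR

namespace ICR
open Classical Filter Topology
section choice
variable {N K : Type*} [Fintype N] [Fintype K] {T : N ⊕ K → N ⊕ K → N ⊕ K → Prop} {sp : K → Fin 4 → N}
  {sec : K → N ⊕ K → Fin 4} {j : K → Fin 4}

theorem KD.I6 (h : KD T sp sec) {k i l w} (t : TS T sp sec j (Sum.inl (sp k i)) (Sum.inl (sp k l)) w) :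
    (∃ m, w = Sum.inl (sp k m)) ∨ (w = Sum.inr (k, l) ∧ i = l + 1) := by
  rcases t with t | ⟨k', i', t⟩ | ⟨k', i', hi, t⟩
  · exact (t.not_spsp h).elim
  · rcases t with ⟨e, e', rfl⟩ | ⟨e, e', rfl⟩ | ⟨e, e', rfl⟩
    · cases e
    · obtain ⟨rfl, rfl⟩ := h.inj _ _ _ _ (Sum.inl_injective e)
      obtain ⟨-, rfl⟩ := h.inj _ _ _ _ (Sum.inl_injective e')
      exact Or.inr ⟨rfl, rfl⟩
    · cases e'
  · left
    rcases t with ⟨e, e', rfl⟩ | ⟨e, e', rfl⟩ | ⟨e, e', rfl⟩ <;>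
    · obtain ⟨rfl, -⟩ := h.inj _ _ _ _ (Sum.inl_injective e)
      exact ⟨_, rfl⟩

theorem TS.I7 {j' : K → Fin 4} {u v w} (t : TS T sp sec j u v w) :
    TS T sp sec j' u v w ∨ ∃ k i l, u = Sum.inl (sp k i) ∧ v = Sum.inl (sp k l) := by
  rcases t with t | t | ⟨k', i', hi, t⟩
  · exact Or.inl (Or.inl t)
  · exact Or.inl (Or.inr (Or.inl t))
  · right
    rcases t with ⟨e, e', rfl⟩ | ⟨e, e', rfl⟩ | ⟨e, e', rfl⟩ <;> exact ⟨_, _, _, e, e'⟩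

/-- the corner vertex `y` is adjacent to both spokes -/
theorem KD.y_adj (h : KD T sp sec) (k i) : (∃ w, TS T sp sec j (Sum.inl (sp k i)) (Sum.inr (k, i)) w) ∧
    ∃ w, TS T sp sec j (Sum.inl (sp k (i+1))) (Sum.inr (k, i)) w :=
  ⟨⟨_, TS.i2'' h k i⟩, (h.sphere j).pair (TS.i2 k i)⟩

theorem cluster (h : KD T sp sec) {o0 o1 o2 : N ⊕ K × Fin 4} (ht : TS T sp sec j o0 o1 o2) (k : K) (X : Set (N ⊕ K × Fin 4))
    (hX : X.Nonempty) (h0 : o0 ∉ X) (h1 : o1 ∉ X) (h2 : o2 ∉ X) (h0' : ∀ i, o0 ≠ Sum.inl (sp k i))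
    (hk : ∀ i, Sum.inl (sp k i) ∉ X)
    (hN : ∀ x u w, x ∈ X → TS T sp sec j x u w → u ∈ X ∨ ∃ i, u = Sum.inl (sp k i)) : False := by
  have S := h.sphere j
  have hN2 : ∀ x u w, x ∈ X → TS T sp sec j u x w → u ∈ X ∨ ∃ i, u = Sum.inl (sp k i) := by
    intro x u w hx t
    obtain ⟨z, hz⟩ := S.pair t
    exact hN x u z hx hz
  have touch : ∃ x u w, x ∈ X ∧ TS T sp sec j x u w := by
    obtain ⟨x, hx⟩ := hX
    obtain ⟨u, w, t⟩ := S.vtx x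
    exact ⟨x, u, w, hx, t⟩
  have hy : ∃ i, (Sum.inr (k, i) : N ⊕ K × Fin 4) ∈ X := by
    by_contra hy
    push Not at hy
    have := S.dual (fun u v w => TS T sp sec j u v w ∧ (u ∈ X ∨ v ∈ X ∨ w ∈ X)) (fun _ _ _ a => a.1)
      (by obtain ⟨x, u, w, hx, t⟩ := touch; exact ⟨x, u, w, t, Or.inl hx⟩)
      (fun u v w a => ⟨S.rot a.1, by tauto⟩)
      (by
        rintro u v w z ⟨t, a⟩ tz
        refine ⟨tz, ?_⟩
        by_cases hu : u ∈ X
        · exact Or.inr (Or.inl hu)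
        by_cases hv : v ∈ X
        · exact Or.inl hv
        have hw : w ∈ X := by tauto
        rcases hN w u v hw (S.rot2 t) with m | ⟨i, rfl⟩
        · exact absurd m hu
        rcases hN2 w v _ hw (S.rot t) with m | ⟨l, rfl⟩
        · exact absurd m hv
        rcases h.I6 t with ⟨m, rfl⟩ | ⟨rfl, _⟩
        · exact absurd hw (hk m)
        · exact absurd hw (hy l))
      _ _ _ ht
    tauto
  have stp : ∀ i, (Sum.inr (k, i) : N ⊕ K × Fin 4) ∈ X → (Sum.inr (k, i+3) : N ⊕ K × Fin 4) ∈ X := by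
    intro i hi
    by_contra hc
    have := S.irr (Sum.inl (sp k i)) {u | u ∉ X ∧ ∀ l, u ≠ Sum.inl (sp k l)}
      (by
        obtain ⟨z, hz⟩ := (h.y_adj (j := j) k (i+3)).2
        rw [f4a] at hz
        exact ⟨_, _, hz, hc, by simp⟩)
      (by
        rintro u w t ⟨hu, hu'⟩
        constructor
        · intro hw
          rcases hN2 w u (Sum.inl (sp k i)) hw (S.rot t) with m | ⟨l, rfl⟩
          · exact hu m
          · exact hu' l rfl
        · rintro l rfl
          rcases h.I6 (S.rot2 t) with ⟨m, rfl⟩ | ⟨rfl, _⟩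
          · exact hu' m rfl
          · exact hu hi)
    obtain ⟨z, hz⟩ := TS.side (j := j) h k i
    exact (this _ _ hz).2 _ rfl
  have ally : ∀ l, (Sum.inr (k, l) : N ⊕ K × Fin 4) ∈ X := by
    obtain ⟨i, hi⟩ := hy
    have a1 := stp _ hi
    have a2 := stp _ a1
    have a3 := stp _ a2
    intro l
    have : l = i ∨ l = i + 3 ∨ l = i + 3 + 3 ∨ l = i + 3 + 3 + 3 := by clear * - i l; revert l i; decide
    rcases this with rfl | rfl | rfl | rfl <;> assumption
  have := S.dual (fun u v w => TS T sp sec j u v w ∧ ((u ∈ X ∨ v ∈ X ∨ w ∈ X) ∨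
      ((∃ i, u = Sum.inl (sp k i)) ∧ (∃ i, v = Sum.inl (sp k i)) ∧ (∃ i, w = Sum.inl (sp k i))))) (fun _ _ _ a => a.1)
      (by obtain ⟨x, u, w, hx, t⟩ := touch; exact ⟨x, u, w, t, Or.inl (Or.inl hx)⟩)
      (fun u v w a => ⟨S.rot a.1, by tauto⟩)
      (by
        rintro u v w z ⟨t, a⟩ tz
        refine ⟨tz, ?_⟩
        by_cases hu : u ∈ X
        · exact Or.inl (Or.inr (Or.inl hu))
        by_cases hv : v ∈ X
        · exact Or.inl (Or.inl hv)
        have : (∃ i, u = Sum.inl (sp k i)) ∧ (∃ i, v = Sum.inl (sp k i)) := by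
          rcases a with a | a
          · have hw : w ∈ X := by tauto
            constructor
            · rcases hN w u v hw (S.rot2 t) with m | m
              · exact absurd m hu
              · exact m
            · rcases hN2 w v u hw (S.rot t) with m | m
              · exact absurd m hv
              · exact m
          · exact ⟨a.1, a.2.1⟩
        obtain ⟨⟨i, rfl⟩, ⟨l, rfl⟩⟩ := this
        rcases h.I6 tz with m | ⟨rfl, _⟩
        · exact Or.inr ⟨⟨_, rfl⟩, ⟨_, rfl⟩, m⟩
        · exact Or.inl (Or.inr (Or.inr (ally _))))
      _ _ _ ht
  rcases this.2 with a | ⟨⟨i, e⟩, _⟩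
  · tauto
  · exact h0' i e

noncomputable def rep (sp : K → Fin 4 → N) (v : N ⊕ K × Fin 4) : N ⊕ K × Fin 4 :=
  if hv : ∃ k i, v = Sum.inl (sp k i) then Sum.inl (sp (Classical.choose hv) 0) else v

theorem rep_sp (h : KD T sp sec) (k i) : rep sp (Sum.inl (sp k i)) = Sum.inl (sp k 0) := by
  have hv : ∃ k' i', (Sum.inl (sp k i) : N ⊕ K × Fin 4) = Sum.inl (sp k' i') := ⟨k, i, rfl⟩
  unfold rep
  rw [dif_pos hv]
  obtain ⟨i', e⟩ := Classical.choose_spec hv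
  rw [← (h.inj _ _ _ _ (Sum.inl_injective e)).1]

theorem rep_self {v : N ⊕ K × Fin 4} (hv : ∀ k i, v ≠ Sum.inl (sp k i)) : rep sp v = v := by
  unfold rep
  rw [dif_neg]
  rintro ⟨k, i, e⟩; exact hv k i e

theorem rep_eq_sp (h : KD T sp sec) {v k} (e : rep sp v = Sum.inl (sp k 0)) : ∃ i, v = Sum.inl (sp k i) := by
  by_cases hv : ∃ k i, v = Sum.inl (sp k i)
  · obtain ⟨k', i, rfl⟩ := hv
    rw [rep_sp h] at e
    obtain ⟨rfl, _⟩ := h.inj _ _ _ _ (Sum.inl_injective e)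
    exact ⟨i, rfl⟩
  · push Not at hv
    rw [rep_self hv] at e
    exact absurd e (hv k 0)

theorem rep_eq_self (h : KD T sp sec) {u v : N ⊕ K × Fin 4} (hv : ∀ k i, v ≠ Sum.inl (sp k i)) (e : rep sp u = v) : u = v := by
  by_cases hu : ∃ k i, u = Sum.inl (sp k i)
  · obtain ⟨k', i, rfl⟩ := hu
    rw [rep_sp h] at e
    exact absurd e.symm (hv _ _)
  · push Not at hu
    rwa [rep_self hu] at e

theorem low_high (Low High ylow yhigh : Fin 4 → Prop) (h1 : ∀ i, ylow i → Low i ∧ Low (i+1)) (h2 : ∀ i, yhigh i → High i ∧ High (i+1))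
    (h3 : ∀ i, ylow i ∨ yhigh i) (h4 : ∃ i, Low i) (h5 : ∃ i, High i) : ∃ i, Low i ∧ High (i+2) := by
  by_contra hc
  push Not at hc
  have al : ∀ i l : Fin 4, l = i ∨ l = i + 1 ∨ l = i + 2 ∨ l = i + 2 + 1 := by decide
  rcases h3 0 with a | a
  · obtain ⟨p, q⟩ := h1 _ a
    have n2 := hc _ p
    have : ylow (0 + 2) := by
      rcases h3 (0+2) with b | b
      · exact b
      · exact absurd (h2 _ b).1 n2
    obtain ⟨p', q'⟩ := h1 _ this
    obtain ⟨l, hl⟩ := h5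
    have c1 := hc _ p'
    have c2 := hc _ q'
    have c3 := hc _ q
    rw [f4c] at c1
    rcases al 0 l with rfl | rfl | rfl | rfl
    · exact c1 hl
    · exact c2 hl
    · exact n2 hl
    · exact c3 hl
  · obtain ⟨p, q⟩ := h2 _ a
    have n2 : ¬ Low (0+2) := fun b => hc _ b p
    have : yhigh (0 + 2) := by
      rcases h3 (0+2) with b | b
      · exact absurd (h1 _ b).1 n2
      · exact b
    obtain ⟨p', q'⟩ := h2 _ this
    obtain ⟨l, hl⟩ := h4
    have c1 := hc _ hl
    rcases al 0 l with rfl | rfl | rfl | rfl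
    · exact c1 p'
    · exact c1 q'
    · exact n2 hl
    · exact c1 q

theorem choice_H (h : KD T sp sec) {o0 o1 o2 : N ⊕ K × Fin 4} (ht : TS T sp sec j o0 o2 o1)
    (hO : ∀ v, Outer o0 o1 o2 v → ∀ k i, v ≠ Sum.inl (sp k i)) (g : N ⊕ K × Fin 4 → ℝ) (hg : Set.InjOn g {v | Outer o0 o1 o2 v}) :
    ∃ H : N ⊕ K × Fin 4 → ℝ, Function.Injective H ∧ (∀ v, Outer o0 o1 o2 v → H v = g v) ∧
      ∀ v, ¬ Outer o0 o1 o2 v → (∀ k i, i ≠ 0 → v ≠ Sum.inl (sp k i)) →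
        (∃ u v' w, TS T sp sec j u v' w ∧ rep sp u = v ∧ H (rep sp v') < H v) ∧
        (∃ u v' w, TS T sp sec j u v' w ∧ rep sp u = v ∧ H v < H (rep sp v')) := by
  have S := h.sphere j
  let adjQ : N ⊕ K × Fin 4 → N ⊕ K × Fin 4 → Prop := fun u v => ∃ u' v' w, TS T sp sec j u' v' w ∧ rep sp u' = u ∧ rep sp v' = v
  let O : Set (N ⊕ K × Fin 4) := {v | Outer o0 o1 o2 v ∨ ∃ k i, i ≠ 0 ∧ v = Sum.inl (sp k i)}
  let e := Fintype.equivFin (N ⊕ K × Fin 4)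
  let g0 : N ⊕ K × Fin 4 → ℝ := fun v => if Outer o0 o1 o2 v then g v else (∑ u, |g u|) + 1 + (e v : ℕ)
  have gle : ∀ v, g v < (∑ u, |g u|) + 1 := by
    intro v
    have := Finset.single_le_sum (f := fun u => |g u|) (fun u _ => abs_nonneg _) (Finset.mem_univ v)
    have := le_abs_self (g v)
    linarith
  have hg0 : Set.InjOn g0 O := by
    intro u _ v _ he
    simp only [g0] at he
    have hen : ∀ v, (0 : ℝ) ≤ ((e v : ℕ) : ℝ) := fun v => Nat.cast_nonneg _
    split_ifs at he with hu hv hv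
    · exact hg hu hv he
    · have := gle u; have := hen v; linarith
    · have := gle v; have := hen u; linarith
    · have : ((e u : ℕ) : ℝ) = ((e v : ℕ) : ℝ) := by linarith
      have := Nat.cast_injective this
      exact e.injective (Fin.ext this)
  obtain ⟨H, H1, H2, H3⟩ := ear adjQ (by
      rintro u v ⟨u', v', w, t, e1, e2⟩
      obtain ⟨z, hz⟩ := S.pair t
      exact ⟨v', u', z, hz, e2, e1⟩) _ O g0 le_rfl hg0 (by
      intro X hX hXO
      have hself : ∀ x ∈ X, rep sp x = x := by
        intro x hx
        by_cases hs : ∃ k i, x = Sum.inl (sp k i)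
        · obtain ⟨k, i, rfl⟩ := hs
          by_cases hi : i = 0
          · subst hi; exact rep_sp h k 0
          · exact absurd (Or.inr ⟨k, i, hi, rfl⟩) (hXO _ hx)
        · push Not at hs
          exact rep_self hs
      have hout : ∀ v, Outer o0 o1 o2 v → v ∉ {v | rep sp v ∈ X} := by
        intro v hv hx
        simp only [Set.mem_ofPred_eq] at hx
        rw [rep_self (hO v hv)] at hx
        exact hXO _ hx (Or.inl hv)
      have hneX : {v | rep sp v ∈ X}.Nonempty := by
        obtain ⟨x, hx⟩ := hX
        refine ⟨x, ?_⟩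
        simp only [Set.mem_ofPred_eq]
        rwa [hself x hx]
      have key : ∀ b, ∃ b', b' ≠ b ∧ b' ∉ X ∧ ∃ x ∈ X, adjQ x b' := by
        intro b
        by_contra hcon
        push Not at hcon
        have hN : ∀ x u w, x ∈ {v | rep sp v ∈ X} → TS T sp sec j x u w → rep sp u ∈ X ∨ rep sp u = b := by
          intro x u w hx t
          by_contra hc
          push Not at hc
          exact hcon _ hc.2 hc.1 _ hx ⟨x, u, w, t, rfl, rfl⟩
        by_cases hb : b ∈ X
        · refine S.three {v | rep sp v ∈ X} hneX ht (hout _ (Or.inl rfl)) (hout _ (Or.inr (Or.inr rfl))) (hout _ (Or.inr (Or.inl rfl))) b b ?_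
          intro x u w hx t
          rcases hN x u w hx t with m | m
          · exact Or.inl m
          · left
            simp only [Set.mem_ofPred_eq]
            rwa [m]
        by_cases hbk : ∃ k, b = Sum.inl (sp k 0)
        · obtain ⟨k, rfl⟩ := hbk
          refine cluster h ht k {v | rep sp v ∈ X} hneX (hout _ (Or.inl rfl)) (hout _ (Or.inr (Or.inr rfl))) (hout _ (Or.inr (Or.inl rfl))) (hO _ (Or.inl rfl) k) ?_ ?_
          · intro i
            simp only [Set.mem_ofPred_eq]
            rwa [rep_sp h]
          · intro x u w hx t
            rcases hN x u w hx t with m | m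
            · exact Or.inl m
            · exact Or.inr (rep_eq_sp h m)
        · refine S.three {v | rep sp v ∈ X} hneX ht (hout _ (Or.inl rfl)) (hout _ (Or.inr (Or.inr rfl))) (hout _ (Or.inr (Or.inl rfl))) b b ?_
          intro x u w hx t
          rcases hN x u w hx t with m | m
          · exact Or.inl m
          · right; left
            by_cases hs : ∃ k i, u = Sum.inl (sp k i)
            · obtain ⟨k, i, rfl⟩ := hs
              rw [rep_sp h] at m
              exact absurd ⟨k, m.symm⟩ hbk
            · push Not at hs
              rwa [rep_self hs] at m
      obtain ⟨b, -, h1, h2⟩ := key o0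
      obtain ⟨b', h3, h4, h5⟩ := key b
      exact ⟨b, b', h3.symm, h1, h4, h2, h5⟩)
  refine ⟨H, H1, ?_, ?_⟩
  · intro v hv
    rw [H2 v (Or.inl hv)]
    simp only [g0]
    rw [if_pos hv]
  · intro v hv hv'
    have : v ∉ O := by
      rintro (m | ⟨k, i, hi, m⟩)
      · exact hv m
      · exact hv' k i hi m
    obtain ⟨⟨u, ⟨u', v', w, t, e1, rfl⟩, hu⟩, ⟨z, ⟨z', y', w', t', e2, rfl⟩, hz⟩⟩ := H3 v this
    exact ⟨⟨u', v', w, t, e1, hu⟩, ⟨z', y', w', t', e2, hz⟩⟩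

theorem choice (h : KD T sp sec) {o0 o1 o2 : N ⊕ K × Fin 4} (ht : ∀ j, TS T sp sec j o0 o2 o1)
    (hO : ∀ v, Outer o0 o1 o2 v → ∀ k i, v ≠ Sum.inl (sp k i)) (g : N ⊕ K × Fin 4 → ℝ) (hg : Set.InjOn g {v | Outer o0 o1 o2 v}) :
    ∃ (j : K → Fin 4) (H : N ⊕ K × Fin 4 → ℝ), (∀ v, Outer o0 o1 o2 v → H v = g v) ∧
      (∀ v, ¬ Outer o0 o1 o2 v → (∀ k, v ≠ Sum.inl (sp k (j k + 1)) ∧ v ≠ Sum.inl (sp k (j k + 3))) →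
        (∃ u w, TS T sp sec j v u w ∧ H u < H v) ∧ (∃ u w, TS T sp sec j v u w ∧ H v < H u)) ∧
      ∀ k, H (Sum.inl (sp k (j k))) < H (Sum.inl (sp k (j k + 2))) ∧
        H (Sum.inl (sp k (j k + 1))) = (H (Sum.inl (sp k (j k))) + H (Sum.inl (sp k (j k + 2)))) / 2 ∧
        H (Sum.inl (sp k (j k + 3))) = (H (Sum.inl (sp k (j k))) + H (Sum.inl (sp k (j k + 2)))) / 2 := by
  obtain ⟨H, H1, H2, H3⟩ := choice_H (j := fun _ => 0) h (ht _) hO g hg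
  let T0 := TS T sp sec (fun _ => 0)
  have hj : ∀ k, ∃ i, (∃ u w, T0 (Sum.inl (sp k i)) u w ∧ H (rep sp u) < H (Sum.inl (sp k 0))) ∧
      (∃ u w, T0 (Sum.inl (sp k (i+2))) u w ∧ H (Sum.inl (sp k 0)) < H (rep sp u)) := by
    intro k
    obtain ⟨⟨u, v', w, t, e, l⟩, ⟨u2, v2, w2, t2, e2, l2⟩⟩ := H3 (Sum.inl (sp k 0)) (fun ho => hO _ ho k 0 rfl) (by
      intro k' i' hi' e
      exact hi' (h.inj _ _ _ _ (Sum.inl_injective e)).2.symm)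
    obtain ⟨i1, rfl⟩ := rep_eq_sp h e
    obtain ⟨i2, rfl⟩ := rep_eq_sp h e2
    have ry : ∀ i, rep sp (Sum.inr (k, i)) = Sum.inr (k, i) := fun i => rep_self (by simp)
    refine low_high (fun i => ∃ u w, T0 (Sum.inl (sp k i)) u w ∧ H (rep sp u) < H (Sum.inl (sp k 0)))
      (fun i => ∃ u w, T0 (Sum.inl (sp k i)) u w ∧ H (Sum.inl (sp k 0)) < H (rep sp u))
      (fun i => H (Sum.inr (k, i)) < H (Sum.inl (sp k 0))) (fun i => H (Sum.inl (sp k 0)) < H (Sum.inr (k, i))) ?_ ?_ ?_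
      ⟨i1, v', w, t, l⟩ ⟨i2, v2, w2, t2, l2⟩
    · intro i hi
      obtain ⟨⟨z, hz⟩, ⟨z', hz'⟩⟩ := h.y_adj (j := fun _ => 0) k i
      exact ⟨⟨_, z, hz, by rw [ry]; exact hi⟩, ⟨_, z', hz', by rw [ry]; exact hi⟩⟩
    · intro i hi
      obtain ⟨⟨z, hz⟩, ⟨z', hz'⟩⟩ := h.y_adj (j := fun _ => 0) k i
      exact ⟨⟨_, z, hz, by rw [ry]; exact hi⟩, ⟨_, z', hz', by rw [ry]; exact hi⟩⟩
    · intro i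
      exact lt_or_gt_of_ne (fun e => by have := H1 e; cases this)
  choose j hlow hhigh using hj
  obtain ⟨η, hη, hgap⟩ : ∃ η : ℝ, 0 < η ∧ ∀ u v, H u < H v → H u + 2 * η < H v := by
    have : ∀ᶠ η in 𝓝[>] (0:ℝ), 0 < η ∧ ∀ u v, H u < H v → H u + 2 * η < H v := by
      refine eventually_mem_nhdsWithin.and ?_
      rw [eventually_all]; intro u
      rw [eventually_all]; intro v
      by_cases hl : H u < H v
      · have : Tendsto (fun η : ℝ => H u + 2 * η) (𝓝[>] 0) (𝓝 (H u + 2 * 0)) :=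
          ((continuous_const.add (continuous_const.mul continuous_id)).tendsto 0).mono_left nhdsWithin_le_nhds
        rw [mul_zero, add_zero] at this
        filter_upwards [this.eventually (gt_mem_nhds hl)] with η a _ using a
      · exact Eventually.of_forall fun _ a => absurd a hl
    exact this.exists
  let δ : N ⊕ K × Fin 4 → ℝ := fun v => if ∃ k, v = Sum.inl (sp k (j k)) then -1 else if ∃ k, v = Sum.inl (sp k (j k + 2)) then 1 else 0
  have δb : ∀ v, -1 ≤ δ v ∧ δ v ≤ 1 := by intro v; simp only [δ]; split_ifs <;> norm_num
  have δa : ∀ k, δ (Sum.inl (sp k (j k))) = -1 := by intro k; simp only [δ]; rw [if_pos ⟨k, rfl⟩]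
  have δn : ∀ k i, i ≠ j k → i ≠ j k + 2 → δ (Sum.inl (sp k i)) = 0 := by
    intro k i h1 h2
    simp only [δ]
    rw [if_neg, if_neg]
    · rintro ⟨k', e⟩
      obtain ⟨rfl, e⟩ := h.inj _ _ _ _ (Sum.inl_injective e); exact h2 e
    · rintro ⟨k', e⟩
      obtain ⟨rfl, e⟩ := h.inj _ _ _ _ (Sum.inl_injective e); exact h1 e
  have δbb : ∀ k, δ (Sum.inl (sp k (j k + 2))) = 1 := by
    intro k; simp only [δ]; rw [if_neg, if_pos ⟨k, rfl⟩]
    rintro ⟨k', e⟩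
    obtain ⟨rfl, e⟩ := h.inj _ _ _ _ (Sum.inl_injective e); exact f4n2 _ e
  have δ0 : ∀ v, (∀ k i, v ≠ Sum.inl (sp k i)) → δ v = 0 := by
    intro v hv
    simp only [δ]
    rw [if_neg, if_neg]
    · rintro ⟨k', e⟩; exact hv _ _ e
    · rintro ⟨k', e⟩; exact hv _ _ e
  let F : N ⊕ K × Fin 4 → ℝ := fun v => H (rep sp v) + η * δ v
  have Fl : ∀ u v, H (rep sp u) < H (rep sp v) → F u < F v := by
    intro u v hl
    have := hgap _ _ hl
    have a := (δb u).2
    have b := (δb v).1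
    simp only [F]
    nlinarith
  have tr : ∀ u v w, T0 u v w → rep sp u ≠ rep sp v → ∃ w', TS T sp sec j u v w' := by
    intro u v w t hne
    rcases TS.I7 (j' := j) t with t' | ⟨k, i, l, rfl, rfl⟩
    · exact ⟨_, t'⟩
    · exact absurd (by rw [rep_sp h, rep_sp h]) hne
  have neH : ∀ {u v}, H (rep sp u) < H (rep sp v) → rep sp u ≠ rep sp v := by
    intro u v hl e; rw [e] at hl; exact lt_irrefl _ hl
  have ab : ∀ k, F (Sum.inl (sp k (j k))) < F (Sum.inl (sp k (j k + 2))) := by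
    intro k
    simp only [F, rep_sp h, δa, δbb]
    linarith
  have adj_ab : ∀ k, (∃ w, TS T sp sec j (Sum.inl (sp k (j k))) (Sum.inl (sp k (j k + 2))) w) ∧ ∃ w, TS T sp sec j (Sum.inl (sp k (j k + 2))) (Sum.inl (sp k (j k))) w := by
    intro k
    have := TS.i3' h k (j k) (Or.inl rfl)
    exact ⟨⟨_, this⟩, (h.sphere j).pair this⟩
  refine ⟨j, F, ?_, ?_, ?_⟩
  · intro v hv
    simp only [F]
    rw [rep_self (hO v hv), δ0 v (hO v hv), H2 v hv]; ring
  · intro v hv hcd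
    by_cases hs : ∃ k i, v = Sum.inl (sp k i)
    · obtain ⟨k, i, rfl⟩ := hs
      have : i = j k ∨ i = j k + 2 := by
        have h1 : i ≠ j k + 1 := fun e => (hcd k).1 (by rw [e])
        have h2 : i ≠ j k + 3 := fun e => (hcd k).2 (by rw [e])
        clear * - h1 h2
        revert h1 h2; generalize j k = jj; revert i jj; decide
      rcases this with rfl | rfl
      · refine ⟨?_, _, _, (adj_ab k).1.choose_spec, ab k⟩
        obtain ⟨u, w, t, l⟩ := hlow k
        rw [← rep_sp h k (j k)] at l
        obtain ⟨w', t'⟩ := tr _ _ _ t (neH l).symm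
        exact ⟨u, w', t', Fl _ _ l⟩
      · refine ⟨⟨_, _, (adj_ab k).2.choose_spec, ab k⟩, ?_⟩
        obtain ⟨u, w, t, l⟩ := hhigh k
        rw [← rep_sp h k (j k + 2)] at l
        obtain ⟨w', t'⟩ := tr _ _ _ t (neH l)
        exact ⟨u, w', t', Fl _ _ l⟩
    · push Not at hs
      obtain ⟨⟨u, v', w, t, e, l⟩, ⟨u2, v2, w2, t2, e2, l2⟩⟩ := H3 v hv (fun k i _ => hs k i)
      obtain rfl := rep_eq_self h hs e
      have e2' := rep_eq_self h hs e2
      subst e2'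
      rw [← rep_self hs] at l l2
      rw [rep_self hs] at l l2
      have l' : H (rep sp v') < H (rep sp u2) := by rw [rep_self hs]; exact l
      have l2' : H (rep sp u2) < H (rep sp v2) := by rw [rep_self hs]; exact l2
      obtain ⟨w', t'⟩ := tr _ _ _ t (neH l').symm
      obtain ⟨w2', t2'⟩ := tr _ _ _ t2 (neH l2')
      exact ⟨⟨_, _, t', Fl _ _ l'⟩, ⟨_, _, t2', Fl _ _ l2'⟩⟩
  · intro k
    refine ⟨ab k, ?_, ?_⟩
    · simp only [F, rep_sp h, δa, δbb, δn k (j k + 1) (f4n1 _) (f4n12 _)]; ring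
    · have : j k + 3 ≠ j k + 2 := by generalize j k = jj; revert jj; decide
      simp only [F, rep_sp h, δa, δbb, δn k (j k + 3) (f4n3 _) this]; ring
end choice
end ICR

namespace ICR
open Classical Filter Topology
section solve
variable {W : Type*} [Fintype W]

theorem maxpr (O : Set W) (h s f : W → ℝ) (lo hi : W → W) (hs : ∀ v, v ∉ O → 0 < s v ∧ s v < 1 ∧ h v < h (hi v))
    (h0 : ∀ v ∈ O, f v = 0) (h1 : ∀ v, v ∉ O → f v = s v * f (lo v) + (1 - s v) * f (hi v)) : ∀ v, f v ≤ 0 := by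
  intro v0
  obtain ⟨m, -, hm⟩ := Finset.exists_max_image Finset.univ f ⟨v0, Finset.mem_univ _⟩
  obtain ⟨v, hv, hv'⟩ := Finset.exists_max_image (Finset.univ.filter fun v => f v = f m) h ⟨m, by simp⟩
  have hfv : f v = f m := (Finset.mem_filter.1 hv).2
  have hle : ∀ u, f u ≤ f v := fun u => hfv ▸ hm u (Finset.mem_univ _)
  by_cases hO : v ∈ O
  · exact (hle v0).trans (h0 v hO).le
  · obtain ⟨s0, s1, hl⟩ := hs v hO
    have e := h1 v hO
    have l1 := hle (lo v)
    have l2 := hle (hi v)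
    have : f (hi v) = f v := by nlinarith
    have := hv' (hi v) (Finset.mem_filter.2 ⟨Finset.mem_univ _, this.trans hfv⟩)
    linarith

theorem maxpr0 (O : Set W) (h s f : W → ℝ) (lo hi : W → W) (hs : ∀ v, v ∉ O → 0 < s v ∧ s v < 1 ∧ h v < h (hi v))
    (h0 : ∀ v ∈ O, f v = 0) (h1 : ∀ v, v ∉ O → f v = s v * f (lo v) + (1 - s v) * f (hi v)) : ∀ v, f v = 0 := by
  intro v
  have a := maxpr O h s f lo hi hs h0 h1 v
  have b := maxpr O h s (fun v => - f v) lo hi hs (fun v hv => by simp [h0 v hv]) (fun v hv => by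
    rw [h1 v hv]; ring) v
  linarith

theorem exists_x0 (O : Set W) (h s X : W → ℝ) (lo hi : W → W) (hs : ∀ v, v ∉ O → 0 < s v ∧ s v < 1 ∧ h v < h (hi v)) :
    ∃ f : W → ℝ, (∀ v ∈ O, f v = X v) ∧ ∀ v, v ∉ O → f v = s v * f (lo v) + (1 - s v) * f (hi v) := by
  let L : (W → ℝ) →ₗ[ℝ] (W → ℝ) :=
    { toFun := fun f v => if v ∈ O then f v else f v - (s v * f (lo v) + (1 - s v) * f (hi v))
      map_add' := by
        intro f g; ext v; simp only [Pi.add_apply]; split_ifs <;> ring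
      map_smul' := by
        intro r f; ext v; simp only [Pi.smul_apply, smul_eq_mul, RingHom.id_apply]; split_ifs <;> ring }
  have hLv : ∀ f v, L f v = if v ∈ O then f v else f v - (s v * f (lo v) + (1 - s v) * f (hi v)) := fun _ _ => rfl
  have inj : Function.Injective L := by
    rw [← LinearMap.ker_eq_bot, LinearMap.ker_eq_bot']
    intro f hf
    ext v
    refine maxpr0 O h s f lo hi hs ?_ ?_ v
    · intro v hv
      have := congrFun hf v
      rw [hLv, if_pos hv] at this
      exact this
    · intro v hv
      have := congrFun hf v
      rw [hLv, if_neg hv] at this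
      simp only [Pi.zero_apply] at this
      linarith
  obtain ⟨f, hf⟩ := LinearMap.injective_iff_surjective.1 inj (fun v => if v ∈ O then X v else 0)
  refine ⟨f, ?_, ?_⟩
  · intro v hv
    have := congrFun hf v
    rw [hLv, if_pos hv, if_pos hv] at this
    exact this
  · intro v hv
    have := congrFun hf v
    rw [hLv, if_neg hv, if_neg hv] at this
    linarith

/-- the residual of vertex `v` for one coordinate -/
noncomputable def Rs (A : W → W → ℝ) (O : Set W) (s : W → ℝ) (lo hi : W → W) (f μ : W → ℝ) (ε : ℝ) (v : W) : ℝ :=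
  if v ∈ O then f v else f v - ((1 - ε) * ((s v - μ v) * f (lo v) + (1 - s v + μ v) * f (hi v)) + ε * ∑ u, A v u * f u)

noncomputable def Qs (DD : Set W) (lo hi cc : W → W) (x y μ : W → ℝ) (v : W) : ℝ :=
  if v ∈ DD then (x v - x (cc v)) * (x (hi v) - x (lo v)) + (y v - y (cc v)) * (y (hi v) - y (lo v)) else μ v

abbrev EE (W : Type*) := (W → ℝ) × (W → ℝ) × (W → ℝ) × ℝ

noncomputable def Psi (A : W → W → ℝ) (O DD : Set W) (s : W → ℝ) (lo hi cc : W → W) (z : EE W) : EE W :=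
  (fun v => Rs A O s lo hi z.1 z.2.2.1 z.2.2.2 v, fun v => Rs A O s lo hi z.2.1 z.2.2.1 z.2.2.2 v,
    fun v => Qs DD lo hi cc z.1 z.2.1 z.2.2.1 v, z.2.2.2)

theorem Psi_cd (A : W → W → ℝ) (O DD : Set W) (s : W → ℝ) (lo hi cc : W → W) : ContDiff ℝ 1 (Psi A O DD s lo hi cc) := by
  have c1 : ∀ v, ContDiff ℝ 1 (fun z : EE W => z.1 v) := fun v => (contDiff_apply ℝ ℝ v).comp contDiff_fst
  have c2 : ∀ v, ContDiff ℝ 1 (fun z : EE W => z.2.1 v) := fun v => (contDiff_apply ℝ ℝ v).comp (contDiff_fst.comp contDiff_snd)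
  have c3 : ∀ v, ContDiff ℝ 1 (fun z : EE W => z.2.2.1 v) :=
    fun v => (contDiff_apply ℝ ℝ v).comp (contDiff_fst.comp (contDiff_snd.comp contDiff_snd))
  have c4 : ContDiff ℝ 1 (fun z : EE W => z.2.2.2) := contDiff_snd.comp (contDiff_snd.comp contDiff_snd)
  have R : ∀ (F : EE W → W → ℝ) (hF : ∀ v, ContDiff ℝ 1 (fun z => F z v)) v, ContDiff ℝ 1 (fun z : EE W => Rs A O s lo hi (F z) z.2.2.1 z.2.2.2 v) := by
    intro F hF v
    unfold Rs
    split_ifs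
    · exact hF v
    · refine (hF v).sub (((contDiff_const.sub c4).mul (((contDiff_const.sub (c3 v)).mul (hF _)).add ((contDiff_const.add (c3 v)).mul (hF _)))).add (c4.mul ?_))
      exact ContDiff.sum fun u _ => contDiff_const.mul (hF u)
  refine ContDiff.prodMk ?_ (ContDiff.prodMk ?_ (ContDiff.prodMk ?_ c4))
  · exact contDiff_pi.2 (R _ c1)
  · exact contDiff_pi.2 (R _ c2)
  · refine contDiff_pi.2 fun v => ?_
    unfold Qs
    split_ifs
    · exact (((c1 _).sub (c1 _)).mul ((c1 _).sub (c1 _))).add (((c2 _).sub (c2 _)).mul ((c2 _).sub (c2 _)))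
    · exact c3 v

theorem quad_deriv {f : ℝ → ℝ} {c0 c1 c2 : ℝ} (hf : ∀ t, f t = c0 + c1 * t + c2 * t ^ 2) {l : ℝ} (h : HasDerivAt f l 0) : l = c1 := by
  have : HasDerivAt (fun t : ℝ => c0 + c1 * t + c2 * t ^ 2) (0 + c1 * 1 + c2 * (2 * 0 ^ 1 * 1)) 0 :=
    ((hasDerivAt_const _ _).add ((hasDerivAt_id _).const_mul _)).add (((hasDerivAt_id (0:ℝ)).pow 2).const_mul _) |>.congr_deriv (by norm_num)
  have e : f = fun t : ℝ => c0 + c1 * t + c2 * t ^ 2 := funext hf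
  rw [e] at h
  have := h.unique this
  simpa using this

theorem solve0 (A : W → W → ℝ) (O DD : Set W) (h X s : W → ℝ) (lo hi cc : W → W)
    (hs : ∀ v, v ∉ O → 0 < s v ∧ s v < 1 ∧ h v < h (hi v) ∧ h v = s v * h (lo v) + (1 - s v) * h (hi v))
    (hD : ∀ v ∈ DD, v ∉ O ∧ cc v ∉ O ∧ cc v ∉ DD ∧ lo (cc v) = lo v ∧ hi (cc v) = hi v ∧ s v = 1/2 ∧ s (cc v) = 1/2) :
    ∃ (x y μ : W → ℝ) (ε : ℝ), 0 < ε ∧ ε < 1 ∧ (∀ v ∈ O, x v = X v ∧ y v = h v) ∧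
      (∀ v, v ∉ O → 0 < s v - μ v ∧ 0 < 1 - s v + μ v ∧
        x v = (1 - ε) * ((s v - μ v) * x (lo v) + (1 - s v + μ v) * x (hi v)) + ε * ∑ u, A v u * x u ∧
        y v = (1 - ε) * ((s v - μ v) * y (lo v) + (1 - s v + μ v) * y (hi v)) + ε * ∑ u, A v u * y u) ∧
      ∀ v ∈ DD, (x v - x (cc v)) * (x (hi v) - x (lo v)) + (y v - y (cc v)) * (y (hi v) - y (lo v)) = 0 ∧
        0 < (x (cc v) - x (lo v)) * (x (hi v) - x (lo v)) + (y (cc v) - y (lo v)) * (y (hi v) - y (lo v)) ∧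
        0 < (x (hi v) - x (cc v)) * (x (hi v) - x (lo v)) + (y (hi v) - y (cc v)) * (y (hi v) - y (lo v)) := by
  have hs' : ∀ v, v ∉ O → 0 < s v ∧ s v < 1 ∧ h v < h (hi v) := fun v hv => ⟨(hs v hv).1, (hs v hv).2.1, (hs v hv).2.2.1⟩
  obtain ⟨x0, hx0, hx1⟩ := exists_x0 O h s X lo hi hs'
  let z0 : EE W := (x0, h, 0, 0)
  have lohi : ∀ v, v ∉ O → h (lo v) < h (hi v) := by
    intro v hv
    obtain ⟨a, b, c, d⟩ := hs v hv
    nlinarith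
  have mid : ∀ (f : W → ℝ), (∀ v, v ∉ O → f v = s v * f (lo v) + (1 - s v) * f (hi v)) → ∀ v ∈ DD, f v = (f (lo v) + f (hi v)) / 2 ∧ f (cc v) = (f (lo v) + f (hi v)) / 2 := by
    intro f hf v hv
    obtain ⟨a1, a2, a3, a4, a5, a6, a7⟩ := hD v hv
    have e1 := hf _ a1
    have e2 := hf _ a2
    rw [a4, a5, a7] at e2
    rw [a6] at e1
    constructor
    · rw [e1]; ring
    · rw [e2]; ring
  have hh1 : ∀ v, v ∉ O → h v = s v * h (lo v) + (1 - s v) * h (hi v) := fun v hv => (hs v hv).2.2.2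
  have cd := Psi_cd A O DD s lo hi cc
  have hL := cd.contDiffAt.hasStrictFDerivAt (x := z0) (by norm_num)
  set L := fderiv ℝ (Psi A O DD s lo hi cc) z0 with hLdef
  have inj : Function.Injective (L : EE W →ₗ[ℝ] EE W) := by
    rw [← LinearMap.ker_eq_bot, LinearMap.ker_eq_bot']
    intro z hz
    have hz : L z = 0 := hz
    have hline : HasDerivAt (fun t : ℝ => z0 + t • z) z 0 := by
      have := ((hasDerivAt_id (0:ℝ)).smul_const z).const_add z0
      simpa using this
    have hd : HasDerivAt (fun t : ℝ => Psi A O DD s lo hi cc (z0 + t • z)) (0 : EE W) 0 := by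
      have h1 : HasFDerivAt (Psi A O DD s lo hi cc) L (z0 + (0:ℝ) • z) := by simpa using hL.hasFDerivAt
      have := h1.comp_hasDerivAt (0:ℝ) hline
      rw [hz] at this
      exact this
    have d1 : ∀ v, HasDerivAt (fun t : ℝ => (Psi A O DD s lo hi cc (z0 + t • z)).1 v) 0 0 := by
      intro v
      exact (((ContinuousLinearMap.proj (R := ℝ) (φ := fun _ : W => ℝ) v).comp (ContinuousLinearMap.fst ℝ (W → ℝ) ((W → ℝ) × (W → ℝ) × ℝ))).hasFDerivAt.comp_hasDerivAt (0:ℝ) hd)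
    have d2 : ∀ v, HasDerivAt (fun t : ℝ => (Psi A O DD s lo hi cc (z0 + t • z)).2.1 v) 0 0 := by
      intro v
      exact (((ContinuousLinearMap.proj (R := ℝ) (φ := fun _ : W => ℝ) v).comp ((ContinuousLinearMap.fst ℝ (W → ℝ) ((W → ℝ) × ℝ)).comp (ContinuousLinearMap.snd ℝ (W → ℝ) ((W → ℝ) × (W → ℝ) × ℝ)))).hasFDerivAt.comp_hasDerivAt (0:ℝ) hd)
    have d3 : ∀ v, HasDerivAt (fun t : ℝ => (Psi A O DD s lo hi cc (z0 + t • z)).2.2.1 v) 0 0 := by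
      intro v
      exact (((ContinuousLinearMap.proj (R := ℝ) (φ := fun _ : W => ℝ) v).comp ((ContinuousLinearMap.fst ℝ (W → ℝ) ℝ).comp ((ContinuousLinearMap.snd ℝ (W → ℝ) ((W → ℝ) × ℝ)).comp (ContinuousLinearMap.snd ℝ (W → ℝ) ((W → ℝ) × (W → ℝ) × ℝ))))).hasFDerivAt.comp_hasDerivAt (0:ℝ) hd)
    have d4 : HasDerivAt (fun t : ℝ => (Psi A O DD s lo hi cc (z0 + t • z)).2.2.2) 0 0 :=
      (((ContinuousLinearMap.snd ℝ (W → ℝ) ℝ).comp ((ContinuousLinearMap.snd ℝ (W → ℝ) ((W → ℝ) × ℝ)).comp (ContinuousLinearMap.snd ℝ (W → ℝ) ((W → ℝ) × (W → ℝ) × ℝ)))).hasFDerivAt.comp_hasDerivAt (0:ℝ) hd)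
    obtain ⟨x', y', μ', ε'⟩ := z
    have hε : ε' = 0 := by
      have := quad_deriv (c0 := 0) (c1 := ε') (c2 := 0) (fun t => by simp [Psi, z0]; ring) d4
      exact this.symm
    subst hε
    have RO : ∀ (f0 f' : W → ℝ) (v : W), v ∈ O → HasDerivAt (fun t : ℝ => Rs A O s lo hi (f0 + t • f') (t • μ') 0 v) 0 0 → f' v = 0 := by
      intro f0 f' v hv hd
      exact (quad_deriv (c0 := f0 v) (c1 := f' v) (c2 := 0) (fun t => by simp [Rs, hv]; ring) hd).symm
    have RI : ∀ (f0 f' : W → ℝ) (v : W), v ∉ O → HasDerivAt (fun t : ℝ => Rs A O s lo hi (f0 + t • f') (t • μ') 0 v) 0 0 →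
        f' v = s v * f' (lo v) + (1 - s v) * f' (hi v) + μ' v * (f0 (hi v) - f0 (lo v)) := by
      intro f0 f' v hv hd
      have := (quad_deriv (c0 := f0 v - (s v * f0 (lo v) + (1 - s v) * f0 (hi v))) (c1 := f' v - (s v * f' (lo v) + (1 - s v) * f' (hi v) + μ' v * (f0 (hi v) - f0 (lo v))))
        (c2 := - (μ' v * (f' (hi v) - f' (lo v)))) (fun t => by simp [Rs, hv]; ring) hd)
      linarith
    have e1 : ∀ v, HasDerivAt (fun t : ℝ => Rs A O s lo hi (x0 + t • x') (t • μ') 0 v) 0 0 := by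
      intro v
      have := d1 v
      simpa [Psi, z0] using this
    have e2 : ∀ v, HasDerivAt (fun t : ℝ => Rs A O s lo hi (h + t • y') (t • μ') 0 v) 0 0 := by
      intro v
      have := d2 v
      simpa [Psi, z0] using this
    have hμ : ∀ v, μ' v = 0 := by
      intro v
      have := d3 v
      by_cases hv : v ∈ DD
      · obtain ⟨a1, a2, a3, a4, a5, a6, a7⟩ := hD v hv
        have hc0 : μ' (cc v) = 0 := by
          have := quad_deriv (c0 := 0) (c1 := μ' (cc v)) (c2 := 0) (fun t => by simp [Psi, z0, Qs, a3]; ring) (d3 (cc v))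
          exact this.symm
        obtain ⟨m1, m2⟩ := mid x0 hx1 v hv
        obtain ⟨m3, m4⟩ := mid h hh1 v hv
        have := quad_deriv (c0 := 0) (c1 := (x' v - x' (cc v)) * (x0 (hi v) - x0 (lo v)) + (y' v - y' (cc v)) * (h (hi v) - h (lo v)))
          (c2 := (x' v - x' (cc v)) * (x' (hi v) - x' (lo v)) + (y' v - y' (cc v)) * (y' (hi v) - y' (lo v))) (fun t => by
            simp [Psi, z0, Qs, hv]; rw [m1, m2, m3, m4]; ring) this
        have r1 := RI x0 x' _ a1 (e1 _)
        have r2 := RI x0 x' _ a2 (e1 _)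
        have r3 := RI h y' _ a1 (e2 _)
        have r4 := RI h y' _ a2 (e2 _)
        rw [a4, a5, a7, hc0] at r2 r4
        rw [a6] at r1 r3
        have k1 : x' v - x' (cc v) = μ' v * (x0 (hi v) - x0 (lo v)) := by rw [r1, r2]; ring
        have k2 : y' v - y' (cc v) = μ' v * (h (hi v) - h (lo v)) := by rw [r3, r4]; ring
        rw [k1, k2] at this
        have pos : 0 < (x0 (hi v) - x0 (lo v)) ^ 2 + (h (hi v) - h (lo v)) ^ 2 := by
          have := lohi v a1
          have : 0 < h (hi v) - h (lo v) := by linarith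
          positivity
        have : μ' v * ((x0 (hi v) - x0 (lo v)) ^ 2 + (h (hi v) - h (lo v)) ^ 2) = 0 := by linarith
        rcases mul_eq_zero.1 this with m | m
        · exact m
        · exact absurd m pos.ne'
      · have := quad_deriv (c0 := 0) (c1 := μ' v) (c2 := 0) (fun t => by simp [Psi, z0, Qs, hv]; ring) this
        exact this.symm
    have x0' : ∀ v, x' v = 0 := by
      refine maxpr0 O h s x' lo hi hs' (fun v hv => RO x0 x' v hv (e1 v)) ?_
      intro v hv
      have := RI x0 x' v hv (e1 v)
      rw [hμ v] at this; linarith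
    have y0' : ∀ v, y' v = 0 := by
      refine maxpr0 O h s y' lo hi hs' (fun v hv => RO h y' v hv (e2 v)) ?_
      intro v hv
      have := RI h y' v hv (e2 v)
      rw [hμ v] at this; linarith
    have : x' = 0 := funext x0'
    have : y' = 0 := funext y0'
    have : μ' = 0 := funext hμ
    subst_vars
    rfl
  have surj : (L : EE W →ₗ[ℝ] EE W).range = ⊤ := LinearMap.range_eq_top.2 (LinearMap.injective_iff_surjective.1 inj)
  have map := hL.map_nhds_eq_of_surj surj
  -- the good neighbourhood
  have good : ∀ᶠ z : EE W in 𝓝 z0, (∀ v, v ∉ O → 0 < s v - z.2.2.1 v ∧ 0 < 1 - s v + z.2.2.1 v) ∧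
      ∀ v ∈ DD, 0 < (z.1 (cc v) - z.1 (lo v)) * (z.1 (hi v) - z.1 (lo v)) + (z.2.1 (cc v) - z.2.1 (lo v)) * (z.2.1 (hi v) - z.2.1 (lo v)) ∧
        0 < (z.1 (hi v) - z.1 (cc v)) * (z.1 (hi v) - z.1 (lo v)) + (z.2.1 (hi v) - z.2.1 (cc v)) * (z.2.1 (hi v) - z.2.1 (lo v)) := by
    refine Eventually.and ?_ ?_
    · rw [eventually_all]; intro v
      by_cases hv : v ∈ O
      · exact Eventually.of_forall fun _ a => absurd hv a
      have c1 : ContinuousAt (fun z : EE W => s v - z.2.2.1 v) z0 := by fun_prop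
      have c2 : ContinuousAt (fun z : EE W => 1 - s v + z.2.2.1 v) z0 := by fun_prop
      obtain ⟨a, b, _⟩ := hs v hv
      filter_upwards [c1.eventually (lt_mem_nhds (a := 0) (by simp [z0]; exact a)), c2.eventually (lt_mem_nhds (a := 0) (by simp [z0]; exact b))] with z h1 h2 _
      exact ⟨h1, h2⟩
    · rw [eventually_all]; intro v
      by_cases hv : v ∈ DD
      · have c1 : ContinuousAt (fun z : EE W => (z.1 (cc v) - z.1 (lo v)) * (z.1 (hi v) - z.1 (lo v)) + (z.2.1 (cc v) - z.2.1 (lo v)) * (z.2.1 (hi v) - z.2.1 (lo v))) z0 := by fun_prop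
        have c2 : ContinuousAt (fun z : EE W => (z.1 (hi v) - z.1 (cc v)) * (z.1 (hi v) - z.1 (lo v)) + (z.2.1 (hi v) - z.2.1 (cc v)) * (z.2.1 (hi v) - z.2.1 (lo v))) z0 := by fun_prop
        have pos : 0 < (x0 (hi v) - x0 (lo v)) ^ 2 + (h (hi v) - h (lo v)) ^ 2 := by
          have := lohi v (hD v hv).1
          have : 0 < h (hi v) - h (lo v) := by linarith
          positivity
        obtain ⟨m1, m2⟩ := mid x0 hx1 v hv
        obtain ⟨m3, m4⟩ := mid h hh1 v hv
        filter_upwards [c1.eventually (lt_mem_nhds (a := 0) (by simp only [z0]; rw [m2, m4]; nlinarith)), c2.eventually (lt_mem_nhds (a := 0) (by simp only [z0]; rw [m2, m4]; nlinarith))] with z h1 h2 _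
        exact ⟨h1, h2⟩
      · exact Eventually.of_forall fun _ a => absurd a hv
  have img : ∀ᶠ w in 𝓝 (Psi A O DD s lo hi cc z0), ∃ z : EE W, Psi A O DD s lo hi cc z = w ∧ ((∀ v, v ∉ O → 0 < s v - z.2.2.1 v ∧ 0 < 1 - s v + z.2.2.1 v) ∧
      ∀ v ∈ DD, 0 < (z.1 (cc v) - z.1 (lo v)) * (z.1 (hi v) - z.1 (lo v)) + (z.2.1 (cc v) - z.2.1 (lo v)) * (z.2.1 (hi v) - z.2.1 (lo v)) ∧
        0 < (z.1 (hi v) - z.1 (cc v)) * (z.1 (hi v) - z.1 (lo v)) + (z.2.1 (hi v) - z.2.1 (cc v)) * (z.2.1 (hi v) - z.2.1 (lo v))) := by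
    rw [← map]
    rw [eventually_map]
    filter_upwards [good] with z hz
    exact ⟨z, rfl, hz⟩
  have tgt : Tendsto (fun ε : ℝ => ((Psi A O DD s lo hi cc z0).1, (Psi A O DD s lo hi cc z0).2.1, (Psi A O DD s lo hi cc z0).2.2.1, ε)) (𝓝[>] 0) (𝓝 (Psi A O DD s lo hi cc z0)) := by
    have : Tendsto (fun ε : ℝ => ((Psi A O DD s lo hi cc z0).1, (Psi A O DD s lo hi cc z0).2.1, (Psi A O DD s lo hi cc z0).2.2.1, ε)) (𝓝 0) (𝓝 ((Psi A O DD s lo hi cc z0).1, (Psi A O DD s lo hi cc z0).2.1, (Psi A O DD s lo hi cc z0).2.2.1, 0)) :=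
      Continuous.tendsto (by fun_prop) 0
    exact this.mono_left nhdsWithin_le_nhds
  have ev1 : ∀ᶠ ε : ℝ in 𝓝[>] 0, 0 < ε ∧ ε < 1 :=
    eventually_mem_nhdsWithin.and (nhdsWithin_le_nhds (gt_mem_nhds one_pos))
  obtain ⟨ε, ⟨⟨x, y, μ, ε'⟩, hz, g1, g2⟩, e0, e1⟩ := ((tgt.eventually img).and ev1).exists
  have z1 : ∀ v, Rs A O s lo hi x μ ε' v = Rs A O s lo hi x0 0 0 v := fun v => congrFun (congrArg Prod.fst hz) v
  have z2 : ∀ v, Rs A O s lo hi y μ ε' v = Rs A O s lo hi h 0 0 v := fun v => congrFun (congrArg (fun q => q.2.1) hz) v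
  have z3 : ∀ v, Qs DD lo hi cc x y μ v = Qs DD lo hi cc x0 h 0 v := fun v => congrFun (congrArg (fun q => q.2.2.1) hz) v
  have z4 : ε' = ε := congrArg (fun q => q.2.2.2) hz
  subst z4
  refine ⟨x, y, μ, ε', e0, e1, ?_, ?_, ?_⟩
  · intro v hv
    have a := z1 v
    have b := z2 v
    simp only [Rs, if_pos hv] at a b
    exact ⟨a.trans (hx0 v hv), b⟩
  · intro v hv
    obtain ⟨k1, k2⟩ := g1 v hv
    have a := z1 v
    have b := z2 v
    have a' := hx1 v hv
    have b' := hh1 v hv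
    simp only [Rs, if_neg hv, Pi.zero_apply] at a b
    refine ⟨k1, k2, ?_, ?_⟩
    · linarith
    · linarith
  · intro v hv
    obtain ⟨k1, k2⟩ := g2 v hv
    refine ⟨?_, k1, k2⟩
    have c := z3 v
    simp only [Qs, if_pos hv] at c
    rw [c]
    obtain ⟨m1, m2⟩ := mid x0 hx1 v hv
    obtain ⟨m3, m4⟩ := mid h hh1 v hv
    rw [m1, m2, m3, m4]; ring
end solve
end ICR

namespace ICR
open Classical Filter Topology
section avg
variable {W : Type*} [Fintype W]
theorem avg_lt (A : W → ℝ) (f : W → ℝ) (c ε r1 r2 l1 l2 : ℝ) (adj : W → Prop) (hA : ∀ u, adj u → 0 < A u) (hA0 : ∀ u, ¬ adj u → A u = 0)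
    (hA1 : ∑ u, A u = 1) (he : 0 < ε) (he1 : ε < 1) (h1 : 0 < r1) (h2 : 0 < r2) (h12 : r1 + r2 = 1) (hl1 : c ≤ l1) (hl2 : c ≤ l2)
    (hc : c = (1 - ε) * (r1 * l1 + r2 * l2) + ε * ∑ u, A u * f u) (hle : ∀ u, adj u → c ≤ f u) (hne : ∃ u, adj u ∧ f u ≠ c) : False := by
  obtain ⟨u0, a0, n0⟩ := hne
  have lt : c < ∑ u, A u * f u := by
    have : ∑ u, A u * c < ∑ u, A u * f u := by
      refine Finset.sum_lt_sum ?_ ⟨u0, Finset.mem_univ _, ?_⟩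
      · intro u _
        by_cases hu : adj u
        · exact mul_le_mul_of_nonneg_left (hle u hu) (hA u hu).le
        · rw [hA0 u hu]; simp
      · exact mul_lt_mul_of_pos_left (lt_of_le_of_ne (hle u0 a0) n0.symm) (hA u0 a0)
    rwa [← Finset.sum_mul, hA1, one_mul] at this
  have k : c ≤ r1 * l1 + r2 * l2 := by
    have k1 := mul_le_mul_of_nonneg_left hl1 h1.le
    have k2 := mul_le_mul_of_nonneg_left hl2 h2.le
    have k3 : c = r1 * c + r2 * c := by rw [← add_mul, h12, one_mul]
    linarith
  have k4 := mul_le_mul_of_nonneg_left k (sub_nonneg.2 he1.le)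
  have k5 := mul_lt_mul_of_pos_left lt he
  nlinarith
end avg

theorem quad_conv {a b c d : ℝ × ℝ} (h1 : 0 < D a c b) (h2 : 0 < D b d a)
    (hp : (d.1 - c.1) * (b.1 - a.1) + (d.2 - c.2) * (b.2 - a.2) = 0)
    (h3 : 0 < (c.1 - a.1) * (b.1 - a.1) + (c.2 - a.2) * (b.2 - a.2))
    (h4 : 0 < (b.1 - c.1) * (b.1 - a.1) + (b.2 - c.2) * (b.2 - a.2)) : 0 < D c b d ∧ 0 < D d a c := by
  have k : 0 < (b.1 - a.1) * (d.2 - c.2) - (b.2 - a.2) * (d.1 - c.1) := by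
    unfold D at *; nlinarith
  have n : 0 < (b.1 - a.1) ^ 2 + (b.2 - a.2) ^ 2 := by nlinarith
  have e1 : ((b.1 - a.1) ^ 2 + (b.2 - a.2) ^ 2) * D c b d = ((b.1 - c.1) * (b.1 - a.1) + (b.2 - c.2) * (b.2 - a.2)) * ((b.1 - a.1) * (d.2 - c.2) - (b.2 - a.2) * (d.1 - c.1))
     + (-(b.1 - a.1) * (b.2 - c.2) + (b.2 - a.2) * (b.1 - c.1)) * ((d.1 - c.1) * (b.1 - a.1) + (d.2 - c.2) * (b.2 - a.2)) := by unfold D; ring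
  have e2 : ((b.1 - a.1) ^ 2 + (b.2 - a.2) ^ 2) * D d a c = ((c.1 - a.1) * (b.1 - a.1) + (c.2 - a.2) * (b.2 - a.2)) * ((b.1 - a.1) * (d.2 - c.2) - (b.2 - a.2) * (d.1 - c.1))
     + (-(b.1 - a.1) * (c.2 - a.2) + (b.2 - a.2) * (c.1 - a.1)) * ((d.1 - c.1) * (b.1 - a.1) + (d.2 - c.2) * (b.2 - a.2)) := by unfold D; ring
  rw [hp, mul_zero, add_zero] at e1 e2
  constructor
  · have := mul_pos h4 k
    rw [← e1] at this
    exact (mul_pos_iff_of_pos_left n).1 this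
  · have := mul_pos h3 k
    rw [← e2] at this
    exact (mul_pos_iff_of_pos_left n).1 this

section draw
variable {N K : Type*} [Fintype N] [Fintype K] {T : N ⊕ K → N ⊕ K → N ⊕ K → Prop} {sp : K → Fin 4 → N}
  {sec : K → N ⊕ K → Fin 4}

theorem drawing1 (h : KD T sp sec) {o0 o1 o2 : N ⊕ K × Fin 4} (ht : ∀ j, TS T sp sec j o0 o2 o1)
    (hO : ∀ v, Outer o0 o1 o2 v → ∀ k i, v ≠ Sum.inl (sp k i)) :
    ∃ (j : K → Fin 4) (p : N ⊕ K × Fin 4 → ℝ × ℝ), Pos (TS T sp sec j) o0 o1 o2 p ∧ ∀ k (a b c d : ℝ × ℝ), a = p (Sum.inl (sp k (j k))) →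
      c = p (Sum.inl (sp k (j k + 1))) → b = p (Sum.inl (sp k (j k + 2))) → d = p (Sum.inl (sp k (j k + 3))) →
      (d.1 - c.1) * (b.1 - a.1) + (d.2 - c.2) * (b.2 - a.2) = 0 ∧
      0 < (c.1 - a.1) * (b.1 - a.1) + (c.2 - a.2) * (b.2 - a.2) ∧
      0 < (b.1 - c.1) * (b.1 - a.1) + (b.2 - c.2) * (b.2 - a.2) := by
  have S0 := h.sphere (fun _ => 0)
  have t0 := ht (fun _ => 0)
  have n02 : o0 ≠ o2 := S0.ne t0
  have n21 : o2 ≠ o1 := S0.ne (S0.rot t0)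
  have n10 : o1 ≠ o0 := S0.ne (S0.rot (S0.rot t0))
  set g : N ⊕ K × Fin 4 → ℝ := fun v => if v = o0 then 0 else if v = o1 then 1 else 2 with hg
  set X : N ⊕ K × Fin 4 → ℝ := fun v => if v = o1 then 1 else 0 with hX
  have g0 : g o0 = 0 := by simp [hg]
  have g1 : g o1 = 1 := by simp [hg, n10]
  have g2 : g o2 = 2 := by simp [hg, n02.symm, n21]
  have ginj : Set.InjOn g {v | Outer o0 o1 o2 v} := by
    intro u hu v hv e
    simp only [Outer, Set.mem_ofPred_eq] at hu hv
    rcases hu with rfl | rfl | rfl <;> rcases hv with rfl | rfl | rfl <;> first | rfl | (exfalso; linarith)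
  obtain ⟨j, H, H1, H2, H3⟩ := choice h ht hO g ginj
  have S := h.sphere j
  set adj : N ⊕ K × Fin 4 → N ⊕ K × Fin 4 → Prop := fun v u => ∃ w, TS T sp sec j v u w with hadj
  have spinj : ∀ {k i k' i'}, (Sum.inl (sp k i) : N ⊕ K × Fin 4) = Sum.inl (sp k' i') → k = k' ∧ i = i' := fun e => h.inj _ _ _ _ (Sum.inl_injective e)
  have LH : ∀ v, ∃ l u s, ¬ Outer o0 o1 o2 v → adj v l ∧ adj v u ∧ 0 < s ∧ s < 1 ∧ H v < H u ∧ H v = s * H l + (1 - s) * H u ∧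
      ∀ k, (v = Sum.inl (sp k (j k + 1)) ∨ v = Sum.inl (sp k (j k + 3))) → l = Sum.inl (sp k (j k)) ∧ u = Sum.inl (sp k (j k + 2)) ∧ s = 1/2 := by
    intro v
    by_cases hk : ∃ k, v = Sum.inl (sp k (j k + 1)) ∨ v = Sum.inl (sp k (j k + 3))
    · obtain ⟨k, hk⟩ := hk
      refine ⟨Sum.inl (sp k (j k)), Sum.inl (sp k (j k + 2)), 1/2, fun _ => ⟨?_, ?_, by norm_num, by norm_num, ?_, ?_, ?_⟩⟩
      · rcases hk with rfl | rfl
        · obtain ⟨w, hw⟩ := TS.side (j := j) h k (j k)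
          exact S.adj_symm ⟨w, hw⟩
        · have := TS.side (j := j) h k (j k + 3)
          rwa [f4a] at this
      · rcases hk with rfl | rfl
        · have := TS.side (j := j) h k (j k + 1)
          rwa [f4d] at this
        · have := TS.side (j := j) h k (j k + 2)
          rw [f4e] at this
          exact S.adj_symm this
      · obtain ⟨a, b, c⟩ := H3 k
        rcases hk with rfl | rfl
        · rw [b]; linarith
        · rw [c]; linarith
      · obtain ⟨a, b, c⟩ := H3 k
        rcases hk with rfl | rfl
        · rw [b]; ring
        · rw [c]; ring
      · intro k' hk'
        have : k = k' := by
          rcases hk with rfl | rfl <;> rcases hk' with e | e <;> exact (spinj e).1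
        subst this
        exact ⟨rfl, rfl, rfl⟩
    · by_cases ho : Outer o0 o1 o2 v
      · exact ⟨v, v, 0, fun h => absurd ho h⟩
      push Not at hk
      obtain ⟨⟨l, w, tl, ll⟩, ⟨u, w', tu, lu⟩⟩ := H2 v ho hk
      refine ⟨l, u, (H u - H v) / (H u - H l), fun _ => ⟨⟨w, tl⟩, ⟨w', tu⟩, ?_, ?_, lu, ?_, ?_⟩⟩
      · apply div_pos <;> linarith
      · rw [div_lt_one (by linarith)]; linarith
      · have : H u - H l ≠ 0 := by linarith
        field_simp; ring
      · intro k e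
        rcases e with e | e
        · exact absurd e (hk k).1
        · exact absurd e (hk k).2
  choose lo hi s hs using LH
  have CC : ∀ v : N ⊕ K × Fin 4, ∃ c : N ⊕ K × Fin 4, ∀ k, v = Sum.inl (sp k (j k + 3)) → c = Sum.inl (sp k (j k + 1)) := by
    intro v
    by_cases hk : ∃ k, v = Sum.inl (sp k (j k + 3))
    · obtain ⟨k, rfl⟩ := hk
      refine ⟨Sum.inl (sp k (j k + 1)), ?_⟩
      intro k' e
      rw [(spinj e).1]
    · push Not at hk
      exact ⟨v, fun k e => absurd e (hk k)⟩
  choose cc hcc using CC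
  set dg : N ⊕ K × Fin 4 → ℝ := fun v => ∑ u, if adj v u then (1:ℝ) else 0 with hdg
  have dpos : ∀ v, 0 < dg v := by
    intro v
    obtain ⟨u, w, t⟩ := S.vtx v
    refine Finset.sum_pos' (fun u _ => by split_ifs <;> norm_num) ⟨u, Finset.mem_univ _, ?_⟩
    rw [if_pos ⟨w, t⟩]; norm_num
  set A : N ⊕ K × Fin 4 → N ⊕ K × Fin 4 → ℝ := fun v u => (if adj v u then (1:ℝ) else 0) / dg v with hA
  obtain ⟨x, y, μ, ε, e0, e1, xO, xI, xD⟩ := solve0 A {v | Outer o0 o1 o2 v} {v | ∃ k, v = Sum.inl (sp k (j k + 3))} H X s lo hi cc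
    (by
      intro v hv
      obtain ⟨_, _, a, b, c, d, _⟩ := hs v hv
      exact ⟨a, b, c, d⟩)
    (by
      rintro v ⟨k, rfl⟩
      have o3 : ¬ Outer o0 o1 o2 (Sum.inl (sp k (j k + 3))) := fun h => hO _ h _ _ rfl
      have o1' : ¬ Outer o0 o1 o2 (Sum.inl (sp k (j k + 1))) := fun h => hO _ h _ _ rfl
      obtain ⟨a1, a2, a3⟩ := (hs _ o3).2.2.2.2.2.2 k (Or.inr rfl)
      obtain ⟨b1, b2, b3⟩ := (hs _ o1').2.2.2.2.2.2 k (Or.inl rfl)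
      rw [hcc _ k rfl, a1, a2, a3, b1, b2, b3]
      refine ⟨o3, o1', ?_, rfl, rfl, rfl, rfl⟩
      rintro ⟨k', e⟩
      obtain ⟨rfl, e⟩ := spinj e
      revert e
      generalize j k = q
      revert q; decide)
  refine ⟨j, fun v => (x v, y v), ?_, ?_⟩
  · refine tutte S (ht j) ?_ ?_
    · have a0 := xO o0 (Or.inl rfl)
      have a1 := xO o1 (Or.inr (Or.inl rfl))
      have a2 := xO o2 (Or.inr (Or.inr rfl))
      simp only [D]
      rw [a0.1, a0.2, a1.1, a1.2, a2.1, a2.2, H1 o0 (Or.inl rfl), H1 o1 (Or.inr (Or.inl rfl)), H1 o2 (Or.inr (Or.inr rfl)), g0, g1, g2]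
      simp [hX, n10.symm, n21]
    · intro v hv a b ⟨u0, w0, t0, ne0⟩
      obtain ⟨q1, q2, q3, q4⟩ := xI v hv
      obtain ⟨b1, b2, -⟩ := hs v hv
      have hAp : ∀ u, adj v u → 0 < A v u := fun u hu => by
        simp only [hA, if_pos hu]; exact div_pos one_pos (dpos v)
      have hA0 : ∀ u, ¬ adj v u → A v u = 0 := fun u hu => by
        simp only [hA, if_neg hu, zero_div]
      have hA1 : ∑ u, A v u = 1 := by
        simp only [hA]
        rw [← Finset.sum_div]
        exact div_self (dpos v).ne'
      have key : ∀ a b : ℝ, (∃ u, adj v u ∧ lin a b (x u, y u) ≠ lin a b (x v, y v)) → ∃ u w, TS T sp sec j v u w ∧ lin a b (x u, y u) < lin a b (x v, y v) := by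
        intro a b hne
        by_contra hcon
        push Not at hcon
        refine avg_lt (A v) (fun u => lin a b (x u, y u)) (lin a b (x v, y v)) ε (s v - μ v) (1 - s v + μ v) (lin a b (x (lo v), y (lo v))) (lin a b (x (hi v), y (hi v))) (adj v) hAp hA0 hA1 e0 e1 q1 q2 (by ring)
          ?_ ?_ ?_ ?_ hne
        · obtain ⟨w, b1⟩ := b1
          exact hcon _ w b1
        · obtain ⟨w, b2⟩ := b2
          exact hcon _ w b2
        · have : ∑ u, A v u * lin a b (x u, y u) = a * ∑ u, A v u * x u + b * ∑ u, A v u * y u := by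
            rw [Finset.mul_sum, Finset.mul_sum, ← Finset.sum_add_distrib]
            refine Finset.sum_congr rfl fun u _ => ?_
            simp only [lin]; ring
          rw [this]
          simp only [lin]
          rw [q3, q4]
          generalize ∑ u, A v u * x u = z1
          generalize ∑ u, A v u * y u = z2
          ring
        · rintro u ⟨w, hu⟩
          exact hcon u w hu
      refine ⟨key a b ⟨u0, ⟨w0, t0⟩, ne0⟩, ?_⟩
      have neg : ∀ q, lin (-a) (-b) q = - lin a b q := fun q => by simp only [lin]; ring
      obtain ⟨u, w, t, l⟩ := key (-a) (-b) ⟨u0, ⟨w0, t0⟩, by rw [neg, neg]; exact fun e => ne0 (neg_injective e)⟩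
      rw [neg, neg] at l
      exact ⟨u, w, t, neg_lt_neg_iff.1 l⟩
  · rintro k a b c d rfl rfl rfl rfl
    have o3 : ¬ Outer o0 o1 o2 (Sum.inl (sp k (j k + 3))) := fun h => hO _ h _ _ rfl
    obtain ⟨a1, a2, a3⟩ := (hs _ o3).2.2.2.2.2.2 k (Or.inr rfl)
    have := xD _ ⟨k, rfl⟩
    rw [hcc _ k rfl, a1, a2] at this
    exact this

theorem drawing2 (h : KD T sp sec) {o0 o1 o2 : N ⊕ K × Fin 4} (ht : ∀ j, TS T sp sec j o0 o2 o1)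
    (hO : ∀ v, Outer o0 o1 o2 v → ∀ k i, v ≠ Sum.inl (sp k i)) :
    ∃ (p : N ⊕ K × Fin 4 → ℝ × ℝ), (∀ j, Pos (TS T sp sec j) o0 o1 o2 p) ∧ ∀ k (a b c d : ℝ × ℝ), a = p (Sum.inl (sp k 0)) →
      c = p (Sum.inl (sp k 1)) → b = p (Sum.inl (sp k 2)) → d = p (Sum.inl (sp k 3)) →
      (d.1 - c.1) * (b.1 - a.1) + (d.2 - c.2) * (b.2 - a.2) = 0 := by
  obtain ⟨j, p, hp, hq⟩ := drawing1 h ht hO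
  refine ⟨p, ?_, ?_⟩
  · intro j'
    refine ⟨hp.1, ?_⟩
    intro u v w t
    rcases t with t | t | ⟨k, i, hi, t⟩
    · exact hp.2 u v w (Or.inl t)
    · exact hp.2 u v w (Or.inr (Or.inl t))
    · by_cases hi2 : i = j k ∨ i = j k + 2
      · exact hp.2 u v w (Or.inr (Or.inr ⟨k, i, hi2, t⟩))
      right
      obtain ⟨b1, b2, b3⟩ := hq k _ _ _ _ rfl rfl rfl rfl
      have nO : ∀ k i u v, ¬ IsOut o0 o1 o2 (Sum.inl (sp k i)) u v := by
        rintro k i u v (e | e | e)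
        · exact hO _ (Or.inl rfl) k i e.1.symm
        · exact hO _ (Or.inr (Or.inr rfl)) k i e.1.symm
        · exact hO _ (Or.inr (Or.inl rfl)) k i e.1.symm
      have c1 := (hp.2 _ _ _ (TS.i3 k (j k) (Or.inl rfl))).resolve_left (nO _ _ _ _)
      have c2 := (hp.2 _ _ _ (TS.i3 k (j k + 2) (Or.inr rfl))).resolve_left (nO _ _ _ _)
      rw [f4c, f4e] at c2
      obtain ⟨d1, d2⟩ := quad_conv c1 c2 b1 b2 b3
      have : 0 < D (p (Sum.inl (sp k i))) (p (Sum.inl (sp k (i+1)))) (p (Sum.inl (sp k (i+2)))) := by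
        have : i = j k + 1 ∨ i = j k + 3 := by
          clear t hi; revert hi2; generalize j k = q; revert i q; decide
        rcases this with rfl | rfl
        · rwa [f4d, f4f]
        · rwa [f4a, f4g]
      rcases t with ⟨rfl, rfl, rfl⟩ | ⟨rfl, rfl, rfl⟩ | ⟨rfl, rfl, rfl⟩
      · exact this
      · unfold D at *; linarith
      · unfold D at *; linarith
  · rintro k a b c d rfl rfl rfl rfl
    obtain ⟨b1, -, -⟩ := hq k _ _ _ _ rfl rfl rfl rfl
    revert b1
    generalize j k = q
    fin_cases q <;> intro b1
    · exact b1
    · simp only [Fin.mk_one, show (1 : Fin 4) + 1 = 2 from rfl, show (1 : Fin 4) + 2 = 3 from rfl, show (1 : Fin 4) + 3 = 0 from rfl] at b1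
      linarith
    · change (((p (Sum.inl (sp k 1))).1 - (p (Sum.inl (sp k 3))).1) * ((p (Sum.inl (sp k 0))).1 - (p (Sum.inl (sp k 2))).1) + ((p (Sum.inl (sp k 1))).2 - (p (Sum.inl (sp k 3))).2) * ((p (Sum.inl (sp k 0))).2 - (p (Sum.inl (sp k 2))).2)) = 0 at b1
      linarith
    · change (((p (Sum.inl (sp k 2))).1 - (p (Sum.inl (sp k 0))).1) * ((p (Sum.inl (sp k 1))).1 - (p (Sum.inl (sp k 3))).1) + ((p (Sum.inl (sp k 2))).2 - (p (Sum.inl (sp k 0))).2) * ((p (Sum.inl (sp k 1))).2 - (p (Sum.inl (sp k 3))).2)) = 0 at b1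
      linarith
end draw
end ICR

namespace ICR
open Classical Filter Topology
section draw
variable {N K : Type*} [Fintype N] [Fintype K] {T : N ⊕ K → N ⊕ K → N ⊕ K → Prop} {sp : K → Fin 4 → N}
  {sec : K → N ⊕ K → Fin 4}

/-- replace the fourth corner by the one determined by a perpendicularity parameter -/
noncomputable def Phi (sp : K → Fin 4 → N) (z : (N ⊕ K × Fin 4 → ℝ × ℝ) × (K → ℝ)) (v : N ⊕ K × Fin 4) : ℝ × ℝ :=
  if h : ∃ k, v = Sum.inl (sp k 3) then
    ((z.1 (Sum.inl (sp h.choose 1))).1 - z.2 h.choose * ((z.1 (Sum.inl (sp h.choose 2))).2 - (z.1 (Sum.inl (sp h.choose 0))).2),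
     (z.1 (Sum.inl (sp h.choose 1))).2 + z.2 h.choose * ((z.1 (Sum.inl (sp h.choose 2))).1 - (z.1 (Sum.inl (sp h.choose 0))).1))
  else z.1 v

theorem Phi_cont (v) : Continuous (fun z => Phi sp z v) := by
  unfold Phi
  split_ifs <;> fun_prop

theorem Phi_3 (h : KD T sp sec) (z) (k) : Phi sp z (Sum.inl (sp k 3)) =
    ((z.1 (Sum.inl (sp k 1))).1 - z.2 k * ((z.1 (Sum.inl (sp k 2))).2 - (z.1 (Sum.inl (sp k 0))).2),
     (z.1 (Sum.inl (sp k 1))).2 + z.2 k * ((z.1 (Sum.inl (sp k 2))).1 - (z.1 (Sum.inl (sp k 0))).1)) := by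
  have hx : ∃ k', (Sum.inl (sp k 3) : N ⊕ K × Fin 4) = Sum.inl (sp k' 3) := ⟨k, rfl⟩
  have e : hx.choose = k := (h.inj _ _ _ _ (Sum.inl_injective hx.choose_spec)).1.symm
  unfold Phi
  rw [dif_pos hx, e]

theorem Phi_n (h : KD T sp sec) (z) (k i) (hi : i ≠ 3) : Phi sp z (Sum.inl (sp k i)) = z.1 (Sum.inl (sp k i)) := by
  unfold Phi
  rw [dif_neg]
  rintro ⟨k', e⟩
  exact hi (h.inj _ _ _ _ (Sum.inl_injective e)).2

theorem D_scale (n : ℝ) (a b c : ℝ × ℝ) : D (n * a.1, n * a.2) (n * b.1, n * b.2) (n * c.1, n * c.2) = n ^ 2 * D a b c := by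
  unfold D; ring

theorem common_den {W : Type*} [Fintype W] (r : W → ℚ × ℚ) : ∃ n : ℕ, 0 < n ∧ ∀ v, ∃ a b : ℤ, ((n : ℝ) * ((r v).1 : ℝ), (n : ℝ) * ((r v).2 : ℝ)) = ((a : ℝ), (b : ℝ)) := by
  refine ⟨∏ v, (r v).1.den * (r v).2.den, Finset.prod_pos fun v _ => Nat.mul_pos (Rat.den_pos _) (Rat.den_pos _), ?_⟩
  intro v
  obtain ⟨m, hm⟩ : (r v).1.den * (r v).2.den ∣ ∏ v, (r v).1.den * (r v).2.den := Finset.dvd_prod_of_mem _ (Finset.mem_univ v)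
  rw [hm]
  have a1 : ((r v).1.den : ℚ) * (r v).1 = (r v).1.num := by rw [mul_comm]; exact Rat.mul_den_eq_num _
  have a2 : ((r v).2.den : ℚ) * (r v).2 = (r v).2.num := by rw [mul_comm]; exact Rat.mul_den_eq_num _
  have a1' : ((r v).1.den : ℝ) * ((r v).1 : ℝ) = ((r v).1.num : ℝ) := by exact_mod_cast a1
  have a2' : ((r v).2.den : ℝ) * ((r v).2 : ℝ) = ((r v).2.num : ℝ) := by exact_mod_cast a2
  refine ⟨(r v).2.den * m * (r v).1.num, (r v).1.den * m * (r v).2.num, ?_⟩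
  push_cast
  rw [← a1', ← a2']
  ext <;> simp only <;> ring

theorem drawing (h : KD T sp sec) {o0 o1 o2 : N ⊕ K × Fin 4} (ht : ∀ j, TS T sp sec j o0 o2 o1)
    (hO : ∀ v, Outer o0 o1 o2 v → ∀ k i, v ≠ Sum.inl (sp k i)) :
    ∃ (p : N ⊕ K × Fin 4 → ℝ × ℝ), (∀ j, Pos (TS T sp sec j) o0 o1 o2 p) ∧ (∀ k (a b c d : ℝ × ℝ), a = p (Sum.inl (sp k 0)) →
      c = p (Sum.inl (sp k 1)) → b = p (Sum.inl (sp k 2)) → d = p (Sum.inl (sp k 3)) →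
      (d.1 - c.1) * (b.1 - a.1) + (d.2 - c.2) * (b.2 - a.2) = 0) ∧ ∀ v, ∃ a b : ℤ, p v = ((a : ℝ), (b : ℝ)) := by
  obtain ⟨p, hp, hq⟩ := drawing2 h ht hO
  have T0 : ∀ k, ∃ t : ℝ, p (Sum.inl (sp k 3)) = ((p (Sum.inl (sp k 1))).1 - t * ((p (Sum.inl (sp k 2))).2 - (p (Sum.inl (sp k 0))).2),
     (p (Sum.inl (sp k 1))).2 + t * ((p (Sum.inl (sp k 2))).1 - (p (Sum.inl (sp k 0))).1)) := by
    intro k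
    have ne : p (Sum.inl (sp k 0)) ≠ p (Sum.inl (sp k 2)) := (hp (fun _ => 0)).pne (TS.i3' h k 0 (Or.inl rfl))
    have := hq k _ _ _ _ rfl rfl rfl rfl
    set a := p (Sum.inl (sp k 0))
    set b := p (Sum.inl (sp k 2))
    set c := p (Sum.inl (sp k 1))
    set d := p (Sum.inl (sp k 3))
    have n : 0 < (b.1 - a.1) ^ 2 + (b.2 - a.2) ^ 2 := by
      by_contra hc
      have h1 : (b.1 - a.1) = 0 := by nlinarith [sq_nonneg (b.1 - a.1), sq_nonneg (b.2 - a.2)]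
      have h2 : (b.2 - a.2) = 0 := by nlinarith [sq_nonneg (b.1 - a.1), sq_nonneg (b.2 - a.2)]
      exact ne (Prod.ext (by linarith) (by linarith))
    refine ⟨((b.1 - a.1) * (d.2 - c.2) - (b.2 - a.2) * (d.1 - c.1)) / ((b.1 - a.1) ^ 2 + (b.2 - a.2) ^ 2), Prod.ext ?_ ?_⟩
    · simp only
      have e : d.1 - c.1 = - (((b.1 - a.1) * (d.2 - c.2) - (b.2 - a.2) * (d.1 - c.1)) / ((b.1 - a.1) ^ 2 + (b.2 - a.2) ^ 2) * (b.2 - a.2)) := by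
        rw [div_mul_eq_mul_div, ← neg_div, eq_div_iff n.ne']
        linear_combination (b.1 - a.1) * this
      linarith
    · simp only
      have e : d.2 - c.2 = (((b.1 - a.1) * (d.2 - c.2) - (b.2 - a.2) * (d.1 - c.1)) / ((b.1 - a.1) ^ 2 + (b.2 - a.2) ^ 2) * (b.1 - a.1)) := by
        rw [div_mul_eq_mul_div, eq_div_iff n.ne']
        linear_combination (b.2 - a.2) * this
      linarith
  choose t0 ht0 using T0
  have P0 : Phi sp (p, t0) = p := by
    funext v
    by_cases hv : ∃ k, v = Sum.inl (sp k 3)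
    · obtain ⟨k, rfl⟩ := hv
      rw [Phi_3 h, ht0]
    · unfold Phi; rw [dif_neg hv]
  have ev : ∀ᶠ z in 𝓝 (p, t0), ∀ j, Pos (TS T sp sec j) o0 o1 o2 (Phi sp z) := by
    rw [eventually_all]
    intro j
    refine (hp j).eventually (Phi sp) fun w => ?_
    have := (Phi_cont (sp := sp) w).tendsto (p, t0)
    rwa [P0] at this
  have dn : DenseRange (Prod.map (Pi.map fun _ => Prod.map (Rat.cast : ℚ → ℝ) (Rat.cast : ℚ → ℝ)) (Pi.map fun _ => (Rat.cast : ℚ → ℝ)) :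
      (N ⊕ K × Fin 4 → ℚ × ℚ) × (K → ℚ) → (N ⊕ K × Fin 4 → ℝ × ℝ) × (K → ℝ)) := by
    refine DenseRange.prodMap (DenseRange.piMap fun _ => DenseRange.prodMap ?_ ?_) (DenseRange.piMap fun _ => ?_) <;> exact Rat.denseRange_cast
  obtain ⟨_, ⟨⟨r, t⟩, rfl⟩, hz⟩ := dn.inter_nhds_nonempty ev
  set z := (Prod.map (Pi.map fun _ => Prod.map (Rat.cast : ℚ → ℝ) (Rat.cast : ℚ → ℝ)) (Pi.map fun _ => (Rat.cast : ℚ → ℝ)) :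
      (N ⊕ K × Fin 4 → ℚ × ℚ) × (K → ℚ) → (N ⊕ K × Fin 4 → ℝ × ℝ) × (K → ℝ)) (r, t) with hzdef
  have z1 : ∀ v, z.1 v = (((r v).1 : ℝ), ((r v).2 : ℝ)) := fun v => rfl
  have z2 : ∀ k, z.2 k = (t k : ℝ) := fun v => rfl
  have rat : ∀ v, ∃ s : ℚ × ℚ, Phi sp z v = ((s.1 : ℝ), (s.2 : ℝ)) := by
    intro v
    by_cases hv : ∃ k, v = Sum.inl (sp k 3)
    · obtain ⟨k, rfl⟩ := hv
      rw [Phi_3 h]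
      simp only [z1, z2]
      exact ⟨((r (Sum.inl (sp k 1))).1 - t k * ((r (Sum.inl (sp k 2))).2 - (r (Sum.inl (sp k 0))).2),
        (r (Sum.inl (sp k 1))).2 + t k * ((r (Sum.inl (sp k 2))).1 - (r (Sum.inl (sp k 0))).1)), by push_cast; rfl⟩
    · unfold Phi; rw [dif_neg hv]
      exact ⟨r v, rfl⟩
  choose s hs using rat
  obtain ⟨n, n0, hn⟩ := common_den s
  have n0' : (0:ℝ) < n := by exact_mod_cast n0
  refine ⟨fun v => ((n:ℝ) * (Phi sp z v).1, (n:ℝ) * (Phi sp z v).2), ?_, ?_, ?_⟩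
  · intro j
    obtain ⟨a, b⟩ := hz j
    refine ⟨?_, ?_⟩
    · rw [D_scale]; positivity
    · intro u v w tt
      rcases b u v w tt with c | c
      · exact Or.inl c
      · right
        rw [D_scale]; positivity
  · rintro k a b c d rfl rfl rfl rfl
    beta_reduce
    rw [Phi_3 h, Phi_n h _ _ _ (by decide), Phi_n h _ _ _ (by decide), Phi_n h _ _ _ (by decide)]
    simp only
    ring
  · intro v
    obtain ⟨a, b, e⟩ := hn v
    refine ⟨a, b, ?_⟩
    beta_reduce
    rw [hs v]
    exact e
end draw
end ICR

namespace ICR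
open Classical Filter Topology
section geoKD
variable {N K : Type*} [Fintype N] [Fintype K] {q : N ⊕ K → ℝ × ℝ} {E : N ⊕ K → N ⊕ K → Prop} {sp : K → Fin 4 → N}

theorem oseg_opp {x a b : ℝ × ℝ} (h : x ∈ openSegment ℝ a b) : ∃ l : ℝ, 0 < l ∧ b.1 - x.1 = - l * (a.1 - x.1) ∧ b.2 - x.2 = - l * (a.2 - x.2) := by
  obtain ⟨t, t0, t1, rfl⟩ := mem_oseg.1 h
  refine ⟨(1 - t) / t, div_pos (by linarith) t0, ?_, ?_⟩ <;> simp <;> field_simp <;> ring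

/-- the half-open sector at `x` between the rays through `s i` and `s (i+1)` -/
def Sct (x : ℝ × ℝ) (s : Fin 4 → ℝ × ℝ) (i : Fin 4) (u : ℝ × ℝ) : Prop := 0 ≤ D x (s i) u ∧ 0 < D x u (s (i+1))

theorem Sct_facts {x : ℝ × ℝ} {s : Fin 4 → ℝ × ℝ} (hc : 0 < D x (s 0) (s 1)) (h1 : x ∈ openSegment ℝ (s 0) (s 2)) (h2 : x ∈ openSegment ℝ (s 1) (s 3))
    {u : ℝ × ℝ} (hu : u ≠ x) : (∃ i, Sct x s i u) ∧ ∀ i l, Sct x s i u → Sct x s l u → i = l := by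
  obtain ⟨l, l0, a1, a2⟩ := oseg_opp h1
  obtain ⟨m, m0, b1, b2⟩ := oseg_opp h2
  have hab : ¬ (D x (s 0) u = 0 ∧ D x (s 1) u = 0) := by
    rintro ⟨h3, h4⟩
    refine hu (pt_of_D hc ?_ h3)
    rw [D_swap]; linarith
  have e2 : D x (s 2) u = - l * D x (s 0) u := by unfold D; rw [a1, a2]; ring
  have e3 : D x (s 3) u = - m * D x (s 1) u := by unfold D; rw [b1, b2]; ring
  have f : ∀ i, D x u (s i) = - D x (s i) u := fun i => by unfold D; ring
  have P0 : Sct x s 0 u ↔ 0 ≤ D x (s 0) u ∧ D x (s 1) u < 0 := by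
    unfold Sct; rw [f, show (0 : Fin 4) + 1 = 1 from rfl]; constructor <;> rintro ⟨h, h'⟩ <;> exact ⟨h, by linarith⟩
  have P1 : Sct x s 1 u ↔ 0 ≤ D x (s 1) u ∧ 0 < D x (s 0) u := by
    unfold Sct; rw [f, show (1 : Fin 4) + 1 = 2 from rfl, e2]; constructor <;> rintro ⟨h, h'⟩ <;> refine ⟨h, by nlinarith⟩
  have P2 : Sct x s 2 u ↔ D x (s 0) u ≤ 0 ∧ 0 < D x (s 1) u := by
    unfold Sct; rw [f, show (2 : Fin 4) + 1 = 3 from rfl, e2, e3]; constructor <;> rintro ⟨h, h'⟩ <;> refine ⟨by nlinarith, by nlinarith⟩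
  have P3 : Sct x s 3 u ↔ D x (s 1) u ≤ 0 ∧ D x (s 0) u < 0 := by
    unfold Sct; rw [f, show (3 : Fin 4) + 1 = 0 from rfl, e3]; constructor <;> rintro ⟨h, h'⟩ <;> refine ⟨by nlinarith, by linarith⟩
  constructor
  · rcases lt_trichotomy (D x (s 0) u) 0 with h | h | h <;> rcases lt_trichotomy (D x (s 1) u) 0 with h' | h' | h'
    · exact ⟨3, P3.2 ⟨h'.le, h⟩⟩
    · exact ⟨3, P3.2 ⟨h'.le, h⟩⟩
    · exact ⟨2, P2.2 ⟨h.le, h'⟩⟩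
    · exact ⟨0, P0.2 ⟨h.ge, h'⟩⟩
    · exact absurd ⟨h, h'⟩ hab
    · exact ⟨2, P2.2 ⟨h.le, h'⟩⟩
    · exact ⟨0, P0.2 ⟨h.le, h'⟩⟩
    · exact ⟨1, P1.2 ⟨h'.ge, h⟩⟩
    · exact ⟨1, P1.2 ⟨h'.le, h⟩⟩
  · have key : ∀ i, Sct x s i u → i = if D x (s 1) u < 0 then (if 0 ≤ D x (s 0) u then 0 else 3) else if 0 < D x (s 0) u then 1 else if 0 < D x (s 1) u then 2 else 3 := by
      intro i hi
      have : i = 0 ∨ i = 1 ∨ i = 2 ∨ i = 3 := by clear hi; revert i; decide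
      rcases this with rfl | rfl | rfl | rfl
      · obtain ⟨a, b⟩ := P0.1 hi
        rw [if_pos b, if_pos a]
      · obtain ⟨a, b⟩ := P1.1 hi
        rw [if_neg (by linarith), if_pos b]
      · obtain ⟨a, b⟩ := P2.1 hi
        rw [if_neg (by linarith), if_neg (by linarith), if_pos b]
      · obtain ⟨a, b⟩ := P3.1 hi
        split_ifs <;> first | rfl | (exfalso; linarith)
    intro i l hi hl
    rw [key i hi, key l hl]

noncomputable def secg (q : N ⊕ K → ℝ × ℝ) (sp : K → Fin 4 → N) (k : K) (u : N ⊕ K) : Fin 4 :=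
  if h : ∃ i, Sct (q (Sum.inr k)) (fun i => q (Sum.inl (sp k i))) i (q u) then h.choose else 0

theorem geoKD {o0 o1 o2 : N} (ho : OutTri q (Sum.inl o0) (Sum.inl o1) (Sum.inl o2)) (hE : MaxPlane q E) (hq : Function.Injective q)
    (spoke : ∀ k i, E (Sum.inr k) (Sum.inl (sp k i)))
    (ccw : ∀ k i, 0 < D (q (Sum.inr k)) (q (Sum.inl (sp k i))) (q (Sum.inl (sp k (i+1)))))
    (mem : ∀ k i, q (Sum.inr k) ∈ openSegment ℝ (q (Sum.inl (sp k i))) (q (Sum.inl (sp k (i+2)))))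
    (non : ∀ k i l, ¬ E (Sum.inl (sp k i)) (Sum.inl (sp k l)))
    (inj : ∀ k i k' i', sp k i = sp k' i' → k = k' ∧ i = i') :
    KD (Tg q E (Sum.inl o0) (Sum.inl o1) (Sum.inl o2)) sp (secg q sp) := by
  have F := fun k {u} (hu : q u ≠ q (Sum.inr k)) => Sct_facts (s := fun i => q (Sum.inl (sp k i))) (ccw k 0) (mem k 0) (mem k 1) hu
  have S1 : ∀ k {u}, q u ≠ q (Sum.inr k) → Sct (q (Sum.inr k)) (fun i => q (Sum.inl (sp k i))) (secg q sp k u) (q u) := by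
    intro k u hu
    have := (F k hu).1
    unfold secg
    rw [dif_pos this]
    exact this.choose_spec
  have S2 : ∀ k {u} i, q u ≠ q (Sum.inr k) → Sct (q (Sum.inr k)) (fun i => q (Sum.inl (sp k i))) i (q u) → secg q sp k u = i := by
    intro k u i hu hi
    exact (F k hu).2 _ _ (S1 k hu) hi
  have ss : ∀ k i, secg q sp k (Sum.inl (sp k i)) = i := by
    intro k i
    refine S2 k i (fun e => by have := hq e; simp at this) ⟨?_, ccw k i⟩
    rw [D_self2]
  refine ⟨sphere_geo ho hE hq, fun k i => edge_T ho hE hq (spoke k i), ss, ?_, ?_, inj⟩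
  · intro k u w t
    have tg : Tgeo q E (Sum.inr k) u w := by
      rcases t with t | t
      · exact t
      · exfalso
        rcases t with ⟨e, -⟩ | ⟨e, -⟩ | ⟨e, -⟩ <;> simp at e
    obtain ⟨t1, t2, t3, t4, t5⟩ := id tg
    have nu : q u ≠ q (Sum.inr k) := fun e => hE.ne t2 (hq e).symm
    have nw : q w ≠ q (Sum.inr k) := fun e => hE.ne t4 (hq e)
    have su := S1 k nu
    set i := secg q sp k u
    obtain ⟨su1, su2⟩ := su
    simp only at su1 su2
    set s' := q (Sum.inl (sp k (i+1))) with hs'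
    set s0 := q (Sum.inl (sp k i)) with hs0
    set x := q (Sum.inr k) with hx
    have c0 := ccw k i
    have n := fun h2 => tg.nop hE hq (spoke k (i+1)) su2 h2
    have n' : 0 ≤ D x (q w) s' := by
      rw [← D_rot] at n
      by_contra hc
      apply n
      have : D x s' (q w) = - D x (q w) s' := by unfold D; ring
      change 0 < D x s' (q w)
      linarith
    rcases n'.lt_or_eq with pos | zero
    · right
      have pl : D x s0 (q w) * D x (q u) s' = D x s0 (q u) * D x (q w) s' + D x s0 s' * D x (q u) (q w) := by unfold D; ring
      have p3 : 0 < D x s0 (q w) := by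
        have : 0 < D x s0 (q w) * D x (q u) s' := by
          rw [pl]
          have := mul_nonneg su1 n'
          have := mul_pos c0 t1
          linarith
        exact (mul_pos_iff_of_pos_right su2).1 this
      have hw : secg q sp k w = i := S2 k i nw ⟨p3.le, pos⟩
      refine ⟨hw, ?_⟩
      rintro m rfl
      rw [ss] at hw
      rw [hw, ← hs0, D_self2] at p3
      exact lt_irrefl _ p3
    · left
      refine same_ray hE hq (hE.symm t4) (spoke k (i+1)) zero.symm ?_
      have nn := nsq_pos hq (hE.ne t2)
      have id1 : D x (q u) (q w) * D x (q u) s' + (((q u).1 - x.1) * ((q w).1 - x.1) + ((q u).2 - x.2) * ((q w).2 - x.2)) * (((q u).1 - x.1) * (s'.1 - x.1) + ((q u).2 - x.2) * (s'.2 - x.2))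
        = (((q u).1 - x.1)^2 + ((q u).2 - x.2)^2) * (((q w).1 - x.1) * (s'.1 - x.1) + ((q w).2 - x.2) * (s'.2 - x.2)) := by unfold D; ring
      have id2 : (((q u).1 - x.1) * ((q w).1 - x.1) + ((q u).2 - x.2) * ((q w).2 - x.2)) * D x (q u) s' - (((q u).1 - x.1) * (s'.1 - x.1) + ((q u).2 - x.2) * (s'.2 - x.2)) * D x (q u) (q w)
        = (((q u).1 - x.1)^2 + ((q u).2 - x.2)^2) * D x (q w) s' := by unfold D; ring
      rw [← zero, mul_zero, sub_eq_zero] at id2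
      change 0 < ((q u).1 - x.1)^2 + ((q u).2 - x.2)^2 at nn
      change 0 < ((q w).1 - x.1) * (s'.1 - x.1) + ((q w).2 - x.2) * (s'.2 - x.2)
      set α := ((q u).1 - x.1) * ((q w).1 - x.1) + ((q u).2 - x.2) * ((q w).2 - x.2)
      set β := ((q u).1 - x.1) * (s'.1 - x.1) + ((q u).2 - x.2) * (s'.2 - x.2)
      have h3 : 0 ≤ α * β := by
        have : (α * β) * D x (q u) s' = β ^ 2 * D x (q u) (q w) := by
          calc (α * β) * D x (q u) s' = β * (α * D x (q u) s') := by ring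
            _ = _ := by rw [id2]; ring
        have h4 : 0 ≤ (α * β) * D x (q u) s' := by rw [this]; exact mul_nonneg (sq_nonneg _) t1.le
        exact (mul_nonneg_iff_of_pos_right su2).1 h4
      have h5 := mul_pos t1 su2
      refine (mul_pos_iff_of_pos_left nn).1 ?_
      rw [← id1]; linarith
  · intro k i l w t
    exact non k i l (t.edge ho hE)
end geoKD
end ICR

namespace ICR
open Classical Filter Topology
section combine
variable {N K : Type*} [Fintype N] [Fintype K] {q : N ⊕ K → ℝ × ℝ} {E0 : N ⊕ K → N ⊕ K → Prop} {sp : K → Fin 4 → N}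

theorem right_not_mem {a b : ℝ × ℝ} (h : a ≠ b) : b ∉ openSegment ℝ a b := by
  rw [openSegment_symm]; exact left_not_mem h.symm

theorem combine {o0 o1 o2 : N} (ho : OutTri q (Sum.inl o0) (Sum.inl o1) (Sum.inl o2)) (hE0 : Plane q E0) (hq : Function.Injective q)
    (spoke : ∀ k i, E0 (Sum.inr k) (Sum.inl (sp k i)))
    (ccw : ∀ k i, 0 < D (q (Sum.inr k)) (q (Sum.inl (sp k i))) (q (Sum.inl (sp k (i+1)))))
    (mem : ∀ k i, q (Sum.inr k) ∈ openSegment ℝ (q (Sum.inl (sp k i))) (q (Sum.inl (sp k (i+2)))))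
    (blk : ∀ k i, ∃ z, q z ∈ openSegment ℝ (q (Sum.inl (sp k i))) (q (Sum.inl (sp k (i+1)))))
    (inj : ∀ k i k' i', sp k i = sp k' i' → k = k' ∧ i = i')
    (hO : ∀ k i, sp k i ≠ o0 ∧ sp k i ≠ o1 ∧ sp k i ≠ o2) :
    ∃ (p : N → ℝ × ℝ) (A : (K → Fin 4) → N → N → Prop), Function.Injective p ∧ (∀ v, ∃ a b : ℤ, p v = ((a : ℝ), (b : ℝ))) ∧
      (∀ k (a b c d : ℝ × ℝ), a = p (sp k 0) → c = p (sp k 1) → b = p (sp k 2) → d = p (sp k 3) →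
        (d.1 - c.1) * (b.1 - a.1) + (d.2 - c.2) * (b.2 - a.2) = 0) ∧
      (∀ j m n z, A j m n → z ≠ m → z ≠ n → p z ∉ openSegment ℝ (p m) (p n)) ∧
      (∀ j m n m' n', A j m n → A j m' n' → m ≠ m' → m ≠ n' → n ≠ m' → n ≠ n' → Disjoint (openSegment ℝ (p m) (p n)) (openSegment ℝ (p m') (p n'))) ∧
      (∀ j m n, E0 (Sum.inl m) (Sum.inl n) → A j m n) ∧ (∀ j k i, A j (sp k i) (sp k (i+1)) ∧ A j (sp k (i+1)) (sp k i)) ∧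
      (∀ j k i, j k = i → A j (sp k i) (sp k (i+2))) := by
  obtain ⟨E, hE, hsub⟩ := exists_maxPlane hE0
  have qne : ∀ k i l, i ≠ l → q (Sum.inl (sp k i)) ≠ q (Sum.inl (sp k l)) := fun k i l hil e =>
    hil (inj _ _ _ _ (Sum.inl_injective (hq e))).2
  have nn : ∀ k i l, (∃ z, q z ∈ openSegment ℝ (q (Sum.inl (sp k i))) (q (Sum.inl (sp k l)))) → i ≠ l → ¬ E (Sum.inl (sp k i)) (Sum.inl (sp k l)) := by
    rintro k i l ⟨z, hz⟩ hil e
    refine hE.vert (z := z) e ?_ ?_ hz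
    · rintro rfl
      exact left_not_mem (qne k i l hil) hz
    · rintro rfl
      exact right_not_mem (qne k i l hil) hz
  have non : ∀ k i l, ¬ E (Sum.inl (sp k i)) (Sum.inl (sp k l)) := by
    intro k i l
    have : l = i ∨ l = i + 1 ∨ l = i + 2 ∨ i = l + 1 := by revert i l; decide
    rcases this with rfl | rfl | rfl | rfl
    · exact fun e => hE.ne e rfl
    · exact nn k i _ (blk k i) (f4n1 i).symm
    · exact nn k i _ ⟨_, mem k i⟩ (f4n2 i).symm
    · exact fun e => nn k l _ (blk k l) (f4n1 l).symm (hE.symm e)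
  have h := geoKD ho hE hq (fun k i => hsub _ _ (spoke k i)) ccw mem non inj
  have ht : ∀ j, TS (Tg q E (Sum.inl o0) (Sum.inl o1) (Sum.inl o2)) sp (secg q sp) j (Sum.inl o0) (Sum.inl o2) (Sum.inl o1) := fun j =>
    TS.i1 (u := Sum.inl o0) (v := Sum.inl o2) (w := Sum.inl o1) (Or.inr (Or.inl ⟨rfl, rfl, rfl⟩))
  obtain ⟨p, hp, perp, int⟩ := drawing h ht (by
    intro v hv k i e
    subst e
    obtain ⟨a, b, c⟩ := hO k i
    rcases hv with e | e | e
    · exact a (Sum.inl_injective e)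
    · exact b (Sum.inl_injective e)
    · exact c (Sum.inl_injective e))
  have S := h.sphere
  refine ⟨fun n => p (Sum.inl n), fun j m n => ∃ w, TS (Tg q E (Sum.inl o0) (Sum.inl o1) (Sum.inl o2)) sp (secg q sp) j (Sum.inl m) (Sum.inl n) w, ?_, ?_, ?_, ?_, ?_, ?_, ?_, ?_⟩
  · intro m n e
    exact Sum.inl_injective (emb_inj (S fun _ => 0) (hp fun _ => 0) e)
  · exact fun v => int _
  · exact perp
  · intro j m n z e h1 h2
    exact emb_vertex (S j) (hp j) e (fun e => h1 (Sum.inl_injective e)) (fun e => h2 (Sum.inl_injective e))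
  · intro j m n m' n' e e' h1 h2 h3 h4
    exact emb_edge (S j) (hp j) e e' (fun e => h1 (Sum.inl_injective e)) (fun e => h2 (Sum.inl_injective e)) (fun e => h3 (Sum.inl_injective e)) (fun e => h4 (Sum.inl_injective e))
  · intro j m n e
    obtain ⟨w, t⟩ := edge_T ho hE hq (hsub _ _ e)
    exact ⟨_, TS.i1 t⟩
  · intro j k i
    have := TS.side (j := j) h k i
    exact ⟨this, (S j).adj_symm this⟩
  · intro j k i e
    exact ⟨_, TS.i3' h k i (Or.inl e.symm)⟩
end combine

/-! ### plane geometry of segments -/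
theorem share_seg {s u v w : ℝ × ℝ} (h : s ∈ openSegment ℝ u v) (h' : s ∈ openSegment ℝ u w) :
    v = w ∨ v ∈ openSegment ℝ u w ∨ w ∈ openSegment ℝ u v := by
  obtain ⟨t, t0, t1, rfl⟩ := mem_oseg.1 h
  obtain ⟨r, r0, r1, e⟩ := mem_oseg.1 h'
  have e1 := congrArg Prod.fst e
  have e2 := congrArg Prod.snd e
  simp only [Prod.fst_add, Prod.smul_fst, Prod.snd_add, Prod.smul_snd, smul_eq_mul] at e1 e2
  rcases lt_trichotomy t r with l | l | l
  · right; right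
    rw [mem_oseg]
    refine ⟨t / r, div_pos t0 r0, (div_lt_one r0).2 l, Prod.ext ?_ ?_⟩ <;>
      simp only [Prod.fst_add, Prod.smul_fst, Prod.snd_add, Prod.smul_snd, smul_eq_mul] <;> field_simp <;> linarith
  · left
    subst l
    exact Prod.ext (mul_left_cancel₀ t0.ne' (by linarith)) (mul_left_cancel₀ t0.ne' (by linarith))
  · right; left
    rw [mem_oseg]
    refine ⟨r / t, div_pos r0 t0, (div_lt_one t0).2 l, Prod.ext ?_ ?_⟩ <;>
      simp only [Prod.fst_add, Prod.smul_fst, Prod.snd_add, Prod.smul_snd, smul_eq_mul] <;> field_simp <;> linarith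

theorem overlap {a b c d y z : ℝ × ℝ} (hcd : c ≠ d) (hyz : y ≠ z) (hy : y ∈ openSegment ℝ a b) (hz : z ∈ openSegment ℝ a b)
    (hy' : y ∈ openSegment ℝ c d) (hz' : z ∈ openSegment ℝ c d) :
    c ∈ openSegment ℝ a b ∨ d ∈ openSegment ℝ a b ∨ a ∈ openSegment ℝ c d ∨ b ∈ openSegment ℝ c d ∨ (a = c ∧ b = d) ∨ (a = d ∧ b = c) := by
  obtain ⟨t, t0, t1, ey⟩ := mem_oseg.1 hy
  obtain ⟨r, r0, r1, ez⟩ := mem_oseg.1 hz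
  obtain ⟨t', t0', t1', ey'⟩ := mem_oseg.1 hy'
  obtain ⟨r', r0', r1', ez'⟩ := mem_oseg.1 hz'
  have htr' : r' - t' ≠ 0 := by
    intro h
    apply hyz
    rw [ey', ez', sub_eq_zero.1 h]
  -- the line coordinates of c and d
  set κ := (r - t) / (r' - t') with hκ
  have hκ' : κ * (r' - t') = r - t := by rw [hκ]; field_simp
  have lin1 : ∀ τ : ℝ, (1 - τ) • c + τ • d = (1 - (t + (τ - t') * κ)) • a + (t + (τ - t') * κ) • b := by
    intro τ
    have y1 := congrArg Prod.fst (ey.symm.trans ey')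
    have y2 := congrArg Prod.snd (ey.symm.trans ey')
    have z1 := congrArg Prod.fst (ez.symm.trans ez')
    have z2 := congrArg Prod.snd (ez.symm.trans ez')
    simp only [Prod.fst_add, Prod.smul_fst, Prod.snd_add, Prod.smul_snd, smul_eq_mul] at y1 y2 z1 z2
    have k1 : d.1 - c.1 = κ * (b.1 - a.1) := mul_right_cancel₀ htr' (by
      calc (d.1 - c.1) * (r' - t') = (r - t) * (b.1 - a.1) := by linarith
        _ = _ := by rw [← hκ']; ring)
    have k2 : d.2 - c.2 = κ * (b.2 - a.2) := mul_right_cancel₀ htr' (by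
      calc (d.2 - c.2) * (r' - t') = (r - t) * (b.2 - a.2) := by linarith
        _ = _ := by rw [← hκ']; ring)
    refine Prod.ext ?_ ?_ <;> simp only [Prod.fst_add, Prod.smul_fst, Prod.snd_add, Prod.smul_snd, smul_eq_mul]
    · linear_combination (-1 : ℝ) * y1 + (τ - t') * k1
    · linear_combination (-1 : ℝ) * y2 + (τ - t') * k2
  have ec : c = (1 - (t - t' * κ)) • a + (t - t' * κ) • b := by
    have := lin1 0
    rw [sub_zero, one_smul, zero_smul, add_zero] at this
    rw [show t - t' * κ = t + (0 - t') * κ by ring]; exact this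
  have ed : d = (1 - (t + (1 - t') * κ)) • a + (t + (1 - t') * κ) • b := by
    have := lin1 1
    rw [sub_self, one_smul, zero_smul, zero_add] at this
    exact this
  have main : ∀ {a b c d : ℝ × ℝ} {γ δ : ℝ}, c = (1 - γ) • a + γ • b → d = (1 - δ) • a + δ • b → γ < 1 → 0 < δ → γ < δ →
      c ∈ openSegment ℝ a b ∨ d ∈ openSegment ℝ a b ∨ a ∈ openSegment ℝ c d ∨ b ∈ openSegment ℝ c d ∨ (a = c ∧ b = d) := by
    intro a b c d γ δ ec ed h1 h2 h3
    by_cases k1 : 0 < γ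
    · left; exact mem_oseg.2 ⟨γ, k1, h1, ec⟩
    by_cases k2 : δ < 1
    · right; left; exact mem_oseg.2 ⟨δ, h2, k2, ed⟩
    push Not at k1 k2
    rcases k1.lt_or_eq with k1 | k1
    · right; right; left
      refine mem_oseg.2 ⟨(0 - γ) / (δ - γ), by apply div_pos <;> linarith, by rw [div_lt_one (by linarith)]; linarith, ?_⟩
      have : δ - γ ≠ 0 := by linarith
      rw [ec, ed]
      refine Prod.ext ?_ ?_ <;> simp only [Prod.fst_add, Prod.smul_fst, Prod.snd_add, Prod.smul_snd, smul_eq_mul] <;> field_simp <;> ring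
    rcases k2.lt_or_eq with k2 | k2
    · right; right; right; left
      refine mem_oseg.2 ⟨(1 - γ) / (δ - γ), by apply div_pos <;> linarith, by rw [div_lt_one (by linarith)]; linarith, ?_⟩
      have : δ - γ ≠ 0 := by linarith
      rw [ec, ed]
      refine Prod.ext ?_ ?_ <;> simp only [Prod.fst_add, Prod.smul_fst, Prod.snd_add, Prod.smul_snd, smul_eq_mul] <;> field_simp <;> ring
    · right; right; right; right
      subst k1; subst k2
      rw [ec, ed]; simp
  rcases lt_trichotomy κ 0 with hk | hk | hk
  · have e1 := mul_pos t0' (neg_pos.2 hk)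
    have e2 := mul_pos (sub_pos.2 t1') (neg_pos.2 hk)
    have := main ed ec (by nlinarith) (by nlinarith) (by nlinarith)
    rw [openSegment_symm ℝ d c] at this
    tauto
  · exfalso
    apply hcd
    rw [ec, ed, hk]; simp
  · have e1 := mul_pos t0' hk
    have e2 := mul_pos (sub_pos.2 t1') hk
    have := main ec ed (by nlinarith) (by nlinarith) (by nlinarith)
    tauto

/-- two segments through a common interior point that are collinear share a further point -/
theorem transversal {x a b c d : ℝ × ℝ} (hab : a ≠ b) (hcd : c ≠ d) (h : x ∈ openSegment ℝ a b) (h' : x ∈ openSegment ℝ c d)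
    (hs : (openSegment ℝ a b ∩ openSegment ℝ c d).Subsingleton) : D x a c ≠ 0 := by
  intro h0
  have main : ∀ c d, c ≠ d → x ∈ openSegment ℝ c d → D x a c = 0 → (openSegment ℝ a b ∩ openSegment ℝ c d).Subsingleton → 
      ∀ g : ℝ, 0 < g → c.1 - x.1 = g * (a.1 - x.1) → c.2 - x.2 = g * (a.2 - x.2) → False := by
    intro c d hcd h' h0 hs g g0 e1 e2
    have ax : a ≠ x := fun e => left_not_mem hab (e ▸ h)
    set r := min g 1 / 2 with hr
    have m0 : 0 < min g 1 := lt_min g0 one_pos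
    have m1 : min g 1 ≤ g := min_le_left _ _
    have m2 : min g 1 ≤ 1 := min_le_right _ _
    have y1 : (1 - r) • x + r • a ∈ openSegment ℝ a b := oseg_trans h (mem_oseg.2 ⟨r, by linarith, by linarith, rfl⟩)
    have y2 : (1 - r) • x + r • a ∈ openSegment ℝ c d := oseg_trans h' (mem_oseg.2 ⟨r / g, by positivity, by rw [div_lt_one g0]; linarith, by
      refine Prod.ext ?_ ?_ <;> simp only [Prod.fst_add, Prod.smul_fst, Prod.snd_add, Prod.smul_snd, smul_eq_mul]
      · have : c.1 = x.1 + g * (a.1 - x.1) := by linarith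
        rw [this]; field_simp; ring
      · have : c.2 = x.2 + g * (a.2 - x.2) := by linarith
        rw [this]; field_simp; ring⟩)
    have := hs ⟨y1, y2⟩ ⟨h, h'⟩
    apply ax
    have q1 := congrArg Prod.fst this
    have q2 := congrArg Prod.snd this
    simp only [Prod.fst_add, Prod.smul_fst, Prod.snd_add, Prod.smul_snd, smul_eq_mul] at q1 q2
    have r0 : r ≠ 0 := by linarith
    exact Prod.ext (mul_left_cancel₀ r0 (by linarith)) (mul_left_cancel₀ r0 (by linarith))
  have ax : a ≠ x := fun e => left_not_mem hab (e ▸ h)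
  have cx : c ≠ x := fun e => left_not_mem hcd (e ▸ h')
  have n : 0 < (a.1 - x.1)^2 + (a.2 - x.2)^2 := by
    by_contra hc
    have g1 : a.1 - x.1 = 0 := by nlinarith [sq_nonneg (a.1 - x.1), sq_nonneg (a.2 - x.2)]
    have g2 : a.2 - x.2 = 0 := by nlinarith [sq_nonneg (a.1 - x.1), sq_nonneg (a.2 - x.2)]
    exact ax (Prod.ext (by linarith) (by linarith))
  set g := ((a.1 - x.1) * (c.1 - x.1) + (a.2 - x.2) * (c.2 - x.2)) / ((a.1 - x.1)^2 + (a.2 - x.2)^2) with hg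
  have e1 : c.1 - x.1 = g * (a.1 - x.1) := by
    rw [hg, div_mul_eq_mul_div, eq_div_iff n.ne']
    unfold D at h0
    linear_combination (- (a.2 - x.2)) * h0
  have e2 : c.2 - x.2 = g * (a.2 - x.2) := by
    rw [hg, div_mul_eq_mul_div, eq_div_iff n.ne']
    unfold D at h0
    linear_combination ((a.1 - x.1)) * h0
  rcases lt_trichotomy g 0 with k | k | k
  · obtain ⟨l, l0, f1, f2⟩ := oseg_opp h'
    refine main d c hcd.symm (by rwa [openSegment_symm]) ?_ (by rwa [openSegment_symm ℝ d c]) (-l * g) (by nlinarith) (by rw [f1, e1]; ring) (by rw [f2, e2]; ring)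
    have : D x a d = - l * D x a c := by unfold D; rw [f1, f2]; ring
    rw [this, h0, mul_zero]
  · rw [k, zero_mul] at e1 e2
    exact cx (Prod.ext (by linarith) (by linarith))
  · exact main c d hcd h' h0 hs g k e1 e2

theorem seg_pick {ι : Type*} [Finite ι] {a b : ℝ × ℝ} (hab : a ≠ b) (S : ι → Set (ℝ × ℝ)) (hS : ∀ i, (openSegment ℝ a b ∩ S i).Subsingleton) :
    ∃ m ∈ openSegment ℝ a b, ∀ i, m ∉ S i := by
  have inf : (openSegment ℝ a b).Infinite := by
    rw [openSegment_eq_image]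
    refine (Set.Ioo_infinite (zero_lt_one' ℝ)).image ?_
    intro s _ t _ e
    by_contra hst
    apply hab
    have e1 := congrArg Prod.fst e
    have e2 := congrArg Prod.snd e
    simp only [Prod.fst_add, Prod.smul_fst, Prod.snd_add, Prod.smul_snd, smul_eq_mul] at e1 e2
    have hst' := sub_ne_zero.2 hst
    exact Prod.ext (mul_left_cancel₀ hst' (by linarith)) (mul_left_cancel₀ hst' (by linarith))
  have fin : (⋃ i, openSegment ℝ a b ∩ S i).Finite := Set.finite_iUnion fun i => (hS i).finite
  obtain ⟨m, hm, hn⟩ := (inf.diff fin).nonempty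
  refine ⟨m, hm, fun i hi => hn (Set.mem_iUnion.2 ⟨i, hm, hi⟩)⟩
end ICR

namespace ICR
open Classical Filter Topology
section kites
variable {V : Type*} [Fintype V] {G : SimpleGraph V} {ρ : V → ℝ × ℝ}

structure Kites {V K : Type*} (G : SimpleGraph V) (ρ : V → ℝ × ℝ) (x : K → ℝ × ℝ) (sp : K → Fin 4 → V) : Prop where
  xinj : Function.Injective x
  inj : ∀ k i k' i', sp k i = sp k' i' → k = k' ∧ i = i'
  edge : ∀ k i, G.Adj (sp k i) (sp k (i+2))
  mem : ∀ k i, x k ∈ openSegment ℝ (ρ (sp k i)) (ρ (sp k (i+2)))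
  ccw : ∀ k i, 0 < D (x k) (ρ (sp k i)) (ρ (sp k (i+1)))
  meet : ∀ a b c d y, G.Adj a b → G.Adj c d → s(a, b) ≠ s(c, d) → y ∈ openSegment ℝ (ρ a) (ρ b) → y ∈ openSegment ℝ (ρ c) (ρ d) → 
    ∃ k i, s(a, b) = s(sp k i, sp k (i+2)) ∧ s(c, d) = s(sp k (i+1), sp k (i+3))

theorem crosses_symm {e f : Sym2 V} (h : Crosses ρ e f) : Crosses ρ f e :=
  ⟨fun v hv hv' => h.1 v hv' hv, by rw [Set.inter_comm]; exact h.2⟩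

theorem share_edge (hd : IsStraightLineDrawing G ρ) {u v w : V} {s : ℝ × ℝ} (e : G.Adj u v) (e' : G.Adj u w) (hs : s ∈ openSegment ℝ (ρ u) (ρ v))
    (hs' : s ∈ openSegment ℝ (ρ u) (ρ w)) : v = w := by
  by_contra hne
  rcases share_seg hs hs' with h | h | h
  · exact hne (hd.inj h)
  · refine hd.no_vertex_on_edge s(u, w) e' v ?_ h
    rw [Sym2.mem_iff]; rintro (h | h)
    · exact e.ne h.symm
    · exact hne h
  · refine hd.no_vertex_on_edge s(u, v) e w ?_ h
    rw [Sym2.mem_iff]; rintro (h | h)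
    · exact e'.ne h.symm
    · exact hne h.symm

theorem meet_crosses (hd : IsStraightLineDrawing G ρ) {a b c d : V} {y : ℝ × ℝ} (e : G.Adj a b) (e' : G.Adj c d) (hne : s(a, b) ≠ s(c, d))
    (h : y ∈ openSegment ℝ (ρ a) (ρ b)) (h' : y ∈ openSegment ℝ (ρ c) (ρ d)) : Crosses ρ s(a, b) s(c, d) := by
  refine ⟨?_, y, h, h'⟩
  intro v hv hv'
  rw [Sym2.mem_iff] at hv hv'
  apply hne
  rcases hv with rfl | rfl <;> rcases hv' with rfl | rfl
  · rw [share_edge hd e e' h h']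
  · rw [openSegment_symm ℝ (ρ c)] at h'
    rw [share_edge hd e e'.symm h h', Sym2.eq_swap]
  · rw [openSegment_symm ℝ (ρ a)] at h
    rw [share_edge hd e.symm e' h h', Sym2.eq_swap]
  · rw [openSegment_symm ℝ (ρ c)] at h'
    rw [openSegment_symm ℝ (ρ a)] at h
    rw [share_edge hd e.symm e'.symm h h']

def KSet (G : SimpleGraph V) (ρ : V → ℝ × ℝ) : Set (ℝ × ℝ) :=
  {x | ∃ a b c d : V, G.Adj a b ∧ G.Adj c d ∧ Crosses ρ s(a, b) s(c, d) ∧ x ∈ openSegment ℝ (ρ a) (ρ b) ∧ x ∈ openSegment ℝ (ρ c) (ρ d)}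

theorem KSet_finite (hd : IsStraightLineDrawing G ρ) : (KSet G ρ).Finite := by
  have : (⋃ t : V × V × V × V, {x | G.Adj t.1 t.2.1 ∧ G.Adj t.2.2.1 t.2.2.2 ∧ Crosses ρ s(t.1, t.2.1) s(t.2.2.1, t.2.2.2) ∧
      x ∈ openSegment ℝ (ρ t.1) (ρ t.2.1) ∧ x ∈ openSegment ℝ (ρ t.2.2.1) (ρ t.2.2.2)}).Finite := by
    refine Set.finite_iUnion fun t => Set.Subsingleton.finite ?_
    rintro x ⟨e, e', h, hx, hx'⟩ y ⟨-, -, -, hy, hy'⟩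
    exact hd.meet_at_most_once _ e _ e' h.1 ⟨hx, hx'⟩ ⟨hy, hy'⟩
  refine this.subset ?_
  rintro x ⟨a, b, c, d, h⟩
  exact Set.mem_iUnion.2 ⟨(a, b, c, d), h⟩

theorem four {P : Fin 4 → Prop} (h0 : P 0) (h1 : P 1) (h2 : P 2) (h3 : P 3) (i : Fin 4) : P i := by
  fin_cases i <;> assumption

theorem f4_cases : ∀ i i' : Fin 4, ¬ i = i' → i' = i + 1 ∨ i' = i + 2 ∨ i' = i + 3 := by decide

theorem mk_kite {x : ℝ × ℝ} {a b c d : V} (e : G.Adj a b) (e' : G.Adj c d) (hc : Crosses ρ s(a, b) s(c, d)) (h : x ∈ openSegment ℝ (ρ a) (ρ b))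
    (h' : x ∈ openSegment ℝ (ρ c) (ρ d)) (hD : 0 < D x (ρ a) (ρ c)) :
    ∃ s : Fin 4 → V, ∀ i, G.Adj (s i) (s (i+2)) ∧ x ∈ openSegment ℝ (ρ (s i)) (ρ (s (i+2))) ∧ 0 < D x (ρ (s i)) (ρ (s (i+1))) ∧ Crosses ρ s(s i, s (i+2)) s(s (i+1), s (i+3)) := by
  obtain ⟨l, l0, f1, f2⟩ := oseg_opp h
  obtain ⟨m, m0, g1, g2⟩ := oseg_opp h'
  have hb : x ∈ openSegment ℝ (ρ b) (ρ a) := by rwa [openSegment_symm]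
  have hd : x ∈ openSegment ℝ (ρ d) (ρ c) := by rwa [openSegment_symm]
  have D1 : D x (ρ c) (ρ b) = l * D x (ρ a) (ρ c) := by unfold D; rw [f1, f2]; ring
  have D2 : D x (ρ b) (ρ d) = l * m * D x (ρ a) (ρ c) := by unfold D; rw [f1, f2, g1, g2]; ring
  have D3 : D x (ρ d) (ρ a) = m * D x (ρ a) (ρ c) := by unfold D; rw [g1, g2]; ring
  refine ⟨![a, c, b, d], four ?_ ?_ ?_ ?_⟩
  · exact ⟨e, h, hD, hc⟩
  · refine ⟨e', h', ?_, ?_⟩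
    · change 0 < D x (ρ c) (ρ b); rw [D1]; positivity
    · change Crosses ρ s(c, d) s(b, a); rw [Sym2.eq_swap (a := b)]; exact crosses_symm hc
  · refine ⟨e.symm, hb, ?_, ?_⟩
    · change 0 < D x (ρ b) (ρ d); rw [D2]; positivity
    · change Crosses ρ s(b, a) s(d, c); rw [Sym2.eq_swap (a := b), Sym2.eq_swap (a := d)]; exact hc
  · refine ⟨e'.symm, hd, ?_, ?_⟩
    · change 0 < D x (ρ d) (ρ a); rw [D3]; positivity
    · change Crosses ρ s(d, c) s(a, b); rw [Sym2.eq_swap (a := d)]; exact crosses_symm hc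

theorem exists_kite (hd : IsStraightLineDrawing G ρ) {x : ℝ × ℝ} (hx : x ∈ KSet G ρ) :
    ∃ s : Fin 4 → V, ∀ i, G.Adj (s i) (s (i+2)) ∧ x ∈ openSegment ℝ (ρ (s i)) (ρ (s (i+2))) ∧ 0 < D x (ρ (s i)) (ρ (s (i+1))) ∧ Crosses ρ s(s i, s (i+2)) s(s (i+1), s (i+3)) := by
  obtain ⟨a, b, c, d, e, e', hc, h, h'⟩ := hx
  have := transversal (fun h => e.ne (hd.inj h)) (fun h => e'.ne (hd.inj h)) h h' (hd.meet_at_most_once _ e _ e' hc.1)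
  rcases this.lt_or_gt with k | k
  · refine mk_kite (c := d) (d := c) e e'.symm (by rwa [Sym2.eq_swap (a := d)]) h (by rwa [openSegment_symm]) ?_
    obtain ⟨l, l0, f1, f2⟩ := oseg_opp h'
    have : D x (ρ a) (ρ d) = - l * D x (ρ a) (ρ c) := by unfold D; rw [f1, f2]; ring
    rw [this]; nlinarith
  · exact mk_kite e e' hc h h' k

theorem exists_kites (h : IsICPlanarDrawing G ρ) : ∃ sp : KSet G ρ → Fin 4 → V, Kites G ρ (fun k : KSet G ρ => k.1) sp := by
  obtain ⟨hd, h1, h2⟩ := h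
  have := fun k : KSet G ρ => exists_kite hd k.2
  choose sp hsp using this
  refine ⟨sp, Subtype.val_injective, ?_, fun k i => (hsp k i).1, fun k i => (hsp k i).2.1, fun k i => (hsp k i).2.2.1, ?_⟩
  · intro k i k' i' e
    obtain ⟨a1, a2, -, a3⟩ := hsp k i
    obtain ⟨b1, b2, -, b3⟩ := hsp k' i'
    have c1 := (hsp k (i+1)).1
    have c2 := (hsp k (i+1)).2.1
    rw [f4f] at c1 c2
    have d1 := (hsp k' (i'+1)).1
    have d2 := (hsp k' (i'+1)).2.1
    rw [f4f] at d1 d2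
    have hk : k = k' := by
      have eq1 : s(sp k i, sp k (i+2)) = s(sp k' i', sp k' (i'+2)) := by
        by_contra hne
        refine h2 _ a1 _ b1 ⟨_, c1, a3⟩ ⟨_, d1, b3⟩ hne (sp k i) (Sym2.mem_mk_left _ _) ?_
        rw [e]; exact Sym2.mem_mk_left _ _
      have eq2 : s(sp k (i+1), sp k (i+3)) = s(sp k' (i'+1), sp k' (i'+3)) := by
        refine h1 _ a1 _ c1 _ d1 a3 ?_
        rw [eq1]; exact b3
      refine Subtype.ext (hd.meet_at_most_once _ a1 _ c1 a3.1 ⟨a2, c2⟩ ⟨?_, ?_⟩)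
      · rw [eq1]; exact b2
      · rw [eq2]; exact d2
    subst hk
    refine ⟨rfl, ?_⟩
    by_contra hi
    have : i' = i + 1 ∨ i' = i + 2 ∨ i' = i + 3 := f4_cases i i' hi
    rcases this with rfl | rfl | rfl
    · refine a3.1 (sp k i) (Sym2.mem_mk_left _ _) ?_
      rw [e]; exact Sym2.mem_mk_left _ _
    · exact a1.ne e
    · refine a3.1 (sp k i) (Sym2.mem_mk_left _ _) ?_
      rw [e]; exact Sym2.mem_mk_right _ _
  · intro a b c d y e e' hne hy hy'
    have cr := meet_crosses hd e e' hne hy hy'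
    set k : KSet G ρ := ⟨y, a, b, c, d, e, e', cr, hy, hy'⟩ with hk
    obtain ⟨a1, a2, -, a3⟩ := hsp k 0
    obtain ⟨b1, b2, -, -⟩ := hsp k 1
    by_cases q : s(a, b) = s(sp k 0, sp k (0+2))
    · refine ⟨k, 0, q, ?_⟩
      refine h1 _ a1 _ e' _ b1 ?_ a3
      rw [← q]; exact cr
    · have c2 := meet_crosses hd e a1 q hy a2
      have q2 : s(c, d) = s(sp k 0, sp k (0+2)) := h1 _ e _ e' _ a1 cr c2
      refine ⟨k, 1, ?_, ?_⟩
      · exact h1 _ a1 _ e _ b1 (crosses_symm c2) a3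
      · rw [q2, Sym2.eq_swap]; rfl
end kites
end ICR

namespace ICR
open Classical Filter Topology
section frame
variable {V K : Type*} [Fintype V] [Fintype K] {G : SimpleGraph V} {ρ : V → ℝ × ℝ} {x : K → ℝ × ℝ} {sp : K → Fin 4 → V}

theorem noV (hd : IsStraightLineDrawing G ρ) {a b : V} (e : G.Adj a b) (v : V) : ρ v ∉ openSegment ℝ (ρ a) (ρ b) := by
  have hne : ρ a ≠ ρ b := fun h => e.ne (hd.inj h)
  by_cases h1 : v = a
  · subst h1; exact left_not_mem hne
  by_cases h2 : v = b
  · subst h2; exact right_not_mem hne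
  refine hd.no_vertex_on_edge s(a, b) e v ?_
  rw [Sym2.mem_iff]; rintro (h | h)
  · exact h1 h
  · exact h2 h

theorem side_pick (hd : IsStraightLineDrawing G ρ) {u v : V} (huv : u ≠ v) : ∃ m ∈ openSegment ℝ (ρ u) (ρ v),
    (∃ w, m = ρ w) ∨ ((∀ w, m ≠ ρ w) ∧ ∀ a b, G.Adj a b → m ∈ openSegment ℝ (ρ a) (ρ b) → s(a, b) = s(u, v)) := by
  by_cases h : ∃ w, ρ w ∈ openSegment ℝ (ρ u) (ρ v)
  · obtain ⟨w, hw⟩ := h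
    exact ⟨ρ w, hw, Or.inl ⟨w, rfl⟩⟩
  push Not at h
  obtain ⟨m, hm, hS⟩ := seg_pick (ι := V × V) (fun e => huv (hd.inj e))
    (fun t => {y | G.Adj t.1 t.2 ∧ s(t.1, t.2) ≠ s(u, v) ∧ y ∈ openSegment ℝ (ρ t.1) (ρ t.2)}) (by
      rintro ⟨a, b⟩ y ⟨hy, e, hne, hy'⟩ z ⟨hz, -, -, hz'⟩
      by_contra hyz
      simp only at e hne hy' hz'
      rcases overlap (fun h => e.ne (hd.inj h)) hyz hy hz hy' hz' with k | k | k | k | ⟨k1, k2⟩ | ⟨k1, k2⟩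
      · exact h a k
      · exact h b k
      · exact noV hd e _ k
      · exact noV hd e _ k
      · exact hne (by rw [hd.inj k1, hd.inj k2])
      · exact hne (by rw [hd.inj k1, hd.inj k2, Sym2.eq_swap]))
  refine ⟨m, hm, Or.inr ⟨fun w e => h w (e ▸ hm), fun a b e hab => ?_⟩⟩
  by_contra hne
  exact hS (a, b) ⟨e, hne, hab⟩

theorem box {T : Set (ℝ × ℝ)} (hT : T.Finite) : ∃ R : ℝ, 0 < R ∧ ∀ p ∈ T, -R < p.1 ∧ p.1 < R ∧ -R < p.2 ∧ p.2 < R := by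
  obtain ⟨R, R0, hR⟩ := hT.isBounded.exists_pos_norm_lt
  refine ⟨R, R0, fun p hp => ?_⟩
  have := hR p hp
  have h1 := lt_of_le_of_lt (norm_fst_le p) this
  have h2 := lt_of_le_of_lt (norm_snd_le p) this
  rw [Real.norm_eq_abs, abs_lt] at h1 h2
  exact ⟨h1.1, h1.2, h2.1, h2.2⟩

theorem box_seg {R : ℝ} {a b y : ℝ × ℝ} (ha : -R < a.1 ∧ a.1 < R ∧ -R < a.2 ∧ a.2 < R) (hb : -R < b.1 ∧ b.1 < R ∧ -R < b.2 ∧ b.2 < R)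
    (hy : y ∈ openSegment ℝ a b) : -R < y.1 ∧ y.1 < R ∧ -R < y.2 ∧ y.2 < R := by
  obtain ⟨t, t0, t1, rfl⟩ := mem_oseg.1 hy
  have s0 : 0 < 1 - t := by linarith
  simp only [Prod.fst_add, Prod.snd_add, Prod.smul_fst, Prod.smul_snd, smul_eq_mul]
  obtain ⟨a1, a2, a3, a4⟩ := ha
  obtain ⟨b1, b2, b3, b4⟩ := hb
  refine ⟨?_, ?_, ?_, ?_⟩ <;> nlinarith

theorem diag_kite (hk : Kites G ρ x sp) {k k' : K} {i i' : Fin 4} {y : ℝ × ℝ} (h : y ∈ openSegment ℝ (ρ (sp k i)) (ρ (sp k (i+2))))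
    (h' : y ∈ openSegment ℝ (ρ (sp k' i')) (ρ (sp k' (i'+2)))) : k = k' := by
  by_cases e : s(sp k i, sp k (i+2)) = s(sp k' i', sp k' (i'+2))
  · rw [Sym2.eq_iff] at e
    rcases e with ⟨e, -⟩ | ⟨e, -⟩ <;> exact (hk.inj _ _ _ _ e).1
  · obtain ⟨k1, i1, e1, e2⟩ := hk.meet _ _ _ _ y (hk.edge k i) (hk.edge k' i') e h h'
    rw [Sym2.eq_iff] at e1 e2
    have a1 : k = k1 := by rcases e1 with ⟨e, -⟩ | ⟨e, -⟩ <;> exact (hk.inj _ _ _ _ e).1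
    have a2 : k' = k1 := by rcases e2 with ⟨e, -⟩ | ⟨e, -⟩ <;> exact (hk.inj _ _ _ _ e).1
    rw [a1, a2]

theorem diag_ne_side (hk : Kites G ρ x sp) {k k' : K} {i i' : Fin 4} : s(sp k i, sp k (i+2)) ≠ s(sp k' i', sp k' (i'+1)) := by
  intro e
  rw [Sym2.eq_iff] at e
  have aux1 : ∀ i : Fin 4, i + 2 ≠ i + 1 := by decide
  have aux2 : ∀ i : Fin 4, i + 1 + 2 ≠ i := by decide
  rcases e with ⟨e, e'⟩ | ⟨e, e'⟩
  · have h1 := (hk.inj _ _ _ _ e).2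
    have h2 := (hk.inj _ _ _ _ e').2
    subst h1; exact aux1 _ h2
  · have h1 := (hk.inj _ _ _ _ e).2
    have h2 := (hk.inj _ _ _ _ e').2
    subst h1; exact aux2 _ h2

def NS (sp : K → Fin 4 → V) (a b : V) : Prop := ∀ k i l, a = sp k i → b = sp k l → False

omit [Fintype V] [Fintype K] in
theorem NS.ne {a b : V} (h : NS sp a b) (k : K) (i l : Fin 4) : s(a, b) ≠ s(sp k i, sp k l) := by
  intro e
  rw [Sym2.eq_iff] at e
  rcases e with ⟨e, e'⟩ | ⟨e, e'⟩ <;> exact h _ _ _ e e'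

theorem ns_meet (hk : Kites G ρ x sp) {a b c d : V} (h : NS sp a b) (e : G.Adj a b) (e' : G.Adj c d) {y : ℝ × ℝ}
    (hy : y ∈ openSegment ℝ (ρ a) (ρ b)) (hy' : y ∈ openSegment ℝ (ρ c) (ρ d)) : s(a, b) = s(c, d) := by
  by_contra hne
  obtain ⟨k, i, h1, -⟩ := hk.meet a b c d y e e' hne hy hy'
  exact h.ne _ _ _ h1

/-- the auxiliary points -/
structure Frame (G : SimpleGraph V) (ρ : V → ℝ × ℝ) (x : K → ℝ × ℝ) (sp : K → Fin 4 → V) (F : Set (ℝ × ℝ)) (o0 o1 o2 : ℝ × ℝ) : Prop where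
  fin : F.Finite
  m0 : o0 ∈ F
  m1 : o1 ∈ F
  m2 : o2 ∈ F
  notV : ∀ f ∈ F, ∀ v, f ≠ ρ v
  notX : ∀ f ∈ F, ∀ k, f ≠ x k
  edge : ∀ f ∈ F, ∀ a b, G.Adj a b → f ∈ openSegment ℝ (ρ a) (ρ b) → ∃ k i, s(a, b) = s(sp k i, sp k (i+1))
  blk : ∀ k i, ∃ z, (z ∈ F ∨ ∃ v, z = ρ v) ∧ z ∈ openSegment ℝ (ρ (sp k i)) (ρ (sp k (i+1)))
  pos : 0 < D o0 o1 o2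
  ins : ∀ z, (z ∈ F ∨ (∃ v, z = ρ v) ∨ ∃ k, z = x k) → z ≠ o0 → z ≠ o1 → z ≠ o2 → 0 < D o0 o1 z ∧ 0 < D o1 o2 z ∧ 0 < D o2 o0 z

theorem exists_frame (hd : IsStraightLineDrawing G ρ) (hk : Kites G ρ x sp) : ∃ F o0 o1 o2, Frame G ρ x sp F o0 o1 o2 := by
  have aux : ∀ i : Fin 4, i ≠ i + 1 := by decide
  have hsd : ∀ k i, sp k i ≠ sp k (i+1) := fun k i e => aux i (hk.inj _ _ _ _ e).2
  have := fun k i => side_pick hd (hsd k i)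
  choose m hm hm' using this
  set M : Set (ℝ × ℝ) := {z | ∃ k i, z = m k i ∧ ∀ w, z ≠ ρ w} with hM
  have Mfin : M.Finite := by
    refine (Set.finite_range (fun t : K × Fin 4 => m t.1 t.2)).subset ?_
    rintro z ⟨k, i, rfl, -⟩
    exact ⟨(k, i), rfl⟩
  obtain ⟨R, R0, hR⟩ := box (T := M ∪ Set.range ρ ∪ Set.range x) ((Mfin.union (Set.finite_range _)).union (Set.finite_range _))
  have hRV : ∀ v, -R < (ρ v).1 ∧ (ρ v).1 < R ∧ -R < (ρ v).2 ∧ (ρ v).2 < R := fun v => hR _ (Or.inl (Or.inr ⟨v, rfl⟩))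
  have hRX : ∀ k, -R < (x k).1 ∧ (x k).1 < R ∧ -R < (x k).2 ∧ (x k).2 < R := fun v => hR _ (Or.inr ⟨v, rfl⟩)
  set O : Set (ℝ × ℝ) := {(-3*R, -R), (3*R, -R), (0, 3*R)} with hO
  have out : ∀ f ∈ O, ¬ (-R < f.1 ∧ f.1 < R ∧ -R < f.2 ∧ f.2 < R) := by
    rintro f (rfl | rfl | rfl) ⟨h1, h2, h3, h4⟩ <;> simp only at h1 h2 h3 h4 <;> linarith
  refine ⟨M ∪ O, (-3*R, -R), (3*R, -R), (0, 3*R), ?_, ?_, ?_, ?_, ?_, ?_, ?_, ?_, ?_, ?_⟩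
  · exact Mfin.union (by rw [hO]; exact Set.toFinite _)
  · exact Or.inr (by simp [hO])
  · exact Or.inr (by simp [hO])
  · exact Or.inr (by simp [hO])
  · rintro f (⟨k, i, -, h⟩ | h) v
    · exact h v
    · rintro rfl; exact out _ h (hRV v)
  · rintro f (⟨k, i, rfl, h⟩ | h) k'
    · intro e
      rcases hm' k i with ⟨w, hw⟩ | ⟨-, h2⟩
      · exact h w hw
      · have := h2 _ _ (hk.edge k' 0) (by rw [e]; exact hk.mem k' 0)
        exact diag_ne_side hk this
    · rintro rfl; exact out _ h (hRX k')
  · rintro f (⟨k, i, rfl, h⟩ | h) a b e hab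
    · rcases hm' k i with ⟨w, hw⟩ | ⟨-, h2⟩
      · exact absurd hw (h w)
      · exact ⟨k, i, h2 _ _ e hab⟩
    · exact absurd (box_seg (hRV a) (hRV b) hab) (out _ h)
  · intro k i
    refine ⟨m k i, ?_, hm k i⟩
    rcases hm' k i with h | ⟨h, -⟩
    · exact Or.inr h
    · exact Or.inl (Or.inl ⟨k, i, rfl, h⟩)
  · unfold D; simp only; nlinarith [mul_pos R0 R0]
  · intro z hz n0 n1 n2
    have hz' : -R < z.1 ∧ z.1 < R ∧ -R < z.2 ∧ z.2 < R := by
      rcases hz with (h | h) | ⟨v, rfl⟩ | ⟨k, rfl⟩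
      · exact hR _ (Or.inl (Or.inl h))
      · rcases h with h | h | h
        · exact absurd h n0
        · exact absurd h n1
        · exact absurd h n2
      · exact hRV v
      · exact hRX k
    obtain ⟨h1, h2, h3, h4⟩ := hz'
    unfold D; simp only
    refine ⟨?_, ?_, ?_⟩
    · have := mul_pos R0 (show 0 < z.2 + R by linarith); nlinarith
    · have := mul_pos R0 (show 0 < 9*R - 3*z.2 - 4*z.1 by linarith); nlinarith
    · have := mul_pos R0 (show 0 < 9*R - 3*z.2 + 4*z.1 by linarith); nlinarith
end frame
end ICR

namespace ICR
open Classical Filter Topology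
section final
variable {V K : Type*} [Fintype V] [Fintype K] {G : SimpleGraph V} {ρ : V → ℝ × ℝ} {x : K → ℝ × ℝ} {sp : K → Fin 4 → V} {F : Set (ℝ × ℝ)} {o0 o1 o2 : ℝ × ℝ}

def qq (ρ : V → ℝ × ℝ) (x : K → ℝ × ℝ) (F : Set (ℝ × ℝ)) : (V ⊕ F) ⊕ K → ℝ × ℝ
  | Sum.inl (Sum.inl v) => ρ v
  | Sum.inl (Sum.inr f) => f.1
  | Sum.inr k => x k

def KE (G : SimpleGraph V) (sp : K → Fin 4 → V) (F : Set (ℝ × ℝ)) (u v : (V ⊕ F) ⊕ K) : Prop :=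
  (∃ a b, u = Sum.inl (Sum.inl a) ∧ v = Sum.inl (Sum.inl b) ∧ G.Adj a b ∧ NS sp a b) ∨
  (∃ k i, u = Sum.inr k ∧ v = Sum.inl (Sum.inl (sp k i))) ∨ (∃ k i, v = Sum.inr k ∧ u = Sum.inl (Sum.inl (sp k i)))

theorem KE_seg (hk : Kites G ρ x sp) {u v : (V ⊕ F) ⊕ K} (h : KE G sp F u v) :
    ∃ a b, G.Adj a b ∧ (∀ y ∈ openSegment ℝ (qq ρ x F u) (qq ρ x F v), y ∈ openSegment ℝ (ρ a) (ρ b)) ∧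
      ((NS sp a b ∧ u = Sum.inl (Sum.inl a) ∧ v = Sum.inl (Sum.inl b)) ∨ ∃ k i, a = sp k i ∧ b = sp k (i+2) ∧ (u = Sum.inr k ∨ v = Sum.inr k)) := by
  rcases h with ⟨a, b, rfl, rfl, e, n⟩ | ⟨k, i, rfl, rfl⟩ | ⟨k, i, rfl, rfl⟩
  · exact ⟨a, b, e, fun y hy => hy, Or.inl ⟨n, rfl, rfl⟩⟩
  · exact ⟨_, _, hk.edge k i, fun y hy => oseg_trans (hk.mem k i) hy, Or.inr ⟨k, i, rfl, rfl, Or.inl rfl⟩⟩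
  · refine ⟨_, _, hk.edge k i, fun y hy => oseg_trans (hk.mem k i) ?_, Or.inr ⟨k, i, rfl, rfl, Or.inr rfl⟩⟩
    rw [openSegment_symm]; exact hy

theorem NS.symm {a b : V} (h : NS sp a b) : NS sp b a := fun k i l h1 h2 => h k l i h2 h1

theorem qq_inj (hd : IsStraightLineDrawing G ρ) (hk : Kites G ρ x sp) (hF : Frame G ρ x sp F o0 o1 o2) : Function.Injective (qq ρ x F) := by
  have vx : ∀ v k, ρ v ≠ x k := fun v k e => noV hd (hk.edge k 0) v (e ▸ hk.mem k 0)
  rintro ((v | f) | k) ((v' | f') | k') e <;> simp only [qq] at e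
  · rw [hd.inj e]
  · exact absurd e.symm (hF.notV _ f'.2 v)
  · exact absurd e (vx _ _)
  · exact absurd e (hF.notV _ f.2 _)
  · rw [Subtype.ext e]
  · exact absurd e (hF.notX _ f.2 _)
  · exact absurd e.symm (vx _ _)
  · exact absurd e.symm (hF.notX _ f'.2 _)
  · rw [hk.xinj e]

theorem KE_plane (hd : IsStraightLineDrawing G ρ) (hk : Kites G ρ x sp) (hF : Frame G ρ x sp F o0 o1 o2) : Plane (qq ρ x F) (KE G sp F) where
  symm := by
    rintro u v (⟨a, b, rfl, rfl, e, n⟩ | h | h)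
    · exact Or.inl ⟨b, a, rfl, rfl, e.symm, n.symm⟩
    · exact Or.inr (Or.inr h)
    · exact Or.inr (Or.inl h)
  ne := by
    rintro u v (⟨a, b, rfl, rfl, e, n⟩ | ⟨k, i, rfl, rfl⟩ | ⟨k, i, rfl, rfl⟩) h
    · exact e.ne (Sum.inl_injective (Sum.inl_injective h))
    · exact Sum.inr_ne_inl h
    · exact Sum.inl_ne_inr h
  vert := by
    intro u v z h zu zv hz
    obtain ⟨a, b, e, sub, h'⟩ := KE_seg (ρ := ρ) (x := x) hk h
    have hz' := sub _ hz
    rcases z with (w | f) | k'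
    · exact noV hd e w hz'
    · obtain ⟨k1, i1, e1⟩ := hF.edge _ f.2 a b e hz'
      rcases h' with ⟨n, -, -⟩ | ⟨k, i, rfl, rfl, -⟩
      · exact n.ne _ _ _ e1
      · exact diag_ne_side hk e1
    · rcases h' with ⟨n, -, -⟩ | ⟨k, i, rfl, rfl, h3⟩
      · exact n.ne _ _ _ (ns_meet hk n e (hk.edge k' 0) hz' (hk.mem k' 0))
      · have := diag_kite hk hz' (hk.mem k' 0)
        subst this
        rcases h3 with h3 | h3
        · exact zu h3.symm
        · exact zv h3.symm
  cross := by
    intro u v u' v' s h g n1 n2 n3 n4 hs hs'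
    obtain ⟨a, b, e, sub, h'⟩ := KE_seg (ρ := ρ) (x := x) hk h
    obtain ⟨c, d, e', sub', g'⟩ := KE_seg (ρ := ρ) (x := x) hk g
    have k1 := sub _ hs
    have k2 := sub' _ hs'
    rcases h' with ⟨n, rfl, rfl⟩ | ⟨k, i, rfl, rfl, h3⟩
    · have m := ns_meet hk n e e' k1 k2
      rcases g' with ⟨-, rfl, rfl⟩ | ⟨k, i, rfl, rfl, -⟩
      · rw [Sym2.eq_iff] at m
        rcases m with ⟨rfl, rfl⟩ | ⟨rfl, rfl⟩
        · exact n1 rfl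
        · exact n2 rfl
      · exact n.ne _ _ _ m
    · rcases g' with ⟨n, rfl, rfl⟩ | ⟨k', i', rfl, rfl, h4⟩
      · exact n.ne _ _ _ (ns_meet hk n e' e k2 k1)
      · have := diag_kite hk k1 k2
        subst this
        rcases h3 with rfl | rfl <;> rcases h4 with rfl | rfl
        · exact n1 rfl
        · exact n2 rfl
        · exact n3 rfl
        · exact n4 rfl

theorem redraw (hd : IsStraightLineDrawing G ρ) (hk : Kites G ρ x sp) : ∃ p : V → ℝ × ℝ, Function.Injective p ∧
    (∀ v, ∃ a b : ℤ, p v = ((a : ℝ), (b : ℝ))) ∧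
    (∀ k (a b c d : ℝ × ℝ), a = p (sp k 0) → c = p (sp k 1) → b = p (sp k 2) → d = p (sp k 3) → (d.1 - c.1) * (b.1 - a.1) + (d.2 - c.2) * (b.2 - a.2) = 0) ∧
    (∀ a b v, G.Adj a b → v ≠ a → v ≠ b → p v ∉ openSegment ℝ (p a) (p b)) ∧
    (∀ a b c d y, G.Adj a b → G.Adj c d → a ≠ c → a ≠ d → b ≠ c → b ≠ d → y ∈ openSegment ℝ (p a) (p b) → y ∈ openSegment ℝ (p c) (p d) →
      ∃ k i, s(a, b) = s(sp k i, sp k (i+2)) ∧ s(c, d) = s(sp k (i+1), sp k (i+3))) := by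
  obtain ⟨F, o0, o1, o2, hF⟩ := exists_frame hd hk
  have := hF.fin.fintype
  obtain ⟨p, A, pinj, pgrid, perp, vert, cross, A0, A1, A2⟩ := combine (q := qq ρ x F) (E0 := KE G sp F) (sp := fun k i => Sum.inl (sp k i))
    (o0 := Sum.inr ⟨o0, hF.m0⟩) (o1 := Sum.inr ⟨o1, hF.m1⟩) (o2 := Sum.inr ⟨o2, hF.m2⟩)
    (by
      refine ⟨hF.pos, fun z hz => ?_⟩
      have hi := qq_inj hd hk hF
      unfold Outer at hz
      push Not at hz
      refine hF.ins _ ?_ (fun e => hz.1 (hi e)) (fun e => hz.2.1 (hi e)) (fun e => hz.2.2 (hi e))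
      rcases z with (v | f) | k
      · exact Or.inr (Or.inl ⟨v, rfl⟩)
      · exact Or.inl f.2
      · exact Or.inr (Or.inr ⟨k, rfl⟩))
    (KE_plane hd hk hF) (qq_inj hd hk hF) (fun k i => Or.inr (Or.inl ⟨k, i, rfl, rfl⟩)) hk.ccw hk.mem
    (by
      intro k i
      obtain ⟨z, hz | ⟨v, rfl⟩, hz'⟩ := hF.blk k i
      · exact ⟨Sum.inl (Sum.inr ⟨z, hz⟩), hz'⟩
      · exact ⟨Sum.inl (Sum.inl v), hz'⟩)
    (fun k i k' i' e => hk.inj _ _ _ _ (Sum.inl_injective e))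
    (fun k i => ⟨Sum.inl_ne_inr, Sum.inl_ne_inr, Sum.inl_ne_inr⟩)
  have cls : ∀ a b, G.Adj a b → (∀ j, A j (Sum.inl a) (Sum.inl b)) ∨ ∃ k i, a = sp k i ∧ b = sp k (i+2) ∧ ∀ j, j k = i → A j (Sum.inl a) (Sum.inl b) := by
    intro a b e
    by_cases n : NS sp a b
    · exact Or.inl fun j => A0 j _ _ (Or.inl ⟨a, b, rfl, rfl, e, n⟩)
    · unfold NS at n
      push Not at n
      obtain ⟨k, i, l, rfl, rfl, -⟩ := n
      have hil : ¬ i = l := by rintro rfl; exact e.ne rfl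
      rcases f4_cases i l hil with rfl | rfl | rfl
      · exact Or.inl fun j => (A1 j k i).1
      · exact Or.inr ⟨k, i, rfl, rfl, fun j hj => A2 j k i hj⟩
      · refine Or.inl fun j => ?_
        have := (A1 j k (i+3)).2
        rw [f4a] at this
        exact this
  refine ⟨fun v => p (Sum.inl v), fun a b e => Sum.inl_injective (pinj e), fun v => pgrid _, perp, ?_, ?_⟩
  · intro a b v e va vb
    have : ∃ j, A j (Sum.inl a) (Sum.inl b) := by
      rcases cls a b e with h | ⟨k, i, -, -, h⟩
      · exact ⟨fun _ => 0, h _⟩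
      · exact ⟨fun _ => i, h _ rfl⟩
    obtain ⟨j, hj⟩ := this
    exact vert j _ _ _ hj (fun h => va (Sum.inl_injective h)) (fun h => vb (Sum.inl_injective h))
  · intro a b c d y e e' n1 n2 n3 n4 hy hy'
    have no : ∀ j, A j (Sum.inl a) (Sum.inl b) → A j (Sum.inl c) (Sum.inl d) → False := by
      intro j h h'
      refine Set.disjoint_left.1 (cross j _ _ _ _ h h' ?_ ?_ ?_ ?_) hy hy' <;> intro h <;> have := Sum.inl_injective h <;> contradiction
    rcases cls a b e with h | ⟨k, i, rfl, rfl, h⟩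
    · exfalso
      rcases cls c d e' with g | ⟨k, i, -, -, g⟩
      · exact no (fun _ => 0) (h _) (g _)
      · exact no (fun _ => i) (h _) (g _ rfl)
    · rcases cls c d e' with g | ⟨k', i', rfl, rfl, g⟩
      · exact (no (fun _ => i) (h _ rfl) (g _)).elim
      · by_cases hkk : k = k'
        · subst hkk
          have hii : ¬ i = i' := by rintro rfl; exact n1 rfl
          rcases f4_cases i i' hii with rfl | rfl | rfl
          · exact ⟨k, i, rfl, by rw [f4f]⟩
          · exact absurd rfl n3
          · refine ⟨k, i, rfl, ?_⟩
            rw [f4g, Sym2.eq_swap]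
        · exact (no (fun κ => if κ = k then i else i') (h _ (by simp)) (g _ (by simp [Ne.symm hkk]))).elim
end final
end ICR

namespace ICR
open Classical Filter Topology

theorem perp_meet {a b c d x y : ℝ × ℝ} (hp : (b.1 - a.1) * (d.1 - c.1) + (b.2 - a.2) * (d.2 - c.2) = 0)
    (hx : x ∈ openSegment ℝ a b) (hy : y ∈ openSegment ℝ a b) (hx' : x ∈ openSegment ℝ c d) (hy' : y ∈ openSegment ℝ c d) : x = y := by
  obtain ⟨t, -, -, ex⟩ := mem_oseg.1 hx
  obtain ⟨s, -, -, ey⟩ := mem_oseg.1 hy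
  obtain ⟨t', -, -, ex'⟩ := mem_oseg.1 hx'
  obtain ⟨s', -, -, ey'⟩ := mem_oseg.1 hy'
  have x1 := congrArg Prod.fst ex
  have x2 := congrArg Prod.snd ex
  have y1 := congrArg Prod.fst ey
  have y2 := congrArg Prod.snd ey
  have x1' := congrArg Prod.fst ex'
  have x2' := congrArg Prod.snd ex'
  have y1' := congrArg Prod.fst ey'
  have y2' := congrArg Prod.snd ey'
  simp only [Prod.fst_add, Prod.snd_add, Prod.smul_fst, Prod.smul_snd, smul_eq_mul] at x1 x2 y1 y2 x1' x2' y1' y2'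
  have u1 : y.1 - x.1 = (s - t) * (b.1 - a.1) := by rw [x1, y1]; ring
  have u2 : y.2 - x.2 = (s - t) * (b.2 - a.2) := by rw [x2, y2]; ring
  have v1 : y.1 - x.1 = (s' - t') * (d.1 - c.1) := by rw [x1', y1']; ring
  have v2 : y.2 - x.2 = (s' - t') * (d.2 - c.2) := by rw [x2', y2']; ring
  have sq : (y.1 - x.1) * (y.1 - x.1) + (y.2 - x.2) * (y.2 - x.2) = 0 := by
    calc _ = ((s - t) * (b.1 - a.1)) * ((s' - t') * (d.1 - c.1)) + ((s - t) * (b.2 - a.2)) * ((s' - t') * (d.2 - c.2)) := by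
            rw [← u1, ← u2, ← v1, ← v2]
      _ = (s - t) * (s' - t') * ((b.1 - a.1) * (d.1 - c.1) + (b.2 - a.2) * (d.2 - c.2)) := by ring
      _ = 0 := by rw [hp, mul_zero]
  have h1 : y.1 - x.1 = 0 := by nlinarith [mul_self_nonneg (y.1 - x.1), mul_self_nonneg (y.2 - x.2)]
  have h2 : y.2 - x.2 = 0 := by nlinarith [mul_self_nonneg (y.1 - x.1), mul_self_nonneg (y.2 - x.2)]
  exact Prod.ext (by linarith) (by linarith)

theorem main {V : Type*} [Fintype V] (G : SimpleGraph V) {ρ : V → ℝ × ℝ} (h : IsICPlanarDrawing G ρ) :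
    ∃ p : V → ℝ × ℝ, IsICPlanarDrawing G p ∧ IsRACDrawing G p ∧ IsGridDrawing p := by
  obtain ⟨sp, hk⟩ := exists_kites h
  have := (KSet_finite h.1).fintype
  obtain ⟨p, pinj, pgrid, perp, vert, meet⟩ := redraw h.1 hk
  obtain ⟨hd, ic1, ic2⟩ := h
  -- crossing pairs are the diagonals of a kite
  have key : ∀ a b c d, G.Adj a b → G.Adj c d → Crosses p s(a, b) s(c, d) →
      ∃ k i, s(a, b) = s(sp k i, sp k (i+2)) ∧ s(c, d) = s(sp k (i+1), sp k (i+3)) := by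
    rintro a b c d e e' ⟨hdis, y, hy, hy'⟩
    have n : ∀ u ∈ s(a, b), ∀ v ∈ s(c, d), u ≠ v := by rintro u hu v hv rfl; exact hdis u hu hv
    exact meet a b c d y e e' (n _ (Sym2.mem_mk_left _ _) _ (Sym2.mem_mk_left _ _)) (n _ (Sym2.mem_mk_left _ _) _ (Sym2.mem_mk_right _ _))
      (n _ (Sym2.mem_mk_right _ _) _ (Sym2.mem_mk_left _ _)) (n _ (Sym2.mem_mk_right _ _) _ (Sym2.mem_mk_right _ _)) hy hy'
  have tr : ∀ e ∈ G.edgeSet, ∀ f ∈ G.edgeSet, Crosses p e f → Crosses ρ e f := by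
    intro e he f hf hc
    induction e using Sym2.ind with | _ a b
    induction f using Sym2.ind with | _ c d
    obtain ⟨k, i, e1, e2⟩ := key a b c d he hf hc
    refine ⟨hc.1, k.1, ?_, ?_⟩
    · rw [e1]; exact hk.mem k i
    · rw [e2]; have := hk.mem k (i+1); rw [f4f] at this; exact this
  have perp2 : ∀ k i, ((p (sp k (i+2))).1 - (p (sp k i)).1) * ((p (sp k (i+3))).1 - (p (sp k (i+1))).1) +
      ((p (sp k (i+2))).2 - (p (sp k i)).2) * ((p (sp k (i+3))).2 - (p (sp k (i+1))).2) = 0 := by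
    intro k
    have := perp k _ _ _ _ rfl rfl rfl rfl
    refine four ?_ ?_ ?_ ?_
    · change ((p (sp k 2)).1 - (p (sp k 0)).1) * ((p (sp k 3)).1 - (p (sp k 1)).1) + ((p (sp k 2)).2 - (p (sp k 0)).2) * ((p (sp k 3)).2 - (p (sp k 1)).2) = 0
      linear_combination this
    · change ((p (sp k 3)).1 - (p (sp k 1)).1) * ((p (sp k 0)).1 - (p (sp k 2)).1) + ((p (sp k 3)).2 - (p (sp k 1)).2) * ((p (sp k 0)).2 - (p (sp k 2)).2) = 0
      linear_combination -this
    · change ((p (sp k 0)).1 - (p (sp k 2)).1) * ((p (sp k 1)).1 - (p (sp k 3)).1) + ((p (sp k 0)).2 - (p (sp k 2)).2) * ((p (sp k 1)).2 - (p (sp k 3)).2) = 0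
      linear_combination this
    · change ((p (sp k 1)).1 - (p (sp k 3)).1) * ((p (sp k 2)).1 - (p (sp k 0)).1) + ((p (sp k 1)).2 - (p (sp k 3)).2) * ((p (sp k 2)).2 - (p (sp k 0)).2) = 0
      linear_combination -this
  have rac : ∀ a b c d, G.Adj a b → G.Adj c d → Crosses p s(a, b) s(c, d) →
      ((p b).1 - (p a).1) * ((p d).1 - (p c).1) + ((p b).2 - (p a).2) * ((p d).2 - (p c).2) = 0 := by
    intro a b c d e e' hc
    obtain ⟨k, i, e1, e2⟩ := key a b c d e e' hc
    have := perp2 k i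
    rw [Sym2.eq_iff] at e1 e2
    rcases e1 with ⟨rfl, rfl⟩ | ⟨rfl, rfl⟩ <;> rcases e2 with ⟨rfl, rfl⟩ | ⟨rfl, rfl⟩
    · linear_combination this
    · linear_combination -this
    · linear_combination -this
    · linear_combination this
  refine ⟨p, ⟨⟨pinj, ?_, ?_⟩, ?_, ?_⟩, ?_, pgrid⟩
  · intro e he v hv
    induction e using Sym2.ind with | _ a b
    rw [Sym2.mem_iff, not_or] at hv
    exact vert a b v he hv.1 hv.2
  · intro e he f hf hdis x hx y hy
    induction e using Sym2.ind with | _ a b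
    induction f using Sym2.ind with | _ c d
    exact perp_meet (rac a b c d he hf ⟨hdis, x, hx⟩) hx.1 hy.1 hx.2 hy.2
  · intro e he f hf g hg h1 h2
    exact ic1 e he f hf g hg (tr e he f hf h1) (tr e he g hg h2)
  · rintro e he f hf ⟨e', he', h1⟩ ⟨f', hf', h2⟩
    exact ic2 e he f hf ⟨e', he', tr _ he _ he' h1⟩ ⟨f', hf', tr _ hf _ hf' h2⟩
  · rintro e he f hf hc a b c d rfl rfl
    exact rac a b c d he hf hc
end ICR

/-- Every graph admitting an IC-planar straight-line drawing admits a
straight-line drawing that is simultaneously IC-planar, RAC and a grid drawing;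
in particular every IC-planar graph is a RAC graph. -/
theorem icplanar_is_rac {V : Type*} [Fintype V] (G : SimpleGraph V)
    (h : ∃ ρ : V → ℝ × ℝ, IsICPlanarDrawing G ρ) :
    ∃ ρ : V → ℝ × ℝ, IsICPlanarDrawing G ρ ∧ IsRACDrawing G ρ ∧ IsGridDrawing ρ := by
  obtain ⟨ρ, hρ⟩ := h
  exact ICR.main G hρ
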